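/- Let X = A_{2s} (rank 2s), let δ = (a_1,…,a_s,a_s,…,a_1) be a nonzero self-dual dominant weight for X, and assume that δ is neither of the form bω_1 + bω_{2s} (b ≥ 1) nor of the form ω_i + ω_{2s+1−i} for any i (in particular s ≥ 2). Let W = V_X(δ) and X < Y = SO(W) (all self-dual irreducibles of A_{2s} are orthogonal). Then for every dominant weight λ for Y with λ ≠ 0, λ_1, the restriction V_Y(λ)↓X is NOT multiplicity-free. -/

import Mathlib

noncomputable section

namespace MFPaper

/-- The Dynkin type of a classical group `B_n = SO_{2n+1}`, `C_n = Sp_{2n}`, `D_n = SO_{2n}`. -/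
inductive CType | B | C | D
deriving DecidableEq

/-- The character ring: the integral group ring of a rational weight space
with `k` coordinates. -/
abbrev CharRing (k : ℕ) : Type := AddMonoidAlgebra ℤ (Fin k → ℚ)

/-- The formal exponential `e^v` of a weight `v`. -/
def mono {k : ℕ} (v : Fin k → ℚ) : CharRing k := AddMonoidAlgebra.single v 1

/-- `e n k` : the `k`-th fundamental dominant weight (`1 ≤ k ≤ n`, 1-indexed) of a rank `n`
group, recorded by its coordinates in the basis of fundamental weights. -/
def e (n k : ℕ) : Fin n → ℕ := fun i => if (i : ℕ) + 1 = k then 1 else 0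

/-! ### Type `A_r` -/

/-- The partition (`gl`) lift of the dominant weight of `A_r` with coordinates `d`
in the basis of fundamental weights. -/
def partLift (r : ℕ) (d : Fin r → ℕ) : Fin (r + 1) → ℚ := fun i =>
  ∑ j ∈ Finset.univ.filter (fun j : Fin r => (i : ℕ) ≤ (j : ℕ)), (d j : ℚ)

/-- The traceless (`sl`) representative of the dominant weight of `A_r` with coordinates `d`. -/
def slWt (r : ℕ) (d : Fin r → ℕ) : Fin (r + 1) → ℚ := fun i =>
  partLift r d i - (∑ j : Fin r, (((j : ℕ) : ℚ) + 1) * (d j : ℚ)) / (r + 1)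

/-- A lift of the half-sum of the positive roots of `A_r`. -/
def rhoA (r : ℕ) : Fin (r + 1) → ℚ := fun i => (r : ℚ) - (i : ℕ)

/-- The Weyl alternating sum `A_v = ∑_{σ} sgn(σ) e^{σ v}` for type `A_r`. -/
def altA (r : ℕ) (v : Fin (r + 1) → ℚ) : CharRing (r + 1) :=
  ∑ σ : Equiv.Perm (Fin (r + 1)),
    ((Equiv.Perm.sign σ : ℤˣ) : ℤ) • mono (fun i => v (σ i))

/-- `IsCharA r d f` : `f` is the formal character of the irreducible `A_r`-module
of highest weight `d` (Weyl character formula). -/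
def IsCharA (r : ℕ) (d : Fin r → ℕ) (f : CharRing (r + 1)) : Prop :=
  altA r (rhoA r) * f = altA r (slWt r d + rhoA r)

/-- `Decomp r F c` : the character `F` of a representation of `A_r` decomposes as
`∑_μ (c μ) · χ_μ`, i.e. the irreducible of highest weight `μ` occurs in it as a
composition factor with multiplicity `c μ`. -/
def Decomp (r : ℕ) (F : CharRing (r + 1)) (c : (Fin r → ℕ) →₀ ℕ) : Prop :=
  F * altA r (rhoA r) = c.sum fun μ k => (k : ℤ) • altA r (slWt r μ + rhoA r)

/-- The Weyl dimension formula for type `A_r`. -/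
def dimA (r : ℕ) (d : Fin r → ℕ) : ℚ :=
  ∏ p ∈ Finset.univ.filter (fun p : Fin (r + 1) × Fin (r + 1) => (p.1 : ℕ) < (p.2 : ℕ)),
    ((partLift r d p.1 - partLift r d p.2 + ((p.2 : ℕ) : ℚ) - ((p.1 : ℕ) : ℚ)) /
      (((p.2 : ℕ) : ℚ) - ((p.1 : ℕ) : ℚ)))

/-- The self-dual irreducible `A_r`-module of highest weight `d` is *symplectic*
(it carries an invariant alternating form); by Steinberg's criterion this happens
exactly when `⟨d, 2ρ^∨⟩ = ∑ d_k · k(r+1-k)` is odd. -/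
def IsSympWt (r : ℕ) (d : Fin r → ℕ) : Prop :=
  Odd (∑ i : Fin r, d i * ((i : ℕ) + 1) * (r - (i : ℕ)))

/-! ### The classical types `B`, `C`, `D` -/

/-- Convenient access to the `k`-th (0-indexed) coordinate. -/
def cval {n : ℕ} (c : Fin n → ℕ) (k : ℕ) : ℚ := if h : k < n then (c ⟨k, h⟩ : ℚ) else 0

/-- `ε`-coordinates of the dominant weight of the classical group of type `t` and rank `n`
with coordinates `c` in the basis of fundamental weights (Bourbaki numbering). -/
def epsWt (t : CType) (n : ℕ) (c : Fin n → ℕ) : Fin n → ℚ := fun i =>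
  (∑ k ∈ Finset.univ.filter (fun k : Fin n => (i : ℕ) ≤ (k : ℕ)), (c k : ℚ)) -
    (match t with
      | .C => 0
      | .B => cval c (n - 1) / 2
      | .D => (cval c (n - 2) + cval c (n - 1)) / 2)

/-- The half-sum of the positive roots in `ε`-coordinates. -/
def rhoY (t : CType) (n : ℕ) : Fin n → ℚ := fun i =>
  match t with
  | .C => (n : ℚ) - (i : ℕ)
  | .B => (n : ℚ) - (i : ℕ) - 1 / 2
  | .D => (n : ℚ) - 1 - (i : ℕ)

/-- The Weyl alternating sum for the classical group of type `t` and rank `n`: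
the Weyl group consists of the signed permutations of the coordinates,
with evenly many sign changes in type `D`. -/
def altY (t : CType) (n : ℕ) (v : Fin n → ℚ) : CharRing n :=
  ∑ σ : Equiv.Perm (Fin n), ∑ s : Fin n → Bool,
    if t = CType.D ∧ ¬ Even (Finset.univ.filter (fun i => s i = true)).card then 0
    else (((Equiv.Perm.sign σ : ℤˣ) : ℤ) *
          (-1) ^ (Finset.univ.filter (fun i => s i = true)).card) •
      mono (fun i => (if s i then -1 else 1) * v (σ i))

/-- `IsCharY t n c f` : `f` is the formal character of the irreducible module of highest
weight `c` for the classical group of type `t` and rank `n` (Weyl character formula). -/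
def IsCharY (t : CType) (n : ℕ) (c : Fin n → ℕ) (f : CharRing n) : Prop :=
  altY t n (rhoY t n) * f = altY t n (epsWt t n c + rhoY t n)

/-! ### The embedding `X = A_r < Y` via `δ`, and restriction of characters -/

/-- `WtSys t n r δ w` : `w` lists "half" of the weights of the natural module
`W = V_X(δ)` of the classical group `Y` of type `t` and rank `n`, for `X = A_r`:
the weights of `W` (with multiplicity) are exactly the `± w i`, together with one
extra zero weight in type `B`.  Such a `w` records a maximal torus embedding
`T_X → T_Y` realising the irreducible embedding `X < Y = SO(W)` or `Sp(W)` given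
by the representation of highest weight `δ`. -/
def WtSys (t : CType) (n r : ℕ) (δ : Fin r → ℕ)
    (w : Fin n → (Fin (r + 1) → ℚ)) : Prop :=
  ((∑ i : Fin n, (mono (w i) + mono (-(w i)))) +
      (if t = CType.B then mono (0 : Fin (r + 1) → ℚ) else 0)) * altA r (rhoA r)
    = altA r (slWt r δ + rhoA r)

/-- Restriction of characters from `Y` to `X = A_r` along the torus embedding
recorded by `w`. -/
def resChar {n r : ℕ} (w : Fin n → (Fin (r + 1) → ℚ)) (F : CharRing n) :
    CharRing (r + 1) :=
  AddMonoidAlgebra.mapDomain (fun v : Fin n → ℚ => ∑ i : Fin n, v i • w i) F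

/-- `IsMFRes t n r δ lam` : in the embedding `X = A_r < Y` (the classical group of type
`t` and rank `n`) given by the irreducible representation of highest weight `δ`, the
restriction to `X` of the irreducible `Y`-module of highest weight `lam` is
multiplicity-free: its character is a sum of *distinct* irreducible characters of `X`. -/
def IsMFRes (t : CType) (n r : ℕ) (δ : Fin r → ℕ) (lam : Fin n → ℕ) : Prop :=
  ∀ w, WtSys t n r δ w → ∀ f, IsCharY t n lam f →
    ∃ c : (Fin r → ℕ) →₀ ℕ, Decomp r (resChar w f) c ∧ ∀ μ, c μ ≤ 1

/-- The operation `e^v ↦ e^{k·v}` on characters (Adams operation on the torus),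
used to express symmetric and exterior powers of characters. -/
def pw {m : ℕ} (k : ℕ) (F : CharRing m) : CharRing m :=
  AddMonoidAlgebra.mapDomain (fun v : Fin m → ℚ => (k : ℚ) • v) F

/-- The irreducible `A_r`-module of highest weight `d` carries a nonzero invariant
*symmetric* bilinear form, i.e. the trivial module occurs in its symmetric square
(whose character `S` satisfies `2S = f² + f^{[2]}`). -/
def HasSymForm (r : ℕ) (d : Fin r → ℕ) : Prop :=
  ∀ f, IsCharA r d f →
    ∃ c : (Fin r → ℕ) →₀ ℕ,
      (f * f + pw 2 f) * altA r (rhoA r)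
          = c.sum (fun μ k => ((2 * k : ℕ) : ℤ) • altA r (slWt r μ + rhoA r)) ∧ 1 ≤ c 0

/-- The irreducible `A_r`-module of highest weight `d` carries a nonzero invariant
*alternating* bilinear form, i.e. the trivial module occurs in its exterior square
(whose character `Λ` satisfies `2Λ = f² - f^{[2]}`). -/
def HasAltForm (r : ℕ) (d : Fin r → ℕ) : Prop :=
  ∀ f, IsCharA r d f →
    ∃ c : (Fin r → ℕ) →₀ ℕ,
      (f * f - pw 2 f) * altA r (rhoA r)
          = c.sum (fun μ k => ((2 * k : ℕ) : ℤ) • altA r (slWt r μ + rhoA r)) ∧ 1 ≤ c 0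

end MFPaper

open MFPaper
open scoped Matrix Kronecker
set_option linter.unusedSectionVars false
set_option linter.unusedVariables false
set_option linter.unusedSimpArgs false

namespace MF

open Finset AddMonoidAlgebra
open Matrix hiding single single_add single_neg single_zero smul_single
open Equiv (Perm swap swap_apply_of_ne_of_ne apply_symm_apply symm_apply_apply swap_apply_left swap_apply_right)
open Equiv.Perm (sign)
open Module (finrank)
open Function (Injective Involutive)
open Finsupp (finsetSum_apply mem_support_iff notMem_support_iff)
open Fin (rev last castAdd natAdd le_def lt_def sum_univ_succ sum_univ_castSucc sum_univ_add val_rev val_zero val_last castSucc_lt_last card_Iic card_Iio rev_rev succ_zero_eq_one val_natAdd val_castAdd exists_castSucc_eq lastCases)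
local notation:max "ℚ^" k:max => Fin k → ℚ
local notation:max "ℝ^" k:max => Fin k → ℝ
variable {k m n r b N : ℕ} {ty : CType}

/-! ### Alternants over a commutative ring -/

/-- The character ring with coefficients in `R`. -/
abbrev ChR (R : Type) [CommRing R] (k : ℕ) : Type := AddMonoidAlgebra R ℚ^k

/-- The basis vector `ε_i`. -/
abbrev eps (i : Fin k) : ℚ^k := Pi.single i 1

/-- The alternant with coefficients in `R`. -/
def alt (R : Type) [CommRing R] (v : ℚ^k) : ChR R k :=
  ∑ σ : Perm (Fin k), single (fun i => v (σ i)) ((sign σ : ℤ) : R)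

lemma altA_eq_alt (r : ℕ) (v : ℚ^(r+1)) : altA r v = alt ℤ v := by unfold altA alt mono; simp

/-- The change of coefficients from `ℤ` to `ℝ`. -/
def toReal (k : ℕ) : CharRing k →+* ChR ℝ k := mapRingHom ℚ^k (Int.castRingHom ℝ)

lemma toReal_single (v : ℚ^k) (n : ℤ) : toReal k (single v n) = single v (n : ℝ) := by simp [toReal]

lemma toReal_coeff (f : CharRing k) (v : ℚ^k) : (toReal k f).coeff v = (f.coeff v : ℝ) := by
  induction f using induction_linear with
  | zero => simp
  | add f g hf hg => simp [hf, hg]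
  | single w n =>
    rw [toReal_single]; simp only [coeff_single, Finsupp.single_apply]; split_ifs <;> simp

lemma toReal_alt (v : ℚ^k) : toReal k (alt ℤ v) = alt ℝ v := by simp [alt, map_sum, toReal_single]

/-- The lift of `ρ` used throughout. -/
abbrev rho (k : ℕ) : ℚ^k := fun i => (k : ℚ)-1-(i : ℕ)

lemma rhoA_eq (r : ℕ) : rhoA r = rho (r+1) := by funext i; simp [rhoA, rho]

section ring
variable {R : Type} [CommRing R] {k : ℕ}

/-- The variable `x_i = e^{ε_i}`. -/
def xv (R : Type) [CommRing R] (i : Fin k) : ChR R k := single (eps i) 1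

lemma single_sum_pow (c : Fin k → ℕ) : ∏ i, xv R i ^ c i = single (fun i => (c i : ℚ)) 1 := by
  have h : ∀ s : Finset (Fin k), ∏ i ∈ s, xv R i ^ c i
      = single (fun i => if i ∈ s then (c i : ℚ) else 0) 1 := by
    intro s
    induction s using Finset.induction_on with
    | empty => simp [one_def]; rfl
    | insert a s ha ih =>
      rw [prod_insert ha, ih, xv, single_pow, single_mul_single]; simp only [one_pow, mul_one]
      congr 1; funext i; by_cases hi : i = a
      all_goals simp_all
  simpa using h univ

lemma alt_rho_eq_prod : alt R (rho k) = ∏ i : Fin k, ∏ j ∈ Ioi i, (xv R i-xv R j) := by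
  have h := det_projVandermonde (n := k) (fun _ => (1 : ChR R k)) (fun i => xv R i)
  simp only [one_mul] at h; rw [← h, ← det_transpose, det_apply, alt]
  refine sum_congr rfl fun σ _ => ?_
  have : ∏ i, (projVandermonde (fun _ => (1 : ChR R k)) (fun i => xv R i)).transpose (σ i) i
      = ∏ i, xv R i ^ ((rev (σ i)) : ℕ) := by
    refine prod_congr rfl fun i _ => ?_; simp [transpose_apply, projVandermonde_apply]
  rw [this, single_sum_pow, Units.smul_def, ← Int.cast_smul_eq_zsmul R, smul_single]
  simp only [smul_eq_mul, mul_one]; congr 1; funext i; have := (σ i).isLt; simp only [rho, val_rev]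
  rw [Nat.cast_sub (by omega)]; push_cast; ring

/-- The derivation `∂_k`. -/
def der (i : Fin k) : ChR ℝ k →ₗ[ℝ] ChR ℝ k where
  toFun f := .ofCoeff (f.coeff.mapRange id rfl |>.sum fun v c => Finsupp.single v ((v i : ℝ)*c))
  map_add' f g := by
    apply coeff_injective; simp only [Finsupp.mapRange_id, coeff_add]
    rw [Finsupp.sum_add_index'] <;> simp [mul_add]
  map_smul' c f := by
    apply coeff_injective; simp only [Finsupp.mapRange_id, coeff_smul, RingHom.id_apply]
    rw [Finsupp.sum_smul_index' (by simp), Finsupp.smul_sum]; refine Finsupp.sum_congr fun v _ => ?_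
    rw [Finsupp.smul_single, smul_eq_mul, smul_eq_mul, mul_left_comm]

lemma der_single (i : Fin k) (v : ℚ^k) (c : ℝ) : der i (single v c) = single v ((v i : ℝ)*c) := by
  apply coeff_injective; simp [der]

lemma der_coeff (i : Fin k) (f : ChR ℝ k) (v : ℚ^k) : (der i f).coeff v = (v i : ℝ)*f.coeff v := by
  induction f using induction_linear with
  | zero => simp
  | add f g hf hg => simp [hf, hg, mul_add]
  | single w n =>
    rw [der_single]; simp only [coeff_single, Finsupp.single_apply]
    simp_all

lemma der_mul (i : Fin k) (f g : ChR ℝ k) : der i (f*g) = der i f*g+f*der i g := by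
  induction f using induction_linear with
  | zero => simp
  | add f f' hf hf' => simp only [add_mul, map_add, hf, hf']; ring
  | single v c =>
    induction g using induction_linear with
    | zero => simp
    | add g g' hg hg' => simp only [mul_add, map_add, hg, hg']; ring
    | single w d =>
      simp only [der_single, single_mul_single]; rw [← single_add]; congr 1
      simp only [Pi.add_apply]; push_cast; ring

lemma der_xv (i j : Fin k) : der i (xv ℝ j) = if i = j then xv ℝ j else 0 := by
  rw [xv, der_single]; by_cases h : i = j
  all_goals simp_all

lemma der_prod {ι : Type} [DecidableEq ι] (i : Fin k) (s : Finset ι) (f : ι → ChR ℝ k) :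
    der i (∏ a ∈ s, f a) = ∑ a ∈ s, (∏ b ∈ s.erase a, f b)*der i (f a) := by
  induction s using Finset.induction_on with
  | empty =>
    have h1 : (1 : ChR ℝ k) = single 0 1 := rfl
    simp [h1, der_single]
  | insert a s ha ih =>
    rw [prod_insert ha, der_mul, ih, sum_insert ha, erase_insert ha,
      mul_sum, mul_comm (der i (f a))]
    congr 1; refine sum_congr rfl fun b hb => ?_; have hab : a ≠ b := fun h => ha (h ▸ hb)
    rw [erase_insert_of_ne hab, prod_insert (by simp [ha]), mul_assoc]

end ring

/-! ### Unitary matrix representations of `gl_m` -/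

/-- A finite-dimensional representation of `gl_m` on `ι → ℝ` for which the standard basis is an
orthonormal basis of weight vectors, the form being contravariant. -/
structure Rep (m : ℕ) (ι : Type) [Fintype ι] [DecidableEq ι] where
  E : Fin m → Fin m → Matrix ι ι ℝ
  wt : ι → ℚ^m
  diag : ∀ i, E i i = diagonal (fun a => (wt a i : ℝ))
  comm : ∀ i j k l, E i j*E k l-E k l*E i j
    = (if j = k then E i l else 0)-(if l = i then E k j else 0)
  symm : ∀ i j, (E i j).transpose = E j i

namespace Rep
variable {m : ℕ} {ι : Type} [Fintype ι] [DecidableEq ι] (R : Rep m ι)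

lemma wt_eq {i j : Fin m} {a b : ι} (h : R.E i j a b ≠ 0) : R.wt a = R.wt b+eps i-eps j := by
  funext k; have hc := R.comm k k i j; have := congrFun (congrFun hc a) b; rw [R.diag k] at this
  simp only [Matrix.sub_apply, diagonal_mul, mul_diagonal] at this
  have h2 : ((R.wt a k : ℝ)-R.wt b k)*R.E i j a b
      = ((if k = i then 1 else 0)-(if j = k then 1 else 0))*R.E i j a b := by
    by_cases h1 : k = i
    · by_cases h2 : j = k
      · subst h1; subst h2; simp only [if_true] at this ⊢; linarith
      · subst h1; simp only [if_true, h2, if_false, Matrix.zero_apply] at this ⊢; linarith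
    · by_cases h2 : j = k
      · subst h2; simp only [if_true, h1, if_false, Matrix.zero_apply] at this ⊢; linarith
      · simp only [h1, h2, if_false, Matrix.zero_apply] at this ⊢; linarith
  have h3 := mul_right_cancel₀ h h2
  have h4 : R.wt a k-R.wt b k = (if k = i then 1 else 0)-(if j = k then 1 else 0) := by
    have : ((R.wt a k-R.wt b k : ℚ) : ℝ) = (((if k = i then 1 else 0)-(if j = k then 1 else 0) : ℚ) : ℝ) := by
      push_cast; rw [h3]; split_ifs <;> simp
    exact_mod_cast this
  simp only [Pi.add_apply, Pi.sub_apply, Pi.single_apply]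
  have : (if j = k then (1 : ℚ) else 0) = if k = j then 1 else 0 := by simp [eq_comm]
  rw [this] at h4; linarith

/-- The formal character. -/
def ch : CharRing m := ∑ a, mono (R.wt a)

/-- The Casimir matrix. -/
def cas : Matrix ι ι ℝ := ∑ i, ∑ j, R.E i j*R.E j i

lemma symm_apply (i j : Fin m) (a b : ι) : R.E i j a b = R.E j i b a := by rw [← R.symm i j]; rfl

lemma cas_comm (k l : Fin m) : R.cas*R.E k l = R.E k l*R.cas := by
  rw [← sub_eq_zero]; unfold cas; rw [sum_mul, mul_sum, ← sum_sub_distrib]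
  simp only [sum_mul, mul_sum, ← sum_sub_distrib]
  have : ∀ i j, R.E i j*R.E j i*R.E k l-R.E k l*(R.E i j*R.E j i)
      = R.E i j*((if i = k then R.E j l else 0)-(if l = j then R.E k i else 0))
        + ((if j = k then R.E i l else 0)-(if l = i then R.E k j else 0))*R.E j i := by
    intro i j; rw [← R.comm, ← R.comm]; noncomm_ring
  simp only [this]
  simp only [mul_sub, sub_mul, mul_ite, ite_mul, mul_zero, zero_mul, sum_add_distrib,
    sum_sub_distrib]
  rw [sum_comm (f := fun x y => if x = k then R.E x y*R.E y l else 0),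
    sum_comm (f := fun x y => if l = x then R.E k y*R.E y x else 0)]
  simp

lemma cas_symm : R.cas.transpose = R.cas := by
  unfold cas; simp only [transpose_sum, transpose_mul, R.symm]

lemma cas_wt {a b : ι} (h : R.cas a b ≠ 0) : R.wt a = R.wt b := by
  funext k; have := congrFun (congrFun (R.cas_comm k k) a) b; rw [R.diag k] at this
  simp only [diagonal_mul, mul_diagonal] at this
  have h3 : (R.wt b k : ℝ) = R.wt a k := by apply mul_left_cancel₀ h; rw [this]; ring
  exact_mod_cast h3.symm

end Rep

section freudenthal
variable {k : ℕ} {ι : Type} [Fintype ι] [DecidableEq ι] (R : Rep k ι)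

/-- The real formal character. -/
def Rep.chR : ChR ℝ k := ∑ a, single (R.wt a) 1

lemma Rep.toReal_ch : toReal k R.ch = R.chR := by
  simp [Rep.ch, Rep.chR, mono, map_sum, toReal_single]

/-- The generating function of the traces of `E_ij E_ji` on weight spaces. -/
def Rep.T (i j : Fin k) : ChR ℝ k := ∑ a, single (R.wt a) ((R.E i j*R.E j i) a a)

lemma Rep.xv_mul_T (i j : Fin k) : xv ℝ j*R.T i j = xv ℝ i*R.T j i := by
  have h : ∀ i j : Fin k, xv ℝ j*R.T i j
      = ∑ a, ∑ b, single (R.wt a+eps j) (R.E i j a b*R.E j i b a) := by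
    intro i j; unfold Rep.T xv; rw [mul_sum]; refine sum_congr rfl fun a _ => ?_
    rw [single_mul_single, Matrix.mul_apply, one_mul, add_comm]
    exact map_sum (singleAddHom (R := ℝ) (R.wt a+eps j)) _ _
  rw [h, h, sum_comm]; refine sum_congr rfl fun b _ => sum_congr rfl fun a _ => ?_; rw [mul_comm]
  by_cases h0 : R.E j i b a = 0
  · simp [h0]
  · rw [R.wt_eq h0]; congr 1; abel

lemma Rep.T_sub_T (i j : Fin k) : R.T i j-R.T j i = der i R.chR-der j R.chR := by
  unfold Rep.T Rep.chR; simp only [map_sum, der_single, ← sum_sub_distrib]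
  refine sum_congr rfl fun a _ => ?_; have h := congrFun (congrFun (R.comm i j j i) a) a
  simp only [if_true, Matrix.sub_apply, R.diag, diagonal_apply_eq] at h
  rw [← single_sub, ← single_sub, h]; simp

lemma Rep.T_self (i : Fin k) : R.T i i = der i (der i R.chR) := by
  unfold Rep.T Rep.chR; simp only [map_sum, der_single]; refine sum_congr rfl fun a _ => ?_
  rw [R.diag]; simp

/-- The quadratic function whose shift by `ρ` gives the Casimir eigenvalue. -/
def Qf (v : ℚ^k) : ℚ := ∑ i, v i ^ 2-(k-1) * ∑ i, v i

lemma xv_isUnit (i : Fin k) : IsUnit (xv ℝ i) := by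
  refine IsUnit.of_mul_eq_one (single (-(eps i)) 1) ?_; rw [xv, single_mul_single]; simp [one_def]

/-- The pairs `i < j`. -/
abbrev prs (k : ℕ) : Finset (Fin k × Fin k) := univ.filter fun p => p.1 < p.2

lemma alt_rho_eq_prod' (R : Type) [CommRing R] :
    alt R (rho k) = ∏ p ∈ prs k, (xv R p.1-xv R p.2) := by
  rw [alt_rho_eq_prod, prod_filter, Fintype.prod_prod_type]; refine prod_congr rfl fun i _ => ?_
  rw [← prod_filter]; congr 1; ext j; simp

lemma sum_prs {M : Type} [AddCommMonoid M] (f : Fin k → Fin k → M) :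
    ∑ i, ∑ j, f i j = ∑ i, f i i + ∑ p ∈ prs k, (f p.1 p.2+f p.2 p.1) := by
  rw [← Fintype.sum_prod_type']
  have h1 : (univ : Finset (Fin k × Fin k)) = univ.filter (fun p => p.1 = p.2) ∪
      (prs k ∪ univ.filter fun p => p.2 < p.1) := by
    ext p; have := lt_trichotomy p.1 p.2
    simp only [mem_union, mem_filter, mem_univ, true_and, true_iff]
    tauto
  rw [h1, sum_union, sum_union, sum_add_distrib]
  · congr 1
    · rw [sum_filter, Fintype.sum_prod_type]; simp
    · congr 1; refine sum_nbij' Prod.swap Prod.swap ?_ ?_ ?_ ?_ ?_ <;> simp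
  · rw [disjoint_left]; intro p; simp +contextual [le_of_lt]
  · rw [disjoint_left]; intro p; simp +contextual

lemma sum_single {ι : Type} (s : Finset ι) (v : ℚ^k) (c : ι → ℝ) :
    ∑ i ∈ s, (single v (c i) : ChR ℝ k) = single v (∑ i ∈ s, c i) :=
  (map_sum (singleAddHom (R := ℝ) v) _ _).symm

lemma lap_alt_rho (v : ℚ^k) :
    ∑ i, der i (der i (alt ℝ v)) = ((∑ i, v i ^ 2 : ℚ) : ℝ) • alt ℝ v := by
  unfold alt; simp only [map_sum, der_single, smul_sum, smul_single]; rw [sum_comm]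
  refine sum_congr rfl fun σ _ => ?_; rw [← Equiv.sum_comp σ (fun i => v i ^ 2)]
  simp only [← mul_assoc]; rw [sum_single, smul_eq_mul]; congr 1
  rw [← sum_mul]; push_cast; simp only [sq]

lemma euler_alt_rho (v : ℚ^k) : ∑ i, der i (alt ℝ v) = ((∑ i, v i : ℚ) : ℝ) • alt ℝ v := by
  unfold alt; simp only [map_sum, der_single, smul_sum, smul_single]; rw [sum_comm]
  refine sum_congr rfl fun σ _ => ?_; rw [← Equiv.sum_comp σ (fun i => v i)]
  rw [sum_single, smul_eq_mul]; congr 1; rw [← sum_mul]; push_cast; rfl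

lemma sum_prs_add {M : Type} [AddCommGroup M] (f : Fin k → M) :
    ∑ p ∈ prs k, (f p.1+f p.2) = ((k : ℤ)-1) • ∑ i, f i := by
  have h := sum_prs (k := k) (fun i _ => f i)
  simp only [sum_const, card_univ, Fintype.card_fin, ← smul_sum] at h
  rw [sub_smul, one_smul, natCast_zsmul, h]; abel

/-- If the Casimir acts by the scalar `c`, the alternating character is supported on
`Q(v) = Q(ρ) + c`. -/
lemma Rep.freudenthal (c : ℝ) (hc : R.cas = c • 1) (v : ℚ^k)
    (hv : (alt ℝ (rho k)*R.chR).coeff v ≠ 0) : (Qf v : ℝ) = Qf (rho k)+c := by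
  set A := alt ℝ (rho k) with hA; set f := R.chR with hf
  let Qp : Fin k × Fin k → ChR ℝ k := fun p => ∏ q ∈ (prs k).erase p, (xv ℝ q.1-xv ℝ q.2)
  have hAQ : ∀ p ∈ prs k, A = (xv ℝ p.1-xv ℝ p.2)*Qp p := by
    intro p hp; rw [hA, alt_rho_eq_prod', ← mul_prod_erase _ _ hp]
  have hcas : c • f = ∑ i, der i (der i f) + ∑ p ∈ prs k, (R.T p.1 p.2+R.T p.2 p.1) := by
    simp only [hf, ← Rep.T_self]; rw [← sum_prs]; simp only [Rep.T, Rep.chR, smul_sum, smul_single]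
    rw [sum_congr rfl fun i _ => sum_comm, sum_comm]; refine sum_congr rfl fun a _ => ?_
    have h := congrFun (congrFun hc a) a
    simp only [Rep.cas, Matrix.sum_apply, Matrix.smul_apply, one_apply_eq] at h; rw [← h]
    simp only [sum_single]
  have hpair : ∀ p ∈ prs k, A*(R.T p.1 p.2+R.T p.2 p.1)
      = 2*(Qp p*(xv ℝ p.1*der p.1 f-xv ℝ p.2*der p.2 f))-A*(der p.1 f+der p.2 f) := by
    intro p hp; apply (xv_isUnit p.1).mul_left_cancel; have h1 := R.xv_mul_T p.1 p.2
    have h2 := R.T_sub_T p.1 p.2; rw [hAQ p hp]; rw [← hf] at h2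
    have h3 : xv ℝ p.1*R.T p.1 p.2-xv ℝ p.2*R.T p.1 p.2 = xv ℝ p.1*(der p.1 f-der p.2 f) := by
      rw [h1, ← h2]; ring
    calc xv ℝ p.1*((xv ℝ p.1-xv ℝ p.2)*Qp p*(R.T p.1 p.2+R.T p.2 p.1))
        = (xv ℝ p.1-xv ℝ p.2)*Qp p*(xv ℝ p.1*R.T p.1 p.2+xv ℝ p.1*R.T p.2 p.1) := by ring
      _ = (xv ℝ p.1+xv ℝ p.2)*Qp p*(xv ℝ p.1*R.T p.1 p.2-xv ℝ p.2*R.T p.1 p.2) := by rw [← h1]; ring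
      _ = _ := by rw [h3]; ring
  have hder : ∀ i, der i A = ∑ p ∈ prs k, Qp p *
      ((if i = p.1 then xv ℝ p.1 else 0)-(if i = p.2 then xv ℝ p.2 else 0)) := by
    intro i; rw [hA, alt_rho_eq_prod', der_prod]; simp only [map_sub, der_xv]; rfl
  have hcross : ∑ i, der i A*der i f
      = ∑ p ∈ prs k, Qp p*(xv ℝ p.1*der p.1 f-xv ℝ p.2*der p.2 f) := by
    simp only [hder, sum_mul]; rw [sum_comm]; refine sum_congr rfl fun p _ => ?_
    simp only [mul_assoc, ← mul_sum, sub_mul, sum_sub_distrib, ite_mul, zero_mul]; simp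
  have hsum : A*(c • f) = A * ∑ i, der i (der i f)+2 * ∑ i, der i A*der i f
      - A*(((k : ℤ)-1) • ∑ i, der i f) := by
    rw [hcas, mul_add, mul_sum (s := prs k), sum_congr rfl hpair,
      sum_sub_distrib, ← mul_sum, ← hcross, ← mul_sum, sum_prs_add (fun i => der i f)]
    ring
  have hlap : ∑ i, der i (der i (A*f)) = (∑ i, der i (der i A))*f
      + 2 * ∑ i, der i A*der i f+A * ∑ i, der i (der i f) := by
    simp only [sum_mul, mul_sum, ← sum_add_distrib]; refine sum_congr rfl fun i _ => ?_
    simp only [der_mul, map_add]; ring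
  have heul : ∑ i, der i (A*f) = (∑ i, der i A)*f+A * ∑ i, der i f := by
    simp only [der_mul, sum_add_distrib, sum_mul, mul_sum]
  rw [hA, lap_alt_rho, ← hA] at hlap; rw [hA, euler_alt_rho, ← hA] at heul
  have h1 : ∑ i, der i (der i (A*f))-((k : ℝ)-1) • ∑ i, der i (A*f)
      = ((Qf (rho k) : ℝ)+c) • (A*f) := by
    have hk : (((k : ℤ)-1) • ∑ i, der i f) = ((k : ℝ)-1) • ∑ i, der i f := by
      rw [← Int.cast_smul_eq_zsmul ℝ]; push_cast; rfl
    rw [hk] at hsum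
    have hs2 : 2 * ∑ i, der i A*der i f = c • (A*f)-A * ∑ i, der i (der i f)
        + ((k : ℝ)-1) • (A * ∑ i, der i f) := by
      rw [mul_smul_comm] at hsum; rw [hsum, mul_smul_comm]; abel
    rw [hlap, heul, hs2, Qf]; push_cast
    simp only [smul_mul_assoc, smul_add, add_smul, sub_smul, mul_smul, one_smul]; abel
  have h2 := congrArg (fun g => g.coeff v) h1
  simp only [coeff_sub, coeff_sum, coeff_smul,
    Finsupp.sub_apply, finsetSum_apply, Finsupp.smul_apply, der_coeff, smul_eq_mul] at h2
  apply mul_right_cancel₀ hv; rw [← h2, Qf]; push_cast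
  simp only [← mul_assoc, ← sum_mul, sub_mul, sq]

end freudenthal

/-! ### Coefficients -/

lemma coeff_mul_single' {R : Type} [CommRing R] (f : ChR R k) (w v : ℚ^k) (c : R) :
    (f*single w c).coeff v = f.coeff (v-w)*c := by
  have h := coeff_mul_single_add f c w (v-w)
  rwa [sub_add_cancel] at h

lemma coeff_mul_alt {R : Type} [CommRing R] (f : ChR R k) (u v : ℚ^k) : (f*alt R u).coeff v
      = ∑ σ : Perm (Fin k), ((sign σ : ℤ) : R)*f.coeff (v-fun i => u (σ i)) := by
  rw [alt, mul_sum, coeff_sum, finsetSum_apply]; refine sum_congr rfl fun σ _ => ?_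
  rw [coeff_mul_single', mul_comm]

/-! ### The dominance cone -/

/-- Partial sums. -/
def ps (β : ℚ^k) (j : ℕ) : ℚ := ∑ i ∈ univ.filter (fun i : Fin k => i.val < j), β i

/-- The cone spanned by the positive roots. -/
def cone (β : ℚ^k) : Prop := (∀ j, 0 ≤ ps β j) ∧ ∑ i, β i = 0

lemma ps_add (β γ : ℚ^k) (j : ℕ) : ps (β+γ) j = ps β j+ps γ j := by simp [ps, sum_add_distrib]

lemma cone_add {β γ : ℚ^k} (h : cone β) (h' : cone γ) : cone (β+γ) :=
  ⟨fun j => by rw [ps_add]; exact add_nonneg (h.1 j) (h'.1 j), by simp [sum_add_distrib, h.2, h'.2]⟩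

lemma cone_zero : cone (0 : ℚ^k) := ⟨fun j => by simp [ps], by simp⟩

lemma ps_eps (i : Fin k) (j : ℕ) : ps (eps i) j = if i.val < j then 1 else 0 := by
  rw [ps, sum_filter]; simp only [Pi.single_apply]; rw [sum_eq_single i]
  all_goals simp_all

lemma cone_root {i j : Fin k} (h : i ≤ j) : cone (eps i-eps j) := by
  refine ⟨fun l => ?_, by simp⟩
  have : ps (eps i-eps j) l = ps (eps i) l-ps (eps j) l := by simp [ps]
  rw [this, ps_eps, ps_eps]; grind

lemma cone_sub_perm {v : ℚ^k} (hv : Antitone v) (σ : Perm (Fin k)) : cone (v-fun i => v (σ i)) := by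
  refine ⟨fun j => ?_, by simp [Equiv.sum_comp σ v]⟩
  set I := univ.filter (fun i : Fin k => i.val < j) with hI
  have h1 : ps (v-fun i => v (σ i)) j = ∑ i ∈ I, v i - ∑ i ∈ I.map σ.toEmbedding, v i := by
    simp [ps, hI]
  rw [h1]; set T := I.map σ.toEmbedding with hT; have hc : (I \ T).card = (T \ I).card := by grind
  have e1 : ∑ i ∈ I, v i = ∑ i ∈ I \ T, v i + ∑ i ∈ I ∩ T, v i := by
    rw [add_comm]; exact (sum_inter_add_sum_sdiff I T v).symm
  have e2 : ∑ i ∈ T, v i = ∑ i ∈ T \ I, v i + ∑ i ∈ I ∩ T, v i := by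
    rw [add_comm, inter_comm]; exact (sum_inter_add_sum_sdiff T I v).symm
  rw [e1, e2]; rcases (I \ T).eq_empty_or_nonempty with h0 | h0
  · have : T \ I = ∅ := by grind
    simp [h0, this]
  · obtain ⟨b, hb⟩ : (T \ I).Nonempty := by rw [← card_pos, ← hc]; exact h0.card_pos
    have hbig : ∀ a ∈ I \ T, ∀ b ∈ T \ I, v b ≤ v a := by
      intro a ha b hb; simp only [hI, mem_sdiff, mem_filter, mem_univ, true_and] at ha hb; apply hv
      rw [le_def]; omega
    obtain ⟨M, hM, hMl⟩ := exists_max_image (T \ I) v ⟨b, hb⟩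
    have a1 : ∑ i ∈ T \ I, v i ≤ (T \ I).card • v M := sum_le_card_nsmul _ _ _ hMl
    have a2 : (I \ T).card • v M ≤ ∑ i ∈ I \ T, v i :=
      card_nsmul_le_sum _ _ _ fun a ha => hbig a ha M hM
    rw [hc] at a2; linarith

lemma ps_succ (β : ℚ^k) (j : Fin k) : ps β (j.val+1) = ps β j.val+β j := by
  unfold ps
  have : univ.filter (fun i : Fin k => i.val < j.val+1)
      = insert j (univ.filter (fun i : Fin k => i.val < j.val)) := by
    grind
  grind

lemma cone_eq_zero_of_ps {β : ℚ^k} (h : ∀ j, ps β j = 0) : β = 0 := by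
  funext j; have := ps_succ β j
  simp_all

lemma sum_mul_eq_abel {F : Type} [Field F] (β : ℚ^k) (η : ℕ → F) [CharZero F] :
    ∑ i : Fin k, (β i : F)*η i = (ps β k : F)*η k
      + ∑ j ∈ range k, (ps β (j+1) : F)*(η j-η (j+1)) := by
  have h : ∀ n ≤ k, ∑ i ∈ univ.filter (fun i : Fin k => i.val < n), (β i : F)*η i
      = (ps β n : F)*η n + ∑ j ∈ range n, (ps β (j+1) : F)*(η j-η (j+1)) := by
    intro n hn
    induction n with
    | zero => simp [ps]
    | succ n ih =>
      have : univ.filter (fun i : Fin k => i.val < n+1)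
          = insert ⟨n, hn⟩ (univ.filter (fun i : Fin k => i.val < n)) := by
        grind
      rw [this, sum_insert (by simp), ih (by omega), sum_range_succ]; have h2 := ps_succ β ⟨n, hn⟩
      simp only at h2; rw [h2]; push_cast; ring
  have h' := h k le_rfl
  simp_all

lemma ps_top (β : ℚ^k) : ps β k = ∑ i, β i := by unfold ps; congr 1; ext i; simp

/-- Pairing with an antitone function is nonnegative on the cone. -/
lemma cone_pair_nonneg {F : Type} [Field F] [LinearOrder F] [IsStrictOrderedRing F]
    {β : ℚ^k} (hβ : cone β) (η : Fin k → F)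
    (hη : ∀ i j, i ≤ j → η j ≤ η i) : 0 ≤ ∑ i, (β i : F)*η i := by
  let η' : ℕ → F := fun n => if h : n < k then η ⟨n, h⟩ else if h' : 0 < k then η ⟨k-1, by omega⟩ else 0
  have e : ∑ i, (β i : F)*η i = ∑ i : Fin k, (β i : F)*η' i := by grind
  rw [e, sum_mul_eq_abel, ps_top, hβ.2]; simp only [Rat.cast_zero, zero_mul, zero_add]
  refine sum_nonneg fun j hj => mul_nonneg (mod_cast hβ.1 _) ?_; rw [mem_range] at hj
  simp only [η', hj, dif_pos, (by omega : 0 < k), sub_nonneg]; grind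

lemma cone_pair_pos {F : Type} [Field F] [LinearOrder F] [IsStrictOrderedRing F]
    {β : ℚ^k} (hβ : cone β) (h0 : β ≠ 0) (η : Fin k → F)
    (hη : ∀ i j, i < j → η j < η i) : 0 < ∑ i, (β i : F)*η i := by
  let η' : ℕ → F := fun n => if h : n < k then η ⟨n, h⟩ else if h' : 0 < k then η ⟨k-1, by omega⟩ else 0
  have e : ∑ i, (β i : F)*η i = ∑ i : Fin k, (β i : F)*η' i := by
    refine sum_congr rfl fun i _ => ?_; simp [η']
  rw [e, sum_mul_eq_abel, ps_top, hβ.2]; simp only [Rat.cast_zero, zero_mul, zero_add]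
  have key : ∀ j ∈ range k, 0 ≤ (ps β (j+1) : F)*(η' j-η' (j+1)) ∧
      (ps β (j+1) ≠ 0 → 0 < (ps β (j+1) : F)*(η' j-η' (j+1))) := by
    intro j hj; rw [mem_range] at hj; have hp := hβ.1 (j+1); by_cases h : j+1 < k
    · have : 0 < η' j-η' (j+1) := by
        simp only [η', hj, h, dif_pos, sub_pos]
        simp_all
      refine ⟨mul_nonneg (mod_cast hp) this.le, fun hne => mul_pos ?_ this⟩
      exact_mod_cast lt_of_le_of_ne hp hne.symm
    · have hjk : j+1 = k := by omega
      have : ps β (j+1) = 0 := by rw [hjk, ps_top, hβ.2]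
      simp [this]
  by_contra hcon
  have hz : ∑ j ∈ range k, (ps β (j+1) : F)*(η' j-η' (j+1)) = 0 :=
    le_antisymm (not_lt.1 hcon) (sum_nonneg fun j hj => (key j hj).1)
  rw [sum_eq_zero_iff_of_nonneg fun j hj => (key j hj).1] at hz; apply h0; apply cone_eq_zero_of_ps
  have hj : ∀ j ≤ k, ps β j = 0 := by
    intro j hj; rcases j with _ | j
    · simp [ps]
    · simp_all
  intro j; by_cases h : j ≤ k
  · exact hj j h
  · have : ps β j = ps β k := by unfold ps; congr 1; ext i; simp; omega
    rw [this, hj k le_rfl]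

/-! ### Elementary constructions -/

lemma spectral_real {ι : Type} [Fintype ι] [DecidableEq ι] (A : Matrix ι ι ℝ)
    (h : Aᵀ = A) : ∃ (U : Matrix ι ι ℝ) (ev : ι → ℝ), Uᵀ*U = 1 ∧ Uᵀ*A*U = diagonal ev := by
  have hA : A.IsHermitian := by rw [IsHermitian, conjTranspose_eq_transpose_of_trivial, h]
  refine ⟨hA.eigenvectorUnitary, hA.eigenvalues, ?_, ?_⟩
  · have := (mem_unitaryGroup_iff'.1 hA.eigenvectorUnitary.2)
    rwa [star_eq_conjTranspose, conjTranspose_eq_transpose_of_trivial] at this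
  · have := hA.conjStarAlgAut_star_eigenvectorUnitary; rw [Unitary.conjStarAlgAut_apply] at this
    simpa [star_eq_conjTranspose, conjTranspose_eq_transpose_of_trivial] using this

namespace Rep
variable {m : ℕ} {ι : Type} [Fintype ι] [DecidableEq ι] (R : Rep m ι)

lemma exists_diag_cas : ∃ (O : Matrix ι ι ℝ) (ev : ι → ℝ), Oᵀ*O = 1 ∧
    Oᵀ*R.cas*O = diagonal ev ∧ ∀ a b, O a b ≠ 0 → R.wt a = R.wt b := by
  classical
  let κ := Set.range R.wt; let f : ι → κ := fun a => ⟨R.wt a, a, rfl⟩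
  let e : (Σ ν : κ, {a // f a = ν}) ≃ ι := Equiv.sigmaFiberEquiv f
  let Cν : ∀ ν : κ, Matrix {a // f a = ν} {a // f a = ν} ℝ := fun ν => R.cas.submatrix (·.1) (·.1)
  have hs : ∀ ν, (Cν ν).transpose = Cν ν := by intro ν; rw [transpose_submatrix, R.cas_symm]
  choose U ev hU hUe using fun ν => spectral_real (Cν ν) (hs ν)
  have hblock : R.cas.submatrix e e = blockDiagonal' Cν := by
    ext ⟨ν, a⟩ ⟨ν', b⟩; by_cases h : ν = ν'
    · subst h; rw [blockDiagonal'_apply_eq]; rfl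
    · rw [blockDiagonal'_apply_ne _ _ _ h]; by_contra hne; apply h; have := R.cas_wt hne
      rw [← a.2, ← b.2]; exact Subtype.ext this
  refine ⟨(blockDiagonal' U).submatrix e.symm e.symm, fun a => ev (e.symm a).1 (e.symm a).2,
    ?_, ?_, ?_⟩
  · rw [transpose_submatrix, submatrix_mul_equiv, blockDiagonal'_transpose, ← blockDiagonal'_mul]
    simp only [hU]; have : (fun k => (1 : Matrix {a // f a = k} {a // f a = k} ℝ)) = 1 := rfl
    simp_all
  · have hC : R.cas = (blockDiagonal' Cν).submatrix e.symm e.symm := by rw [← hblock]; ext a b; simp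
    rw [hC, transpose_submatrix, submatrix_mul_equiv, submatrix_mul_equiv,
      blockDiagonal'_transpose, ← blockDiagonal'_mul, ← blockDiagonal'_mul]
    simp_all
  · intro a b h; rw [submatrix_apply] at h; by_contra hne; apply h; apply blockDiagonal'_apply_ne
    grind

/-- Transport along a weight-preserving orthogonal matrix. -/
def conj (O : Matrix ι ι ℝ) (hO : Oᵀ*O = 1)
    (hw : ∀ a b, O a b ≠ 0 → R.wt a = R.wt b) : Rep m ι where
  E i j := Oᵀ*R.E i j*O
  wt := R.wt
  diag i := by
    have : R.E i i*O = O*R.E i i := by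
      rw [R.diag]; ext a b; simp only [diagonal_mul, mul_diagonal]; grind
    rw [Matrix.mul_assoc, this, ← Matrix.mul_assoc, hO, Matrix.one_mul, R.diag]
  comm i j k l := by
    have hO' := mul_eq_one_comm.1 hO
    have h : ∀ A B : Matrix ι ι ℝ, Oᵀ*A*O*(Oᵀ*B*O) = Oᵀ*(A*B)*O := by grind
    rw [h, h, ← Matrix.sub_mul, ← Matrix.mul_sub, R.comm, Matrix.mul_sub, Matrix.sub_mul]
    split_ifs <;> simp
  symm i j := by rw [transpose_mul, transpose_mul, transpose_transpose, R.symm, Matrix.mul_assoc]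

/-- The restriction to a set of basis vectors stable under the action. -/
def sub (p : ι → Prop) [DecidablePred p]
    (hp : ∀ i j a b, R.E i j a b ≠ 0 → (p a ↔ p b)) : Rep m {a // p a} where
  E i j := (R.E i j).submatrix (·.1) (·.1)
  wt a := R.wt a.1
  diag i := by
    rw [R.diag]; ext a b; by_cases h : a = b
    · subst h; simp
    · have : a.1 ≠ b.1 := fun h' => h (Subtype.ext h')
      simp_all
  comm i j k l := by
    have h : ∀ i j k l, (R.E i j).submatrix (fun a : {a // p a} => a.1) (fun a : {a // p a} => a.1) *
        (R.E k l).submatrix (fun a : {a // p a} => a.1) (fun a : {a // p a} => a.1)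
        = (R.E i j*R.E k l).submatrix (·.1) (·.1) := by
      intro i j k l; ext a b; simp only [Matrix.mul_apply, submatrix_apply]
      rw [← sum_filter_of_ne (p := p) (s := univ), sum_subtype _ (p := p) (by simp)]; grind
    rw [h, h]; ext a b; have := congrFun (congrFun (R.comm i j k l) a.1) b.1
    simp only [Matrix.sub_apply, submatrix_apply] at this ⊢; rw [this]; split_ifs <;> rfl
  symm i j := by rw [transpose_submatrix, R.symm]

end Rep

namespace Rep
variable {m : ℕ} {ι : Type} [Fintype ι] [DecidableEq ι] (R : Rep m ι)

/-! ### Weight vectors and highest weight vectors -/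

/-- The weight space of weight `μ`. -/
def Wt (μ : ℚ^m) : Submodule ℝ (ι → ℝ) where
  carrier := {x | ∀ a, R.wt a ≠ μ → x a = 0}
  zero_mem' a _ := rfl
  add_mem' hx hy a h := by simp [hx a h, hy a h]
  smul_mem' c x hx a h := by simp [hx a h]

/-- The space of highest weight vectors of weight `μ`. -/
def Inv (μ : ℚ^m) : Submodule ℝ (ι → ℝ) where
  carrier := {x | x ∈ R.Wt μ ∧ ∀ i j, i < j → R.E i j *ᵥ x = 0}
  zero_mem' := ⟨zero_mem _, fun i j _ => by simp⟩
  add_mem' hx hy := ⟨add_mem hx.1 hy.1, fun i j h => by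
    rw [mulVec_add, hx.2 i j h, hy.2 i j h, add_zero]⟩
  smul_mem' c x hx := ⟨Submodule.smul_mem _ c hx.1, fun i j h => by
    rw [mulVec_smul, hx.2 i j h, smul_zero]⟩

variable {R}

lemma mem_Wt {μ : ℚ^m} {x : ι → ℝ} : x ∈ R.Wt μ ↔ ∀ a, R.wt a ≠ μ → x a = 0 := Iff.rfl

lemma mem_Inv {μ : ℚ^m} {x : ι → ℝ} :
    x ∈ R.Inv μ ↔ x ∈ R.Wt μ ∧ ∀ i j, i < j → R.E i j *ᵥ x = 0 := Iff.rfl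

lemma E_mem_Wt {μ : ℚ^m} {x : ι → ℝ} (hx : x ∈ R.Wt μ) (i j : Fin m) :
    R.E i j *ᵥ x ∈ R.Wt (μ+eps i-eps j) := by
  intro a ha; rw [mulVec, dotProduct]; refine sum_eq_zero fun b _ => ?_; by_contra hne
  have h1 := R.wt_eq (left_ne_zero_of_mul hne)
  have h2 : R.wt b = μ := by by_contra h; exact right_ne_zero_of_mul hne (hx b h)
  exact ha (by rw [h1, h2])

lemma E_self {μ : ℚ^m} {x : ι → ℝ} (hx : x ∈ R.Wt μ) (i : Fin m) :
    R.E i i *ᵥ x = (μ i : ℝ) • x := by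
  funext a; rw [R.diag, mulVec_diagonal, Pi.smul_apply, smul_eq_mul]; by_cases h : R.wt a = μ
  · rw [h]
  · rw [hx a h]; simp

variable (R)

lemma comm_vec (i j k l : Fin m) (x : ι → ℝ) : R.E i j *ᵥ (R.E k l *ᵥ x) = R.E k l *ᵥ (R.E i j *ᵥ x)
      + (if j = k then R.E i l *ᵥ x else 0)-(if l = i then R.E k j *ᵥ x else 0) := by
  have := congrArg (fun M => M *ᵥ x) (R.comm i j k l)
  simp only [sub_mulVec, ← mulVec_mulVec] at this
  have h : ∀ (c : Prop) [Decidable c] (M : Matrix ι ι ℝ),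
      (if c then M else 0) *ᵥ x = if c then M *ᵥ x else 0 := by
    intro c _ M; split_ifs <;> simp
  rw [h, h, sub_eq_iff_eq_add] at this; rw [this]; abel

lemma dot_E (i j : Fin m) (x y : ι → ℝ) : (R.E i j *ᵥ x) ⬝ᵥ y = x ⬝ᵥ (R.E j i *ᵥ y) := by
  rw [← R.symm i j, mulVec_transpose, dotProduct_comm, dotProduct_mulVec, dotProduct_comm]

variable {R}

lemma dot_E_E {μ : ℚ^m} {x : ι → ℝ} (hx : x ∈ R.Wt μ) {i j : Fin m} (hij : i ≠ j) :
    (R.E j i *ᵥ x) ⬝ᵥ (R.E j i *ᵥ x)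
      = (R.E i j *ᵥ x) ⬝ᵥ (R.E i j *ᵥ x)+((μ i : ℝ)-μ j)*(x ⬝ᵥ x) := by
  rw [dot_E, R.comm_vec i j j i x, dot_E R i j]
  simp only [if_true, E_self hx, dotProduct_add, dotProduct_sub, dotProduct_smul, smul_eq_mul]; ring

lemma dot_self_pos {x : ι → ℝ} (hx : x ≠ 0) : 0 < x ⬝ᵥ x := by
  have h : 0 ≤ x ⬝ᵥ x := sum_nonneg fun a _ => mul_self_nonneg _
  exact lt_of_le_of_ne h fun h0 => hx (dotProduct_self_eq_zero.1 h0.symm)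

lemma dot_self_nonneg (x : ι → ℝ) : 0 ≤ x ⬝ᵥ x := sum_nonneg fun a _ => mul_self_nonneg _

lemma E_ne_zero {μ : ℚ^m} {x : ι → ℝ} (hx : x ∈ R.Wt μ) (h0 : x ≠ 0) {i j : Fin m}
    (hij : μ j < μ i) : R.E j i *ᵥ x ≠ 0 := by
  intro h; have h1 := dot_E_E hx (i := i) (j := j) (by rintro rfl; exact lt_irrefl _ hij)
  rw [h, zero_dotProduct] at h1
  have h2 : (0 : ℝ) < (μ i : ℝ)-μ j := by rw [sub_pos]; exact_mod_cast hij
  nlinarith [dot_self_nonneg (R.E i j *ᵥ x), mul_pos h2 (dot_self_pos h0)]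

/-- The weight of a highest weight vector is dominant. -/
lemma antitone_of_Inv {μ : ℚ^m} {x : ι → ℝ} (hx : x ∈ R.Inv μ) (h0 : x ≠ 0) :
    Antitone μ := by
  intro i j hij; rcases hij.eq_or_lt with rfl | hlt
  · exact le_rfl
  by_contra hcon
  push Not at hcon
  exact E_ne_zero hx.1 h0 hcon (hx.2 i j hlt)

lemma Qf_sub (μ ν : ℚ^m) : Qf (ν+rho m)-Qf (μ+rho m) = ∑ i, (ν-μ) i*(ν+μ+(2 : ℚ) • rho m) i
      - (m-1) * ∑ i, (ν-μ) i := by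
  unfold Qf
  rw [mul_sum, mul_sum, mul_sum, ← sum_sub_distrib,
    ← sum_sub_distrib, ← sum_sub_distrib, ← sum_sub_distrib]
  refine sum_congr rfl fun i _ => ?_
  simp only [Pi.add_apply, Pi.sub_apply, Pi.smul_apply, smul_eq_mul]; ring

lemma sum_prs_sub (μ : ℚ^m) :
    ∑ p ∈ prs m, (μ p.1-μ p.2) = ∑ i : Fin m, ((m : ℚ)-1-2*((i : ℕ) : ℚ))*μ i := by
  have h1 : ∑ p ∈ prs m, μ p.2 = ∑ i : Fin m, ((i : ℕ) : ℚ)*μ i := by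
    rw [sum_filter, ← univ_product_univ, sum_product_right]; refine sum_congr rfl fun i _ => ?_
    simp only; rw [← sum_filter, sum_const, nsmul_eq_mul]; congr 2
    have : univ.filter (fun x : Fin m => x < i) = Iio i := by ext; simp
    rw [this]; simp
  have h2 := sum_prs_add (k := m) μ; rw [sum_add_distrib] at h2
  rw [sum_sub_distrib, eq_sub_of_add_eq h2, h1]
  rw [zsmul_eq_mul, mul_sum, ← sum_sub_distrib, ← sum_sub_distrib]
  refine sum_congr rfl fun i _ => ?_; push_cast; ring

/-- The Casimir eigenvalue attached to the highest weight `μ`. -/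
def cv (μ : ℚ^m) : ℚ := Qf (μ+rho m)-Qf (rho m)

lemma cas_Inv {μ : ℚ^m} {x : ι → ℝ} (hx : x ∈ R.Inv μ) : R.cas *ᵥ x = ((cv μ : ℚ) : ℝ) • x := by
  have h1 : R.cas *ᵥ x = ∑ i, R.E i i *ᵥ (R.E i i *ᵥ x)
      + ∑ p ∈ prs m, (R.E p.1 p.2 *ᵥ (R.E p.2 p.1 *ᵥ x)+R.E p.2 p.1 *ᵥ (R.E p.1 p.2 *ᵥ x)) := by
    have := sum_prs (k := m) (fun i j => R.E i j *ᵥ (R.E j i *ᵥ x)); rw [← this]; unfold cas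
    simp only [sum_mulVec, ← mulVec_mulVec]
  have h2 : ∀ p ∈ prs m, R.E p.1 p.2 *ᵥ (R.E p.2 p.1 *ᵥ x)+R.E p.2 p.1 *ᵥ (R.E p.1 p.2 *ᵥ x)
      = (((μ p.1-μ p.2 : ℚ)) : ℝ) • x := by
    intro p hp; rw [mem_filter] at hp; rw [R.comm_vec, hx.2 _ _ hp.2]
    simp only [if_true, E_self hx.1, mulVec_zero]; push_cast; rw [sub_smul]; abel
  rw [h1, sum_congr rfl h2, ← sum_smul]; simp only [E_self hx.1, mulVec_smul, smul_smul]
  rw [← sum_smul, ← add_smul]; congr 1; rw [← Rat.cast_sum, sum_prs_sub]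
  have := Qf_sub (m := m) 0 μ; unfold cv; rw [zero_add] at this; rw [this]; push_cast
  rw [mul_sum, ← sum_add_distrib, ← sum_sub_distrib]; refine sum_congr rfl fun i _ => ?_
  simp only [Pi.add_apply, Pi.sub_apply, Pi.smul_apply, Pi.zero_apply, smul_eq_mul]; push_cast; ring

lemma cv_lt {μ ν : ℚ^m} (hμ : Antitone μ) (hν : Antitone ν) (hc : cone (ν-μ))
    (hne : ν ≠ μ) : cv μ < cv ν := by
  unfold cv; have h := Qf_sub (m := m) μ ν; rw [hc.2, mul_zero, sub_zero] at h
  have h2 := cone_pair_pos (F := ℚ) hc (sub_ne_zero.2 hne) (ν+μ+(2 : ℚ) • rho m) (by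
    intro i j hij; simp only [Pi.add_apply, Pi.smul_apply, smul_eq_mul]; have h1 := hμ hij.le
    have h2 := hν hij.le; have : ((i : ℕ) : ℚ) < (j : ℕ) := mod_cast hij
    linarith)
  simp only [Rat.cast_id] at h2; linarith

/-- In a representation where the Casimir acts by `cv μ`, no weight lies above `μ`. -/
lemma eq_of_cone {μ : ℚ^m} (hμ : Antitone μ) (hc : ∀ a b, R.cas a b ≠ 0 → a = b ∧ R.cas a a = cv μ)
    (hc' : ∀ a, R.cas a a = cv μ) (a : ι) (ha : cone (R.wt a-μ)) : R.wt a = μ := by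
  classical
  by_contra hne; let S := univ.filter fun a => cone (R.wt a-μ) ∧ R.wt a ≠ μ
  obtain ⟨b, hbS, hb⟩ := exists_max_image S (fun a => ∑ i, R.wt a i*rho m i)
    ⟨a, by simp [S, ha, hne]⟩
  simp only [S, mem_filter, mem_univ, true_and] at hbS hb
  have hx : (Pi.single b 1 : ι → ℝ) ∈ R.Inv (R.wt b) := by
    refine ⟨fun a' h => ?_, fun i j hij => ?_⟩
    · grind
    · funext a'; rw [mulVec_single_one, col_apply, Pi.zero_apply]; by_contra hE
      have hw := R.wt_eq hE; have hr := cone_root hij.le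
      have hcone : cone (R.wt a'-μ) := by have := cone_add hbS.1 hr; grind
      have hgt : ∑ i, R.wt b i*rho m i < ∑ i, R.wt a' i*rho m i := by
        have := cone_pair_pos (F := ℚ) hr (by
          intro h; have := congrFun h i
          simp [hij.ne] at this) (rho m) (by simp)
        rw [← sub_pos, ← sum_sub_distrib]; refine this.trans_eq (sum_congr rfl fun l _ => ?_)
        rw [hw]; simp only [Pi.add_apply, Pi.sub_apply, Rat.cast_id]; ring
      refine absurd (hb a' ⟨hcone, ?_⟩) (not_le.2 hgt); rintro rfl
      have h3 := (cone_pair_nonneg (F := ℚ) hbS.1 (rho m) (by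
            intro i j hij; have : ((i : ℕ) : ℚ) ≤ (j : ℕ) := mod_cast hij
            linarith))
      have : ∑ i, (((R.wt b-R.wt a') i : ℚ) : ℚ)*rho m i
          = ∑ i, R.wt b i*rho m i - ∑ i, R.wt a' i*rho m i := by
        rw [← sum_sub_distrib]; refine sum_congr rfl fun l _ => ?_; simp only [Pi.sub_apply]; ring
      simp only [Rat.cast_id] at h3 this; rw [this] at h3; linarith
  have hb0 : (Pi.single b 1 : ι → ℝ) ≠ 0 := by simp
  have hd := antitone_of_Inv hx hb0; have h1 := congrFun (cas_Inv hx) b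
  rw [mulVec_single_one, col_apply] at h1
  simp only [Pi.smul_apply, Pi.single_eq_same, smul_eq_mul, mul_one] at h1; rw [hc' b] at h1
  have h2 : cv μ = cv (R.wt b) := mod_cast h1; exact (cv_lt hμ hd hbS.1 hbS.2).ne h2

lemma ch_coeff (ν : ℚ^m) : R.ch.coeff ν = (#{a | R.wt a = ν} : ℤ) := by
  unfold ch mono; rw [coeff_sum, finsetSum_apply]; simp only [coeff_single, Finsupp.single_apply]
  rw [sum_boole]

lemma finrank_coord (S : Finset ι) (P : Submodule ℝ (ι → ℝ))
    (hP : ∀ x, x ∈ P ↔ ∀ a, a ∉ S → x a = 0) : finrank ℝ P = S.card := by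
  have e : P ≃ₗ[ℝ] (S → ℝ) :=
    { toFun := fun x a => x.1 a
      map_add' := fun x y => rfl
      map_smul' := fun c x => rfl
      invFun := fun y => ⟨fun a => if h : a ∈ S then y ⟨a, h⟩ else 0, by
        simp_all⟩
      left_inv := fun x => by ext a; grind
      right_inv := fun y => by ext a; simp }
  rw [e.finrank_eq]; simp

/-- The multiplicity of `μ` in the character of a representation with scalar Casimir. -/
lemma coeff_of_cas {c : ℝ} (hc : R.cas = c • 1) {μ : ℚ^m} (hμ : Antitone μ) :
    (R.ch*alt ℤ (rho m)).coeff (μ+rho m) = if c = cv μ then R.ch.coeff μ else 0 := by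
  split_ifs with h
  · rw [coeff_mul_alt, sum_eq_single 1]
    · simp
    · intro σ _ hσ
      have hanti : Antitone (rho m) := by
        intro i j hij; have : ((i : ℕ) : ℚ) ≤ (j : ℕ) := mod_cast hij; linarith
      have : R.ch.coeff (μ+rho m-fun i => rho m (σ i)) = 0 := by
        rw [ch_coeff]; norm_cast; rw [card_eq_zero, filter_eq_empty_iff]; intro a _ ha
        have h1 := eq_of_cone (R := R) hμ (fun a b hab => by
          rw [hc] at hab ⊢; by_cases hab' : a = b
          · simp_all
          · simp [hab'] at hab) (fun a => by rw [hc]; simp [h]) a (by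
            rw [ha]; have := cone_sub_perm hanti σ
            convert this using 1; abel)
        rw [h1] at ha; apply hσ; ext i; have := congrFun ha i
        simp only [Pi.add_apply, Pi.sub_apply] at this
        have h3 : ((σ i : ℕ) : ℚ) = (i : ℕ) := by linarith
        have h4 : (σ i : ℕ) = i := mod_cast h3; simpa using h4
      rw [this, mul_zero]
    · simp
  · by_contra hne; apply h
    have h1 := R.freudenthal c hc (μ+rho m) (by
      rw [← toReal_ch, ← toReal_alt, ← map_mul, toReal_coeff, mul_comm]
      exact_mod_cast hne)
    unfold cv; push_cast; linarith

lemma ev_eq {ev : ι → ℝ} (hev : R.cas = diagonal ev) {i j : Fin m} {a b : ι}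
    (h : R.E i j a b ≠ 0) : ev a = ev b := by
  have := congrFun (congrFun (R.cas_comm i j) a) b
  rw [hev, diagonal_mul, mul_diagonal, mul_comm] at this
  simp_all

variable (R) in
/-- The eigenspace of a diagonal Casimir for the eigenvalue `c`. -/
def evPart (ev : ι → ℝ) (hev : R.cas = diagonal ev) (c : ℝ) : Rep m {a // ev a = c} :=
  R.sub (fun a => ev a = c) (fun i j a b h => by rw [ev_eq hev h])

lemma evPart_cas (ev : ι → ℝ) (hev : R.cas = diagonal ev) (c : ℝ) :
    (R.evPart ev hev c).cas = c • 1 := by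
  classical
  have : (R.evPart ev hev c).cas = R.cas.submatrix (·.1) (·.1) := by
    unfold cas; ext a b; simp only [submatrix_apply, Matrix.sum_apply, Matrix.mul_apply]
    refine sum_congr rfl fun i _ => sum_congr rfl fun j _ => ?_; symm
    rw [← sum_filter_of_ne (p := fun a => ev a = c) (s := univ),
      sum_subtype _ (p := fun a => ev a = c) (by simp)]
    · rfl
    · intro d _ hd; rw [← ev_eq hev (left_ne_zero_of_mul hd)]; exact a.2
  rw [this, hev]; ext a b; by_cases h : a = b
  · subst h; simp [a.2]
  · have : a.1 ≠ b.1 := fun h' => h (Subtype.ext h'); simp [h, this]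

lemma ch_eq_sum_evPart (ev : ι → ℝ) (hev : R.cas = diagonal ev) :
    R.ch = ∑ c ∈ univ.image ev, (R.evPart ev hev c).ch := by
  classical
  unfold ch
  rw [← sum_fiberwise_of_maps_to (t := univ.image ev) (g := ev)
    (fun a _ => mem_image_of_mem _ (mem_univ a))]
  refine sum_congr rfl fun c _ => ?_; rw [sum_subtype _ (p := fun a => ev a = c) (by simp)]; rfl

/-- Multiplicities as dimensions of spaces of highest weight vectors, when the Casimir is diagonal. -/
lemma finrank_Inv_of_diagonal (ev : ι → ℝ) (hev : R.cas = diagonal ev)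
    {μ : ℚ^m} (hμ : Antitone μ) :
    (finrank ℝ (R.Inv μ) : ℤ) = (R.ch*alt ℤ (rho m)).coeff (μ+rho m) := by
  classical
  let P := R.evPart ev hev; have hPcas : ∀ c, (P c).cas = c • 1 := evPart_cas ev hev
  have hch : R.ch = ∑ c ∈ univ.image ev, (P c).ch := ch_eq_sum_evPart ev hev
  have hcomm : ∀ i j a b, R.E i j a b ≠ 0 → ev a = ev b := fun i j a b h => ev_eq hev h
  have hPch : ∀ c, (P c).ch.coeff μ = (#{a | R.wt a = μ ∧ ev a = c} : ℤ) := by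
    intro c; rw [ch_coeff]; congr 1; rw [← card_map (Function.Embedding.subtype _)]; congr 1; ext a
    simp only [mem_map, mem_filter, mem_univ, true_and,
      Function.Embedding.coe_subtype, Subtype.exists, exists_and_right, exists_eq_right]
    constructor
    · rintro ⟨h, h'⟩; exact ⟨h', h⟩
    · rintro ⟨h, h'⟩; exact ⟨h', h⟩
  rw [hch, sum_mul, coeff_sum, finsetSum_apply]; simp only [coeff_of_cas (hPcas _) hμ, hPch]
  rw [sum_ite_eq']
  have hfin := finrank_coord (univ.filter fun a => R.wt a = μ ∧ ev a = cv μ) (R.Inv μ) (by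
    intro x; constructor
    · intro hx a ha; by_contra hne; apply ha; simp only [mem_filter_univ]
      refine ⟨by by_contra h; exact hne (hx.1 a h), ?_⟩; have := congrFun (cas_Inv hx) a
      rw [hev, mulVec_diagonal, Pi.smul_apply, smul_eq_mul] at this
      simp_all
    · intro hx; simp only [mem_filter_univ] at hx
      refine ⟨fun a ha => hx a fun h => ha h.1, fun i j hij => ?_⟩; funext a
      rw [mulVec, dotProduct, Pi.zero_apply]; refine sum_eq_zero fun b _ => ?_; by_contra hne
      have hE := left_ne_zero_of_mul hne; have hb : R.wt b = μ ∧ ev b = cv μ := by grind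
      have hw := R.wt_eq hE; rw [hb.1] at hw; have ha := hcomm i j a b hE; rw [hb.2] at ha
      have := eq_of_cone (R := P (cv μ)) hμ (fun a b hab => by
          rw [hPcas] at hab ⊢; by_cases hab' : a = b
          · simp_all
          · simp [hab'] at hab) (fun a => by rw [hPcas]; simp) ⟨a, ha⟩ (by
            change cone (R.wt a-μ); rw [hw]
            convert cone_root hij.le using 1; abel)
      change R.wt a = μ at this; rw [this] at hw; have := congrFun hw i
      simp [hij.ne] at this)
  simp_all

lemma conj_cas (O : Matrix ι ι ℝ) (hO : Oᵀ*O = 1) (hw : ∀ a b, O a b ≠ 0 → R.wt a = R.wt b) :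
    (R.conj O hO hw).cas = Oᵀ*R.cas*O := by
  have hO' := mul_eq_one_comm.1 hO; unfold cas
  have h : ∀ A B : Matrix ι ι ℝ, Oᵀ*A*O*(Oᵀ*B*O) = Oᵀ*(A*B)*O := by grind
  simp only [mul_sum, sum_mul, ← h]; rfl

variable (R) in
/-- The multiplicity of the dominant weight `μ` is the dimension of the space of highest weight
vectors of weight `μ`. -/
lemma finrank_Inv {μ : ℚ^m} (hμ : Antitone μ) :
    (finrank ℝ (R.Inv μ) : ℤ) = (R.ch*alt ℤ (rho m)).coeff (μ+rho m) := by
  obtain ⟨O, ev, hO, hC, hw⟩ := R.exists_diag_cas; have hO' := mul_eq_one_comm.1 hO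
  let R' := R.conj O hO hw; have hcas : R'.cas = diagonal ev := by rw [← hC]; exact conj_cas O hO hw
  have key := finrank_Inv_of_diagonal (R := R') ev hcas hμ; have hch : R'.ch = R.ch := rfl
  rw [hch] at key; rw [← key]; norm_cast
  have hmem : ∀ x, x ∈ R'.Inv μ ↔ O *ᵥ x ∈ R.Inv μ := by
    intro x
    have e1 : x ∈ R'.Wt μ ↔ O *ᵥ x ∈ R.Wt μ := by
      constructor
      · intro hx a ha; rw [mulVec, dotProduct]; refine sum_eq_zero fun b _ => ?_
        by_cases h : O a b = 0
        · rw [h, zero_mul]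
        · rw [hx b (by change R.wt b ≠ μ; rw [← hw a b h]; exact ha), mul_zero]
      · intro hx a ha; have : x = Oᵀ *ᵥ (O *ᵥ x) := by simp_all
        rw [this, mulVec, dotProduct]; refine sum_eq_zero fun b _ => ?_; by_cases h : O b a = 0
        · rw [transpose_apply, h, zero_mul]
        · rw [hx b (by rw [hw b a h]; exact ha), mul_zero]
    have e2 : ∀ i j, R'.E i j *ᵥ x = 0 ↔ R.E i j *ᵥ (O *ᵥ x) = 0 := by
      intro i j; change (Oᵀ*R.E i j*O) *ᵥ x = 0 ↔ _; rw [← mulVec_mulVec, ← mulVec_mulVec]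
      constructor
      · intro h; have := congrArg (fun y => O *ᵥ y) h; simp only [mulVec_zero] at this
        rw [mulVec_mulVec, hO', one_mulVec] at this; exact this
      · simp_all
    rw [mem_Inv, mem_Inv, e1]; simp only [e2]
  let e : (ι → ℝ) ≃ₗ[ℝ] (ι → ℝ) :=
    { mulVecLin O with
      invFun := fun x => Oᵀ *ᵥ x
      left_inv := fun x => by simp [mulVec_mulVec, hO]
      right_inv := fun x => by simp [mulVec_mulVec, hO'] }
  have : (R'.Inv μ).map (e : (ι → ℝ) →ₗ[ℝ] (ι → ℝ)) = R.Inv μ := by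
    ext y; rw [Submodule.mem_map]; constructor
    · rintro ⟨x, hx, rfl⟩; exact (hmem x).1 hx
    · intro hy; refine ⟨e.symm y, (hmem _).2 ?_, e.apply_symm_apply y⟩
      have : O *ᵥ (e.symm y) = y := e.apply_symm_apply y; rw [this]; exact hy
  rw [← this]; exact (LinearEquiv.finrank_map_eq e _)

end Rep

namespace Rep
variable {m : ℕ} {ι κ : Type} [Fintype ι] [DecidableEq ι] [Fintype κ] [DecidableEq κ]

/-! ### Casimir eigenspaces as quotients -/

lemma exists_part (R : Rep m ι) (c : ℚ) :
    ∃ (κ : Type) (_ : Fintype κ) (_ : DecidableEq κ) (P : Rep m κ) (J : (ι → ℝ) →ₗ[ℝ] (κ → ℝ)),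
      (∀ v, (P.ch*alt ℤ (rho m)).coeff v
        = if Qf v = Qf (rho m)+c then (R.ch*alt ℤ (rho m)).coeff v else 0) ∧
      (∀ i j x, J (R.E i j *ᵥ x) = P.E i j *ᵥ J x) ∧
      (∀ x, x ≠ 0 → R.cas *ᵥ x = (c : ℝ) • x → J x ≠ 0) ∧
      (∀ μ x, x ∈ R.Wt μ → J x ∈ P.Wt μ) := by
  obtain ⟨O, ev, hO, hC, hw⟩ := R.exists_diag_cas; have hO' := mul_eq_one_comm.1 hO
  let R' := R.conj O hO hw; have hcas : R'.cas = diagonal ev := by rw [← hC]; exact conj_cas O hO hw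
  have hcomm : ∀ i j a b, R'.E i j a b ≠ 0 → ev a = ev b := fun i j a b h => ev_eq hcas h
  refine ⟨{a // ev a = c}, inferInstance, inferInstance, R'.evPart ev hcas c,
    (LinearMap.funLeft ℝ ℝ Subtype.val).comp (mulVecLin Oᵀ), ?_, ?_, ?_, ?_⟩
  · intro v
    have hch : R.ch = ∑ c ∈ univ.image ev, (R'.evPart ev hcas c).ch :=
      ch_eq_sum_evPart (R := R') ev hcas
    have key : ∀ c' : ℝ, ((R'.evPart ev hcas c').ch*alt ℤ (rho m)).coeff v ≠ 0 →
        (Qf v : ℝ) = Qf (rho m)+c' := by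
      intro c' h; refine (R'.evPart ev hcas c').freudenthal c' (evPart_cas ev hcas c') v ?_
      rw [← toReal_ch, ← toReal_alt, ← map_mul, toReal_coeff, mul_comm]; exact_mod_cast h
    rw [hch, sum_mul, coeff_sum, finsetSum_apply]; split_ifs with h
    · rw [sum_eq_single (c : ℝ)]
      · intro c' _ hc'; by_contra hne; have := key c' hne; rw [h] at this; push_cast at this
        exact hc' (by linarith)
      · intro hc; have : IsEmpty {a // ev a = c} := ⟨fun a => hc (by grind)⟩
        rw [ch, univ_eq_empty, sum_empty, zero_mul]; rfl
    · by_contra hne; have := key c hne; exact h (mod_cast this)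
  · intro i j x
    have h1 : Oᵀ *ᵥ (R.E i j *ᵥ x) = R'.E i j *ᵥ (Oᵀ *ᵥ x) := by
      change _ = (Oᵀ*R.E i j*O) *ᵥ _
      rw [mulVec_mulVec, mulVec_mulVec, Matrix.mul_assoc _ O, hO', Matrix.mul_one]
    funext a
    change (Oᵀ *ᵥ (R.E i j *ᵥ x)) a.1 = ∑ b : {a // ev a = c}, R'.E i j a.1 b.1*(Oᵀ *ᵥ x) b.1
    rw [h1, mulVec, dotProduct]
    rw [← sum_filter_of_ne (p := fun a => ev a = c) (s := univ),
        sum_subtype _ (p := fun a => ev a = c) (by simp)]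
    grind
  · intro x hx hc h0; apply hx
    have h1 : diagonal ev *ᵥ (Oᵀ *ᵥ x) = (c : ℝ) • (Oᵀ *ᵥ x) := by
      rw [← hC, mulVec_mulVec, Matrix.mul_assoc, hO', Matrix.mul_one, ← mulVec_mulVec,
        hc, mulVec_smul]
    have h2 : Oᵀ *ᵥ x = 0 := by
      funext a; by_cases ha : ev a = c
      · exact congrFun h0 ⟨a, ha⟩
      · have := congrFun h1 a; rw [mulVec_diagonal, Pi.smul_apply, smul_eq_mul] at this
        simp_all
    have := congrArg (fun y => O *ᵥ y) h2; simp only [mulVec_zero] at this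
    rwa [mulVec_mulVec, hO', one_mulVec] at this
  · intro μ x hx a ha; change (Oᵀ *ᵥ x) a.1 = 0; rw [mulVec, dotProduct]
    refine sum_eq_zero fun b _ => ?_; by_cases h : O b a.1 = 0
    · simp_all
    · rw [hx b (by rw [hw b a h]; exact ha), mul_zero]

/-! ### Tensor products, duals, twists and pullbacks -/

/-- The tensor product of two representations. -/
def tensor (R : Rep m ι) (S : Rep m κ) : Rep m (ι × κ) where
  E i j := R.E i j ⊗ₖ 1+1 ⊗ₖ S.E i j
  wt a := R.wt a.1+S.wt a.2
  diag i := by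
    rw [R.diag, S.diag, ← diagonal_one, ← diagonal_one, diagonal_kronecker_diagonal,
      diagonal_kronecker_diagonal, diagonal_add]
    congr 1; funext a; simp
  comm i j k l := by
    have h1 := R.comm i j k l; have h2 := S.comm i j k l
    have e1 : ∀ (p : Prop) [Decidable p] (A : Matrix ι ι ℝ) (B : Matrix κ κ ℝ),
        (if p then A ⊗ₖ (1 : Matrix κ κ ℝ)+(1 : Matrix ι ι ℝ) ⊗ₖ B else 0)
        = (if p then A else 0) ⊗ₖ (1 : Matrix κ κ ℝ)+(1 : Matrix ι ι ℝ) ⊗ₖ (if p then B else 0) := by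
      intro p _ A B; split_ifs
      · rfl
      · simp
    have s1 : ∀ A B : Matrix ι ι ℝ, (A-B) ⊗ₖ (1 : Matrix κ κ ℝ) = A ⊗ₖ 1-B ⊗ₖ 1 := by
      intro A B; ext a b; simp [kroneckerMap_apply, sub_mul]
    have s2 : ∀ A B : Matrix κ κ ℝ, (1 : Matrix ι ι ℝ) ⊗ₖ (A-B) = 1 ⊗ₖ A-1 ⊗ₖ B := by
      intro A B; ext a b; simp [kroneckerMap_apply, mul_sub]
    rw [e1, e1, add_sub_add_comm, ← s1, ← s2, ← h1, ← h2, s1, s2]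
    simp only [mul_add, add_mul, ← mul_kronecker_mul, mul_one, one_mul]; abel
  symm i j := by
    rw [transpose_add, ← R.symm i j, ← S.symm i j]
    congr 1 <;> (ext ⟨a, b⟩ ⟨c, d⟩; simp [kroneckerMap_apply, Matrix.one_apply, eq_comm])

lemma tensor_ch (R : Rep m ι) (S : Rep m κ) : (R.tensor S).ch = R.ch*S.ch := by
  unfold ch; rw [sum_mul_sum, ← univ_product_univ, sum_product]
  refine sum_congr rfl fun a _ => sum_congr rfl fun b _ => ?_; unfold mono
  rw [single_mul_single]; simp [tensor]

/-- The decomposable tensor. -/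
def tmulVec (x : ι → ℝ) (y : κ → ℝ) : ι × κ → ℝ := fun a => x a.1*y a.2

lemma tensor_E (R : Rep m ι) (S : Rep m κ) (i j : Fin m) (x : ι → ℝ) (y : κ → ℝ) :
    (R.tensor S).E i j *ᵥ tmulVec x y = tmulVec (R.E i j *ᵥ x) y+tmulVec x (S.E i j *ᵥ y) := by
  funext ⟨a, b⟩; change ((R.E i j ⊗ₖ 1+1 ⊗ₖ S.E i j) *ᵥ tmulVec x y) (a, b) = _; rw [add_mulVec]
  simp only [Pi.add_apply, mulVec, dotProduct, tmulVec, Fintype.sum_prod_type,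
    kroneckerMap_apply, Matrix.one_apply]
  congr 1
  · rw [sum_mul]; refine sum_congr rfl fun c _ => ?_; rw [sum_eq_single b]
    all_goals grind
  · rw [sum_eq_single a]
    · rw [mul_sum]; grind
    · intro d _ hd; simp [hd.symm]
    · simp

lemma tmulVec_mem_Wt {R : Rep m ι} {S : Rep m κ} {μ ν : ℚ^m} {x : ι → ℝ} {y : κ → ℝ}
    (hx : x ∈ R.Wt μ) (hy : y ∈ S.Wt ν) : tmulVec x y ∈ (R.tensor S).Wt (μ+ν) := by
  rintro ⟨a, b⟩ h; unfold tmulVec; by_cases ha : R.wt a = μ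
  · have : S.wt b ≠ ν := by rintro rfl; exact h (by rw [← ha]; rfl)
    simp [hy b this]
  · simp [hx a ha]

/-- The dual representation. -/
def dual (R : Rep m ι) : Rep m ι where
  E i j := -R.E j i
  wt a := -R.wt a
  diag i := by rw [R.diag, diagonal_neg]; congr 1; funext a; simp
  comm i j k l := by
    have := R.comm j i l k
    have e : -R.E j i * -R.E l k - -R.E l k * -R.E j i = R.E j i*R.E l k-R.E l k*R.E j i := by
      noncomm_ring
    grind
  symm i j := by rw [transpose_neg, R.symm]

/-- The twist by `c` times the trace. -/
def twist (R : Rep m ι) (c : ℚ) : Rep m ι where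
  E i j := R.E i j+if i = j then (c : ℝ) • 1 else 0
  wt a := R.wt a+fun _ => c
  diag i := by
    rw [if_pos rfl, R.diag, ← diagonal_one, ← diagonal_smul, diagonal_add]; congr 1; funext a; simp
  comm i j k l := by
    have := R.comm i j k l
    have e : (R.E i j+if i = j then (c : ℝ) • 1 else 0)*(R.E k l+if k = l then (c : ℝ) • 1 else 0)
        - (R.E k l+if k = l then (c : ℝ) • 1 else 0)*(R.E i j+if i = j then (c : ℝ) • 1 else 0)
        = R.E i j*R.E k l-R.E k l*R.E i j := by
      simp only [mul_add, add_mul]; split_ifs <;> simp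
      abel
    grind
  symm i j := by
    rw [transpose_add, R.symm]; by_cases h : i = j
    · subst h; simp
    · simp [h, Ne.symm h]

/-- The pullback of a representation of `gl_N` along a representation of `gl_m` of dimension `N`. -/
def pull (R : Rep m ι) (e : Fin N ≃ ι) (S : Rep N κ) : Rep m κ where
  E i j := ∑ a, ∑ b, R.E i j (e a) (e b) • S.E a b
  wt c := ∑ a, S.wt c a • R.wt (e a)
  diag i := by
    have : ∀ a b, R.E i i (e a) (e b) • S.E a b
        = if a = b then diagonal (fun c => ((S.wt c a • R.wt (e a)) i : ℝ)) else 0 := by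
      intro a b; by_cases h : a = b
      · subst h; rw [if_pos rfl, S.diag, R.diag, diagonal_apply_eq, ← diagonal_smul]
        congr 1; funext c; simp [mul_comm]
      · rw [if_neg h, R.diag, diagonal_apply_ne _ (fun h' => h (e.injective h')), zero_smul]
    simp only [this, sum_ite_eq, mem_univ, if_true]; ext c d; by_cases h : c = d
    · subst h; simp [Matrix.sum_apply]
    · simp [Matrix.sum_apply, h]
  comm i j k l := by
    have key : ∀ A B : Matrix ι ι ℝ,
        (∑ a, ∑ b, A (e a) (e b) • S.E a b)*(∑ a, ∑ b, B (e a) (e b) • S.E a b)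
        - (∑ a, ∑ b, B (e a) (e b) • S.E a b)*(∑ a, ∑ b, A (e a) (e b) • S.E a b)
        = ∑ a, ∑ b, (A*B-B*A) (e a) (e b) • S.E a b := by
      intro A B; simp only [← Fintype.sum_prod_type']
      rw [sum_mul_sum, sum_mul_sum, sum_comm (f := fun p q : Fin N × Fin N =>
        B (e p.1) (e p.2) • S.E p.1 p.2*A (e q.1) (e q.2) • S.E q.1 q.2), ← sum_sub_distrib]
      have h1 : ∀ p q : Fin N × Fin N, A (e p.1) (e p.2) • S.E p.1 p.2*B (e q.1) (e q.2) • S.E q.1 q.2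
          - B (e q.1) (e q.2) • S.E q.1 q.2*A (e p.1) (e p.2) • S.E p.1 p.2
          = (if p.2 = q.1 then (A (e p.1) (e p.2)*B (e q.1) (e q.2)) • S.E p.1 q.2 else 0)
            - if q.2 = p.1 then (B (e q.1) (e q.2)*A (e p.1) (e p.2)) • S.E q.1 p.2 else 0 := by
        intro p q
        rw [smul_mul, Matrix.mul_smul, smul_mul, Matrix.mul_smul, smul_smul, smul_smul,
          mul_comm (B _ _), ← smul_sub, S.comm, smul_sub]
        split_ifs <;> simp
      simp only [← sum_sub_distrib, h1]
      simp only [sum_sub_distrib, Fintype.sum_prod_type, Matrix.sub_apply, sub_smul]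
      have hm : ∀ (C D : Matrix ι ι ℝ) (a b : Fin N), (C*D) (e a) (e b) • S.E a b
          = ∑ c, (C (e a) (e c)*D (e c) (e b)) • S.E a b := by
        intro C D a b; rw [Matrix.mul_apply, ← e.sum_comp, sum_smul]
      simp only [hm]; congr 1
      · refine sum_congr rfl fun a _ => ?_
        rw [sum_comm (f := fun b c => (A (e a) (e c)*B (e c) (e b)) • S.E a b)]; simp
      · simp only [sum_ite_eq', mem_univ, if_true]; rw [sum_congr rfl fun a _ => sum_comm, sum_comm]
        refine sum_congr rfl fun a _ => ?_; rw [sum_comm]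
    rw [key, R.comm]
    by_cases h1 : j = k <;> by_cases h2 : l = i <;>
      simp [h1, h2, sub_smul, sum_sub_distrib]
  symm i j := by
    simp only [transpose_sum, transpose_smul, S.symm]; rw [sum_comm]
    refine sum_congr rfl fun a _ => sum_congr rfl fun b _ => ?_; rw [R.symm_apply]

end Rep

/-! ### Permuting variables -/

/-- The action of a permutation on the character ring. -/
def permHom (R : Type) [CommRing R] (σ : Perm (Fin k)) : ChR R k →+* ChR R k := mapDomainRingHom R
    ({ toFun := fun v => v ∘ σ, map_zero' := rfl, map_add' := fun _ _ => rfl } :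
      ℚ^k →+ ℚ^k)

lemma permHom_single {R : Type} [CommRing R] (σ : Perm (Fin k)) (v : ℚ^k)
    (c : R) : permHom R σ (single v c) = single (v ∘ σ) c := by
  simp [permHom, mapDomainRingHom_apply, mapDomain_single]

lemma permHom_coeff {R : Type} [CommRing R] (σ : Perm (Fin k)) (f : ChR R k)
    (v : ℚ^k) : (permHom R σ f).coeff (v ∘ σ) = f.coeff v := by
  induction f using induction_linear with
  | zero => simp
  | add f g hf hg => simp [hf, hg]
  | single w n =>
    rw [permHom_single]; simp only [coeff_single, Finsupp.single_apply]; congr 1; rw [eq_iff_iff]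
    exact ⟨fun h => σ.surjective.injective_comp_right h, fun h => by rw [h]⟩

lemma permHom_alt {R : Type} [CommRing R] (σ : Perm (Fin k)) (v : ℚ^k) :
    permHom R σ (alt R v) = ((sign σ : ℤ) : R) • alt R v := by
  unfold alt; rw [map_sum, smul_sum]
  rw [← Equiv.sum_comp (Equiv.mulRight σ) (fun τ => ((sign σ : ℤ) : R) • (single
    (fun i => v (τ i)) ((sign τ : ℤ) : R) : ChR R k))]
  refine sum_congr rfl fun τ _ => ?_; rw [permHom_single, smul_single]; congr 1
  simp only [Equiv.coe_mulRight, Perm.sign_mul, smul_eq_mul]; rw [← Int.cast_mul]; congr 1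
  rcases Int.units_eq_one_or (sign σ) with h | h <;> simp [h]

lemma exists_antitone_perm (v : ℚ^k) : ∃ σ : Perm (Fin k), Antitone (v ∘ σ) := by
  refine ⟨Tuple.sort (fun i => -v i), ?_⟩; have := Tuple.monotone_sort (fun i => -v i); intro i j h
  have := this h; simpa using this

lemma antitone_perm_eq {u v : ℚ^k} (hu : Antitone u) (hv : Antitone v)
    (σ : Perm (Fin k)) (h : u ∘ σ = v) : u = v := by
  have h1 := cone_sub_perm hu σ; have h2 := cone_sub_perm hv σ⁻¹
  have e2 : (v-fun i => v (σ⁻¹ i)) = v-u := by funext i; simp only [Pi.sub_apply]; rw [← h]; simp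
  have e1 : (u-fun i => u (σ i)) = u-v := by rw [← h]; rfl
  rw [e2] at h2; rw [e1] at h1
  have : ∀ j, ps (u-v) j = 0 := by
    intro j; have a1 := h1.1 j; have a2 := h2.1 j; have : ps (v-u) j = - ps (u-v) j := by simp [ps]
    linarith
  exact sub_eq_zero.1 (cone_eq_zero_of_ps this)

lemma antitone_rho (m : ℕ) : Antitone (rho m) := by
  intro i j hij; have : ((i : ℕ) : ℚ) ≤ (j : ℕ) := mod_cast hij; linarith

lemma strictAnti_rho (m : ℕ) : StrictAnti (rho m) := by
  intro i j hij
  simp_all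

lemma strictAnti_perm {u : ℚ^k} (hu : StrictAnti u) (σ : Perm (Fin k)) (h : u ∘ σ = u) : σ = 1 := by
  ext i; have := hu.injective (congrFun h i); simp [this]

lemma strictAnti_add_rho {v : ℚ^m} (hv : Antitone v) : StrictAnti (v+rho m) := by
  intro i j hij; exact add_lt_add_of_le_of_lt (hv hij.le) (strictAnti_rho m hij)

lemma alt_coeff {R : Type} [CommRing R] (u v : ℚ^k) : (alt R u).coeff v
    = ∑ σ : Perm (Fin k), if u ∘ σ = v then ((sign σ : ℤ) : R) else 0 := by
  unfold alt; rw [coeff_sum, finsetSum_apply]; simp only [coeff_single, Finsupp.single_apply]; rfl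

/-- Coefficients of an alternant at a strictly dominant weight. -/
lemma alt_coeff_dominant {R : Type} [CommRing R] {u v : ℚ^k} (hu : StrictAnti u)
    (hv : StrictAnti v) : (alt R u).coeff v = if u = v then 1 else 0 := by
  rw [alt_coeff]; split_ifs with h
  · subst h; rw [sum_eq_single 1]
    · simp
    · intro σ _ hσ; rw [if_neg fun h => hσ (strictAnti_perm hu σ h)]
    · simp
  · refine sum_eq_zero fun σ _ => if_neg fun h' => h (antitone_perm_eq hu.antitone hv.antitone σ h')

lemma alt_rho_ne_zero (k : ℕ) : alt ℤ (rho k) ≠ 0 := by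
  intro h; have := alt_coeff_dominant (R := ℤ) (strictAnti_rho k) (strictAnti_rho k)
  simp_all

lemma coeff_perm_of_mul_alt {f : CharRing k} {u : ℚ^k}
    (h : f*alt ℤ (rho k) = alt ℤ u) (σ : Perm (Fin k)) (v : ℚ^k) :
    f.coeff (v ∘ σ) = f.coeff v := by
  have h1 := congrArg (permHom ℤ σ) h; have hs : ((sign σ : ℤˣ) : ℤ) ≠ 0 := Units.ne_zero _
  rw [map_mul, permHom_alt, permHom_alt, ← h, mul_smul_comm] at h1
  have h2 := smul_right_injective _ hs h1; have h3 := mul_right_cancel₀ (alt_rho_ne_zero k) h2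
  rw [← permHom_coeff σ f v, h3]

lemma Qf_perm (v : ℚ^k) (σ : Perm (Fin k)) : Qf (v ∘ σ) = Qf v := by
  unfold Qf; congr 1
  · exact Equiv.sum_comp σ (fun i => v i ^ 2)
  · congr 1; exact Equiv.sum_comp σ v

namespace Rep
variable {m : ℕ} {ι κ : Type} [Fintype ι] [DecidableEq ι] [Fintype κ] [DecidableEq κ]

lemma exists_wt_of_mem {R : Rep m ι} {μ : ℚ^m} {x : ι → ℝ} (hx : x ∈ R.Wt μ) (h0 : x ≠ 0) :
    ∃ a, R.wt a = μ ∧ x a ≠ 0 := by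
  obtain ⟨a, ha⟩ := Function.ne_iff.1 h0; exact ⟨a, by by_contra h; exact ha (hx a h), ha⟩

/-- A nonzero weight vector in a subspace stable under raising operators yields a highest weight
vector in it. -/
lemma exists_Inv_above (R : Rep m ι) (K : Submodule ℝ (ι → ℝ))
    (hK : ∀ i j, i < j → ∀ x ∈ K, R.E i j *ᵥ x ∈ K) {μ₀ : ℚ^m} {x₀ : ι → ℝ}
    (hx₀ : x₀ ∈ K) (hw₀ : x₀ ∈ R.Wt μ₀) (h0 : x₀ ≠ 0) :
    ∃ μ x, x ∈ K ∧ x ∈ R.Inv μ ∧ x ≠ 0 ∧ cone (μ-μ₀) := by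
  classical
  let S := univ.filter fun a => cone (R.wt a-μ₀) ∧ ∃ x ∈ K, x ∈ R.Wt (R.wt a) ∧ x ≠ 0
  obtain ⟨a₀, ha₀, -⟩ := exists_wt_of_mem hw₀ h0
  obtain ⟨b, hbS, hb⟩ := exists_max_image S (fun a => ∑ i, R.wt a i*rho m i) ⟨a₀, by
      simp only [S, mem_filter, mem_univ, true_and]; rw [ha₀]
      exact ⟨by rw [sub_self]; exact cone_zero, x₀, hx₀, hw₀, h0⟩⟩
  simp only [S, mem_filter, mem_univ, true_and] at hbS hb; obtain ⟨hbc, x, hxK, hxW, hx0⟩ := hbS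
  refine ⟨R.wt b, x, hxK, ⟨hxW, fun i j hij => ?_⟩, hx0, hbc⟩; by_contra hne
  have hW := E_mem_Wt hxW i j; obtain ⟨a', ha', -⟩ := exists_wt_of_mem hW hne
  have hr := cone_root hij.le
  have hgt : ∑ i, R.wt b i*rho m i < ∑ i, R.wt a' i*rho m i := by
    have := cone_pair_pos (F := ℚ) hr (by
      intro h; have := congrFun h i
      simp [hij.ne] at this) (rho m) (fun i j h => strictAnti_rho m h)
    rw [← sub_pos, ← sum_sub_distrib]; refine this.trans_eq (sum_congr rfl fun l _ => ?_); rw [ha']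
    simp only [Pi.add_apply, Pi.sub_apply, Rat.cast_id]; ring
  refine absurd (hb a' ⟨?_, _, hK i j hij x hxK, ?_, hne⟩) (not_le.2 hgt)
  · rw [ha']; have := cone_add hbc hr; convert this using 1; abel
  · rw [ha']; exact hW

/-! ### Irreducible characters -/

/-- The character of `R` is the irreducible character of highest weight `lam`. -/
structure IsIrr (R : Rep m ι) (lam : ℚ^m) : Prop where
  anti : Antitone lam
  ch_eq : R.ch*alt ℤ (rho m) = alt ℤ (lam+rho m)

namespace IsIrr
variable {R : Rep m ι} {lam : ℚ^m}

lemma finrank_Inv (h : R.IsIrr lam) {μ : ℚ^m} (hμ : Antitone μ) : finrank ℝ (R.Inv μ) = if lam = μ then 1 else 0 := by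
  have h1 := R.finrank_Inv hμ
  rw [h.ch_eq, alt_coeff_dominant (strictAnti_add_rho h.anti) (strictAnti_add_rho hμ)] at h1; grind

lemma eq_of_Inv (h : R.IsIrr lam) {μ : ℚ^m} {x : ι → ℝ} (hx : x ∈ R.Inv μ) (h0 : x ≠ 0) : μ = lam := by
  have h1 := h.finrank_Inv (antitone_of_Inv hx h0); by_contra hne
  rw [if_neg (Ne.symm hne), Submodule.finrank_eq_zero] at h1; rw [h1] at hx; exact h0 hx

lemma exists_Inv (h : R.IsIrr lam) : ∃ x ∈ R.Inv lam, x ≠ 0 := by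
  have h1 := h.finrank_Inv h.anti; rw [if_pos rfl] at h1
  have : Nontrivial (R.Inv lam) := Module.nontrivial_of_finrank_pos (R := ℝ) (by omega)
  obtain ⟨x, hx⟩ := exists_ne (0 : R.Inv lam); exact ⟨x.1, x.2, fun h => hx (Subtype.ext h)⟩

lemma cone_wt (h : R.IsIrr lam) (a : ι) : cone (lam-R.wt a) := by
  obtain ⟨μ, x, -, hx, h0, hc⟩ := R.exists_Inv_above ⊤ (fun _ _ _ _ _ => trivial)
    (x₀ := Pi.single a 1) (μ₀ := R.wt a) trivial (by
      intro b hb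
      rw [Pi.single_apply, if_neg]; rintro rfl; exact hb rfl) (by simp)
  rwa [h.eq_of_Inv hx h0] at hc

lemma ch_perm (h : R.IsIrr lam) (σ : Perm (Fin m)) (v : ℚ^m) : R.ch.coeff (v ∘ σ) = R.ch.coeff v := by
  exact coeff_perm_of_mul_alt h.ch_eq σ v

lemma ch_lam (h : R.IsIrr lam) : R.ch.coeff lam = 1 := by
  have h1 := congrArg (fun f => f.coeff (lam+rho m)) h.ch_eq
  simp only [alt_coeff_dominant (strictAnti_add_rho h.anti) (strictAnti_add_rho h.anti), if_true] at h1
  rw [coeff_mul_alt, sum_eq_single 1] at h1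
  · simpa using h1
  · intro σ _ hσ
    have : R.ch.coeff (lam+rho m-fun i => rho m (σ i)) = 0 := by
      rw [ch_coeff]; norm_cast; rw [card_eq_zero, filter_eq_empty_iff]; intro a _ ha
      have c1 := h.cone_wt a; have c2 := cone_sub_perm (antitone_rho m) σ; rw [ha] at c1
      have : ∀ j, ps (rho m-fun i => rho m (σ i)) j = 0 := by
        intro j; have a1 := c1.1 j; have a2 := c2.1 j
        have : ps (lam-(lam+rho m-fun i => rho m (σ i))) j
            = - ps (rho m-fun i => rho m (σ i)) j := by
          simp only [ps, ← sum_neg_distrib]; refine sum_congr rfl fun i _ => ?_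
          simp only [Pi.sub_apply, Pi.add_apply]; ring
        linarith
      have := sub_eq_zero.1 (cone_eq_zero_of_ps this)
      exact hσ (strictAnti_perm (strictAnti_rho m) σ this.symm)
    rw [this, mul_zero]
  · simp

lemma sq_le (h : R.IsIrr lam) (a : ι) : ∑ i, R.wt a i ^ 2 ≤ ∑ i, lam i ^ 2 := by
  obtain ⟨σ, hσ⟩ := exists_antitone_perm (R.wt a)
  have h1 : 0 < R.ch.coeff (R.wt a ∘ σ) := by
    rw [h.ch_perm, ch_coeff]; exact_mod_cast card_pos.2 ⟨a, by simp⟩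
  rw [ch_coeff] at h1; obtain ⟨b, hb⟩ := card_pos.1 (mod_cast h1); simp only [mem_filter_univ] at hb
  have hc := h.cone_wt b
  have h2 := cone_pair_nonneg (F := ℚ) hc (lam+R.wt b) (fun i j hij => by
    rw [hb]; exact add_le_add (h.anti hij) (hσ hij))
  have h3 : ∑ i, R.wt a i ^ 2 = ∑ i, R.wt b i ^ 2 := by
    rw [hb]; exact (Equiv.sum_comp σ (fun i => R.wt a i ^ 2)).symm
  rw [h3, ← sub_nonneg, ← sum_sub_distrib]; refine h2.trans_eq (sum_congr rfl fun i _ => ?_)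
  simp only [Pi.sub_apply, Pi.add_apply, Rat.cast_id]; ring

lemma eq_of_Qf (h : R.IsIrr lam) {lam₂ : ℚ^m} (h₂ : Antitone lam₂) (a : ι)
    (hQ : Qf (R.wt a+lam₂+rho m) = Qf (lam+lam₂+rho m)) : R.wt a = lam := by
  by_contra hne; have hc := h.cone_wt a
  have h1 := cone_pair_pos (F := ℚ) hc (sub_ne_zero.2 (Ne.symm hne)) (lam₂+rho m)
    (fun i j hij => strictAnti_add_rho h₂ hij)
  have h2 := h.sq_le a
  have h3 : Qf (lam+lam₂+rho m)-Qf (R.wt a+lam₂+rho m)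
      = (∑ i, lam i ^ 2 - ∑ i, R.wt a i ^ 2)+2 * ∑ i, (lam-R.wt a) i*(lam₂+rho m) i
        - (m-1) * ∑ i, (lam-R.wt a) i := by
    unfold Qf; simp only [mul_sum, ← sum_sub_distrib, ← sum_add_distrib]
    refine sum_congr rfl fun i _ => ?_; simp only [Pi.add_apply, Pi.sub_apply]; ring
  rw [hc.2, hQ] at h3; simp only [Rat.cast_id] at h1; linarith

end IsIrr

/-- The Cartan product of two irreducible characters, together with an injection of the first factor
given by multiplication with a highest weight vector of the second. -/
lemma exists_cartan {R : Rep m ι} {S : Rep m κ} {lam₁ lam₂ : ℚ^m} (hR : R.IsIrr lam₁)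
    (hS : S.IsIrr lam₂) :
    ∃ (η : Type) (_ : Fintype η) (_ : DecidableEq η) (P : Rep m η) (Φ : (ι → ℝ) →ₗ[ℝ] (η → ℝ)),
      P.IsIrr (lam₁+lam₂) ∧ Injective Φ ∧
      (∀ i j, i < j → ∀ x, Φ (R.E i j *ᵥ x) = P.E i j *ᵥ Φ x) ∧
      (∀ μ x, x ∈ R.Wt μ → Φ x ∈ P.Wt (μ+lam₂)) := by
  classical
  have hanti : Antitone (lam₁+lam₂) := fun i j hij => add_le_add (hR.anti hij) (hS.anti hij)
  obtain ⟨η, i1, i2, P, J, hch, hE, hJ, hW⟩ := (R.tensor S).exists_part (cv (lam₁+lam₂))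
  obtain ⟨u, hu, hu0⟩ := hS.exists_Inv
  let tu : (ι → ℝ) →ₗ[ℝ] (ι × κ → ℝ) :=
    { toFun := fun x => tmulVec x u
      map_add' := fun x y => by funext a; simp [tmulVec, add_mul]
      map_smul' := fun c x => by funext a; simp [tmulVec, mul_assoc] }
  let Φ : (ι → ℝ) →ₗ[ℝ] (η → ℝ) := J.comp tu; have hΦ : ∀ x, Φ x = J (tmulVec x u) := fun x => rfl
  have hΦE : ∀ i j, i < j → ∀ x, Φ (R.E i j *ᵥ x) = P.E i j *ᵥ Φ x := by
    intro i j hij x; rw [hΦ, hΦ, ← hE, tensor_E, hu.2 i j hij]; congr 1; funext a; simp [tmulVec]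
  have hΦW : ∀ μ x, x ∈ R.Wt μ → Φ x ∈ P.Wt (μ+lam₂) :=
    fun μ x hx => hW _ _ (tmulVec_mem_Wt hx hu.1)
  refine ⟨η, i1, i2, P, Φ, ⟨hanti, ?_⟩, ?_, hΦE, hΦW⟩
  · ext v; rw [hch, tensor_ch, mul_assoc, hS.ch_eq]
    have hQ : Qf (rho m)+cv (lam₁+lam₂) = Qf (lam₁+lam₂+rho m) := by unfold cv; ring
    rw [hQ, coeff_mul_alt, alt_coeff]
    have key : ∀ σ : Perm (Fin m), (if Qf v = Qf (lam₁+lam₂+rho m) then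
        R.ch.coeff (v-fun i => (lam₂+rho m) (σ i)) else 0)
        = if (lam₁+lam₂+rho m) ∘ σ = v then 1 else 0 := by
      intro σ; set ν : ℚ^m := v ∘ σ.symm-(lam₂+rho m) with hν
      have e1 : (v-fun i => (lam₂+rho m) (σ i)) = ν ∘ σ := by funext i; simp [hν]
      have e2 : v = (ν+lam₂+rho m) ∘ σ := by
        funext i; simp only [hν, Function.comp_apply, Pi.add_apply, Pi.sub_apply, symm_apply_apply]
        ring
      have e3 : (lam₁+lam₂+rho m) ∘ σ = v ↔ ν = lam₁ := by
        constructor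
        · intro h'; rw [hν, ← h']; funext i; simp
        · intro h'; rw [e2, h']
      rw [e1, hR.ch_perm]; have e4 : Qf v = Qf (ν+lam₂+rho m) := by rw [e2, Qf_perm]
      by_cases hνl : ν = lam₁
      · rw [if_pos (by rw [e4, hνl]), if_pos (e3.2 hνl), hνl, hR.ch_lam]
      · rw [if_neg (fun h' => hνl (e3.1 h'))]; split_ifs with hq
        · rw [ch_coeff]; norm_cast; rw [card_eq_zero, filter_eq_empty_iff]; intro a _ ha; apply hνl
          rw [← ha]; apply hR.eq_of_Qf hS.anti; rw [ha, ← e4, hq]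
        · rfl
    rw [← sum_filter, sum_filter]
    have : ∀ σ : Perm (Fin m), (if (lam₁+lam₂+rho m) ∘ σ = v then
        ((sign σ : ℤ) : ℤ) else 0) = (sign σ : ℤ) *
        if (lam₁+lam₂+rho m) ∘ σ = v then 1 else 0 := by
      simp
    simp only [Int.cast_id, this, ← key]; simp
  · rw [← LinearMap.ker_eq_bot]; by_contra hne
    obtain ⟨x, hx, hx0⟩ := Submodule.exists_mem_ne_zero_of_ne_bot hne
    obtain ⟨a, ha⟩ := Function.ne_iff.1 hx0
    let y : ι → ℝ := fun b => if R.wt b = R.wt a then x b else 0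
    have hyW : y ∈ R.Wt (R.wt a) := fun b hb => by simp [y, hb]
    have hy0 : y ≠ 0 := Function.ne_iff.2 ⟨a, by simpa [y] using ha⟩
    have hyK : y ∈ LinearMap.ker Φ := by
      rw [LinearMap.mem_ker] at hx ⊢; funext c; by_cases hc : P.wt c = R.wt a+lam₂
      · have e : x = y + ∑ b, (if R.wt b = R.wt a then 0 else x b) • (Pi.single b 1 : ι → ℝ) := by
          funext b
          simp only [Pi.add_apply, Finset.sum_apply, Pi.smul_apply, Pi.single_apply, smul_eq_mul,
            mul_ite, mul_one, mul_zero, sum_ite_eq, mem_univ, if_true, y]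
          split_ifs <;> simp
        have h1 := congrFun hx c; rw [e, map_add, map_sum] at h1
        simp only [Pi.add_apply, Finset.sum_apply, map_smul, Pi.smul_apply, Pi.zero_apply] at h1
        rw [sum_eq_zero, add_zero] at h1
        · exact h1
        · intro b _; split_ifs with hb
          · simp
          · have := hΦW (R.wt b) (Pi.single b 1) (by
              intro b' hb'
              rw [Pi.single_apply, if_neg]; rintro rfl; exact hb' rfl) c (by
                rw [hc]; intro h'; exact hb (add_right_cancel h').symm)
            rw [this, smul_zero]
      · exact hΦW _ _ hyW c hc
    obtain ⟨μ, z, hzK, hz, hz0, -⟩ := R.exists_Inv_above (LinearMap.ker Φ) (fun i j hij x hx => by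
      rw [LinearMap.mem_ker] at hx ⊢
      rw [hΦE i j hij, hx, mulVec_zero]) hyK hyW hy0
    have hμ := hR.eq_of_Inv hz hz0; subst hμ
    have hT : tmulVec z u ∈ (R.tensor S).Inv (μ+lam₂) := by
      refine ⟨tmulVec_mem_Wt hz.1 hu.1, fun i j hij => ?_⟩
      rw [tensor_E, hz.2 i j hij, hu.2 i j hij]; funext a; simp [tmulVec]
    refine hJ _ ?_ (cas_Inv hT) hzK; obtain ⟨a, ha⟩ := Function.ne_iff.1 hz0
    obtain ⟨b, hb⟩ := Function.ne_iff.1 hu0; exact Function.ne_iff.2 ⟨(a, b), mul_ne_zero ha hb⟩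

end Rep

/-! ### The fermionic Fock space -/

section Fock
variable {N : ℕ}

/-- The sign `(-1)^{#{b ∈ S : b < a}}`. -/
def sgn (a : Fin N) (S : Finset (Fin N)) : ℝ := (-1) ^ (S.filter (· < a)).card

lemma sgn_mul_self (a : Fin N) (S : Finset (Fin N)) : sgn a S*sgn a S = 1 := by
  unfold sgn; rw [← pow_add, ← two_mul, pow_mul]; simp

lemma sgn_insert {a b : Fin N} {S : Finset (Fin N)} (hb : b ∉ S) :
    sgn a (insert b S) = (if b < a then -1 else 1)*sgn a S := by
  unfold sgn; rw [filter_insert]; split_ifs with h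
  all_goals grind

lemma sgn_erase {a b : Fin N} {S : Finset (Fin N)} (hb : b ∈ S) :
    sgn a (S.erase b) = (if b < a then -1 else 1)*sgn a S := by
  have h := sgn_insert (a := a) (notMem_erase b S)
  simp_all

/-- The creation operator. -/
def cr (a : Fin N) : (Finset (Fin N) → ℝ) →ₗ[ℝ] (Finset (Fin N) → ℝ) where
  toFun x S := if a ∈ S then sgn a S*x (S.erase a) else 0
  map_add' x y := by funext S; simp only [Pi.add_apply]; split_ifs <;> ring
  map_smul' c x := by
    funext S; simp only [Pi.smul_apply, smul_eq_mul, RingHom.id_apply]; split_ifs <;> ring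

/-- The annihilation operator. -/
def an (a : Fin N) : (Finset (Fin N) → ℝ) →ₗ[ℝ] (Finset (Fin N) → ℝ) where
  toFun x S := if a ∈ S then 0 else sgn a S*x (insert a S)
  map_add' x y := by funext S; simp only [Pi.add_apply]; split_ifs <;> ring
  map_smul' c x := by
    funext S; simp only [Pi.smul_apply, smul_eq_mul, RingHom.id_apply]; split_ifs <;> ring

lemma cr_apply (a : Fin N) (x : Finset (Fin N) → ℝ) (S : Finset (Fin N)) :
    cr a x S = if a ∈ S then sgn a S*x (S.erase a) else 0 := rfl

lemma an_apply (a : Fin N) (x : Finset (Fin N) → ℝ) (S : Finset (Fin N)) :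
    an a x S = if a ∈ S then 0 else sgn a S*x (insert a S) := rfl

lemma cr_cr (a b : Fin N) (x : Finset (Fin N) → ℝ) : cr a (cr b x) = -cr b (cr a x) := by
  funext S; simp only [cr_apply, Pi.neg_apply, mem_erase]; by_cases hab : a = b
  · subst hab; simp
  by_cases ha : a ∈ S
  · by_cases hb : b ∈ S
    · simp only [ha, hb, Ne.symm hab, hab, if_true, ne_eq, not_false_eq_true, and_self,
        sgn_erase, erase_right_comm (a := a)]
      grind
    · simp [ha, hb]
  · simp [ha]

lemma cr_self (a : Fin N) (x : Finset (Fin N) → ℝ) : cr a (cr a x) = 0 := by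
  funext S; simp [cr_apply]

lemma an_cr (a b : Fin N) (x : Finset (Fin N) → ℝ) :
    an a (cr b x) = (if a = b then x else 0)-cr b (an a x) := by
  funext S; simp only [cr_apply, an_apply, Pi.sub_apply, mem_erase]; by_cases hab : a = b
  · subst hab; by_cases ha : a ∈ S
    · simp only [ha, if_true, not_true, ne_eq, false_and, if_false, sgn_erase, lt_irrefl]
      rw [insert_erase ha, one_mul, ← mul_assoc, sgn_mul_self]; simp
    · simp only [ha, if_true, if_false, mem_insert_self, erase_insert ha, sgn_insert,
        not_false_eq_true, lt_irrefl]
      rw [one_mul, ← mul_assoc, sgn_mul_self]; simp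
  · have hba : b ≠ a := Ne.symm hab; by_cases ha : a ∈ S
    · simp [ha, hab]
    · by_cases hb : b ∈ S
      · simp only [ha, hb, hab, if_true, if_false, mem_insert, or_true, not_false_eq_true,
          sgn_insert, sgn_erase, Pi.zero_apply, ne_eq, and_false]
        rw [erase_insert_of_ne hab]; grind
      · simp [ha, hb, hab, hba]

lemma an_an (a b : Fin N) (x : Finset (Fin N) → ℝ) : an a (an b x) = -an b (an a x) := by
  funext S; simp only [an_apply, Pi.neg_apply, mem_insert]; by_cases hab : a = b
  · subst hab; simp
  by_cases ha : a ∈ S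
  · simp [ha]
  · by_cases hb : b ∈ S
    · simp [ha, hb]
    · simp only [ha, hb, Ne.symm hab, hab, if_false, or_self, not_false_eq_true,
        sgn_insert, insert_comm a]
      grind

lemma dot_cr (a : Fin N) (x y : Finset (Fin N) → ℝ) : cr a x ⬝ᵥ y = x ⬝ᵥ an a y := by
  have h1 : cr a x ⬝ᵥ y
      = ∑ S ∈ univ.filter (fun S : Finset (Fin N) => a ∈ S), sgn a S*x (S.erase a)*y S := by
    rw [sum_filter]; refine sum_congr rfl fun S _ => ?_; rw [cr_apply]; split_ifs <;> simp
  have h2 : x ⬝ᵥ an a y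
      = ∑ S ∈ univ.filter (fun S : Finset (Fin N) => a ∉ S), x S*(sgn a S*y (insert a S)) := by
    rw [sum_filter]; refine sum_congr rfl fun S _ => ?_; rw [an_apply]; split_ifs <;> simp_all
  rw [h1, h2]; refine sum_nbij' (fun S => S.erase a) (fun S => insert a S) ?_ ?_ ?_ ?_ ?_
  · intro S _; simp
  · intro S _; simp
  · simp_all
  · simp
  · intro S hS; have hS' : a ∈ S := by simpa using hS
    rw [insert_erase hS', sgn_erase hS', if_neg (lt_irrefl _)]; ring

/-- The action of `gl_N` on Fock space. -/
def fockOp (a b : Fin N) : (Finset (Fin N) → ℝ) →ₗ[ℝ] (Finset (Fin N) → ℝ) := (cr a).comp (an b)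

lemma fockOp_apply (a b : Fin N) (x : Finset (Fin N) → ℝ) : fockOp a b x = cr a (an b x) := rfl

lemma fockOp_cr (a b c : Fin N) (x : Finset (Fin N) → ℝ) :
    fockOp a b (cr c x) = cr c (fockOp a b x)+if b = c then cr a x else 0 := by
  rw [fockOp_apply, fockOp_apply, an_cr, map_sub, cr_cr a c (an b x)]; grind

lemma fockOp_an (a b c : Fin N) (x : Finset (Fin N) → ℝ) :
    fockOp a b (an c x) = an c (fockOp a b x)-if c = a then an b x else 0 := by
  rw [fockOp_apply, fockOp_apply, an_cr, an_an b c, map_neg]; split_ifs <;> simp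

lemma fockOp_self (a : Fin N) (x : Finset (Fin N) → ℝ) (S : Finset (Fin N)) :
    fockOp a a x S = if a ∈ S then x S else 0 := by
  rw [fockOp_apply, cr_apply, an_apply]; split_ifs with h h'
  · simp at h'
  · rw [insert_erase h, sgn_erase h, if_neg (lt_irrefl _), one_mul, ← mul_assoc, sgn_mul_self,
      one_mul]
  · rfl

/-- The Fock space as a representation of `gl_N`. -/
def fock (N : ℕ) : Rep N (Finset (Fin N)) where
  E a b := LinearMap.toMatrix' (fockOp a b)
  wt S := fun a => if a ∈ S then 1 else 0
  diag a := by
    apply ext_of_mulVec_single; intro S; rw [LinearMap.toMatrix'_mulVec]; funext T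
    rw [fockOp_self, mulVec_diagonal]; split_ifs <;> simp
  comm a b c d := by
    have : fockOp a b*fockOp c d-fockOp c d*fockOp a b
        = (if b = c then fockOp a d else 0)-(if d = a then fockOp c b else 0) := by
      apply LinearMap.ext; intro x
      rw [LinearMap.sub_apply, Module.End.mul_apply, Module.End.mul_apply, fockOp_apply c d x, fockOp_cr,
        fockOp_an, map_sub, ← fockOp_apply c d, LinearMap.sub_apply]
      split_ifs <;> simp [fockOp_apply]
      abel
    have h2 := congrArg LinearMap.toMatrix' this
    rw [map_sub, map_sub, LinearMap.toMatrix'_mul, LinearMap.toMatrix'_mul] at h2; rw [h2]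
    split_ifs <;> simp
  symm a b := by
    have key : ∀ x y : Finset (Fin N) → ℝ, fockOp a b x ⬝ᵥ y = x ⬝ᵥ fockOp b a y := by
      intro x y; rw [fockOp_apply, fockOp_apply, dot_cr, dotProduct_comm, ← dot_cr, dotProduct_comm]
    ext S T; have := key (Pi.single S 1) (Pi.single T 1)
    simpa [LinearMap.toMatrix'_apply, dotProduct_single, single_dotProduct] using this

lemma fock_E (a b : Fin N) (x : Finset (Fin N) → ℝ) : (fock N).E a b *ᵥ x = fockOp a b x :=
  LinearMap.toMatrix'_mulVec _ _

lemma fockOp_card {a b : Fin N} {S T : Finset (Fin N)} (h : (fock N).E a b S T ≠ 0) :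
    S.card = T.card := by
  have hw := (fock N).wt_eq h
  have : ∀ U : Finset (Fin N), ∑ c, (fock N).wt U c = (U.card : ℚ) := by intro U; simp [fock]
  have h2 : ∑ c, (fock N).wt S c = ∑ c, (fock N).wt T c := by rw [hw]; simp [sum_add_distrib]
  rw [this, this] at h2; exact_mod_cast h2

/-- The `k`-th exterior power of the natural representation. -/
def ext (N k : ℕ) : Rep N {S : Finset (Fin N) // S.card = k} :=
  (fock N).sub (fun S => S.card = k) (fun a b S T h => by rw [fockOp_card h])

/-- The `k`-th fundamental weight. -/
def om (N k : ℕ) : ℚ^N := fun i => if (i : ℕ) < k then 1 else 0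

lemma antitone_om (N k : ℕ) : Antitone (om N k) := by intro i j hij; unfold om; grind

end Fock

lemma alt_perm (u : ℚ^k) (τ : Perm (Fin k)) : alt ℤ (u ∘ τ) = ((sign τ : ℤˣ) : ℤ) • alt ℤ u := by
  unfold alt; simp only [Int.cast_id]
  rw [← Equiv.sum_comp (Equiv.mulLeft τ)
    (fun σ => (single (fun i => u (σ i)) (((sign σ : ℤˣ) : ℤ) : ℤ) : ChR ℤ k)),
    smul_sum]
  refine sum_congr rfl fun σ _ => ?_; rw [smul_single]; congr 1
  rcases Int.units_eq_one_or (sign τ) with h | h <;> simp [h]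

lemma alt_eq_zero {u : ℚ^k} {i j : Fin k} (hij : i ≠ j) (h : u i = u j) : alt ℤ u = 0 := by
  have hu : u ∘ swap i j = u := by grind
  have h1 := alt_perm u (swap i j); rw [hu, Perm.sign_swap hij] at h1; ext v
  have h2 := congrArg (fun f => f.coeff v) h1; simp at h2 ⊢; omega

/-- The product of a symmetric sum of exponentials with an alternant. -/
lemma sum_mono_mul_alt {ι : Type} [Fintype ι] (wt : ι → ℚ^k)
    (hwt : ∀ σ : Perm (Fin k), ∃ e : ι ≃ ι, ∀ a, wt (e a) = wt a ∘ σ) (u : ℚ^k) :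
    (∑ a, mono (wt a))*alt ℤ u = ∑ a, alt ℤ (u+wt a) := by
  unfold alt; rw [sum_mul_sum, sum_comm, sum_comm (s := univ (α := ι))]
  refine sum_congr rfl fun σ _ => ?_; obtain ⟨e, he⟩ := hwt σ; rw [← Equiv.sum_comp e]
  refine sum_congr rfl fun a _ => ?_; rw [he, mono, single_mul_single, one_mul]; congr 1
  rw [add_comm]; rfl

lemma ext_isIrr (hk : k ≤ N) : (ext N k).IsIrr (om N k) := by
  refine ⟨antitone_om N k, ?_⟩
  have hwt : ∀ S : {S : Finset (Fin N) // S.card = k}, (ext N k).wt S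
      = fun a => if a ∈ S.1 then 1 else 0 := fun S => rfl
  rw [Rep.ch, sum_mono_mul_alt]
  · have hS0 : #{i : Fin N | (i : ℕ) < k} = k := by rw [Fin.card_filter_val_lt, min_eq_right hk]
    rw [sum_eq_single ⟨univ.filter (fun i : Fin N => (i : ℕ) < k), hS0⟩]
    · rw [add_comm]; congr 2; funext i; simp [hwt, om]
    · rintro ⟨S, hS⟩ _ hne; by_cases hlow : ∀ i j : Fin N, (i : ℕ)+1 = j → j ∈ S → i ∈ S
      · exfalso; apply hne; apply Subtype.ext; apply eq_of_subset_of_card_le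
        · intro x hx
          have hd : ∀ n : ℕ, ∀ y : Fin N, (y : ℕ)+n = x → y ∈ S := by
            intro n
            induction n with
            | zero => intro y hy; have : y = x := Fin.ext (by omega); rwa [this]
            | succ n ih =>
              intro y hy; have hlt : (y : ℕ)+1 < N := by have := x.2; omega
              exact hlow y ⟨y+1, hlt⟩ rfl (ih _ (by simp; omega))
          simp only [mem_filter_univ]; by_contra hcon
          have hsub : Iic x ⊆ S := fun y hy => hd (x-y) y (by
            simp_all)
          have := card_le_card hsub; rw [card_Iic, hS] at this; omega
        · rw [hS0, hS]
      · push Not at hlow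
        obtain ⟨i, j, hij, hj, hi⟩ := hlow
        apply alt_eq_zero (i := i) (j := j) (by intro h; rw [h] at hij; omega)
        simp only [Pi.add_apply, hwt, hj, hi, if_true, if_false]
        have : ((j : ℕ) : ℚ) = (i : ℕ)+1 := mod_cast hij.symm; unfold rho; rw [this]; ring
    · simp
  · intro σ; refine ⟨(Equiv.finsetCongr σ.symm).subtypeEquiv (fun S => by simp), fun S => ?_⟩
    rw [hwt, hwt]; funext a; simp

/-- Every sum of fundamental weights is the highest weight of an irreducible character. -/
lemma exists_irr (L : List ℕ) (hL : ∀ k ∈ L, k ≤ N) :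
    ∃ (κ : Type) (_ : Fintype κ) (_ : DecidableEq κ) (P : Rep N κ), P.IsIrr (L.map (om N)).sum := by
  induction L with
  | nil =>
    refine ⟨_, inferInstance, inferInstance, ext N 0, ?_⟩
    have h := ext_isIrr (N := N) (Nat.zero_le N); have : om N 0 = 0 := by funext i; simp [om]
    simp_all
  | cons k L ih =>
    obtain ⟨κ, _, _, P, hP⟩ := ih fun k hk => hL k (List.mem_cons_of_mem _ hk)
    obtain ⟨η, i1, i2, Q, Φ, hQ, -⟩ := Rep.exists_cartan (ext_isIrr (hL k List.mem_cons_self)) hP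
    grind

/-! ### Gradings by linear functionals -/

section Slice
variable {n : ℕ} (ℓ : ℚ^n →+ ℝ)

lemma coeff_mul_eq (f g : CharRing n) (v : ℚ^n) :
    (f*g).coeff v = ∑ w ∈ g.coeff.support, f.coeff (v-w)*g.coeff w := by
  conv_lhs => rw [← sum_coeff_single g]
  rw [Finsupp.sum, mul_sum, coeff_sum, finsetSum_apply]
  exact sum_congr rfl fun w _ => coeff_mul_single' _ _ _ _

lemma exists_of_coeff_mul_ne {f g : CharRing n} {v : ℚ^n} (h : (f*g).coeff v ≠ 0) :
    ∃ w, f.coeff (v-w) ≠ 0 ∧ g.coeff w ≠ 0 := by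
  rw [coeff_mul_eq] at h; obtain ⟨w, -, hw⟩ := exists_ne_zero_of_sum_ne_zero h; grind

/-- All exponents of `f` have degree at most `a`. -/
def DegLe (f : CharRing n) (a : ℝ) : Prop := ∀ v, f.coeff v ≠ 0 → ℓ v ≤ a

/-- The part of `f` of degree exactly `a`. -/
def slice (a : ℝ) (f : CharRing n) : CharRing n := ofCoeff (f.coeff.filter fun v => ℓ v = a)

lemma slice_coeff (a : ℝ) (f : CharRing n) (v : ℚ^n) :
    (slice ℓ a f).coeff v = if ℓ v = a then f.coeff v else 0 := by
  rw [slice, coeff_ofCoeff, Finsupp.filter_apply]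

variable {ℓ}

lemma DegLe.mul {f g : CharRing n} {a b : ℝ} (hf : DegLe ℓ f a) (hg : DegLe ℓ g b) :
    DegLe ℓ (f*g) (a+b) := by
  intro v hv; obtain ⟨w, h1, h2⟩ := exists_of_coeff_mul_ne hv; have e1 := hf _ h1
  have e2 := hg _ h2; rw [map_sub] at e1; linarith

lemma DegLe.mono {f : CharRing n} {a b : ℝ} (hf : DegLe ℓ f a) (hab : a ≤ b) : DegLe ℓ f b :=
  fun v hv => (hf v hv).trans hab

lemma DegLe.sub {f g : CharRing n} {a : ℝ} (hf : DegLe ℓ f a) (hg : DegLe ℓ g a) :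
    DegLe ℓ (f-g) a := by
  intro v hv; rw [coeff_sub, Finsupp.sub_apply] at hv; by_cases h : f.coeff v = 0
  · exact hg v (by rw [h, zero_sub, neg_ne_zero] at hv; exact hv)
  · exact hf v h

lemma slice_mul {f g : CharRing n} {a b : ℝ} (hf : DegLe ℓ f a) (hg : DegLe ℓ g b) :
    slice ℓ (a+b) (f*g) = slice ℓ a f*slice ℓ b g := by
  ext v; rw [slice_coeff, coeff_mul_eq, coeff_mul_eq]
  have hsub : (slice ℓ b g).coeff.support ⊆ g.coeff.support := by
    intro w hw; rw [mem_support_iff, slice_coeff] at hw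
    simp_all
  rw [sum_subset hsub]
  · split_ifs with h
    · refine sum_congr rfl fun w _ => ?_; rw [slice_coeff, slice_coeff]
      by_cases h1 : f.coeff (v-w) = 0
      · simp [h1]
      by_cases h2 : g.coeff w = 0
      · simp [h2]
      have e1 := hf _ h1; have e2 := hg _ h2; grind
    · symm; refine sum_eq_zero fun w _ => ?_; rw [slice_coeff, slice_coeff, map_sub]; grind
  · simp_all

lemma exists_deg {f : CharRing n} (hf : f ≠ 0) (ℓ : ℚ^n →+ ℝ) :
    ∃ b, DegLe ℓ f b ∧ slice ℓ b f ≠ 0 := by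
  have hne : f.coeff.support.Nonempty := by
    simp_all
  obtain ⟨v, hv, hmax⟩ := exists_max_image _ ℓ hne
  refine ⟨ℓ v, fun w hw => hmax w (mem_support_iff.2 hw), fun h => ?_⟩
  have := slice_coeff ℓ (ℓ v) f v
  simp_all

/-- Degrees subtract under division. -/
lemma DegLe.of_mul {f g : CharRing n} {a b : ℝ} (hf : DegLe ℓ f a) (hs : slice ℓ a f ≠ 0)
    (h : DegLe ℓ (f*g) (a+b)) : DegLe ℓ g b := by
  by_cases hg : g = 0
  · intro v hv; rw [hg] at hv; exact absurd rfl hv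
  obtain ⟨b', hb', hs'⟩ := exists_deg hg ℓ; have h1 := slice_mul hf hb'
  have h2 : slice ℓ (a+b') (f*g) ≠ 0 := by simp_all
  have h3 : ∃ v, (slice ℓ (a+b') (f*g)).coeff v ≠ 0 := by
    by_contra hcon
    push Not at hcon
    apply h2; ext v; rw [hcon]; rfl
  obtain ⟨v, hv⟩ := h3; rw [slice_coeff] at hv; have hv1 : ℓ v = a+b' := by simp_all
  rw [if_pos hv1] at hv; have := h v hv; exact hb'.mono (by linarith)

lemma DegLe.prod {ι : Type} (s : Finset ι) (f : ι → CharRing n) (a : ι → ℝ)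
    (hf : ∀ i ∈ s, DegLe ℓ (f i) (a i)) : DegLe ℓ (∏ i ∈ s, f i) (∑ i ∈ s, a i) ∧
      slice ℓ (∑ i ∈ s, a i) (∏ i ∈ s, f i) = ∏ i ∈ s, slice ℓ (a i) (f i) := by
  classical
  induction s using Finset.induction_on with
  | empty =>
    have h1 : (1 : CharRing n) = single 0 1 := rfl; constructor
    · intro v hv; rw [prod_empty, h1, coeff_single, Finsupp.single_apply] at hv
      have : v = 0 := by simp_all
      simp [this]
    · ext v; rw [slice_coeff, prod_empty, prod_empty, h1, coeff_single, Finsupp.single_apply]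
      split_ifs with h2 h3 h3 <;> first | rfl | skip
      exfalso; apply h2; rw [← h3]; simp
  | insert i s hi ih =>
    have ih' := ih fun j hj => hf j (mem_insert_of_mem hj); have hfi := hf i (mem_insert_self i s)
    rw [prod_insert hi, sum_insert hi, prod_insert hi]
    exact ⟨hfi.mul ih'.1, by rw [slice_mul hfi ih'.1, ih'.2]⟩

end Slice

/-! ### Divisibility by `1 - e^{-β}` -/

section Divisibility

lemma eq_zero_of_one_sub_single_mul {G : Type} [AddCommGroup G] {γ : G}
    (hγ : ∀ k : ℤ, k • γ = 0 → k = 0) {g : AddMonoidAlgebra ℤ G}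
    (h : (1-single γ 1)*g = 0) : g = 0 := by
  have h1 : ∀ v, g.coeff v = g.coeff (v+γ) := by
    intro v; have h2 := congrArg (fun f => f.coeff (v+γ)) h
    simp only [sub_mul, one_mul, coeff_sub, Finsupp.sub_apply] at h2
    rw [add_comm v γ, coeff_single_mul_add] at h2; have h3 : g.coeff (γ+v)-1*g.coeff v = 0 := h2
    grind
  by_contra hg
  have : ∃ v, g.coeff v ≠ 0 := by
    by_contra hcon
    push Not at hcon
    exact hg (by ext v; rw [hcon]; rfl)
  obtain ⟨v, hv⟩ := this
  have h2 : ∀ k : ℕ, g.coeff (v+k • γ) ≠ 0 := by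
    intro k
    induction k with
    | zero => simpa using hv
    | succ k ih => rw [succ_nsmul, ← add_assoc, ← h1]; exact ih
  have h3 : Injective fun k : ℕ => v+k • γ := by
    intro a b hab; have hab' : a • γ = b • γ := add_left_cancel hab
    have := hγ ((a : ℤ)-b) (by rw [sub_smul, natCast_zsmul, natCast_zsmul, hab', sub_self]); omega
  exact Set.infinite_of_injective_forall_mem (s := (g.coeff.support : Set G)) h3
    (fun k => mem_support_iff.2 (h2 k)) (finite_toSet _)

variable {n : ℕ}

/-- Reduction of exponents modulo multiples of `β`. -/
def modRoot (β : ℚ^n) : CharRing n →+* AddMonoidAlgebra ℤ (ℚ^n ⧸ AddSubgroup.zmultiples β) :=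
  mapDomainRingHom ℤ (QuotientAddGroup.mk' (AddSubgroup.zmultiples β))

lemma modRoot_single (β v : ℚ^n) (c : ℤ) : modRoot β (single v c)
    = single (QuotientAddGroup.mk v) c := by
  simp [modRoot, mapDomainRingHom_apply, mapDomain_single]

lemma dvd_of_modRoot_eq_zero {β : ℚ^n} {g : CharRing n} (h : modRoot β g = 0) :
    (1-mono (-β)) ∣ g := by
  have base : ∀ k : ℕ, ∀ v, (1-mono (-β)) ∣ mono v-mono (v-(k : ℤ) • β) := by
    intro k
    induction k with
    | zero => intro v; simp
    | succ k ih =>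
      intro v
      have h1 : mono v-mono (v-((k+1 : ℕ) : ℤ) • β)
          = (mono v-mono (v-(k : ℤ) • β))+mono (v-(k : ℤ) • β)*(1-mono (-β)) := by
        rw [mul_sub, mul_one]; unfold mono; rw [single_mul_single]
        have : v-((k+1 : ℕ) : ℤ) • β = v-(k : ℤ) • β + -β := by push_cast; rw [add_smul]; simp; abel
        rw [this]; simp
      rw [h1]; exact dvd_add (ih v) (dvd_mul_left _ _)
  have base' : ∀ v w : ℚ^n, (QuotientAddGroup.mk v : ℚ^n ⧸ AddSubgroup.zmultiples β)
      = QuotientAddGroup.mk w → (1-mono (-β)) ∣ mono v-mono w := by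
    intro v w hvw; rw [QuotientAddGroup.eq, AddSubgroup.mem_zmultiples_iff] at hvw
    obtain ⟨k, hk⟩ := hvw; have hw : w = v+k • β := by rw [hk]; abel
    rcases Int.eq_nat_or_neg k with ⟨j, rfl | rfl⟩
    · have := base j w; rw [hw, add_sub_cancel_right] at this; rw [hw]; have h2 := dvd_neg.2 this
      rwa [neg_sub] at h2
    · have := base j v; rw [hw, neg_smul, ← sub_eq_add_neg]; exact this
  let sec : ℚ^n ⧸ AddSubgroup.zmultiples β → ℚ^n := Quotient.out
  let back : AddMonoidAlgebra ℤ (ℚ^n ⧸ AddSubgroup.zmultiples β) → CharRing n :=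
    fun x => x.coeff.sum fun c z => single (sec c) z
  have key : ∀ g : CharRing n, (1-mono (-β)) ∣ g-back (modRoot β g) := by
    intro g
    induction g using induction_linear with
    | zero => simp [back]
    | add f g hf hg =>
      have : back (modRoot β (f+g)) = back (modRoot β f)+back (modRoot β g) := by
        simp only [back, map_add, coeff_add]
        exact Finsupp.sum_add_index' (by simp) (by intro a b c; exact single_add _ _ _)
      rw [this, add_sub_add_comm]
      exact dvd_add hf hg
    | single v c =>
      rw [modRoot_single]; simp only [back, coeff_single]; rw [Finsupp.sum_single_index (by simp)]
      have h1 := base' v (sec (QuotientAddGroup.mk v)) (by simp [sec])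
      have h2 : single v c-single (sec (QuotientAddGroup.mk v)) c = (single 0 c : CharRing n) *
            (mono v-mono (sec (QuotientAddGroup.mk v))) := by
        unfold mono; rw [mul_sub, single_mul_single, single_mul_single]; simp
      rw [h2]; exact Dvd.dvd.mul_left h1 _
  have := key g; rw [h] at this; simpa [back] using this

lemma prod_dvd_of_modRoot {ι : Type} [DecidableEq ι] (s : Finset ι) (β : ι → ℚ^n)
    (hβ : ∀ i ∈ s, ∀ j ∈ s, i ≠ j → ∀ k l : ℤ, k • β i = l • β j → k = 0) {g : CharRing n}
    (h : ∀ i ∈ s, modRoot (β i) g = 0) : (∏ i ∈ s, (1-mono (-β i))) ∣ g := by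
  induction s using Finset.induction_on generalizing g with
  | empty => simp
  | insert i s hi ih =>
    obtain ⟨g', rfl⟩ := dvd_of_modRoot_eq_zero (h i (mem_insert_self i s)); rw [prod_insert hi]
    refine mul_dvd_mul_left _ (ih (fun a ha b hb => hβ a (mem_insert_of_mem ha) b
      (mem_insert_of_mem hb)) fun j hj => ?_)
    have h1 := h j (mem_insert_of_mem hj)
    rw [map_mul, map_sub, map_one, mono, modRoot_single] at h1
    refine eq_zero_of_one_sub_single_mul (fun k hk => ?_) h1
    rw [← QuotientAddGroup.mk_zsmul, QuotientAddGroup.eq_zero_iff, AddSubgroup.mem_zmultiples_iff] at hk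
    obtain ⟨l, hl⟩ := hk
    refine hβ i (mem_insert_self i s) j (mem_insert_of_mem hj)
      (by rintro rfl; exact hi hj) k (-l) ?_
    rw [neg_smul, hl]; simp

end Divisibility

/-! ### Alternating sums for types `B` and `D` -/

section TypeBD
variable {n : ℕ}

/-- The sign `±1` attached to a Boolean. -/
def bs (b : Bool) : ℤ := if b then -1 else 1

lemma bs_xor (a b : Bool) : bs (xor a b) = bs a*bs b := by cases a <;> cases b <;> rfl

lemma bs_mul_self (a : Bool) : bs a*bs a = 1 := by cases a <;> rfl

/-- The sign of a family of sign changes. -/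
def sg (s : Fin n → Bool) : ℤ := ∏ i, bs (s i)

lemma sg_eq (s : Fin n → Bool) : sg s = (-1) ^ #{i | s i = true} := by
  unfold sg bs; rw [prod_ite]; simp

/-- The coefficient of a signed permutation in `altY`. -/
def cf (t : CType) (σ : Perm (Fin n)) (s : Fin n → Bool) : ℤ :=
  if t = .D ∧ sg s ≠ 1 then 0 else ((sign σ : ℤˣ) : ℤ)*sg s

/-- The action of a signed permutation. -/
def sact (σ : Perm (Fin n)) (s : Fin n → Bool) (u : ℚ^n) : ℚ^n := fun i => bs (s i)*u (σ i)

lemma altY_eq (t : CType) (u : ℚ^n) : altY t n u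
    = ∑ σ : Perm (Fin n), ∑ s : Fin n → Bool, single (sact σ s u) (cf t σ s) := by
  unfold altY; refine sum_congr rfl fun σ _ => sum_congr rfl fun s _ => ?_
  have hEven : Even #{i | s i = true} ↔ sg s = 1 := by
    rw [sg_eq]; constructor
    · simp_all
    · intro h; by_contra h'
      simp_all
  have hact : (fun i => (if s i then -1 else 1)*u (σ i)) = sact σ s u := by
    funext i; unfold sact bs; split_ifs <;> simp
  rw [cf, hact, ← sg_eq]; by_cases h : t = .D ∧ sg s ≠ 1
  · simp_all
  · rw [if_neg h, if_neg fun h' => h ⟨h'.1, fun h2 => h'.2 (hEven.2 h2)⟩, mono, smul_single]; simp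

/-- The ring automorphism attached to a signed permutation. -/
def spHom (π : Perm (Fin n)) (e : Fin n → Bool) : CharRing n →+* CharRing n := mapDomainRingHom ℤ
    ({ toFun := sact π e
       map_zero' := by funext i; simp [sact]
       map_add' := fun u v => by funext i; simp [sact, mul_add] } : ℚ^n →+ ℚ^n)

lemma spHom_single (π : Perm (Fin n)) (e : Fin n → Bool) (v : ℚ^n) (c : ℤ) :
    spHom π e (single v c) = single (sact π e v) c := by
  simp [spHom, mapDomainRingHom_apply, mapDomain_single]

lemma sact_injective (π : Perm (Fin n)) (e : Fin n → Bool) : Injective (sact π e) := by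
  intro u v h; funext i; have := congrFun h (π.symm i); simp only [sact, apply_symm_apply] at this
  refine mul_left_cancel₀ ?_ this; unfold bs; split_ifs <;> norm_num

lemma spHom_coeff (π : Perm (Fin n)) (e : Fin n → Bool) (f : CharRing n)
    (v : ℚ^n) : (spHom π e f).coeff (sact π e v) = f.coeff v := by
  induction f using induction_linear with
  | zero => simp
  | add f g hf hg => simp [hf, hg]
  | single w n =>
    rw [spHom_single]; simp only [coeff_single, Finsupp.single_apply]; congr 1; rw [eq_iff_iff]
    exact ⟨fun h => sact_injective π e h, fun h => by rw [h]⟩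

lemma sact_sact (π σ : Perm (Fin n)) (e s : Fin n → Bool) (u : ℚ^n) :
    sact π e (sact σ s u) = sact (σ*π) (fun i => xor (s (π i)) (e i)) u := by
  funext i; simp only [sact, Perm.mul_apply, bs_xor]; push_cast; ring

lemma sg_xor (s e : Fin n → Bool) : sg (fun i => xor (s i) (e i)) = sg s*sg e := by
  unfold sg; rw [← prod_mul_distrib]; exact prod_congr rfl fun i _ => bs_xor _ _

lemma sg_comp (s : Fin n → Bool) (π : Perm (Fin n)) : sg (fun i => s (π i)) = sg s :=
  Equiv.prod_comp π fun i => bs (s i)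

lemma sg_sq (s : Fin n → Bool) : sg s*sg s = 1 := by
  unfold sg; rw [← prod_mul_distrib]; exact prod_eq_one fun i _ => bs_mul_self _

lemma spHom_altY {t : CType} (π : Perm (Fin n)) (e : Fin n → Bool)
    (he : t = .D → sg e = 1) (u : ℚ^n) :
    spHom π e (altY t n u) = (((sign π : ℤˣ) : ℤ)*sg e) • altY t n u := by
  rw [altY_eq, map_sum, smul_sum, ← Equiv.sum_comp (Equiv.mulRight π) (fun σ : Perm (Fin n) =>
    (((sign π : ℤˣ) : ℤ)*sg e) • ∑ s : Fin n → Bool, (single (sact σ s u) (cf t σ s) : CharRing n))]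
  refine sum_congr rfl fun σ _ => ?_
  let E : (Fin n → Bool) ≃ (Fin n → Bool) :=
    { toFun := fun s i => xor (s (π i)) (e i)
      invFun := fun s i => xor (s (π.symm i)) (e (π.symm i))
      left_inv := fun s => by funext i; simp
      right_inv := fun s => by funext i; simp }
  rw [map_sum, smul_sum]; refine Fintype.sum_equiv E _ _ fun s => ?_
  rw [spHom_single, sact_sact, smul_single]; congr 1
  have hE : sg (E s) = sg s*sg e := by
    change sg (fun i => xor (s (π i)) (e i)) = _; rw [sg_xor (fun i => s (π i)), sg_comp]
  unfold cf; rw [hE]; have h1 := sg_sq e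
  have h2 : ((sign π : ℤˣ) : ℤ)*((sign π : ℤˣ) : ℤ) = 1 := by simp
  by_cases ht : t = .D
  · rw [he ht]; simp only [mul_one, Equiv.coe_mulRight, Perm.sign_mul, Units.val_mul, smul_eq_mul]
    grind
  · simp only [ht, false_and, if_false, Equiv.coe_mulRight, Perm.sign_mul, Units.val_mul,
      smul_eq_mul]
    linear_combination (-((sign σ : ℤˣ) : ℤ)*sg s)*h2
      - (((sign σ : ℤˣ) : ℤ)*sg s*((sign π : ℤˣ) : ℤ) * ((sign π : ℤˣ) : ℤ))*h1

/-! ### Positive roots -/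

/-- Indices for the positive roots `e_i ∓ e_j` and `e_i`. -/
abbrev RootIx (n : ℕ) := (Fin n × Fin n × Bool) ⊕ Fin n

/-- The positive roots. -/
def rt : RootIx n → ℚ^n
  | Sum.inl (i, j, b) => fun l => if l = i then 1 else if l = j then -bs b else 0
  | Sum.inr i => fun l => if l = i then 1 else 0

/-- The index set of positive roots. -/
def posRoots (t : CType) (n : ℕ) : Finset (RootIx n) :=
  (univ.filter fun p : Fin n × Fin n × Bool => p.1 < p.2.1).disjSum (if t = .B then univ else ∅)

lemma rt_independent {t : CType} : ∀ x ∈ posRoots t n, ∀ y ∈ posRoots t n, x ≠ y →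
    ∀ k l : ℤ, k • rt x = l • rt y → k = 0 := by
  intro x hx y hy hxy k l h
  have hb : ∀ b : Bool, ((bs b : ℤ) : ℚ) = 1 ∨ ((bs b : ℤ) : ℚ) = -1 := by intro b; cases b <;> simp [bs]
  by_contra hk; have hk' : (k : ℚ) ≠ 0 := mod_cast hk
  have hval : ∀ q, (k : ℚ)*rt x q = l*rt y q := by intro q; have := congrFun h q; simpa using this
  rcases x with ⟨i, j, b⟩ | i <;> rcases y with ⟨i', j', b'⟩ | i'
  · simp only [posRoots, inl_mem_disjSum, mem_filter, mem_univ, true_and] at hx hy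
    have h1 := hval i; have h2 := hval j; simp only [rt, if_true, if_neg (ne_of_gt hx)] at h1 h2
    have hi : i = i' ∨ i = j' := by grind
    have hj : j = i' ∨ j = j' := by grind
    have e1 : i = i' := by omega
    have e2 : j = j' := by omega
    subst e1; subst e2; rw [if_pos rfl, mul_one, mul_one] at h1
    rw [if_neg (ne_of_gt hx), if_pos rfl, h1] at h2
    have hl : (l : ℚ) ≠ 0 := by rw [← h1]; exact hk'
    have h3 := mul_left_cancel₀ hl h2; apply hxy
    cases b <;> cases b' <;> first | rfl | (simp [bs] at h3; norm_num at h3)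
  · simp only [posRoots, inl_mem_disjSum, mem_filter, mem_univ, true_and] at hx; have h1 := hval i
    have h2 := hval j; simp only [rt, if_true, if_neg (ne_of_gt hx)] at h1 h2; grind
  · simp only [posRoots, inl_mem_disjSum, mem_filter, mem_univ, true_and] at hy; have h1 := hval i
    have h2 := hval i'; have h3 := hval j'
    simp only [rt, if_true, if_neg (ne_of_gt hy)] at h1 h2 h3; grind
  · have h1 := hval i; simp only [rt, if_true] at h1
    simp_all

/-- All coordinates are congruent to `d / 2` modulo `1`. -/
def Half (d : ℤ) (u : ℚ^n) : Prop := ∀ i, ∃ k : ℤ, u i = d/2+k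

lemma Half.sact {d : ℤ} {u : ℚ^n} (hu : Half d u) (σ : Perm (Fin n))
    (s : Fin n → Bool) : Half d (sact σ s u) := by
  intro i; obtain ⟨k, hk⟩ := hu (σ i); unfold MF.sact bs; rw [hk]; cases s i
  · exact ⟨k, by simp⟩
  · exact ⟨-d-k, by simp; ring⟩

lemma modRoot_eq_of_sub {β v w : ℚ^n} (k : ℤ) (h : w-v = k • β) (c : ℤ) :
    modRoot β (single v c) = modRoot β (single w c) := by
  rw [modRoot_single, modRoot_single]; congr 1
  rw [QuotientAddGroup.eq, AddSubgroup.mem_zmultiples_iff]; grind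

lemma modRoot_altY {t : CType} {d : ℤ} {u : ℚ^n} (hu : Half d u) {x : RootIx n}
    (hx : x ∈ posRoots t n) : modRoot (rt x) (altY t n u) = 0 := by
  have key : ∀ (π : Perm (Fin n)) (e : Fin n → Bool), (t = .D → sg e = 1) →
      ((sign π : ℤˣ) : ℤ)*sg e = -1 →
      (∀ v : ℚ^n, Half d v → ∃ k : ℤ, sact π e v-v = k • rt x) →
      modRoot (rt x) (altY t n u) = 0 := by
    intro π e he hs hk; have h1 := congrArg (modRoot (rt x)) (spHom_altY (t := t) π e he u)
    rw [hs] at h1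
    have h2 : modRoot (rt x) (spHom π e (altY t n u)) = modRoot (rt x) (altY t n u) := by
      rw [altY_eq]; simp only [map_sum, spHom_single]
      refine sum_congr rfl fun σ _ => sum_congr rfl fun s _ => ?_
      obtain ⟨k, hk⟩ := hk (sact σ s u) (hu.sact σ s); exact (modRoot_eq_of_sub k hk _).symm
    rw [h2, map_zsmul] at h1; ext v; have h3 := congrArg (fun f => f.coeff v) h1; simp at h3 ⊢
    omega
  rcases x with ⟨i, j, b⟩ | i
  · simp only [posRoots, inl_mem_disjSum, mem_filter, mem_univ, true_and] at hx
    have hij := ne_of_lt hx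
    have hsg : sg (fun l : Fin n => b && decide (l = i ∨ l = j)) = 1 := by
      cases b
      · simp [sg, bs]
      · unfold sg bs; simp only [Bool.true_and, decide_eq_true_eq]; rw [prod_ite]
        have : univ.filter (fun l : Fin n => l = i ∨ l = j) = {i, j} := by ext; simp
        rw [this]; simp [card_pair hij]
    refine key (swap i j) (fun l => b && decide (l = i ∨ l = j)) (fun _ => hsg) (by
      rw [hsg, Perm.sign_swap hij]; rfl) fun v hv => ?_
    obtain ⟨k1, hk1⟩ := hv i; obtain ⟨k2, hk2⟩ := hv j; refine ⟨if b then -(d+k1+k2) else k2-k1, ?_⟩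
    funext l; simp only [sact, rt, Pi.sub_apply, Pi.smul_apply, zsmul_eq_mul]; by_cases h1 : l = i
    · subst h1; rw [swap_apply_left, hk1, hk2]; cases b <;> simp [bs] <;> ring
    · by_cases h2 : l = j
      · subst h2; rw [swap_apply_right, hk1, hk2]; cases b <;> simp [bs, h1] <;> ring
      · rw [swap_apply_of_ne_of_ne h1 h2]; cases b <;> simp [bs, h1, h2]
  · have ht : t = .B := by by_contra ht; simp [posRoots, ht] at hx
    have hsg : sg (fun l : Fin n => decide (l = i)) = -1 := by unfold sg bs; simp
    refine key 1 (fun l => decide (l = i)) (fun h => by rw [ht] at h; cases h) (by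
      rw [hsg]; simp) fun v hv => ?_
    obtain ⟨k, hk⟩ := hv i; refine ⟨-(d+2*k), ?_⟩; funext l
    simp only [sact, rt, Pi.sub_apply, Pi.smul_apply, zsmul_eq_mul, Perm.one_apply]
    by_cases h1 : l = i
    · subst h1; rw [hk]; simp [bs]; ring
    · simp [bs, h1]

/-- The product over the positive roots. -/
def rootProd (t : CType) (n : ℕ) : CharRing n := ∏ x ∈ posRoots t n, (1-mono (-rt x))

lemma rootProd_dvd {t : CType} {d : ℤ} {u : ℚ^n} (hu : Half d u) : rootProd t n ∣ altY t n u :=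
  prod_dvd_of_modRoot _ _ rt_independent fun _ hx => modRoot_altY hu hx

end TypeBD

section TypeBD
variable {n : ℕ}

/-- The functional `v ↦ ∑ t_i v_i`. -/
def dotHom (t : ℝ^n) : ℚ^n →+ ℝ where
  toFun v := ∑ i, t i*v i
  map_zero' := by simp
  map_add' u v := by simp [mul_add, sum_add_distrib]

lemma dotHom_apply (t : ℝ^n) (v : ℚ^n) : dotHom t v = ∑ i, t i*v i := rfl

lemma sum_prs_perm (g : Fin n → ℝ^n) (hg : ∀ i j, g i j = g j i)
    (σ : Perm (Fin n)) : ∑ p ∈ prs n, g (σ p.1) (σ p.2) = ∑ p ∈ prs n, g p.1 p.2 := by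
  have h1 := sum_prs (k := n) g; have h2 := sum_prs (k := n) fun i j => g (σ i) (σ j)
  have h3 : ∑ i, ∑ j, g (σ i) (σ j) = ∑ i, ∑ j, g i j := by
    rw [← Equiv.sum_comp σ (fun i => ∑ j, g i j)]
    exact sum_congr rfl fun i _ => Equiv.sum_comp σ fun j => g (σ i) j
  have h4 : ∑ i, g (σ i) (σ i) = ∑ i, g i i := Equiv.sum_comp σ fun i => g i i
  have e1 : ∀ p ∈ prs n, g p.1 p.2+g p.2 p.1 = 2*g p.1 p.2 := fun p _ => by rw [hg p.2 p.1]; ring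
  have e2 : ∀ p ∈ prs n, g (σ p.1) (σ p.2)+g (σ p.2) (σ p.1) = 2*g (σ p.1) (σ p.2) := fun p _ => by
    grind
  rw [sum_congr rfl e1, ← mul_sum] at h1; rw [sum_congr rfl e2, ← mul_sum] at h2; linarith

lemma sum_posRoots {M : Type} [AddCommMonoid M] (t : CType) (g : RootIx n → M) :
    ∑ x ∈ posRoots t n, g x = ∑ p ∈ prs n, (g (Sum.inl (p.1, p.2, false))+g (Sum.inl (p.1, p.2, true)))
      + if t = .B then ∑ i, g (Sum.inr i) else 0 := by
  unfold posRoots; rw [sum_disjSum]; congr 1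
  · rw [sum_filter, Fintype.sum_prod_type, sum_filter, Fintype.sum_prod_type]
    refine sum_congr rfl fun i _ => ?_; rw [Fintype.sum_prod_type]
    refine sum_congr rfl fun j _ => ?_; simp only [Fintype.sum_bool]; grind
  · split_ifs <;> simp

lemma rhoY_apply {t : CType} (ht : t ≠ .C) (i : Fin n) :
    rhoY t n i = (n : ℚ)-1-(i : ℕ)+if t = .B then 1/2 else 0 := by
  cases t
  · simp [rhoY]; ring
  · exact absurd rfl ht
  · simp [rhoY]

lemma dot_rt_inl (t : ℝ^n) {i j : Fin n} (hij : i < j) (b : Bool) :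
    dotHom t (rt (Sum.inl (i, j, b))) = t i-bs b*t j := by
  rw [dotHom_apply]
  have : ∀ l, t l*((rt (Sum.inl (i, j, b)) l : ℚ) : ℝ)
      = (if l = i then t i else 0)+if l = j then -bs b*t j else 0 := by
    intro l; simp only [rt]; by_cases h1 : l = i
    · subst h1; simp [ne_of_lt hij]
    · by_cases h2 : l = j
      · subst h2; simp [h1]; ring
      · simp [h1, h2]
  simp only [this, sum_add_distrib, sum_ite_eq', mem_univ, if_true]; ring

lemma dot_rt_inr (t : ℝ^n) (i : Fin n) : dotHom t (rt (Sum.inr i)) = t i := by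
  rw [dotHom_apply, sum_eq_single i]
  · simp [rt]
  · intro j _ hj; simp [rt, hj]
  · simp

lemma sum_prs_fst (g : ℝ^n) : ∑ p ∈ prs n, g p.1 = ∑ i : Fin n, ((n : ℝ)-1-((i : ℕ) : ℝ))*g i := by
  rw [sum_filter, Fintype.sum_prod_type]; refine sum_congr rfl fun i _ => ?_; simp only
  rw [← sum_filter, sum_const, nsmul_eq_mul]; congr 1
  have : univ.filter (fun x : Fin n => i < x) = Ioi i := by ext; simp
  rw [this, Fin.card_Ioi]; have : (i : ℕ) < n := i.2; rw [Nat.sub_sub, Nat.cast_sub (by omega)]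
  push_cast; ring

lemma sum_dot_rt  (hty : ty ≠ .C) (t : ℝ^n) :
    ∑ x ∈ posRoots ty n, dotHom t (rt x) = 2*dotHom t (rhoY ty n) := by
  rw [sum_posRoots]
  have : ∀ p ∈ prs n, dotHom t (rt (Sum.inl (p.1, p.2, false)))+dotHom t (rt (Sum.inl (p.1, p.2, true)))
      = 2*t p.1 := by
    intro p hp; rw [mem_filter] at hp; rw [dot_rt_inl t hp.2, dot_rt_inl t hp.2]; simp [bs]; ring
  rw [sum_congr rfl this, ← mul_sum, sum_prs_fst]; simp only [dot_rt_inr]; rw [dotHom_apply]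
  split_ifs with h
  · rw [mul_sum, mul_sum, ← sum_add_distrib]; refine sum_congr rfl fun i _ => ?_
    rw [rhoY_apply hty, if_pos h]; push_cast; ring
  · rw [add_zero, mul_sum, mul_sum]; refine sum_congr rfl fun i _ => ?_
    rw [rhoY_apply hty, if_neg h]; push_cast; ring

lemma dot_sact_rho_le  (hty : ty ≠ .C) (t : ℝ^n) (σ : Perm (Fin n)) (s : Fin n → Bool) :
    dotHom t (sact σ s (rhoY ty n)) ≤ ∑ x ∈ posRoots ty n, |dotHom t (rt x)| / 2 := by
  have hbs : ∀ b : Bool, |((bs b : ℤ) : ℝ)| = 1 := by intro b; cases b <;> simp [bs]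
  let a : ℝ^n := fun i => |t (σ.symm i)|; have ha : ∀ i, 0 ≤ a i := fun i => abs_nonneg _
  have h1 : dotHom t (sact σ s (rhoY ty n)) ≤ ∑ i, a i*(rhoY ty n i : ℝ) := by
    rw [dotHom_apply, ← Equiv.sum_comp σ (fun i => a i*(rhoY ty n i : ℝ))]
    refine sum_le_sum fun i _ => ?_
    have hr : (0 : ℝ) ≤ (rhoY ty n (σ i) : ℝ) := by
      have : (0 : ℚ) ≤ rhoY ty n (σ i) := by
        rw [rhoY_apply hty]; have : ((σ i : ℕ) : ℚ)+1 ≤ n := mod_cast (σ i).2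
        split_ifs <;> linarith
      exact_mod_cast this
    simp only [sact, a, symm_apply_apply]; push_cast; rw [← mul_assoc]
    refine mul_le_mul_of_nonneg_right ?_ hr; refine (le_abs_self _).trans ?_
    rw [abs_mul, hbs, mul_one]
  refine h1.trans ?_; have hmax : ∀ x y : ℝ, (|x-y| + |x+y|)/2 = max |x| |y| := by grind
  rw [sum_posRoots]
  have h2 : ∀ p ∈ prs n, |dotHom t (rt (Sum.inl (p.1, p.2, false)))| / 2
      + |dotHom t (rt (Sum.inl (p.1, p.2, true)))| / 2 = max |t p.1| |t p.2| := by
    intro p hp; rw [mem_filter] at hp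
    rw [dot_rt_inl t hp.2, dot_rt_inl t hp.2, ← add_div, ← hmax]; simp [bs]
  rw [sum_congr rfl h2]
  have h3 : ∑ p ∈ prs n, max |t p.1| |t p.2| = ∑ p ∈ prs n, max (a p.1) (a p.2) :=
    (sum_prs_perm (fun i j => max |t i| |t j|) (fun i j => max_comm _ _) σ.symm).symm
  have h4 : ∑ p ∈ prs n, a p.1 ≤ ∑ p ∈ prs n, max (a p.1) (a p.2) :=
    sum_le_sum fun p _ => le_max_left _ _
  rw [sum_prs_fst] at h4
  have h5 : ∑ i, |t i| = ∑ i, a i := (Equiv.sum_comp σ.symm fun i => |t i|).symm; rw [h3]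
  simp only [dot_rt_inr, ← sum_div]; rw [h5]; split_ifs with h
  · refine le_trans (le_of_eq ?_) (add_le_add h4 le_rfl); rw [sum_div, ← sum_add_distrib]
    refine sum_congr rfl fun i _ => ?_; rw [rhoY_apply hty, if_pos h]; push_cast; ring
  · refine le_trans (le_of_eq ?_) (add_le_add h4 le_rfl); rw [add_zero]
    refine sum_congr rfl fun i _ => ?_; rw [rhoY_apply hty, if_neg h]; push_cast; ring

lemma altY_coeff (t : CType) (u v : ℚ^n) : (altY t n u).coeff v
    = ∑ σ : Perm (Fin n), ∑ s : Fin n → Bool, if sact σ s u = v then cf t σ s else 0 := by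
  rw [altY_eq, coeff_sum, finsetSum_apply]; refine sum_congr rfl fun σ _ => ?_
  rw [coeff_sum, finsetSum_apply]; simp only [coeff_single, Finsupp.single_apply]

lemma altY_coeff_ne {t : CType} {u v : ℚ^n} (h : (altY t n u).coeff v ≠ 0) :
    ∃ σ s, sact σ s u = v := by
  rw [altY_coeff] at h; obtain ⟨σ, -, h⟩ := exists_ne_zero_of_sum_ne_zero h
  obtain ⟨s, -, h⟩ := exists_ne_zero_of_sum_ne_zero h; grind

/-- Strictly dominant weights. -/
structure Reg (t : CType) (u : ℚ^n) : Prop where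
  lt : ∀ i j, i < j → |u j| < u i
  pos : t = .B → ∀ i, 0 < u i

lemma Reg.strictAnti_abs {t : CType} {u : ℚ^n} (h : Reg t u) : StrictAnti fun i => |u i| :=
  fun i j hij => (h.lt i j hij).trans_le (le_abs_self _)

lemma altY_coeff_self {t : CType} (ht : t ≠ .C) {u : ℚ^n} (h : Reg t u) :
    (altY t n u).coeff u = 1 := by
  have hbs : ∀ b : Bool, |((bs b : ℤ) : ℚ)| = 1 := by intro b; cases b <;> simp [bs]
  have hσ : ∀ σ s, sact σ s u = u → σ = 1 := by
    intro σ s hs; refine strictAnti_perm h.strictAnti_abs σ ?_; funext i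
    have := congrArg abs (congrFun hs i); rw [sact, abs_mul, hbs, one_mul] at this; exact this
  have hs : ∀ σ s, sact σ s u = u → cf t σ s ≠ 0 → s = fun _ => false := by
    intro σ s hs hcf; have h1 := hσ σ s hs; subst h1
    have hz : ∀ i, s i = true → u i = 0 := by
      intro i hi; have := congrFun hs i; simp only [sact, hi, bs, Perm.one_apply, if_true] at this
      push_cast at this; linarith
    by_contra hne; have : ∃ i, s i = true := by grind
    obtain ⟨i, hi⟩ := this; have hi0 := hz i hi; cases t
    · exact (h.pos rfl i).ne' hi0
    · exact ht rfl
    · apply hcf; rw [cf, if_pos]; refine ⟨rfl, ?_⟩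
      have : ∀ j, j ≠ i → s j = false := by
        intro j hj; by_contra hcon; have hj0 := hz j (by simpa using hcon)
        rcases lt_or_gt_of_ne hj with hlt | hlt
        · have := h.lt j i hlt
          simp_all
        · have := h.lt i j hlt
          simp_all
      unfold sg; rw [prod_eq_single i (fun j _ hj => by rw [this j hj]; rfl) (by simp), hi]
      simp [bs]
  rw [altY_coeff, sum_eq_single 1, sum_eq_single (fun _ => false)]
  · have h1 : sact 1 (fun _ => false) u = u := by funext i; simp [sact, bs]
    have h2 : sg (fun _ : Fin n => false) = 1 := by simp [sg, bs]
    rw [if_pos h1, cf, h2]; simp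
  · grind
  · simp
  · intro σ _ hne; refine sum_eq_zero fun s _ => if_neg fun h' => hne (hσ σ s h')
  · simp

lemma reg_rhoY {t : CType} (ht : t ≠ .C) : Reg t (rhoY t n) := by
  have h1 : ∀ i : Fin n, ((i : ℕ) : ℚ)+1 ≤ n := fun i => mod_cast i.2; constructor
  · intro i j hij; have : ((i : ℕ) : ℚ) < (j : ℕ) := mod_cast hij; have h2 := h1 j
    rw [rhoY_apply ht, rhoY_apply ht, abs_of_nonneg (by split_ifs <;> linarith)]
    linarith
  · intro h i; rw [rhoY_apply ht, if_pos h]; have := h1 i; linarith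

lemma half_rhoY {t : CType} (ht : t ≠ .C) : Half (if t = .B then 1 else 0) (rhoY t n) := by
  intro i; refine ⟨(n : ℤ)-1-(i : ℕ), ?_⟩; rw [rhoY_apply ht]; split_ifs <;> (push_cast; ring)

lemma one_sub_mono_deg (t : ℝ^n) {β : ℚ^n} (hβ : β ≠ 0) :
    DegLe (dotHom t) (1-mono (-β)) (max 0 (-dotHom t β)) ∧
    slice (dotHom t) (max 0 (-dotHom t β)) (1-mono (-β)) ≠ 0 := by
  have hc : ∀ v, (1-mono (-β) : CharRing n).coeff v
      = (if (0 : ℚ^n) = v then 1 else 0)-if -β = v then 1 else 0 := by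
    intro v; have h1 : (1 : CharRing n) = single 0 1 := rfl
    rw [coeff_sub, Finsupp.sub_apply, h1, mono, coeff_single,
      coeff_single, Finsupp.single_apply, Finsupp.single_apply]
  have hβ' : -β ≠ 0 := neg_ne_zero.2 hβ; constructor
  · intro v hv; rw [hc] at hv; by_cases h1 : (0 : ℚ^n) = v
    · rw [← h1, map_zero]; exact le_max_left _ _
    · by_cases h2 : -β = v
      · rw [← h2, map_neg]; exact le_max_right _ _
      · simp_all
  · intro h; rcases max_choice 0 (-dotHom t β) with hm | hm
    · have := slice_coeff (dotHom t) (max 0 (-dotHom t β)) (1-mono (-β)) 0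
      rw [h, hc, if_pos rfl, if_neg hβ', hm, map_zero (dotHom t), if_pos rfl] at this; simp at this
    · have := slice_coeff (dotHom t) (max 0 (-dotHom t β)) (1-mono (-β)) (-β)
      simp_all

lemma rt_ne_zero {t : CType} {x : RootIx n} (hx : x ∈ posRoots t n) : rt x ≠ 0 := by
  rcases x with ⟨i, j, b⟩ | i
  · intro h; have := congrFun h i; simp [rt] at this
  · intro h; have := congrFun h i; simp [rt] at this

/-- The Weyl denominator formula. -/
lemma altY_rho  (hty : ty ≠ .C) : altY ty n (rhoY ty n) = rootProd ty n*mono (rhoY ty n) := by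
  obtain ⟨h, hh⟩ := rootProd_dvd (half_rhoY (n := n) hty)
  have hdeg : ∀ t : ℝ^n, DegLe (dotHom t) h (dotHom t (rhoY ty n)) := by
    intro t
    have hp := DegLe.prod (ℓ := dotHom t) (posRoots ty n) (fun x => 1-mono (-rt x))
      (fun x => max 0 (-dotHom t (rt x))) (fun x hx => (one_sub_mono_deg t (rt_ne_zero hx)).1)
    refine DegLe.of_mul (f := rootProd ty n) hp.1 ?_ ?_
    · unfold rootProd; rw [hp.2]
      exact prod_ne_zero_iff.2 fun x hx => (one_sub_mono_deg t (rt_ne_zero hx)).2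
    · rw [← hh]; intro v hv; obtain ⟨σ, s, rfl⟩ := altY_coeff_ne hv
      refine (dot_sact_rho_le hty t σ s).trans (le_of_eq ?_); have h2 := sum_dot_rt hty t (n := n)
      have h3 : ∀ x : RootIx n, |dotHom t (rt x)| / 2
          = max 0 (-dotHom t (rt x))+dotHom t (rt x)/2 := by
        grind
      rw [sum_congr rfl fun x _ => h3 x, sum_add_distrib, ← sum_div, h2]; ring
  have hsupp : ∀ v, h.coeff v ≠ 0 → v = rhoY ty n := by
    intro v hv; have := hdeg (fun i => ((v i-rhoY ty n i : ℚ) : ℝ)) v hv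
    rw [dotHom_apply, dotHom_apply, ← sub_nonpos, ← sum_sub_distrib] at this
    have h2 : ∀ i ∈ univ, (0 : ℝ) ≤ ((v i-rhoY ty n i : ℚ) : ℝ)*v i
        - ((v i-rhoY ty n i : ℚ) : ℝ)*rhoY ty n i := by
      intro i _; rw [← mul_sub]; push_cast; exact mul_self_nonneg _
    have h3 := (sum_eq_zero_iff_of_nonneg h2).1 (le_antisymm this (sum_nonneg h2)); funext i
    have h4 := h3 i (mem_univ i); rw [← mul_sub] at h4; push_cast at h4
    have h5 := mul_self_eq_zero.1 h4; have h6 : (v i : ℝ) = rhoY ty n i := by linarith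
    exact_mod_cast h6
  have hsingle : h = single (rhoY ty n) (h.coeff (rhoY ty n)) := by
    ext v; rw [coeff_single, Finsupp.single_apply]; grind
  have h0 : (rootProd ty n).coeff 0 = 1 := by
    let t0 : ℝ^n := fun i => (n : ℝ)-(i : ℕ)
    have hpos : ∀ x ∈ posRoots ty n, 0 < dotHom t0 (rt x) := by
      intro x hx; have hn : ∀ i : Fin n, ((i : ℕ) : ℝ)+1 ≤ n := fun i => mod_cast i.2
      rcases x with ⟨i, j, b⟩ | i
      · simp only [posRoots, inl_mem_disjSum, mem_filter, mem_univ, true_and] at hx; have h1 := hn i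
        have h2 := hn j; have h3 : ((i : ℕ) : ℝ) < (j : ℕ) := mod_cast hx; rw [dot_rt_inl t0 hx]
        cases b <;> simp only [bs, t0, if_true, if_false, Bool.false_eq_true] <;> push_cast <;> linarith
      · rw [dot_rt_inr]; grind
    have hp := DegLe.prod (ℓ := dotHom t0) (posRoots ty n) (fun x => 1-mono (-rt x))
      (fun x => max 0 (-dotHom t0 (rt x))) (fun x hx => (one_sub_mono_deg t0 (rt_ne_zero hx)).1)
    have hz : ∑ x ∈ posRoots ty n, max 0 (-dotHom t0 (rt x)) = 0 :=
      sum_eq_zero fun x hx => max_eq_left (by have := hpos x hx; linarith)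
    have hs : ∀ x ∈ posRoots ty n, slice (dotHom t0) (max 0 (-dotHom t0 (rt x))) (1-mono (-rt x)) = 1 := by
      intro x hx; have hx0 := hpos x hx; rw [max_eq_left (by linarith)]; ext v
      have h1 : (1 : CharRing n) = single 0 1 := rfl
      rw [slice_coeff, coeff_sub, Finsupp.sub_apply, h1, mono,
        coeff_single, coeff_single, Finsupp.single_apply,
        Finsupp.single_apply]
      by_cases e1 : (0 : ℚ^n) = v
      · subst e1; have : -rt x ≠ 0 := neg_ne_zero.2 (rt_ne_zero hx); simp [this]
      · by_cases e2 : -rt x = v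
        · subst e2; rw [map_neg, if_neg (by linarith), if_neg e1]
        · simp [e1, e2]
    have h2 := hp.2; rw [hz, prod_congr rfl hs, prod_const_one] at h2
    have h3 := slice_coeff (dotHom t0) 0 (rootProd ty n) 0
    rw [rootProd, h2, map_zero (dotHom t0), if_pos rfl] at h3
    have h4 : (1 : CharRing n).coeff 0 = 1 := by simp
    rw [h4] at h3; exact h3.symm
  have h1 := altY_coeff_self hty (reg_rhoY (n := n) hty)
  rw [hh, hsingle, coeff_mul_single', sub_self, h0, one_mul] at h1; rw [hh, hsingle, h1]; rfl

/-- Irreducible characters exist. -/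
lemma exists_isCharY  (hty : ty ≠ .C) {d : ℤ} (c : Fin n → ℕ)
    (hd : Half d (epsWt ty n c+rhoY ty n)) : ∃ f, IsCharY ty n c f := by
  obtain ⟨h, hh⟩ := rootProd_dvd (t := ty) hd; refine ⟨mono (-rhoY ty n)*h, ?_⟩
  rw [IsCharY, altY_rho hty, hh, mul_assoc, ← mul_assoc (mono (rhoY ty n))]; unfold mono
  rw [single_mul_single]; have : (single (0 : ℚ^n) (1 : ℤ) : CharRing n) = 1 := rfl; simp [this]

end TypeBD

section TypeBD
variable {n : ℕ}

lemma abs_bs (b : Bool) : |((bs b : ℤ) : ℝ)| = 1 := by cases b <;> simp [bs]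

lemma Reg.strictAnti_absR  {u : ℚ^n} (h : Reg ty u) : StrictAnti fun i => |(u i : ℝ)| := by
  intro i j hij; have := h.strictAnti_abs hij; simp only at this
  have h2 : ((|u j| : ℚ) : ℝ) < ((|u i| : ℚ) : ℝ) := mod_cast this
  simp_all

lemma dot_eq_abs {t : ℝ^n} {u : ℚ^n} (hpos : ∀ i, t i = 0 ∨ 0 ≤ u i) :
    dotHom t u = ∑ i, t i * |(u i : ℝ)| := by
  rw [dotHom_apply]; refine sum_congr rfl fun i _ => ?_; rcases hpos i with h | h
  · simp [h]
  · rw [abs_of_nonneg (mod_cast h)]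

lemma dot_sact_le_abs {t : ℝ^n} (h0 : ∀ i, 0 ≤ t i) (u : ℚ^n)
    (σ : Perm (Fin n)) (s : Fin n → Bool) :
    dotHom t (sact σ s u) ≤ ∑ i, t i * |(u (σ i) : ℝ)| := by
  rw [dotHom_apply]; refine sum_le_sum fun i _ => mul_le_mul_of_nonneg_left ?_ (h0 i)
  refine (le_abs_self _).trans (le_of_eq ?_); unfold sact; push_cast; rw [abs_mul, abs_bs, one_mul]

lemma monovary_of_anti {t : ℝ^n} (ht : Antitone t) {a : ℝ^n} (ha : StrictAnti a) :
    Monovary t a := by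
  intro i j hij; exact ht (ha.lt_iff_gt.1 hij).le

lemma dot_sact_le  {t : ℝ^n} (ht : Antitone t) (h0 : ∀ i, 0 ≤ t i)
    {u : ℚ^n} (hu : Reg ty u) (hpos : ∀ i, t i = 0 ∨ 0 ≤ u i) (σ : Perm (Fin n))
    (s : Fin n → Bool) : dotHom t (sact σ s u) ≤ dotHom t u := by
  rw [dot_eq_abs hpos]
  exact (dot_sact_le_abs h0 u σ s).trans
    ((monovary_of_anti ht hu.strictAnti_absR).sum_mul_comp_perm_le_sum_mul (σ := σ))

lemma of_dot_sact_eq  {t : ℝ^n} (ht : Antitone t) (h0 : ∀ i, 0 ≤ t i)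
    {u : ℚ^n} (hu : Reg ty u) (hpos : ∀ i, t i = 0 ∨ 0 < u i) {σ : Perm (Fin n)}
    {s : Fin n → Bool} (h : dotHom t (sact σ s u) = dotHom t u) :
    (∀ i, t (σ i) = t i) ∧ ∀ i, s i = true → t i = 0 := by
  have hpos' : ∀ i, t i = 0 ∨ 0 ≤ u i := fun i => (hpos i).imp_right le_of_lt
  have h1 := dot_sact_le_abs h0 u σ s; have hmono := monovary_of_anti ht hu.strictAnti_absR
  have h2 := hmono.sum_mul_comp_perm_le_sum_mul (σ := σ); have h3 := dot_eq_abs hpos'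
  have h4 : ∑ i, t i * |(u (σ i) : ℝ)| = ∑ i, t i * |(u i : ℝ)| := by linarith
  rw [hmono.sum_mul_comp_perm_eq_sum_mul_iff] at h4
  have hanti : ∀ a b : Fin n, a < b → t (σ.symm b) ≤ t (σ.symm a) := by
    intro a b hab; refine h4 ?_; simp only [Function.comp_apply, apply_symm_apply]
    exact hu.strictAnti_absR hab
  have hσ : ∀ i, t (σ i) = t i := by
    have hsum : ∀ c : ℝ, #{i | c ≤ t (σ.symm i)} = #{i | c ≤ t i} := by
      intro c; refine card_bij (fun i _ => σ.symm i) ?_ ?_ ?_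
      · simp
      · simp
      · intro i hi; exact ⟨σ i, by simpa using hi, by simp⟩
    have low : ∀ {t' : ℝ^n}, (∀ a b : Fin n, a ≤ b → t' b ≤ t' a) → ∀ (c : ℝ) (i : Fin n),
        c ≤ t' i ↔ (i : ℕ) < #{i | c ≤ t' i} := by
      intro t' ht' c i; constructor
      · intro hi; have : Iic i ⊆ univ.filter fun i => c ≤ t' i := by grind
        have := card_le_card this
        simp_all
      · intro hi; by_contra hc
        have : (univ.filter fun i => c ≤ t' i) ⊆ Iio i := by
          intro j hj; simp only [mem_filter_univ] at hj; rw [mem_Iio]; by_contra hij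
          exact hc (hj.trans (ht' i j (not_lt.1 hij)))
        have := card_le_card this; rw [card_Iio] at this; omega
    have hanti' : ∀ a b : Fin n, a ≤ b → t (σ.symm b) ≤ t (σ.symm a) := by grind
    have heq : ∀ i, t (σ.symm i) = t i := by
      intro i; apply le_antisymm
      · rw [low (fun a b hab => ht hab) _ i, ← hsum, ← low hanti' _ i]
      · rw [low hanti' _ i, hsum, ← low (fun a b hab => ht hab) _ i]
    grind
  refine ⟨hσ, fun i hi => ?_⟩; by_contra hne
  have hlt : dotHom t (sact σ s u) < ∑ i, t i * |(u (σ i) : ℝ)| := by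
    rw [dotHom_apply]
    refine sum_lt_sum (fun j _ => mul_le_mul_of_nonneg_left ?_ (h0 j)) ⟨i, mem_univ i, ?_⟩
    · refine (le_abs_self _).trans (le_of_eq ?_); unfold sact; push_cast
      rw [abs_mul, abs_bs, one_mul]
    · have hti : 0 < t i := lt_of_le_of_ne (h0 i) (Ne.symm hne); have hui : 0 < u (σ i) := by grind
      have hui' : (0 : ℝ) < u (σ i) := mod_cast hui; refine mul_lt_mul_of_pos_left ?_ hti
      rw [abs_of_pos hui']; unfold sact; rw [hi]; simp only [bs, if_true]; push_cast; linarith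
  linarith

lemma altY_degLe  {t : ℝ^n} (ht : Antitone t) (h0 : ∀ i, 0 ≤ t i)
    {u : ℚ^n} (hu : Reg ty u) (hpos : ∀ i, t i = 0 ∨ 0 ≤ u i) :
    DegLe (dotHom t) (altY ty n u) (dotHom t u) := by
  intro v hv; obtain ⟨σ, s, rfl⟩ := altY_coeff_ne hv; exact dot_sact_le ht h0 hu hpos σ s

lemma slice_altY_ne  (hty : ty ≠ .C) (t : ℝ^n)
    {u : ℚ^n} (hu : Reg ty u) : slice (dotHom t) (dotHom t u) (altY ty n u) ≠ 0 := by
  intro h; have := slice_coeff (dotHom t) (dotHom t u) (altY ty n u) u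
  rw [h, if_pos rfl, altY_coeff_self hty hu] at this; simp at this

lemma rhoY_nonneg  (hty : ty ≠ .C) (i : Fin n) : 0 ≤ rhoY ty n i := by
  rw [rhoY_apply hty]; have : ((i : ℕ) : ℚ)+1 ≤ n := mod_cast i.2; split_ifs <;> linarith

/-- The degree of a quotient of alternating sums. -/
lemma quot_degLe  (hty : ty ≠ .C) {t : ℝ^n} (ht : Antitone t)
    (h0 : ∀ i, 0 ≤ t i) {lam : ℚ^n} (hu : Reg ty (lam+rhoY ty n))
    (hpos : ∀ i, t i = 0 ∨ 0 ≤ (lam+rhoY ty n) i) {f : CharRing n}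
    (hf : altY ty n (rhoY ty n)*f = altY ty n (lam+rhoY ty n)) :
    DegLe (dotHom t) f (dotHom t lam) := by
  refine DegLe.of_mul (altY_degLe ht h0 (reg_rhoY hty) fun i => Or.inr (rhoY_nonneg hty i))
    (slice_altY_ne hty t (reg_rhoY hty)) ?_
  rw [hf, ← map_add (dotHom t), add_comm (rhoY ty n) lam]; exact altY_degLe ht h0 hu hpos

/-! ### Polynomial functionals -/

/-- Polynomial functions of degree at most `d`. -/
inductive PD : ℕ → (ℚ^n → ℝ) → Prop
  | const (c : ℝ) : PD 0 fun _ => c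
  | add {d : ℕ} {f g : ℚ^n → ℝ} : PD d f → PD d g → PD d fun v => f v+g v
  | mul {d : ℕ} {f : ℚ^n → ℝ} (a : ℚ^n →+ ℝ) (c : ℝ) :
      PD d f → PD (d+1) fun v => (a v+c)*f v

lemma PD.shift {d : ℕ} {f : ℚ^n → ℝ} (h : PD d f) (w : ℚ^n) : PD d fun v => f (v-w) := by
  induction h with
  | const c => exact PD.const c
  | add _ _ h1 h2 => exact PD.add h1 h2
  | mul a c _ h1 =>
    have := PD.mul a (c-a w) h1; grind

lemma PD.smul {d : ℕ} {f : ℚ^n → ℝ} (h : PD d f) (b : ℝ) : PD d fun v => b*f v := by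
  induction h with
  | const c => exact PD.const _
  | add _ _ h1 h2 =>
    have := PD.add h1 h2
    convert this using 2; ring
  | mul a c _ h1 =>
    have := PD.mul a c h1; convert this using 2; ring

lemma PD.mul' {d e : ℕ} {f g : ℚ^n → ℝ} (h : PD d f) (h' : PD e g) : PD (d+e) fun v => f v*g v := by
  induction h with
  | const c => rw [zero_add]; exact h'.smul c
  | add _ _ h1 h2 =>
    have := PD.add h1 h2
    convert this using 2; ring
  | @mul d f a c _ h1 =>
    have := PD.mul a c h1; grind

lemma PD.prod {ι : Type} (s : Finset ι) (d : ι → ℕ) (f : ι → ℚ^n → ℝ)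
    (h : ∀ i ∈ s, PD (d i) (f i)) : PD (∑ i ∈ s, d i) fun v => ∏ i ∈ s, f i v := by
  classical
  induction s using Finset.induction_on with
  | empty => simpa using PD.const 1
  | insert i s hi ih =>
    simp only [prod_insert hi]; rw [sum_insert hi]
    exact (h i (mem_insert_self i s)).mul' (ih fun j hj => h j (mem_insert_of_mem hj))

lemma PD.diff {d : ℕ} {f : ℚ^n → ℝ} (h : PD d f) (β : ℚ^n) :
    (d = 0 → ∀ v, f v-f (v-β) = 0) ∧ ∀ e, d = e+1 → PD e fun v => f v-f (v-β) := by
  induction h with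
  | const c => exact ⟨fun _ v => sub_self _, fun e he => by omega⟩
  | add _ _ h1 h2 =>
    refine ⟨fun hd v => ?_, fun e he => ?_⟩
    · grind
    · have := PD.add (h1.2 e he) (h2.2 e he)
      convert this using 2; ring
  | @mul d f a c hf h1 =>
    refine ⟨fun hd => by omega, fun e he => ?_⟩; have hed : e = d := by omega
    subst hed; have hs := (hf.shift β).smul (a β); rcases e with _ | e
    · grind
    · have := PD.add (PD.mul a c (h1.2 e rfl)) hs; grind

/-- Evaluation of a character against a function on weights. -/
def pair (Q : ℚ^n → ℝ) (g : CharRing n) : ℝ := g.coeff.sum fun v c => (c : ℝ)*Q v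

lemma pair_add (Q : ℚ^n → ℝ) (f g : CharRing n) : pair Q (f+g) = pair Q f+pair Q g := by
  unfold pair; rw [coeff_add]
  exact Finsupp.sum_add_index' (by simp) (by intro a b c; push_cast; ring)

lemma pair_single (Q : ℚ^n → ℝ) (v : ℚ^n) (c : ℤ) : pair Q (single v c) = c*Q v := by
  unfold pair; simp

lemma pair_zero (Q : ℚ^n → ℝ) : pair Q 0 = 0 := by simp [pair]

lemma pair_sum (Q : ℚ^n → ℝ) {ι : Type} (s : Finset ι) (f : ι → CharRing n) :
    pair Q (∑ i ∈ s, f i) = ∑ i ∈ s, pair Q (f i) :=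
  map_sum ({ toFun := pair Q, map_zero' := pair_zero Q, map_add' := pair_add Q } : CharRing n →+ ℝ) f s

lemma pair_diff (Q : ℚ^n → ℝ) (β : ℚ^n) (g : CharRing n) :
    pair Q ((1-mono (-β))*g) = pair (fun v => Q v-Q (v-β)) g := by
  induction g using induction_linear with
  | zero => simp [pair_zero]
  | add f g hf hg => rw [mul_add, pair_add, pair_add, hf, hg]
  | single v c =>
    have : (1-mono (-β))*single v c = (single v c+single (v-β) (-c) : CharRing n) := by
      rw [sub_mul, one_mul, mono, single_mul_single, single_neg, one_mul, sub_eq_add_neg]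
      congr 3; abel
    rw [this, pair_add, pair_single, pair_single, pair_single]; push_cast; ring

lemma pair_prod_const {ι : Type} (s : Finset ι) (β : ι → ℚ^n) (Q : ℚ^n → ℝ)
    (hQ : PD s.card Q) (v w : ℚ^n) :
    pair Q ((∏ x ∈ s, (1-mono (-β x)))*mono v) = pair Q ((∏ x ∈ s, (1-mono (-β x)))*mono w) := by
  classical
  induction s using Finset.induction_on generalizing Q with
  | empty =>
    simp only [prod_empty, one_mul, mono, pair_single]; have h1 := (hQ.diff (v-w)).1 rfl v
    rw [sub_sub_cancel] at h1
    rw [sub_eq_zero.1 h1]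
  | insert x s hx ih =>
    rw [prod_insert hx, mul_assoc, mul_assoc, pair_diff, pair_diff]
    exact ih _ ((hQ.diff (β x)).2 _ (card_insert_of_notMem hx))

/-! ### The dimension of the top slice -/

/-- The factor attached to a pair of coordinates. -/
def qf (t : ℝ^n) (v : ℚ^n) (i j : Fin n) : ℝ :=
  if t i = t j then (if t i = 0 then (v i : ℝ) ^ 2-(v j : ℝ) ^ 2 else (v i : ℝ)-v j) else t i-t j

/-- The product of the positive roots orthogonal to `t`, up to a positive constant. -/
def qprod (ty : CType) (t : ℝ^n) (v : ℚ^n) : ℝ := (∏ i, ∏ j ∈ Ioi i, qf t v i j)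
    * if ty = .B then ∏ i ∈ univ.filter (fun i => t i = 0), (v i : ℝ) else 1

lemma qprod_sact  (hty : ty ≠ .C) {t : ℝ^n} {σ : Perm (Fin n)} {s : Fin n → Bool}
    (hσ : ∀ i, t (σ i) = t i) (hs : ∀ i, s i = true → t i = 0) (hD : ty = .D → sg s = 1)
    (u : ℚ^n) : (cf ty σ s : ℝ)*qprod ty t (sact σ s u) = qprod ty t u := by
  have hsq : ∀ b : Bool, ((bs b : ℤ) : ℝ) ^ 2 = 1 := by intro b; cases b <;> simp [bs]
  have h1 : ∀ i j, qf t (sact σ s u) i j = qf t u (σ i) (σ j) := by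
    intro i j; unfold qf; rw [hσ, hσ]; by_cases hij : t i = t j
    · rw [if_pos hij, if_pos hij]; by_cases h0 : t i = 0
      · rw [if_pos h0, if_pos h0]; simp only [sact]; push_cast; grind
      · rw [if_neg h0, if_neg h0]; have e1 : s i = false := by grind
        have e2 : s j = false := by grind
        simp [sact, e1, e2, bs]
    · simp_all
  have h2 : ∀ i j, qf t u i j = -qf t u j i := by intro i j; unfold qf; grind
  have h3 := Perm.prod_Ioi_comp_eq_sign_mul_prod σ h2
  have hss : (((sign σ : ℤˣ) : ℤ) : ℝ)*(((sign σ : ℤˣ) : ℤ) : ℝ) = 1 := by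
    rcases Int.units_eq_one_or (sign σ) with h | h <;> simp [h]
  unfold qprod; simp only [h1]; rw [h3]; cases ty
  · have h4 : ∏ i ∈ univ.filter (fun i => t i = 0), ((sact σ s u i : ℚ) : ℝ)
        = sg s * ∏ i ∈ univ.filter (fun i => t i = 0), (u i : ℝ) := by
      have e1 : ((sg s : ℤ) : ℝ) = ∏ i ∈ univ.filter (fun i => t i = 0), ((bs (s i) : ℤ) : ℝ) := by
        unfold sg; push_cast; rw [prod_filter]; refine prod_congr rfl fun i _ => ?_
        split_ifs with h
        · rfl
        · have : s i = false := by grind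
          simp [this, bs]
      have e2 : ∏ i ∈ univ.filter (fun i => t i = 0), (u i : ℝ)
          = ∏ i ∈ univ.filter (fun i => t i = 0), (u (σ i) : ℝ) := by
        rw [prod_filter, prod_filter,
          ← Equiv.prod_comp σ (fun i => if t i = 0 then (u i : ℝ) else 1)]
        simp only [hσ]
      rw [e1, e2, ← prod_mul_distrib]; refine prod_congr rfl fun i _ => ?_; simp [sact]
    have hg : ((sg s : ℤ) : ℝ)*sg s = 1 := mod_cast sg_sq s; simp only [if_true, h4, cf]; grind
  · exact absurd rfl hty
  · have hg := hD rfl; rw [cf, if_neg (by simp [hg]), hg]; grind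

lemma PD_qprod (ty : CType) {t : ℝ^n} (h0 : ∀ i, 0 ≤ t i) :
    PD ((posRoots ty n).filter fun x => dotHom t (rt x) = 0).card (qprod ty t) := by
  have hco : ∀ i : Fin n, PD 1 fun v => (v i : ℝ) := by
    intro i
    have := PD.mul ({ toFun := fun v : ℚ^n => ((v i : ℚ) : ℝ), map_zero' := by simp,
                      map_add' := by intro u v; simp } : ℚ^n →+ ℝ) 0 (PD.const 1)
    simpa using this
  have hsub : ∀ {d : ℕ} {f g : ℚ^n → ℝ}, PD d f → PD d g → PD d fun v => f v-g v := by
    intro d f g hf hg; have := PD.add hf (hg.smul (-1)); convert this using 2; ring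
  have hqf : ∀ i j : Fin n, PD ((if t i = t j then 1 else 0)+if t i+t j = 0 then 1 else 0)
      fun v => qf t v i j := by
    intro i j; unfold qf; by_cases hij : t i = t j
    · simp only [if_pos hij]; by_cases hi : t i = 0
      · have : t i+t j = 0 := by rw [← hij, hi]; simp
        simp only [if_pos hi, if_pos this]
        have e : ∀ i : Fin n, PD (1+1) fun v => (v i : ℝ) ^ 2 := by
          intro i; have := (hco i).mul' (hco i); convert this using 2; ring
        exact hsub (e i) (e j)
      · simp_all
    · have : t i+t j ≠ 0 := by grind
      simp only [if_neg hij, if_neg this]; exact PD.const _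
  have hcard : ((posRoots ty n).filter fun x => dotHom t (rt x) = 0).card
      = (∑ i, ∑ j ∈ Ioi i, ((if t i = t j then 1 else 0)+if t i+t j = 0 then 1 else 0))
        + if ty = .B then ∑ i ∈ univ.filter (fun i => t i = 0), 1 else 0 := by
    rw [card_filter, sum_posRoots]; congr 1
    · rw [sum_filter, Fintype.sum_prod_type]; refine sum_congr rfl fun i _ => ?_
      have : Ioi i = univ.filter fun x : Fin n => i < x := by ext; simp
      rw [this, sum_filter]; refine sum_congr rfl fun j _ => ?_; simp only; split_ifs with hij
      all_goals try rfl
      all_goals simp_all [dot_rt_inl, bs, sub_eq_zero]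
    · simp [dot_rt_inr]
  rw [hcard]; unfold qprod; refine PD.mul' ?_ ?_
  · exact PD.prod _ _ _ fun i _ => PD.prod _ _ _ fun j _ => hqf i j
  · split_ifs with h
    · exact PD.prod _ _ _ fun i _ => hco i
    · exact PD.const 1

end TypeBD

section TypeBD
variable {n : ℕ}

lemma slice_add (ℓ : ℚ^n →+ ℝ) (a : ℝ) (f g : CharRing n) :
    slice ℓ a (f+g) = slice ℓ a f+slice ℓ a g := by
  ext v; rw [coeff_add, Finsupp.add_apply]; simp only [slice_coeff, coeff_add, Finsupp.add_apply]
  split_ifs <;> simp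

lemma slice_zero (ℓ : ℚ^n →+ ℝ) (a : ℝ) : slice ℓ a (0 : CharRing n) = 0 := by
  ext v; rw [slice_coeff]; simp

lemma slice_sum (ℓ : ℚ^n →+ ℝ) (a : ℝ) {ι : Type} (s : Finset ι) (f : ι → CharRing n) :
    slice ℓ a (∑ i ∈ s, f i) = ∑ i ∈ s, slice ℓ a (f i) :=
  map_sum ({ toFun := slice ℓ a, map_zero' := slice_zero ℓ a, map_add' := slice_add ℓ a } :
    CharRing n →+ CharRing n) f s

lemma slice_single (ℓ : ℚ^n →+ ℝ) (a : ℝ) (v : ℚ^n) (c : ℤ) : slice ℓ a (single v c : CharRing n)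
      = if ℓ v = a then single v c else 0 := by
  classical
  ext w; rw [slice_coeff]; by_cases h : v = w
  · subst h; split_ifs <;> simp
  · have : (single v c : CharRing n).coeff w = 0 := by
      simp_all
    split_ifs <;> first | rw [this] | rfl
    all_goals simp

open Classical in
/-- The order of the stabiliser of `t` in the Weyl group. -/
def stabCard (ty : CType) (t : ℝ^n) : ℝ := ∑ σ : Perm (Fin n), ∑ s : Fin n → Bool,
    if (∀ i, t (σ i) = t i) ∧ (∀ i, s i = true → t i = 0) ∧ (ty = .D → sg s = 1) then 1 else 0

lemma stabCard_pos (ty : CType) (t : ℝ^n) : 0 < stabCard ty t := by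
  classical
  unfold stabCard
  refine sum_pos' (fun σ _ => sum_nonneg fun s _ => by split_ifs <;> simp) ⟨1, mem_univ _, ?_⟩
  refine sum_pos' (fun s _ => by split_ifs <;> simp) ⟨fun _ => false, mem_univ _, ?_⟩
  rw [if_pos ⟨fun i => rfl, fun i h => by simp at h, fun _ => by simp [sg, bs]⟩]; exact one_pos

lemma pair_slice_altY  (hty : ty ≠ .C) {t : ℝ^n} (ht : Antitone t)
    (h0 : ∀ i, 0 ≤ t i) {u : ℚ^n} (hu : Reg ty u) (hpos : ∀ i, t i = 0 ∨ 0 < u i) :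
    pair (qprod ty t) (slice (dotHom t) (dotHom t u) (altY ty n u)) = stabCard ty t*qprod ty t u := by
  classical
  rw [altY_eq, slice_sum, pair_sum, stabCard, sum_mul]; refine sum_congr rfl fun σ _ => ?_
  rw [slice_sum, pair_sum, sum_mul]; refine sum_congr rfl fun s _ => ?_; rw [slice_single]
  split_ifs with h1 h2 h2
  · rw [pair_single, one_mul, qprod_sact hty h2.1 h2.2.1 h2.2.2]
  · rw [pair_single, zero_mul]; obtain ⟨h3, h4⟩ := of_dot_sact_eq ht h0 hu hpos h1
    have : cf ty σ s = 0 := by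
      by_contra hne; refine h2 ⟨h3, h4, fun hD => ?_⟩; by_contra hg; apply hne
      rw [cf, if_pos ⟨hD, hg⟩]
    rw [this]; simp
  · exfalso; apply h1; rw [dotHom_apply, dotHom_apply, ← Equiv.sum_comp σ (fun i => t i*(u i : ℝ))]
    refine sum_congr rfl fun i _ => ?_; rw [h2.1]; by_cases hti : t i = 0
    · rw [hti]; simp
    · have : s i = false := by grind
      simp [sact, this, bs]
  · rw [pair_zero, zero_mul]

lemma slice_altY_rho  (hty : ty ≠ .C) {t : ℝ^n} (ht : Antitone t) (h0 : ∀ i, 0 ≤ t i) :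
    slice (dotHom t) (dotHom t (rhoY ty n)) (altY ty n (rhoY ty n))
      = (∏ x ∈ (posRoots ty n).filter fun x => dotHom t (rt x) = 0, (1-mono (-rt x)))
        * mono (rhoY ty n) := by
  classical
  have hnn : ∀ x ∈ posRoots ty n, 0 ≤ dotHom t (rt x) := by
    intro x hx; rcases x with ⟨i, j, b⟩ | i
    · have hij : i < j := by unfold posRoots at hx; simp at hx; exact hx
      rw [dot_rt_inl t hij]; have h1 := ht hij.le; have h2 := h0 j
      cases b <;> simp [bs] <;> linarith
    · rw [dot_rt_inr]; exact h0 i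
  have key : ∀ x ∈ posRoots ty n, DegLe (dotHom t) (1-mono (-rt x)) 0 ∧
      slice (dotHom t) 0 (1-mono (-rt x)) = if dotHom t (rt x) = 0 then 1-mono (-rt x) else 1 := by
    intro x hx; have hd := (one_sub_mono_deg t (rt_ne_zero hx)).1
    rw [max_eq_left (by linarith [hnn x hx])] at hd; refine ⟨hd, ?_⟩
    have e1 : (1-mono (-rt x) : CharRing n) = single 0 1+single (-rt x) (-1) := by
      rw [mono, single_neg, sub_eq_add_neg]; rfl
    have e2 : (1 : CharRing n) = single 0 1 := rfl
    rw [e1, slice_add, slice_single, slice_single, map_zero (dotHom t), if_pos rfl, map_neg (dotHom t), e2]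
    by_cases h : dotHom t (rt x) = 0
    · rw [if_pos h, if_pos (by rw [h]; simp)]
    · rw [if_neg h, if_neg (by simpa using h), add_zero]
  have hp := DegLe.prod (ℓ := dotHom t) (posRoots ty n) (fun x => 1-mono (-rt x)) (fun _ => 0)
    fun x hx => (key x hx).1
  rw [sum_const_zero] at hp
  have hm : DegLe (dotHom t) (mono (rhoY ty n)) (dotHom t (rhoY ty n)) := by
    intro v hv; by_cases h : rhoY ty n = v
    · rw [h]
    · exfalso; apply hv; rw [mono, coeff_single, Finsupp.single_eq_of_ne (Ne.symm h)]
  have := slice_mul hp.1 hm; rw [zero_add] at this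
  rw [altY_rho hty, rootProd, this, hp.2, mono, slice_single, if_pos rfl]; congr 1; rw [prod_filter]
  exact prod_congr rfl fun x hx => (key x hx).2

lemma pair_prod_mul {ι : Type} (s : Finset ι) (β : ι → ℚ^n) (Q : ℚ^n → ℝ)
    (hQ : PD s.card Q) (w : ℚ^n) (h : CharRing n) :
    pair Q ((∏ x ∈ s, (1-mono (-β x)))*mono w*h)
      = pair (fun _ => 1) h*pair Q ((∏ x ∈ s, (1-mono (-β x)))*mono w) := by
  induction h using induction_linear with
  | zero => simp [pair_zero]
  | add f g hf hg => rw [mul_add, pair_add, pair_add, hf, hg]; ring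
  | single v c =>
    have e : (single v c : CharRing n) = c • mono v := by rw [mono, smul_single]; simp
    have hs : ∀ (c : ℤ) (g : CharRing n), pair Q (c • g) = c*pair Q g := by
      intro c g
      have := map_zsmul ({ toFun := pair Q, map_zero' := pair_zero Q, map_add' := pair_add Q } :
        CharRing n →+ ℝ) c g
      simpa using this
    rw [pair_single, e, mul_smul_comm, hs, mul_assoc]
    have : (mono w*mono v : CharRing n) = mono (w+v) := by
      rw [mono, mono, single_mul_single, one_mul]; rfl
    rw [this, pair_prod_const s β Q hQ (w+v) w]; simp

/-- The total multiplicity of a top slice, by Weyl's dimension formula for a Levi factor. -/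
lemma face_sum  (hty : ty ≠ .C) {t : ℝ^n} (ht : Antitone t)
    (h0 : ∀ i, 0 ≤ t i) {lam : ℚ^n} (hu : Reg ty (lam+rhoY ty n))
    (hpos : ∀ i, t i = 0 ∨ 0 < (lam+rhoY ty n) i) (hpos' : ∀ i, t i = 0 ∨ 0 < rhoY ty n i)
    {f : CharRing n} (hf : altY ty n (rhoY ty n)*f = altY ty n (lam+rhoY ty n)) :
    pair (fun _ => 1) (slice (dotHom t) (dotHom t lam) f)*qprod ty t (rhoY ty n)
      = qprod ty t (lam+rhoY ty n) := by
  have hd := quot_degLe hty ht h0 hu (fun i => (hpos i).imp_right le_of_lt) hf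
  have h1 := slice_mul (altY_degLe ht h0 (reg_rhoY hty) fun i => Or.inr (rhoY_nonneg hty i)) hd
  rw [hf, ← map_add (dotHom t), add_comm (rhoY ty n) lam] at h1
  have h2 := pair_slice_altY hty ht h0 hu hpos
  have h3 := pair_slice_altY hty ht h0 (reg_rhoY hty) hpos'
  rw [h1, slice_altY_rho hty ht h0, pair_prod_mul _ _ _ (PD_qprod ty h0),
    ← slice_altY_rho hty ht h0, h3] at h2
  have hK := stabCard_pos ty t
  have : stabCard ty t*(pair (fun _ => 1) (slice (dotHom t) (dotHom t lam) f)*qprod ty t (rhoY ty n))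
      = stabCard ty t*qprod ty t (lam+rhoY ty n) := by linarith
  exact mul_left_cancel₀ hK.ne' this

/-- Dominance in types `B` and `D`. -/
structure DomY (ty : CType) (lam : ℚ^n) : Prop where
  le : ∀ i j, i < j → |lam j| ≤ lam i
  nonneg : ty = .B → ∀ i, 0 ≤ lam i

lemma DomY.reg  (hty : ty ≠ .C) {lam : ℚ^n} (h : DomY ty lam) : Reg ty (lam+rhoY ty n) := by
  have hr := reg_rhoY (n := n) hty; refine ⟨fun i j hij => ?_, fun hB i => ?_⟩
  · simp only [Pi.add_apply]; have h1 := h.le i j hij; have h2 := hr.lt i j hij; grind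
  · simp only [Pi.add_apply]; linarith [h.nonneg hB i, hr.pos hB i]

lemma qprod_lt  (hty : ty ≠ .C) {t : ℝ^n} (ht : Antitone t)
    (h0 : ∀ i, 0 ≤ t i) {lam : ℚ^n} (h : DomY ty lam) {z : Fin n} (hz : t z = 0)
    (hz' : lam z ≠ 0) (hD : ty = .D → ∃ z', z' ≠ z ∧ t z' = 0) :
    0 < qprod ty t (rhoY ty n) ∧ qprod ty t (rhoY ty n) < qprod ty t (lam+rhoY ty n) := by
  have hr := reg_rhoY (n := n) hty
  have cR : ∀ {a b : ℚ}, a ≤ b → (a : ℝ) ≤ b := fun h => mod_cast h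
  have cR' : ∀ {a b : ℚ}, a < b → (a : ℝ) < b := fun h => mod_cast h
  have fact : ∀ i j : Fin n, i < j → 0 < qf t (rhoY ty n) i j ∧
      qf t (rhoY ty n) i j ≤ qf t (lam+rhoY ty n) i j ∧
      (t i = 0 → (lam i ≠ 0 ∨ lam j ≠ 0) →  qf t (rhoY ty n) i j < qf t (lam+rhoY ty n) i j) := by
    intro i j hij; have h1 := abs_le.1 (h.le i j hij); have h2 := abs_lt.1 (hr.lt i j hij)
    have a1 := cR h1.1; have a2 := cR h1.2; have b1 := cR' h2.1; have b2 := cR' h2.2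
    push_cast at a1 b1; unfold qf; simp only [Pi.add_apply]; push_cast; by_cases hij' : t i = t j
    · by_cases hi : t i = 0
      · simp only [if_pos hij', if_pos hi]; refine ⟨by nlinarith, by nlinarith, fun _ hne => ?_⟩
        rcases eq_or_lt_of_le a2 with e | e
        · rcases eq_or_lt_of_le a1 with e' | e'
          · exfalso; have : (lam i : ℝ) = 0 := by linarith
            have h' : (lam j : ℝ) = 0 := by linarith
            rcases hne with h | h
            · exact h (mod_cast this)
            · exact h (mod_cast h')
          · nlinarith
        · nlinarith
      · grind
    · have := ht hij.le; grind
  have p1 : ∀ i, 0 < ∏ j ∈ Ioi i, qf t (rhoY ty n) i j := fun i =>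
    prod_pos fun j hj => (fact i j (mem_Ioi.1 hj)).1
  have p2 : ∀ i, ∏ j ∈ Ioi i, qf t (rhoY ty n) i j ≤ ∏ j ∈ Ioi i, qf t (lam+rhoY ty n) i j :=
    fun i => prod_le_prod (fun j hj => (fact i j (mem_Ioi.1 hj)).1.le)
      fun j hj => (fact i j (mem_Ioi.1 hj)).2.1
  have P1 : 0 < ∏ i, ∏ j ∈ Ioi i, qf t (rhoY ty n) i j := prod_pos fun i _ => p1 i
  have P2 : ∏ i, ∏ j ∈ Ioi i, qf t (rhoY ty n) i j ≤ ∏ i, ∏ j ∈ Ioi i, qf t (lam+rhoY ty n) i j :=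
    prod_le_prod (fun i _ => (p1 i).le) fun i _ => p2 i
  unfold qprod; cases ty
  · simp only [if_true]
    have q1 : ∀ i : Fin n, (0 : ℝ) < rhoY CType.B n i := fun i => mod_cast hr.pos rfl i
    have q2 : ∀ i : Fin n, ((rhoY CType.B n i : ℚ) : ℝ) ≤ ((lam+rhoY CType.B n) i : ℚ) := fun i => by
      simp only [Pi.add_apply]; push_cast; have := cR (h.nonneg rfl i); push_cast at this; linarith
    have Q1 : 0 < ∏ i ∈ univ.filter (fun i => t i = 0), ((rhoY CType.B n i : ℚ) : ℝ) :=
      prod_pos fun i _ => q1 i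
    have Q2 : ∏ i ∈ univ.filter (fun i => t i = 0), ((rhoY CType.B n i : ℚ) : ℝ)
        < ∏ i ∈ univ.filter (fun i => t i = 0), (((lam+rhoY CType.B n) i : ℚ) : ℝ) := by
      refine prod_lt_prod (fun i _ => q1 i) (fun i _ => q2 i) ⟨z, by simp [hz], ?_⟩
      simp only [Pi.add_apply]; push_cast
      have : 0 < lam z := lt_of_le_of_ne (h.nonneg rfl z) (Ne.symm hz')
      have := cR' this; push_cast at this; linarith
    exact ⟨mul_pos P1 Q1, mul_lt_mul' P2 Q2 Q1.le (P1.trans_le P2)⟩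
  · exact absurd rfl hty
  · simp only [reduceCtorEq, if_false, mul_one]; refine ⟨P1, ?_⟩; obtain ⟨z', hzz, hz0⟩ := hD rfl
    have : ∃ i j : Fin n, i < j ∧ t i = 0 ∧ (lam i ≠ 0 ∨ lam j ≠ 0) := by
      rcases lt_or_gt_of_ne hzz with h | h
      · grind
      · grind
    obtain ⟨i, j, hij, hti, hl⟩ := this
    refine prod_lt_prod (fun i _ => p1 i) (fun i _ => p2 i) ⟨i, mem_univ i, ?_⟩
    exact prod_lt_prod (fun j hj => (fact i j (mem_Ioi.1 hj)).1)
      (fun j hj => (fact i j (mem_Ioi.1 hj)).2.1)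
      ⟨j, mem_Ioi.2 hij, (fact i j hij).2.2 hti hl⟩

/-- If `lam` is nonzero at a coordinate where `t` vanishes, the top slice has total at least two. -/
lemma two_le_face  (hty : ty ≠ .C) {t : ℝ^n} (ht : Antitone t)
    (h0 : ∀ i, 0 ≤ t i) {lam : ℚ^n} (h : DomY ty lam) {z : Fin n} (hz : t z = 0)
    (hz' : lam z ≠ 0) (hD : ty = .D → ∃ z', z' ≠ z ∧ t z' = 0)
    {f : CharRing n} (hf : altY ty n (rhoY ty n)*f = altY ty n (lam+rhoY ty n)) :
    1 < pair (fun _ => 1) (slice (dotHom t) (dotHom t lam) f) := by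
  have hlast : ∀ i, t i ≠ 0 → i < z := by
    intro i hi; by_contra hle; have := ht (not_lt.1 hle)
    exact hi (le_antisymm (by linarith) (h0 i))
  have hpos' : ∀ i, t i = 0 ∨ 0 < rhoY ty n i := by
    intro i; by_cases hi : t i = 0
    · exact Or.inl hi
    · right; rw [rhoY_apply hty]; have h1 := hlast i hi; have : (i : ℕ)+2 ≤ n := by omega
      have : ((i : ℕ) : ℚ)+2 ≤ n := mod_cast this; split_ifs <;> linarith
  have hpos : ∀ i, t i = 0 ∨ 0 < (lam+rhoY ty n) i := by
    intro i; by_cases hi : t i = 0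
    · exact Or.inl hi
    · right; have h1 := h.le i z (hlast i hi); have h2 := (hpos' i).resolve_left hi
      have := abs_nonneg (lam z); simp only [Pi.add_apply]; linarith
  have h1 := face_sum hty ht h0 (h.reg hty) hpos hpos' hf
  obtain ⟨h2, h3⟩ := qprod_lt hty ht h0 h hz hz' hD; rw [← h1] at h3; by_contra hle; nlinarith

end TypeBD

/-! ### Multiplicity-free characters -/

lemma partLift_sub (d : Fin r → ℕ) (i : Fin r) :
    partLift r d i.castSucc-partLift r d i.succ = d i := by
  unfold partLift
  have : univ.filter (fun j : Fin r => ((i.castSucc : Fin (r+1)) : ℕ) ≤ (j : ℕ))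
      = insert i (univ.filter fun j : Fin r => ((i.succ : Fin (r+1)) : ℕ) ≤ (j : ℕ)) := by
    grind
  simp_all

lemma slWt_sub (d : Fin r → ℕ) (i : Fin r) : slWt r d i.castSucc-slWt r d i.succ = d i := by
  unfold slWt; rw [← partLift_sub d i]; ring

lemma slWt_antitone (d : Fin r → ℕ) : Antitone (slWt r d) := by
  refine Fin.antitone_iff_succ_le.2 fun i => ?_; have := slWt_sub d i; grind

lemma slWt_injective (r : ℕ) : Injective (slWt r) := by
  intro d d' h; funext i; have h1 := slWt_sub d i; rw [h, slWt_sub] at h1; exact_mod_cast h1.symm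

lemma alt_coeff_le {u : ℚ^k} (hu : StrictAnti u) (v : ℚ^k) :
    (alt ℤ u).coeff v ≤ 1 ∧ ((alt ℤ u).coeff v ≠ 0 → ∃ σ : Perm (Fin k), u ∘ σ = v) := by
  rw [alt_coeff]; by_cases h : ∃ σ : Perm (Fin k), u ∘ σ = v
  · refine ⟨?_, fun _ => h⟩; obtain ⟨σ, hσ⟩ := h; rw [sum_eq_single σ]
    · rw [if_pos hσ]; rcases Int.units_eq_one_or (sign σ) with h | h <;> simp [h]
    · intro τ _ hτ; rw [if_neg]; intro h'; apply hτ; ext i; have := congrFun (h'.trans hσ.symm) i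
      rw [hu.injective this]
    · simp
  · simp_all

lemma coeff_le_one {F : CharRing (r+1)} {c : (Fin r → ℕ) →₀ ℕ} (hd : Decomp r F c)
    (hc : ∀ μ, c μ ≤ 1) (v : ℚ^(r+1)) : (F*alt ℤ (rho (r+1))).coeff v ≤ 1 := by
  have hd' : F*alt ℤ (rho (r+1)) = ∑ μ ∈ c.support, (c μ : ℤ) • alt ℤ (slWt r μ+rho (r+1)) := by
    have := hd; unfold Decomp at this; rw [altA_eq_alt, rhoA_eq] at this; rw [this, Finsupp.sum]
    exact sum_congr rfl fun μ _ => by rw [altA_eq_alt]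
  rw [hd', coeff_sum, finsetSum_apply]; simp only [coeff_smul, Finsupp.smul_apply, smul_eq_mul]
  have hsa : ∀ μ : Fin r → ℕ, StrictAnti (slWt r μ+rho (r+1)) := fun μ =>
    strictAnti_add_rho (slWt_antitone μ)
  by_cases h : ∃ μ ∈ c.support, (alt ℤ (slWt r μ+rho (r+1))).coeff v ≠ 0
  · obtain ⟨μ, hμ, hne⟩ := h; obtain ⟨σ, hσ⟩ := (alt_coeff_le (hsa μ) v).2 hne; rw [sum_eq_single μ]
    · have h1 := (alt_coeff_le (hsa μ) v).1; grind
    · intro ν _ hν; by_contra hne'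
      obtain ⟨τ, hτ⟩ := (alt_coeff_le (hsa ν) v).2 (right_ne_zero_of_mul hne'); apply hν
      apply slWt_injective r
      have : slWt r ν+rho (r+1) = slWt r μ+rho (r+1) := by
        refine antitone_perm_eq (hsa ν).antitone (hsa μ).antitone (τ*σ⁻¹) ?_; funext i
        have h1 := congrFun hτ (σ⁻¹ i); have h2 := congrFun hσ (σ⁻¹ i)
        simp_all
      simp_all
    · simp_all
  · push Not at h
    rw [sum_eq_zero]
    all_goals simp_all

/-! ### Restriction of characters -/

section Res
variable {n m : ℕ}

lemma resChar_single (w : Fin n → ℚ^(r+1)) (v : ℚ^n) (c : ℤ) :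
    resChar w (single v c) = single (∑ i, v i • w i) c := by
  unfold resChar; rw [mapDomain_single]

lemma resChar_coeff (w : Fin n → ℚ^(r+1)) (f : CharRing n) (z : ℚ^(r+1)) :
    (resChar w f).coeff z = f.coeff.sum fun v c => if ∑ i, v i • w i = z then c else 0 := by
  classical
  induction f using induction_linear with
  | zero => simp [resChar]
  | add f g hf hg =>
    have : resChar w (f+g) = resChar w f+resChar w g := by unfold resChar; rw [mapDomain_add]
    rw [this, coeff_add, Finsupp.add_apply, hf, hg, coeff_add, Finsupp.sum_add_index']
    all_goals grind
  | single v c =>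
    rw [resChar_single, coeff_single, coeff_single,
      Finsupp.sum_single_index (by simp), Finsupp.single_apply]

lemma dot_resMap (η : ℝ^m) (w : Fin n → ℚ^m) (v : ℚ^n) :
    dotHom η (∑ i, v i • w i) = dotHom (fun i => dotHom η (w i)) v := by
  simp only [dotHom_apply, Finset.sum_apply, Pi.smul_apply, smul_eq_mul]; simp only [sum_mul]
  rw [sum_comm]; refine sum_congr rfl fun i _ => ?_; push_cast; simp only [mul_sum]; grind

lemma resChar_coeff_eq_zero {w : Fin n → ℚ^(r+1)} {η : ℝ^(r+1)}
    {f : CharRing n} {a : ℝ} (hf : DegLe (dotHom fun i => dotHom η (w i)) f a)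
    {z : ℚ^(r+1)} (hz : a < dotHom η z) : (resChar w f).coeff z = 0 := by
  rw [resChar_coeff, Finsupp.sum]; refine sum_eq_zero fun v hv => ?_; rw [if_neg]; rintro rfl
  have := hf v (mem_support_iff.1 hv); rw [dot_resMap] at hz; linarith

lemma dot_rho_sub_pos {η : ℝ^m} (hη : StrictAnti η) {σ : Perm (Fin m)} (hσ : σ ≠ 1) :
    0 < dotHom η (rho m-fun i => rho m (σ i)) := by
  have hc := cone_sub_perm (antitone_rho m) σ
  have := cone_pair_pos hc (fun h => hσ (strictAnti_perm (strictAnti_rho m) σ (by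
    funext i; have := congrFun h i; simp only [Pi.sub_apply, Pi.zero_apply] at this
    simp only [Function.comp_apply]; linarith))) η (fun i j h => hη h)
  rw [dotHom_apply]; grind

/-- The coefficient of `F * alt ρ` only depends on the coefficients of `F` above. -/
lemma coeff_mul_alt_congr {η : ℝ^m} (hη : StrictAnti η) {F G : CharRing m}
    {z : ℚ^m} (h : ∀ z', dotHom η z ≤ dotHom η z' → F.coeff z' = G.coeff z') :
    (F*alt ℤ (rho m)).coeff (z+rho m) = (G*alt ℤ (rho m)).coeff (z+rho m) := by
  rw [coeff_mul_alt, coeff_mul_alt]; refine sum_congr rfl fun σ _ => ?_; rw [h]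
  rw [add_sub_assoc, map_add (dotHom η)]; by_cases hσ : σ = 1
  · subst hσ; simp
  · linarith [dot_rho_sub_pos hη hσ]

lemma coeff_mul_alt_top {η : ℝ^m} (hη : StrictAnti η) {F : CharRing m}
    {z : ℚ^m} (h : ∀ z', dotHom η z < dotHom η z' → F.coeff z' = 0) :
    (F*alt ℤ (rho m)).coeff (z+rho m) = F.coeff z := by
  rw [coeff_mul_alt, sum_eq_single 1]
  · simp
  · intro σ _ hσ; rw [h, mul_zero]; rw [add_sub_assoc, map_add (dotHom η)]
    linarith [dot_rho_sub_pos hη hσ]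
  · simp

/-- The indicator of the first `j` coordinates. -/
def ind (n j : ℕ) : ℝ^n := fun i => if (i : ℕ) < j then 1 else 0

lemma dot_ind (j : ℕ) (v : ℚ^n) : dotHom (ind n j) v = (ps v j : ℝ) := by
  rw [dotHom_apply, ps]; push_cast; rw [sum_filter]; refine sum_congr rfl fun i _ => ?_
  unfold ind; split_ifs <;> simp

lemma antitone_ind (n j : ℕ) : Antitone (ind n j) := by
  intro a b hab; have : (a : ℕ) ≤ b := hab; unfold ind; grind

lemma ind_nonneg (n j : ℕ) (i : Fin n) : 0 ≤ ind n j i := by unfold ind; split_ifs <;> norm_num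

lemma DomY.nonneg_of_lt  {lam : ℚ^n} (h : DomY ty lam) {i : Fin n}
    (hi : (i : ℕ)+1 < n) : 0 ≤ lam i :=
  (abs_nonneg _).trans (h.le i ⟨i+1, hi⟩ (by simp [lt_def]))

lemma ps_le_of_coeff  (hty : ty ≠ .C) {lam : ℚ^n} (h : DomY ty lam)
    {f : CharRing n} (hf : altY ty n (rhoY ty n)*f = altY ty n (lam+rhoY ty n)) {j : ℕ}
    (hj : j < n) {v : ℚ^n} (hv : f.coeff v ≠ 0) : ps v j ≤ ps lam j := by
  have := quot_degLe hty (antitone_ind n j) (ind_nonneg n j) (h.reg hty) (fun i => ?_) hf v hv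
  · rw [dot_ind, dot_ind] at this; exact_mod_cast this
  · by_cases hi : (i : ℕ) < j
    · right; have h1 := h.nonneg_of_lt (i := i) (by omega); have h2 := rhoY_nonneg hty i
      simp only [Pi.add_apply]; linarith
    · left; simp [ind, hi]

/-- A highest weight with multiplicity-free restriction vanishes on the coordinates restricting to
zero. -/
lemma lam_eq_zero (hty : ty ≠ .C) {η : ℝ^(r+1)} (hη : StrictAnti η)
    {w : Fin n → ℚ^(r+1)} (hw : Antitone fun i => dotHom η (w i))
    (hw0 : ∀ i, 0 ≤ dotHom η (w i)) (hw1 : ∀ i j, dotHom η (w i) = dotHom η (w j) → w i = w j)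
    (hw2 : ∀ i, dotHom η (w i) = 0 → w i = 0) {lam : ℚ^n} (h : DomY ty lam)
    {f : CharRing n} (hf : altY ty n (rhoY ty n)*f = altY ty n (lam+rhoY ty n))
    (hmf : ∀ v, (resChar w f*alt ℤ (rho (r+1))).coeff v ≤ 1)
    {z : Fin n} (hz : w z = 0) (hD : ty = .D → ∃ z', z' ≠ z ∧ w z' = 0) : lam z = 0 := by
  by_contra hne; set t : ℝ^n := fun i => dotHom η (w i) with ht
  have htz : t z = 0 := by simp only [ht, hz]; exact map_zero (dotHom η)
  have hface := two_le_face hty hw hw0 h htz hne (fun hh => by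
      obtain ⟨z', h1, h2⟩ := hD hh
      exact ⟨z', h1, by change dotHom η (w z') = 0; rw [h2]; exact map_zero (dotHom η)⟩) hf
  have hdeg : DegLe (dotHom t) f (dotHom t lam) := by
    refine quot_degLe hty hw hw0 (h.reg hty) (fun i => ?_) hf; by_cases hi : t i = 0
    · exact Or.inl hi
    · right
      have hiz : i < z := by
        by_contra hle; have h1 := hw (not_lt.1 hle)
        exact hi (le_antisymm (by simpa [htz] using h1) (hw0 i))
      have h1 := h.nonneg_of_lt (i := i) (by have := z.2; have : (i : ℕ) < z := hiz; omega)
      have h2 := rhoY_nonneg hty i; simp only [Pi.add_apply]; linarith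
  set z0 := ∑ i, lam i • w i with hz0
  have htop := coeff_mul_alt_top hη (F := resChar w f) (z := z0) (fun z' hz' =>
    resChar_coeff_eq_zero hdeg (by rw [← dot_resMap]; exact hz'))
  have hle := hmf (z0+rho (r+1)); rw [htop] at hle
  have hz0' : ∀ v, f.coeff v ≠ 0 → (∑ i, v i • w i = z0 ↔ dotHom t v = dotHom t lam) := by
    intro v hv; constructor
    · intro hh; rw [ht, ← dot_resMap, ← dot_resMap, hh]
    · intro hh; set b : ℚ^n := v-lam with hb
      have hbps : ∀ j, j < n → ps b j ≤ 0 := by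
        intro j hj; have h1 := ps_le_of_coeff hty h hf hj hv; have h2 := ps_add b lam j
        rw [hb, sub_add_cancel] at h2; linarith
      let T : ℕ → ℝ := fun j => if hj : j < n then t ⟨j, hj⟩ else 0
      have hT : ∀ j, T (j+1) ≤ T j := by
        intro j; by_cases h1 : j+1 < n
        · simp only [T, dif_pos h1, dif_pos (show j < n by omega)]; exact hw (by simp [le_def])
        · simp only [T, dif_neg h1]; split_ifs with h2
          · exact hw0 _
          · exact le_rfl
      have hTz : ∀ j, (z : ℕ) ≤ j → T j = 0 := by
        intro j hj; simp only [T]; split_ifs with h2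
        · refine le_antisymm ?_ (hw0 _); have := hw (show z ≤ ⟨j, h2⟩ from hj)
          simpa [htz] using this
        · rfl
      have hs : ∑ i : Fin n, (b i : ℝ)*T i = 0 := by
        have : dotHom t b = 0 := by rw [hb, map_sub (dotHom t), hh, sub_self]
        rw [dotHom_apply] at this; rw [← this]; refine sum_congr rfl fun i _ => ?_
        simp [T, mul_comm]
      rw [sum_mul_eq_abel, hTz n z.2.le, mul_zero, zero_add] at hs
      have hterm : ∀ j ∈ range n, (ps b (j+1) : ℝ)*(T j-T (j+1)) = 0 := by
        have hnp : ∀ j ∈ range n, (ps b (j+1) : ℝ)*(T j-T (j+1)) ≤ 0 := by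
          intro j hj; by_cases h1 : j+1 < n
          · have h2 : (ps b (j+1) : ℝ) ≤ 0 := mod_cast hbps _ h1; have h3 := hT j; nlinarith
          · have hj' := mem_range.1 hj; have := z.2
            rw [hTz j (by omega), hTz (j+1) (by omega)]; simp
        exact (sum_eq_zero_iff_of_nonpos hnp).1 hs
      have : ∑ i, b i • w i = 0 := by
        funext l; let U : ℕ → ℚ := fun j => if hj : j < n then w ⟨j, hj⟩ l else 0
        have hU : ∀ i : Fin n, U i = w i l := fun i => by simp [U]
        have h1 := sum_mul_eq_abel b U; rw [Finset.sum_apply]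
        simp only [Pi.smul_apply, smul_eq_mul, Pi.zero_apply]; simp only [Rat.cast_id, hU] at h1
        rw [h1]; have hUn : U n = 0 := by simp [U]
        rw [hUn, mul_zero, zero_add]; refine sum_eq_zero fun j hj => ?_; have hj' := mem_range.1 hj
        rcases mul_eq_zero.1 (hterm j hj) with h2 | h2
        · have : ps b (j+1) = 0 := mod_cast h2; rw [this, zero_mul]
        · have : U j = U (j+1) := by
            by_cases h1 : j+1 < n
            · simp only [T, dif_pos h1, dif_pos hj'] at h2; simp only [U, dif_pos h1, dif_pos hj']
              rw [hw1 ⟨j, hj'⟩ ⟨j+1, h1⟩ (by simpa [ht] using sub_eq_zero.1 h2)]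
            · have := z.2; have h3 := hTz j (by omega); simp only [T, dif_pos hj'] at h3
              simp only [U, dif_neg h1, dif_pos hj']; rw [hw2 _ h3]; rfl
          rw [this, sub_self, mul_zero]
      have h2 : ∑ i, v i • w i = ∑ i, b i • w i+z0 := by
        rw [hz0, ← sum_add_distrib]; refine sum_congr rfl fun i _ => ?_; rw [← add_smul, hb]; simp
      rw [h2, this, zero_add]
  have hpair : pair (fun _ => 1) (slice (dotHom t) (dotHom t lam) f) = ((resChar w f).coeff z0 : ℝ) := by
    rw [resChar_coeff, Finsupp.sum, pair, Finsupp.sum]; push_cast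
    have hsub : (slice (dotHom t) (dotHom t lam) f).coeff.support ⊆ f.coeff.support := by
      intro v hv; rw [mem_support_iff, slice_coeff] at hv; rw [mem_support_iff]; omega
    rw [sum_subset hsub]
    · refine sum_congr rfl fun v hv => ?_; rw [slice_coeff, mul_one]
      have := hz0' v (mem_support_iff.1 hv); by_cases h1 : dotHom t v = dotHom t lam
      · rw [if_pos h1, if_pos (this.2 h1)]
      · rw [if_neg h1, if_neg (fun h => h1 (this.1 h))]; simp
    · simp
  rw [hpair] at hface; have : (1 : ℤ) < (resChar w f).coeff z0 := mod_cast hface; omega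

end Res

/-! ### Expansion of alternating sums along the last coordinate -/

/-- The vector `u` with the entry `a` exchanged with the last one and removed. -/
def dropAt (u : ℚ^(k+1)) (a : Fin (k+1)) : ℚ^k := fun i => u (swap (last k) a i.castSucc)

/-- The extension of a permutation fixing the last point. -/
def permSnoc (τ : Perm (Fin k)) : Perm (Fin (k+1)) :=
  finSuccEquivLast.symm.permCongr (Equiv.optionCongr τ)

lemma permSnoc_castSucc (τ : Perm (Fin k)) (i : Fin k) :
    permSnoc τ i.castSucc = (τ i).castSucc := by
  simp [permSnoc, Equiv.permCongr_apply]

lemma permSnoc_last (τ : Perm (Fin k)) : permSnoc τ (last k) = last k := by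
  simp [permSnoc, Equiv.permCongr_apply]

lemma sign_permSnoc (τ : Perm (Fin k)) : sign (permSnoc τ) = sign τ := by
  rw [permSnoc, Perm.sign_permCongr, Equiv.optionCongr_sign]

/-- Permutations of `Fin (k + 1)` by the image of the last point. -/
def permLast (k : ℕ) : Fin (k+1) × Perm (Fin k) ≃ Perm (Fin (k+1)) :=
  ((Equiv.prodCongr finSuccEquivLast (Equiv.refl _)).trans Perm.decomposeOption.symm).trans
    finSuccEquivLast.symm.permCongr

lemma permLast_apply (a : Fin (k+1)) (τ : Perm (Fin k)) :
    permLast k (a, τ) = swap (last k) a*permSnoc τ := by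
  ext i
  have h := (finSuccEquivLast (n := k)).symm.injective.map_swap none (finSuccEquivLast a)
    (Equiv.optionCongr τ (finSuccEquivLast i))
  simp only [finSuccEquivLast_symm_none, symm_apply_apply] at h
  simp only [permLast, permSnoc, Equiv.trans_apply, Equiv.prodCongr_apply, Prod.map_apply,
    Equiv.refl_apply, Perm.decomposeOption_symm_apply, Equiv.permCongr_apply, Equiv.symm_symm,
    Perm.mul_apply]
  rw [h]

/-- Append a last coordinate. -/
def sn (v : ℚ^k) (y : ℚ) : ℚ^(k+1) := Fin.snoc (α := fun _ => ℚ) v y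

lemma sn_castSucc (v : ℚ^k) (y : ℚ) (i : Fin k) : sn v y i.castSucc = v i := by simp [sn]

lemma sn_last (v : ℚ^k) (y : ℚ) : sn v y (last k) = y := by simp [sn]

lemma sn_inj {v v' : ℚ^k} {y y' : ℚ} (h : sn v y = sn v' y') : v = v' ∧ y = y' :=
  ⟨funext fun i => by have := congrFun h i.castSucc; rwa [sn_castSucc, sn_castSucc] at this,
    by have := congrFun h (last k); rwa [sn_last, sn_last] at this⟩

lemma alt_sum_last {M : Type} [AddCommGroup M] (u : ℚ^(k+1)) (G : ℚ^(k+1) → M) :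
    ∑ σ : Perm (Fin (k+1)), ((sign σ : ℤˣ) : ℤ) • G (u ∘ σ)
      = ∑ a : Fin (k+1), (if a = last k then 1 else -1 : ℤ) • ∑ τ : Perm (Fin k),
          ((sign τ : ℤˣ) : ℤ) • G (sn (dropAt u a ∘ τ) (u a)) := by
  rw [← (permLast k).sum_comp, Fintype.sum_prod_type]; refine sum_congr rfl fun a _ => ?_
  rw [smul_sum]; refine sum_congr rfl fun τ _ => ?_; rw [permLast_apply, smul_smul]; congr 1
  · rw [Perm.sign_mul, sign_permSnoc]; by_cases h : a = last k
    · simp_all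
    · rw [Perm.sign_swap (Ne.symm h), if_neg h]; simp
  · congr 1; funext i; refine lastCases ?_ (fun i => ?_) i
    · rw [sn_last]; simp [permSnoc_last]
    · rw [sn_castSucc]; simp [permSnoc_castSucc, dropAt]

lemma dropAt_last (u : ℚ^(k+1)) (i : Fin k) : dropAt u (last k) i = u i.castSucc := by simp [dropAt]

lemma rho_castSucc (i : Fin k) : rho (k+1) i.castSucc = rho k i+1 := by grind

lemma rho_last (k : ℕ) : rho (k+1) (last k) = 0 := by simp [rho]

/-- Restriction of a polynomial character to one variable less. -/
lemma restrict_last {h : CharRing (k+1)} {lam : ℚ^(k+1)}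
    (hl : lam (last k) = 0) (hpos : ∀ i : Fin k, 0 ≤ lam i.castSucc)
    (hnn : ∀ v, h.coeff v ≠ 0 → 0 ≤ v (last k))
    (hh : h*alt ℤ (rho (k+1)) = alt ℤ (lam+rho (k+1))) :
    ∃ h' : CharRing k, (∀ v, h'.coeff v = h.coeff (sn v 0)) ∧
      h'*alt ℤ (rho k) = alt ℤ ((fun i : Fin k => lam i.castSucc)+rho k) := by
  have hinj : Injective fun v : ℚ^k => sn v 0 := fun v v' h => (sn_inj h).1
  refine ⟨ofCoeff (h.coeff.comapDomain (fun v => sn v 0) hinj.injOn),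
    fun v => by rw [coeff_ofCoeff]; rfl, ?_⟩
  have hcast : ∀ i : Fin k, i.castSucc ≠ last k := fun i => (castSucc_lt_last i).ne
  have hrpos : ∀ i : Fin k, 0 < rho (k+1) i.castSucc := by simp
  ext v
  have h1 : (h*alt ℤ (rho (k+1))).coeff (sn (v+1) 0)
      = (alt ℤ (lam+rho (k+1))).coeff (sn (v+1) 0) := by rw [hh]
  rw [coeff_mul_alt, alt_coeff] at h1
  have e1 := alt_sum_last (rho (k+1)) fun x => h.coeff (sn (v+1) 0-x)
  have e2 := alt_sum_last (lam+rho (k+1)) fun x => if x = sn (v+1) 0 then (1 : ℤ) else 0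
  rw [sum_eq_single (last k)] at e1 e2
  rotate_left
  · intro a _ ha
    have : ∀ τ : Perm (Fin k), ¬ sn (dropAt (lam+rho (k+1)) a ∘ τ) ((lam+rho (k+1)) a)
        = sn (v+1) 0 := by
      intro τ hτ; have h2 := (sn_inj hτ).2; obtain ⟨i, rfl⟩ := exists_castSucc_eq.2 ha
      have := hrpos i; have := hpos i; simp only [Pi.add_apply] at h2; linarith
    simp only [if_neg (this _), smul_zero, sum_const_zero]
  · simp
  · intro a _ ha
    have : ∀ τ : Perm (Fin k),
        h.coeff (sn (v+1) 0-sn (dropAt (rho (k+1)) a ∘ τ) (rho (k+1) a)) = 0 := by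
      intro τ; by_contra hne; have h2 := hnn _ hne; obtain ⟨i, rfl⟩ := exists_castSucc_eq.2 ha
      have := hrpos i; rw [Pi.sub_apply, sn_last, sn_last] at h2; linarith
    simp only [this]; simp
  · simp
  rw [if_pos rfl, one_smul] at e1 e2; rw [coeff_mul_alt, alt_coeff]; simp only [Int.cast_id] at h1 ⊢
  have l1 : ∑ τ : Perm (Fin k), ((sign τ : ℤˣ) : ℤ) •
      h.coeff (sn (v+1) 0-sn (dropAt (rho (k+1)) (last k) ∘ τ) (rho (k+1) (last k)))
      = ∑ σ : Perm (Fin k), ((sign σ : ℤ) : ℤ) *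
        (ofCoeff (h.coeff.comapDomain (fun v => sn v 0) hinj.injOn)).coeff
          (v-fun i => rho k (σ i)) := by
    refine sum_congr rfl fun τ _ => ?_; rw [coeff_ofCoeff, Finsupp.comapDomain_apply, smul_eq_mul]
    congr 2; funext i; refine lastCases ?_ (fun i => ?_) i
    · simp only [Pi.sub_apply, sn_last, rho_last, sub_zero]
    · simp only [Pi.sub_apply, sn_castSucc, Function.comp_apply, dropAt_last, rho_castSucc,
        Pi.add_apply, Pi.one_apply]
      ring
  have l2 : ∑ τ : Perm (Fin k), ((sign τ : ℤˣ) : ℤ) •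
      (if sn (dropAt (lam+rho (k+1)) (last k) ∘ τ) ((lam+rho (k+1)) (last k))
        = sn (v+1) 0 then (1 : ℤ) else 0)
      = ∑ σ : Perm (Fin k), if ((fun i : Fin k => lam i.castSucc)+rho k) ∘ σ = v
        then ((sign σ : ℤ) : ℤ) else 0 := by
    refine sum_congr rfl fun τ _ => ?_
    have : (sn (dropAt (lam+rho (k+1)) (last k) ∘ τ) ((lam+rho (k+1)) (last k))
        = sn (v+1) 0) ↔ ((fun i : Fin k => lam i.castSucc)+rho k) ∘ τ = v := by
      constructor
      · intro hτ; funext i; have := congrFun (sn_inj hτ).1 i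
        simp only [Function.comp_apply, dropAt_last, Pi.add_apply, rho_castSucc, Pi.one_apply] at this ⊢
        linarith
      · rintro rfl; funext i; refine lastCases ?_ (fun i => ?_) i
        · simp only [sn_last, Pi.add_apply, rho_last, hl, add_zero]
        · simp only [sn_castSucc, Function.comp_apply, dropAt_last, Pi.add_apply, rho_castSucc,
            Pi.one_apply]
          ring
    by_cases hc : ((fun i : Fin k => lam i.castSucc)+rho k) ∘ τ = v
    · rw [if_pos hc, if_pos (this.2 hc)]; simp
    · rw [if_neg hc, if_neg (fun h => hc (this.1 h))]; simp
  rw [← l1, ← l2, ← e1, ← e2]; simp only [smul_eq_mul, mul_ite, mul_one, mul_zero]; exact h1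

/-- Extension by zero. -/
def pad {q j : ℕ} (v : ℚ^q) : ℚ^(q+j) := fun a => if h : (a : ℕ) < q then v ⟨a, h⟩ else 0

lemma pad_succ {q j : ℕ} (v : ℚ^q) : (pad v : Fin (q+(j+1)) → ℚ) = sn (pad (j := j) v) 0 := by
  funext i; refine lastCases (n := q+j) ?_ (fun i => ?_) i
  · rw [sn_last]; simp [pad]
  · rw [sn_castSucc]; simp [pad]

lemma restrict_pad {q : ℕ} (lam : ℚ^q) (hpos : ∀ i, 0 ≤ lam i) : ∀ (j : ℕ)
    (h : CharRing (q+j)), (∀ v, h.coeff v ≠ 0 → ∀ i, 0 ≤ v i) →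
    h*alt ℤ (rho (q+j)) = alt ℤ (pad lam+rho (q+j)) →
    ∃ h' : CharRing q, (∀ v, h'.coeff v = h.coeff (pad v)) ∧
      h'*alt ℤ (rho q) = alt ℤ (lam+rho q) := by
  intro j
  induction j with
  | zero =>
    intro h _ hh
    have hp : ∀ v : ℚ^q, (pad (j := 0) v : ℚ^(q+0)) = v := by intro v; funext a; exact dif_pos a.2
    refine ⟨h, fun v => by rw [hp], ?_⟩; rw [hp] at hh
    exact hh
  | succ j ih =>
    intro h hnn hh
    have hp0 : ∀ i, 0 ≤ (pad (j := j) lam) i := by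
      intro i; unfold pad; split_ifs
      · exact hpos _
      · exact le_rfl
    rw [pad_succ] at hh
    obtain ⟨h1, h2, h3⟩ := restrict_last (k := q+j) (sn_last _ _)
      (fun i => by rw [sn_castSucc]; exact hp0 i) (fun v hv => hnn v hv _) hh
    obtain ⟨h', h4, h5⟩ := ih h1 (fun v hv i => by
      rw [h2] at hv; have := hnn _ hv (Fin.castSucc i)
      rwa [sn_castSucc] at this) (by rw [h3]; congr 2; funext i; rw [sn_castSucc])
    exact ⟨h', fun v => by rw [h4, h2, pad_succ], h5⟩

/-! ### Integrality -/

/-- All coordinates are integers. -/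
def Intg (v : ℚ^k) : Prop := ∀ i, ∃ z : ℤ, v i = z

lemma Intg.add {v w : ℚ^k} (hv : Intg v) (hw : Intg w) : Intg (v+w) := fun i => by
  obtain ⟨a, ha⟩ := hv i; obtain ⟨b, hb⟩ := hw i; exact ⟨a+b, by simp [ha, hb]⟩

lemma Intg.sub {v w : ℚ^k} (hv : Intg v) (hw : Intg w) : Intg (v-w) := fun i => by
  obtain ⟨a, ha⟩ := hv i; obtain ⟨b, hb⟩ := hw i; exact ⟨a-b, by simp [ha, hb]⟩

lemma intg_rho (k : ℕ) : Intg (rho k) := fun i => ⟨(k : ℤ)-1-(i : ℕ), by simp [rho]⟩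

lemma intg_of_alt {u v : ℚ^k} (hu : Intg u) (h : (alt ℤ u).coeff v ≠ 0) : Intg v := by
  rw [alt_coeff] at h; obtain ⟨σ, -, hσ⟩ := exists_ne_zero_of_sum_ne_zero h; by_cases hc : u ∘ σ = v
  · rw [← hc]; exact fun i => hu (σ i)
  · simp_all

lemma intg_of_mul_alt {f : CharRing k} {u : ℚ^k} (hu : Intg u)
    (h : f*alt ℤ (rho k) = alt ℤ u) {v : ℚ^k} (hv : f.coeff v ≠ 0) : Intg v := by
  classical
  set f1 : CharRing k := ofCoeff (f.coeff.filter Intg) with hf1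
  have c1 : ∀ v, f1.coeff v = if Intg v then f.coeff v else 0 := by
    intro v; rw [hf1, coeff_ofCoeff, Finsupp.filter_apply]
  have c2 : ∀ v, (f-f1).coeff v = if Intg v then 0 else f.coeff v := by
    intro v; rw [coeff_sub, Finsupp.sub_apply, c1]; split_ifs <;> simp
  have hz : (f-f1)*alt ℤ (rho k) = 0 := by
    ext x; by_contra hne; have hne' : ((f-f1)*alt ℤ (rho k)).coeff x ≠ 0 := by simpa using hne
    obtain ⟨w, h1, h2⟩ := exists_of_coeff_mul_ne hne'; have hw := intg_of_alt (intg_rho k) h2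
    have hxw : ¬ Intg (x-w) := by
      simp_all
    have hx : ¬ Intg x := fun hx => hxw (hx.sub hw)
    rw [sub_mul, h, coeff_sub, Finsupp.sub_apply] at hne'; by_cases h3 : (alt ℤ u).coeff x = 0
    · rw [h3, zero_sub, neg_ne_zero] at hne'; obtain ⟨w', h4, h5⟩ := exists_of_coeff_mul_ne hne'
      have hw' := intg_of_alt (intg_rho k) h5; rw [c1] at h4; have : Intg (x-w') := by simp_all
      apply hx; have := this.add hw'
      simp_all
    · exact hx (intg_of_alt hu h3)
  have := (mul_eq_zero.1 hz).resolve_right (alt_rho_ne_zero k); grind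

/-! ### Homomorphisms of character rings -/

/-- The homomorphism of character rings induced by a map of weights. -/
def mapHom {a b : ℕ} (φ : ℚ^a →+ ℚ^b) : CharRing a →+* CharRing b := mapDomainRingHom ℤ φ

lemma mapHom_single {a b : ℕ} (φ : ℚ^a →+ ℚ^b) (v : ℚ^a) (c : ℤ) :
    mapHom φ (single v c) = single (φ v) c := by
  simp [mapHom, mapDomainRingHom_apply, mapDomain_single]

lemma mapHom_eq_sum {a b : ℕ} (φ : ℚ^a →+ ℚ^b) (f : CharRing a) :
    mapHom φ f = ∑ v ∈ f.coeff.support, single (φ v) (f.coeff v) := by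
  conv_lhs => rw [← sum_coeff_single f]
  rw [Finsupp.sum, map_sum]; exact sum_congr rfl fun v _ => mapHom_single φ _ _

lemma exists_of_mapHom {a b : ℕ} {φ : ℚ^a →+ ℚ^b} {f : CharRing a} {z : ℚ^b}
    (h : (mapHom φ f).coeff z ≠ 0) : ∃ v, f.coeff v ≠ 0 ∧ φ v = z := by
  rw [mapHom_eq_sum, coeff_sum, finsetSum_apply] at h
  obtain ⟨v, hv, hne⟩ := exists_ne_zero_of_sum_ne_zero h; refine ⟨v, mem_support_iff.1 hv, ?_⟩
  by_contra hc
  simp_all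

section Cmp
variable {n : ℕ}

/-- The sum of coordinates. -/
def deg (n : ℕ) : ℚ^n →+ ℝ := dotHom fun _ => 1

lemma deg_apply (v : ℚ^n) : deg n v = ∑ i, (v i : ℝ) := by simp [deg, dotHom_apply]

lemma DegLe.sum {ℓ : ℚ^n →+ ℝ} {ι : Type} (s : Finset ι) (f : ι → CharRing n) (a : ℝ)
    (h : ∀ i ∈ s, DegLe ℓ (f i) a) : DegLe ℓ (∑ i ∈ s, f i) a := by
  intro v hv; rw [coeff_sum, finsetSum_apply] at hv
  obtain ⟨i, hi, hne⟩ := exists_ne_zero_of_sum_ne_zero hv; exact h i hi v hne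

lemma DegLe.single {ℓ : ℚ^n →+ ℝ} {v : ℚ^n} {c : ℤ} {a : ℝ}
    (h : c ≠ 0 → ℓ v ≤ a) : DegLe ℓ (single v c) a := by
  intro w hw; by_cases hc : v = w
  all_goals simp_all

lemma deg_sact (σ : Perm (Fin n)) (s : Fin n → Bool) (u : ℚ^n) :
    deg n (sact σ s u) = deg n u-2 * ∑ i ∈ univ.filter (fun i => s i = true), (u (σ i) : ℝ) := by
  have : deg n u = ∑ i, (u (σ i) : ℝ) := by rw [deg_apply, Equiv.sum_comp σ fun i => (u i : ℝ)]
  rw [this, deg_apply, sum_filter, mul_sum, ← sum_sub_distrib]; refine sum_congr rfl fun i _ => ?_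
  cases h : s i <;> simp [sact, h, bs]; ring

lemma alt_eq_single (u : ℚ^n) : alt ℤ u = ∑ σ : Perm (Fin n),
    single (u ∘ σ) ((sign σ : ℤˣ) : ℤ) := by
  rfl

lemma sact_false (σ : Perm (Fin n)) (u : ℚ^n) : sact σ (fun _ => false) u = u ∘ σ := by
  funext i; simp [sact, bs]

lemma sg_false : sg (fun _ : Fin n => false) = 1 := by simp [sg, bs]

lemma altD_deg {u : ℚ^n} (hi : Intg u) (hu : StrictAnti u) (h0 : ∀ i, 0 ≤ u i) :
    DegLe (deg n) (altY CType.D n u-alt ℤ u) (deg n u-2) := by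
  classical
  have e : altY CType.D n u-alt ℤ u = ∑ σ : Perm (Fin n), ∑ s ∈ univ.erase (fun _ : Fin n => false),
        single (sact σ s u) (cf CType.D σ s) := by
    rw [altY_eq, alt_eq_single, ← sum_sub_distrib]; refine sum_congr rfl fun σ _ => ?_
    rw [← add_sum_erase _ _ (mem_univ fun _ : Fin n => false), sact_false, cf,
      if_neg (by simp [sg_false]), sg_false, mul_one]
    simp
  rw [e]; refine DegLe.sum _ _ _ fun σ _ => DegLe.sum _ _ _ fun s hs => DegLe.single fun hc => ?_
  have hsg : sg s = 1 := by by_contra h; apply hc; rw [cf, if_pos ⟨rfl, h⟩]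
  have hne : s ≠ fun _ => false := ne_of_mem_erase hs; obtain ⟨i, hsi⟩ : ∃ i, s i = true := by grind
  obtain ⟨j, hji, hsj⟩ : ∃ j, j ≠ i ∧ s j = true := by
    by_contra h; push Not at h
    have : sg s = -1 := by
      unfold sg; rw [prod_eq_single i]
      · simp [bs, hsi]
      all_goals aesop
    omega
  rw [deg_sact]
  have h1 : (1 : ℚ) ≤ u (σ i)+u (σ j) := by
    obtain ⟨a, ha⟩ := hi (σ i); obtain ⟨c, hc⟩ := hi (σ j); have h2 := h0 (σ i); have h3 := h0 (σ j)
    have h4 : u (σ i) ≠ u (σ j) := fun h => hji (σ.injective (hu.injective h)).symm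
    rw [ha, hc] at *; have h2' : 0 ≤ a := mod_cast h2; have h3' : 0 ≤ c := mod_cast h3
    have h4' : a ≠ c := mod_cast h4; have : 1 ≤ a+c := by omega
    exact_mod_cast this
  have h1' : (1 : ℝ) ≤ u (σ i)+u (σ j) := mod_cast h1
  have h2 : ∑ l ∈ ({i, j} : Finset (Fin n)), (u (σ l) : ℝ)
      ≤ ∑ l ∈ univ.filter (fun l => s l = true), (u (σ l) : ℝ) := by
    refine sum_le_sum_of_subset_of_nonneg ?_ fun l _ _ => mod_cast h0 (σ l); grind
  grind

/-- Restriction to the first coordinates. -/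
def takeMap (n b : ℕ) : ℚ^(n+b) →+ ℚ^n where
  toFun v i := v (castAdd b i)
  map_zero' := rfl
  map_add' _ _ := rfl

lemma altB_deg {u : ℚ^(k+1)} (hl : u (last k) = 1/2) (h0 : ∀ i, i ≠ last k → 3/2 ≤ u i) :
    DegLe (deg (k+1)) (altY CType.B (k+1) u-mono (fun _ => -(1/2))
      * mapHom (takeMap (k+1) 1) (alt ℤ (sn (fun i => u i+1/2) 0))) (deg (k+1) u-2) := by
  classical
  have h0' : ∀ i, 0 ≤ u i := by
    intro i; by_cases h : i = last k
    · rw [h, hl]; norm_num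
    · linarith [h0 i h]
  set u' : ℚ^(k+1) := fun i => if i = last k then -(1/2) else u i with hu'
  have e1 : DegLe (deg (k+1)) (altY CType.B (k+1) u-(alt ℤ u-alt ℤ u')) (deg (k+1) u-2) := by
    let fl : Perm (Fin (k+1)) → Fin (k+1) → Bool := fun σ i => decide (σ i = last k)
    have hfl : ∀ σ : Perm (Fin (k+1)), fl σ ∈ univ.erase (fun _ : Fin (k+1) => false) := by
      intro σ; rw [mem_erase]; refine ⟨fun h => ?_, mem_univ _⟩
      have := congrFun h (σ.symm (last k)); simp [fl] at this
    have hsgfl : ∀ σ : Perm (Fin (k+1)), sg (fl σ) = -1 := by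
      intro σ; unfold sg; rw [prod_eq_single (σ.symm (last k))]
      · simp [fl, bs]
      · intro j _ hj; have : ¬ σ j = last k := fun h => hj (by rw [← h]; simp); simp [fl, bs, this]
      · simp
    have hact : ∀ σ : Perm (Fin (k+1)), sact σ (fl σ) u = u' ∘ σ := by
      intro σ; funext i; by_cases h : σ i = last k
      · simp [sact, fl, hu', h, bs, hl]
      · simp [sact, fl, hu', h, bs]
    have e : altY CType.B (k+1) u-(alt ℤ u-alt ℤ u') = ∑ σ : Perm (Fin (k+1)),
        ∑ s ∈ (univ.erase (fun _ : Fin (k+1) => false)).erase (fl σ),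
          single (sact σ s u) (cf CType.B σ s) := by
      rw [altY_eq, alt_eq_single, alt_eq_single, ← sum_sub_distrib, ← sum_sub_distrib]
      refine sum_congr rfl fun σ _ => ?_
      rw [← add_sum_erase _ _ (mem_univ fun _ : Fin (k+1) => false), sact_false, cf,
        if_neg (by simp), sg_false, mul_one, ← add_sum_erase _ _ (hfl σ), hact, cf,
        if_neg (by simp), hsgfl, mul_neg_one, single_neg]
      abel
    rw [e]; refine DegLe.sum _ _ _ fun σ _ => DegLe.sum _ _ _ fun s hs => DegLe.single fun hc => ?_
    rw [mem_erase, mem_erase] at hs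
    obtain ⟨i, hsi, hil⟩ : ∃ i, s i = true ∧ σ i ≠ last k := by
      by_contra h; push Not at h; by_cases hz : s (σ.symm (last k)) = true
      · apply hs.1; funext i; by_cases hi : σ i = last k
        · grind
        · grind
      · grind
    rw [deg_sact]
    have h1 : (u (σ i) : ℝ) ≤ ∑ l ∈ univ.filter (fun l => s l = true), (u (σ l) : ℝ) :=
      single_le_sum (f := fun l => (u (σ l) : ℝ)) (fun l _ => mod_cast h0' (σ l)) (by simp [hsi])
    have h2 : (((3 : ℚ)/2 : ℚ) : ℝ) ≤ u (σ i) := mod_cast h0 _ hil; push_cast at h2; linarith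
  have e2 : DegLe (deg (k+1)) (mono (fun _ => -(1/2))
      * mapHom (takeMap (k+1) 1) (alt ℤ (sn (fun i => u i+1/2) 0))-(alt ℤ u-alt ℤ u'))
      (deg (k+1) u-2) := by
    set U : ℚ^(k+1+1) := sn (fun i => u i+1/2) 0 with hU
    have h1 := alt_sum_last U fun x => (mono (fun _ => -(1/2))
      * mapHom (takeMap (k+1) 1) (mono x) : CharRing (k+1))
    have hm : ∀ x : ℚ^(k+1+1), (mono (fun _ => -(1/2))*mapHom (takeMap (k+1) 1) (mono x)
        : CharRing (k+1)) = mono fun i => x i.castSucc-1/2 := by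
      intro x; unfold mono; rw [mapHom_single, single_mul_single, one_mul]; congr 1; funext i
      simp only [Pi.add_apply, takeMap, AddMonoidHom.coe_mk, ZeroHom.coe_mk]
      have : castAdd 1 i = i.castSucc := rfl; rw [this]; ring
    have hL : mono (fun _ => -(1/2))*mapHom (takeMap (k+1) 1) (alt ℤ U)
        = ∑ σ : Perm (Fin (k+1+1)), ((sign σ : ℤˣ) : ℤ) •
          (mono (fun _ => -(1/2))*mapHom (takeMap (k+1) 1) (mono (U ∘ σ)) : CharRing (k+1)) := by
      rw [alt_eq_single, map_sum, mul_sum]; refine sum_congr rfl fun σ _ => ?_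
      rw [← mul_smul_comm, ← map_zsmul]; congr 2; rw [mono, smul_single]; simp
    rw [hL, h1, sum_univ_castSucc, if_pos rfl, one_smul, sum_univ_castSucc]
    simp only [hm, sn_castSucc]
    have t1 : ∑ τ : Perm (Fin (k+1)), ((sign τ : ℤˣ) : ℤ) •
        (mono fun i => (dropAt U (last (k+1)) ∘ τ) i-1/2 : CharRing (k+1)) = alt ℤ u := by
      rw [alt_eq_single]; refine sum_congr rfl fun τ _ => ?_; rw [mono, smul_single]; congr 1
      · funext i; simp only [Function.comp_apply, dropAt_last, hU, sn_castSucc]; ring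
      · simp
    have t2 : ∑ τ : Perm (Fin (k+1)), ((sign τ : ℤˣ) : ℤ) •
        (mono fun i => (dropAt U (last k).castSucc ∘ τ) i-1/2 : CharRing (k+1)) = alt ℤ u' := by
      rw [alt_eq_single]; refine sum_congr rfl fun τ _ => ?_; rw [mono, smul_single]; congr 1
      · funext i; simp only [Function.comp_apply, dropAt, hu']; by_cases hi : τ i = last k
        · rw [if_pos hi, hi, swap_apply_right, hU, sn_last]; ring
        · rw [if_neg hi, swap_apply_of_ne_of_ne (castSucc_lt_last _).ne
            (fun h => hi (Fin.castSucc_injective _ h)), hU, sn_castSucc]; ring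
      · simp
    rw [t1, t2, if_neg (castSucc_lt_last _).ne, neg_one_smul]
    have hcan : ∀ A B C : CharRing (k+1), A + -C+B-(B-C) = A := by intro A B C; abel
    rw [hcan]; refine DegLe.sum _ _ _ fun a _ => ?_
    rw [if_neg (castSucc_lt_last _).ne, neg_one_smul]
    have hneg : ∀ {g : CharRing (k+1)} {c : ℝ}, DegLe (deg (k+1)) g c → DegLe (deg (k+1)) (-g) c := by
      intro g c hg v hv; apply hg v
      simp_all
    refine hneg (DegLe.sum _ _ _ fun τ _ => ?_); rw [mono, smul_single]
    refine DegLe.single fun _ => ?_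
    have hs : ∑ i : Fin (k+1), dropAt U a.castSucc.castSucc i = ∑ i, (u i+1/2)-(u a.castSucc+1/2) := by
      have e1 : ∑ i : Fin (k+1+1), U (swap (last (k+1)) a.castSucc.castSucc i) = ∑ i, U i :=
        Equiv.sum_comp _ U
      rw [sum_univ_castSucc, sum_univ_castSucc (f := U), swap_apply_left, hU, sn_last,
        sn_castSucc] at e1
      simp only [sn_castSucc] at e1; unfold dropAt; linarith
    have h2 := h0 a.castSucc (castSucc_lt_last _).ne
    have h3 : ∑ i : Fin (k+1), ((dropAt U a.castSucc.castSucc ∘ τ) i-1/2) ≤ ∑ i, u i-2 := by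
      rw [sum_sub_distrib]
      have : ∑ i, (dropAt U a.castSucc.castSucc ∘ τ) i = ∑ i, dropAt U a.castSucc.castSucc i :=
        Equiv.sum_comp τ _
      rw [this, hs, sum_add_distrib]; linarith
    rw [deg_apply, deg_apply]; exact_mod_cast h3
  have := e1.sub e2
  simp_all

/-! ### Sign changes -/

lemma altD_flip {u : ℚ^n} {z : Fin n} (hz : u z = 0) (e : Fin n → Bool) :
    spHom 1 e (altY CType.D n u) = altY CType.D n u := by
  classical
  rw [altY_eq, map_sum]; refine sum_congr rfl fun σ _ => ?_; rw [map_sum]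
  let d : Fin n → Bool := fun i => if sg e = 1 then false else decide (σ i = z)
  have hd : sg e*sg d = 1 := by
    by_cases h : sg e = 1
    · have : d = fun _ => false := by funext i; simp [d, h]
      rw [this, h, sg_false]; rfl
    · have h1 : sg e = -1 := by
        rcases Int.eq_one_or_neg_one_of_mul_eq_one (sg_sq e) with h' | h'
        all_goals omega
      have : sg d = -1 := by
        unfold sg; rw [prod_eq_single (σ.symm z)]
        · simp [d, h, bs]
        · intro j _ hj; have : ¬ σ j = z := fun h => hj (by rw [← h]; simp); simp [d, h, bs, this]
        · simp
      rw [h1, this]; rfl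
  let T : (Fin n → Bool) → (Fin n → Bool) := fun s i => xor (xor (s i) (e i)) (d i)
  have hT : Involutive T := by
    intro s; funext i
    aesop
  have hsg : ∀ s, sg (T s) = sg s := by
    intro s; have : sg (T s) = sg s*sg e*sg d := by rw [← sg_xor, ← sg_xor]
    grind
  rw [← Equiv.sum_comp hT.toPerm (fun s => single (sact σ s u) (cf CType.D σ s))]
  refine sum_congr rfl fun s _ => ?_; rw [spHom_single]
  have hc : cf CType.D σ (T s) = cf CType.D σ s := by unfold cf; rw [hsg]
  have ha : sact 1 e (sact σ s u) = sact σ (T s) u := by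
    funext i; simp only [sact, T, Perm.one_apply, bs_xor]; by_cases h : σ i = z
    · rw [h, hz]; simp
    · have : d i = false := by simp [d, h]
      rw [this]; simp [bs]; split_ifs <;> ring
  rw [ha, ← hc]; rfl

lemma altY_rho_ne_zero  (hty : ty ≠ .C) : altY ty n (rhoY ty n) ≠ 0 := by
  intro h; have := altY_coeff_self hty (reg_rhoY (n := n) hty)
  simp_all

lemma quot_flip  (hty : ty ≠ .C) {lam : ℚ^n}
    (hl : ∀ i : Fin n, (i : ℕ)+1 = n → lam i = 0) {f : CharRing n}
    (hf : altY ty n (rhoY ty n)*f = altY ty n (lam+rhoY ty n)) (e : Fin n → Bool) (v : ℚ^n) :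
    f.coeff (sact 1 e v) = f.coeff v := by
  have key : spHom 1 e f = f := by
    rcases Nat.eq_zero_or_pos n with h0 | hpos
    · subst h0; ext; have := spHom_coeff 1 e f default
      rw [Subsingleton.elim (sact 1 e default) default] at this; convert this
    have h1 := congrArg (spHom 1 e) hf; rw [map_mul] at h1
    have hc : ∃ c : ℤ, c ≠ 0 ∧ spHom 1 e (altY ty n (rhoY ty n)) = c • altY ty n (rhoY ty n) ∧
        spHom 1 e (altY ty n (lam+rhoY ty n)) = c • altY ty n (lam+rhoY ty n) := by
      cases ty
      · refine ⟨_, ?_, spHom_altY 1 e (by simp) _, spHom_altY 1 e (by simp) _⟩; have := sg_sq e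
        aesop
      · exact absurd rfl hty
      · have hr : rhoY CType.D n ⟨n-1, by omega⟩ = 0 := by
          rw [rhoY_apply (by simp)]
          simp_all
        have hr' : (lam+rhoY CType.D n) ⟨n-1, by omega⟩ = 0 := by
          rw [Pi.add_apply, hr, hl _ (by simp; omega), add_zero]
        exact ⟨1, one_ne_zero, by rw [altD_flip hr, one_smul], by rw [altD_flip hr', one_smul]⟩
    obtain ⟨c, hc0, h2, h3⟩ := hc; rw [h2, h3, ← hf, smul_mul_assoc] at h1
    have h4 : (c : CharRing n)*(altY ty n (rhoY ty n)*(spHom 1 e f-f)) = 0 := by grind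
    have h5 : (c : CharRing n) ≠ 0 := by
      intro h; apply hc0
      have := congrArg (fun g : CharRing n => g.coeff 0) (show ((c : CharRing n)) = (0 : CharRing n) from h)
      simp only [intCast_def] at this; simpa using this
    have h6 := (mul_eq_zero.1 ((mul_eq_zero.1 h4).resolve_left h5)).resolve_left (altY_rho_ne_zero hty)
    exact sub_eq_zero.1 h6
  have := spHom_coeff 1 e f v
  rwa [key] at this

end Cmp

lemma mapHom_comp {a b c : ℕ} (φ : ℚ^b →+ ℚ^c) (ψ : ℚ^a →+ ℚ^b)
    (f : CharRing a) : mapHom φ (mapHom ψ f) = mapHom (φ.comp ψ) f := by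
  induction f using induction_linear with
  | zero => simp
  | add f g hf hg => rw [map_add, map_add, map_add, hf, hg]
  | single v c => rw [mapHom_single, mapHom_single, mapHom_single]; rfl

lemma mapHom_coeff_inj {a b : ℕ} {φ : ℚ^a →+ ℚ^b} (hφ : Injective φ)
    (f : CharRing a) (v : ℚ^a) : (mapHom φ f).coeff (φ v) = f.coeff v := by
  classical
  rw [mapHom_eq_sum, coeff_sum, finsetSum_apply]
  simp only [coeff_single, Finsupp.single_apply, hφ.eq_iff]
  simp_all

/-- Extension by zero as a homomorphism. -/
def padMap (q j : ℕ) : ℚ^q →+ ℚ^(q+j) where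
  toFun := pad
  map_zero' := by funext a; simp [pad]
  map_add' u v := by funext a; simp only [pad, Pi.add_apply]; split_ifs <;> simp

lemma pad_castAdd {q j : ℕ} (v : ℚ^q) (i : Fin q) : pad v (castAdd j i) = v i := by simp [pad]

lemma pad_natAdd {q j : ℕ} (v : ℚ^q) (i : Fin j) : pad v (natAdd q i) = 0 := by simp [pad]

lemma padMap_injective (q j : ℕ) : Injective (padMap q j) := by
  intro u v h; funext i; have := congrFun h (castAdd j i); simpa [padMap, pad_castAdd] using this

section Cmp
variable {n b : ℕ}

/-- The index of the `i`-th positive coordinate. -/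
def lo (b : ℕ) (i : Fin n) : Fin (n+b+n) := ⟨i, by omega⟩

lemma lo_eq (i : Fin n) : lo b i = castAdd n (castAdd b i) := rfl

lemma rev_lo (i : Fin n) : rev (lo b i) = natAdd (n+b) (rev i) := by
  apply Fin.ext; simp only [lo, val_rev, val_natAdd]; omega

/-- The restriction of weights from `gl` to the orthogonal algebra. -/
def foldMap (n b : ℕ) : ℚ^(n+b+n) →+ ℚ^n where
  toFun v i := v (lo b i)-v (rev (lo b i))
  map_zero' := by funext i; simp
  map_add' u v := by funext i; simp only [Pi.add_apply]; ring

lemma sum_split {M : Type} [AddCommMonoid M] (g : Fin (n+b+n) → M) :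
    ∑ a, g a = (∑ i, g (lo b i) + ∑ j : Fin b, g (castAdd n (natAdd n j)))
      + ∑ i, g (rev (lo b i)) := by
  rw [sum_univ_add, sum_univ_add]; congr 1; simp only [rev_lo]; rw [← Equiv.sum_comp Fin.revPerm]
  simp

lemma deg_fold_le {v : ℚ^(n+b+n)} (hnn : ∀ a, 0 ≤ v a) :
    deg n (foldMap n b v) ≤ ((∑ a, v a-2 * ∑ i, v (rev (lo b i)) : ℚ) : ℝ) := by
  have h1 := sum_split (b := b) v
  have h2 : 0 ≤ ∑ j : Fin b, v (castAdd n (natAdd n j)) := sum_nonneg fun _ _ => hnn _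
  have h3 : ∑ i, (foldMap n b v) i = ∑ i, v (lo b i) - ∑ i, v (rev (lo b i)) := by
    rw [← sum_sub_distrib]; rfl
  rw [deg_apply]; have : ∑ i, (foldMap n b v) i ≤ ∑ a, v a-2 * ∑ i, v (rev (lo b i)) := by linarith
  exact_mod_cast this

/-- Comparison of an orthogonal character with the restriction of the general linear one. -/
lemma deg_compare (hn : 0 < n) (hty : ty ≠ .C) (hb : b = if ty = .B then 1 else 0)
    {lam : ℚ^n} (hi : Intg lam) (ha : Antitone lam)
    (hl : ∀ i : Fin n, (i : ℕ)+1 = n → lam i = 0) (h0 : ∀ i, 0 ≤ lam i)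
    {h : CharRing (n+b+n)} (hnn : ∀ v, h.coeff v ≠ 0 → ∀ i, 0 ≤ v i)
    (hit : ∀ v, h.coeff v ≠ 0 → Intg v) (hsum : ∀ v, h.coeff v ≠ 0 → ∑ a, v a = ∑ i, lam i)
    (hh : h*alt ℤ (rho (n+b+n)) = alt ℤ (pad (pad lam)+rho (n+b+n)))
    {f : CharRing n} (hf : altY ty n (rhoY ty n)*f = altY ty n (lam+rhoY ty n)) :
    DegLe (deg n) (f-mapHom (foldMap n b) h) (deg n lam-2) := by
  have hdl : deg n lam = ((∑ i, lam i : ℚ) : ℝ) := by rw [deg_apply]; push_cast; rfl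
  obtain ⟨h', hc, hq⟩ := restrict_pad (pad (j := b) lam) (fun i => by
    unfold pad; split_ifs
    · exact h0 _
    · exact le_rfl) n h hnn hh
  set g1 := h-mapHom (padMap (n+b) n) h' with hg1
  have hg1c : ∀ v, g1.coeff v ≠ 0 → h.coeff v ≠ 0 ∧ ∃ i : Fin n, v (natAdd (n+b) i) ≠ 0 := by
    intro v hv; rw [hg1, coeff_sub, Finsupp.sub_apply] at hv
    by_cases hz : ∃ i : Fin n, v (natAdd (n+b) i) ≠ 0
    · refine ⟨fun h1 => ?_, hz⟩; rw [h1, zero_sub, neg_ne_zero] at hv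
      obtain ⟨u, -, rfl⟩ := exists_of_mapHom hv; obtain ⟨i, hi⟩ := hz; exact hi (pad_natAdd u i)
    · exfalso
      push Not at hz
      have : v = padMap (n+b) n (fun i => v (castAdd n i)) := by
        funext a; refine Fin.addCases (fun i => ?_) (fun i => ?_) a
        · exact (pad_castAdd (fun i => v (castAdd n i)) i).symm
        · rw [hz]; exact (pad_natAdd (fun i => v (castAdd n i)) i).symm
      apply hv; rw [this, mapHom_coeff_inj (padMap_injective _ _), hc, sub_eq_zero]; rfl
  have hfp : (foldMap n b).comp (padMap (n+b) n) = takeMap n b := by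
    ext v i
    simp only [AddMonoidHom.comp_apply, foldMap, padMap, takeMap, AddMonoidHom.coe_mk, ZeroHom.coe_mk]
    rw [rev_lo, pad_natAdd, lo_eq, pad_castAdd, sub_zero]
  have hg : mapHom (foldMap n b) h = mapHom (takeMap n b) h'+mapHom (foldMap n b) g1 := by
    rw [← hfp, ← mapHom_comp, ← map_add, hg1, add_sub_cancel]
  have hd1 : DegLe (deg n) (mapHom (foldMap n b) g1) (deg n lam-2) := by
    intro v hv; obtain ⟨u, hu, rfl⟩ := exists_of_mapHom hv; obtain ⟨hu1, i, hui⟩ := hg1c u hu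
    refine (deg_fold_le (hnn u hu1)).trans ?_; rw [hsum u hu1, hdl]
    have h1 : (1 : ℚ) ≤ ∑ i, u (rev (lo b i)) := by
      have h2 : u (natAdd (n+b) i) ≤ ∑ i, u (rev (lo b i)) := by
        have := single_le_sum (f := fun i : Fin n => u (rev (lo b i)))
          (fun j _ => hnn u hu1 _) (mem_univ (rev i))
        simpa [rev_lo] using this
      obtain ⟨z, hz⟩ := hit u hu1 (natAdd (n+b) i); have h3 := hnn u hu1 (natAdd (n+b) i)
      rw [hz] at h2 h3 hui; have h4 : (0 : ℤ) ≤ z := mod_cast h3; have h5 : z ≠ 0 := mod_cast hui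
      have h6 : (1 : ℤ) ≤ z := by omega
      have : (1 : ℚ) ≤ z := mod_cast h6; linarith
    have : (∑ i, lam i-2 * ∑ i, u (rev (lo b i)) : ℚ) ≤ ∑ i, lam i-2 := by linarith
    exact_mod_cast this
  have hd2 : DegLe (deg n) (mapHom (takeMap n b) h') (deg n lam) := by
    intro v hv; obtain ⟨u, hu, rfl⟩ := exists_of_mapHom hv; rw [hc] at hu
    have h1 : takeMap n b u = foldMap n b (pad u) := by rw [← hfp]; rfl
    rw [h1]; refine (deg_fold_le (hnn _ hu)).trans ?_; rw [hsum _ hu, hdl]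
    have : 0 ≤ ∑ i, (pad u : ℚ^(n+b+n)) (rev (lo b i)) := sum_nonneg fun i _ => hnn _ hu _
    have : (∑ i, lam i-2 * ∑ i, (pad u : ℚ^(n+b+n)) (rev (lo b i)) : ℚ) ≤ ∑ i, lam i := by linarith
    exact_mod_cast this
  have halt : ∃ c : CharRing n, DegLe (deg n) (altY ty n (rhoY ty n)-c*mapHom (takeMap n b) (alt ℤ (rho (n+b))))
        (deg n (rhoY ty n)-2) ∧
      DegLe (deg n) (altY ty n (lam+rhoY ty n)
        - c*mapHom (takeMap n b) (alt ℤ (pad lam+rho (n+b)))) (deg n (lam+rhoY ty n)-2) := by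
    cases ty
    · simp only [if_true] at hb; subst hb; obtain _ | k := n
      · omega
      refine ⟨mono fun _ => -(1/2), ?_, ?_⟩
      · have := altB_deg (k := k) (u := rhoY CType.B (k+1)) (by rw [rhoY_apply (by simp)]; simp)
          (fun i hi => by
            rw [rhoY_apply (by simp)]; have : (i : ℕ) < k := Fin.val_lt_last hi
            have : ((i : ℕ) : ℚ)+1 ≤ k := mod_cast this
            push_cast; simp; linarith)
        convert this using 5; funext i; refine lastCases ?_ (fun i => ?_) i
        · rw [sn_last]; simp [rho]
        · rw [sn_castSucc, rhoY_apply (by simp)]; simp [rho]; ring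
      · have := altB_deg (k := k) (u := lam+rhoY CType.B (k+1)) (by
            rw [Pi.add_apply, rhoY_apply (by simp), hl (last k) (by simp)]; simp)
          (fun i hi => by
            rw [Pi.add_apply, rhoY_apply (by simp)]; have h1 : (i : ℕ) < k := Fin.val_lt_last hi
            have h2 : ((i : ℕ) : ℚ)+1 ≤ k := mod_cast h1; have h3 := h0 i
            push_cast; simp; linarith)
        convert this using 5; funext i; refine lastCases (n := k+1) ?_ (fun i => ?_) i
        · rw [sn_last]; simp [rho, pad]
        · have hp : (pad lam : ℚ^(k+1+1)) i.castSucc = lam i := pad_castAdd lam i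
          rw [sn_castSucc, Pi.add_apply, Pi.add_apply, hp, rhoY_apply (by simp)]; simp [rho]; ring
    · exact absurd rfl hty
    · simp only [reduceCtorEq, if_false] at hb; subst hb
      have ht : ∀ g : CharRing n, mapHom (takeMap n 0) g = g := by
        intro g
        induction g using induction_linear with
        | zero => simp
        | add f g hf hg => rw [map_add, hf, hg]
        | single v c => rw [mapHom_single]; rfl
      have hr : rhoY CType.D n = rho n := by funext i; rw [rhoY_apply (by simp)]; simp [rho]
      have hp : (pad lam : ℚ^(n+0)) = lam := by funext a; exact dif_pos a.2
      have hrn : ∀ i, 0 ≤ rho n i := by rw [← hr]; exact rhoY_nonneg (by simp)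
      refine ⟨1, ?_, ?_⟩
      · have := altD_deg (intg_rho n) (strictAnti_rho n) hrn; rw [one_mul, hr]; convert this using 2
        exact ht (alt ℤ (rho n))
      · have := altD_deg (u := lam+rho n) (hi.add (intg_rho n)) (strictAnti_add_rho ha)
          (fun i => add_nonneg (h0 i) (hrn i))
        rw [one_mul, hr]; convert this using 2; rw [hp]; exact ht (alt ℤ (lam+rho n))
  obtain ⟨c, hA1, hA2⟩ := halt
  refine DegLe.of_mul (altY_degLe (fun i j _ => le_rfl) (fun _ => zero_le_one) (reg_rhoY hty)
    fun i => Or.inr (rhoY_nonneg hty i)) (slice_altY_ne hty _ (reg_rhoY hty)) ?_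
  have hdadd : deg n (lam+rhoY ty n) = deg n lam+deg n (rhoY ty n) := map_add _ _ _
  have hrho : DegLe (deg n) (altY ty n (rhoY ty n)) (deg n (rhoY ty n)) :=
    altY_degLe (fun i j _ => le_rfl) (fun _ => zero_le_one) (reg_rhoY hty)
      fun i => Or.inr (rhoY_nonneg hty i)
  have key : altY ty n (rhoY ty n)*(f-mapHom (foldMap n b) h)
      = (altY ty n (lam+rhoY ty n)-c*mapHom (takeMap n b) (alt ℤ (pad lam+rho (n+b))))
        - (altY ty n (rhoY ty n)-c*mapHom (takeMap n b) (alt ℤ (rho (n+b))))*mapHom (takeMap n b) h'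
        - altY ty n (rhoY ty n)*mapHom (foldMap n b) g1 := by
    rw [hg, mul_sub, hf, ← hq, map_mul]; ring
  rw [key]; have e1 := hA1.mul hd2; have e2 := hrho.mul hd1
  refine DegLe.sub (DegLe.sub (hA2.mono ?_) (e1.mono ?_)) (e2.mono ?_)
  · rw [hdadd]; change _ ≤ deg n (rhoY ty n)+_; linarith
  · change _ ≤ deg n (rhoY ty n)+_; linarith
  · change _ ≤ deg n (rhoY ty n)+_; linarith

end Cmp

section Cmp
variable {n b : ℕ}

lemma lo_ne_rev_lo (i j : Fin n) : lo b i ≠ rev (lo b j) := by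
  intro h; have := congrArg Fin.val h; simp only [lo, val_rev] at this; omega

lemma lo_injective : Injective (lo b : Fin n → Fin (n+b+n)) := by
  intro i j h; exact Fin.ext (by simpa [lo] using congrArg Fin.val h)

lemma fold_flip {h : CharRing (n+b+n)}
    (hperm : ∀ (σ : Perm (Fin (n+b+n))) v, h.coeff (v ∘ σ) = h.coeff v)
    (e : Fin n → Bool) (v : ℚ^n) :
    (mapHom (foldMap n b) h).coeff (sact 1 e v) = (mapHom (foldMap n b) h).coeff v := by
  classical
  let p : Fin (n+b+n) → Prop := fun a => ∃ i, (a = lo b i ∨ rev a = lo b i) ∧ e i = true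
  have hp : ∀ a, p (rev a) ↔ p a := by grind
  let τ : Fin (n+b+n) → Fin (n+b+n) := fun a => if p a then rev a else a
  have hτ : Involutive τ := by
    intro a; simp only [τ]; by_cases h : p a
    all_goals simp_all
  have h1 : ∀ x : CharRing (n+b+n), spHom 1 e (mapHom (foldMap n b) x)
      = mapHom (foldMap n b) (permHom ℤ hτ.toPerm x) := by
    intro x
    induction x using induction_linear with
    | zero => simp
    | add f g hf hg => simp only [map_add, hf, hg]
    | single u c =>
      rw [mapHom_single, spHom_single, permHom_single, mapHom_single]; congr 1; funext i
      have hpi : p (lo b i) ↔ e i = true := by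
        constructor
        · rintro ⟨j, hj | hj, hej⟩
          · rw [lo_injective hj]; exact hej
          · exact absurd (by rw [← hj, rev_rev]) (lo_ne_rev_lo (b := b) i j)
        · grind
      have c1 : (hτ.toPerm : Perm _) (lo b i) = if e i = true then rev (lo b i) else lo b i := by
        change τ (lo b i) = _; simp only [τ, hpi]
      have c2 : (hτ.toPerm : Perm _) (rev (lo b i)) = if e i = true then lo b i else rev (lo b i) := by
        change τ (rev (lo b i)) = _; simp only [τ, hp, hpi, rev_rev]
      simp only [sact, foldMap, AddMonoidHom.coe_mk, ZeroHom.coe_mk, Function.comp_apply, c1, c2,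
        Perm.one_apply]
      cases e i <;> simp [bs]
  have h2 : permHom ℤ hτ.toPerm h = h := by
    ext u; have := permHom_coeff hτ.toPerm h (u ∘ hτ.toPerm)
    have hu : (u ∘ hτ.toPerm) ∘ hτ.toPerm = u := by
      funext a; simp only [Function.comp_apply]; congr 1; exact hτ a
    grind
  have := spHom_coeff 1 e (mapHom (foldMap n b) h) v
  rwa [h1, h2] at this

lemma abs_compare (hn : 0 < n) (hty : ty ≠ .C) (hb : b = if ty = .B then 1 else 0)
    {lam : ℚ^n} (hi : Intg lam) (ha : Antitone lam)
    (hl : ∀ i : Fin n, (i : ℕ)+1 = n → lam i = 0) (h0 : ∀ i, 0 ≤ lam i)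
    {h : CharRing (n+b+n)} (hnn : ∀ v, h.coeff v ≠ 0 → ∀ i, 0 ≤ v i)
    (hit : ∀ v, h.coeff v ≠ 0 → Intg v) (hsum : ∀ v, h.coeff v ≠ 0 → ∑ a, v a = ∑ i, lam i)
    (hperm : ∀ (σ : Perm (Fin (n+b+n))) v, h.coeff (v ∘ σ) = h.coeff v)
    (hh : h*alt ℤ (rho (n+b+n)) = alt ℤ (pad (pad lam)+rho (n+b+n)))
    {f : CharRing n} (hf : altY ty n (rhoY ty n)*f = altY ty n (lam+rhoY ty n)) {v : ℚ^n}
    (hv : f.coeff v ≠ (mapHom (foldMap n b) h).coeff v) : ∑ i, |v i| ≤ ∑ i, lam i-2 := by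
  have h1 := deg_compare hn hty hb hi ha hl h0 hnn hit hsum hh hf
  let e : Fin n → Bool := fun i => decide (v i < 0)
  have he : sact 1 e v = fun i => |v i| := by
    funext i; by_cases hvi : v i < 0
    · simp [sact, e, hvi, bs, abs_of_neg hvi]
    · simp [sact, e, hvi, bs, abs_of_nonneg (not_lt.1 hvi)]
  have h2 := h1 (sact 1 e v) (by
    rw [coeff_sub, Finsupp.sub_apply, quot_flip hty hl hf, fold_flip hperm]
    exact sub_ne_zero.2 hv)
  rw [he, deg_apply, deg_apply] at h2; exact_mod_cast h2

lemma sum_tail {T : ℕ → ℝ} (a N : ℕ) : ∑ j ∈ range N, (if a ≤ j then T j-T (j+1) else 0)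
    = if a ≤ N then T a-T N else 0 := by
  induction N with
  | zero =>
    simp_all
  | succ N ih =>
    rw [sum_range_succ, ih]; grind

/-- The restrictions of the two characters agree near the top. -/
lemma res_compare (hn : 0 < n) (hty : ty ≠ .C) (hb : b = if ty = .B then 1 else 0)
    {lam : ℚ^n} (hi : Intg lam) (hdom : DomY ty lam) (h0 : ∀ i, 0 ≤ lam i)
    (hk : k+1 < n) (hlk : ∀ i : Fin n, k < (i : ℕ) → lam i = 0)
    {κ : Type} [Fintype κ] [DecidableEq κ] {P : Rep (n+b+n) κ} (hP : P.IsIrr (pad (pad lam)))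
    {f : CharRing n} (hf : altY ty n (rhoY ty n)*f = altY ty n (lam+rhoY ty n))
    {η : ℝ^(r+1)} {w : Fin n → ℚ^(r+1)} (hw : Antitone fun i => dotHom η (w i))
    (hw0 : ∀ i, 0 ≤ dotHom η (w i)) {z : ℚ^(r+1)}
    (hz : dotHom (fun i => dotHom η (w i)) lam-2*dotHom η (w ⟨k, by omega⟩) < dotHom η z) :
    (resChar w f).coeff z = (resChar w (mapHom (foldMap n b) P.ch)).coeff z := by
  classical
  have ha : Antitone lam := by
    intro i j hij; rcases hij.eq_or_lt with rfl | h
    · exact le_rfl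
    · exact (le_abs_self _).trans (hdom.le i j h)
  have hpadsum : ∑ a, (pad (pad (j := b) lam) : ℚ^(n+b+n)) a = ∑ i, lam i := by
    rw [sum_univ_add, sum_univ_add]; simp [pad_castAdd, pad_natAdd]
  have hwt : ∀ v, P.ch.coeff v ≠ 0 → ∃ a, P.wt a = v := by
    intro v hv; rw [P.ch_coeff] at hv
    simp_all
  have hsum : ∀ v, P.ch.coeff v ≠ 0 → ∑ a, v a = ∑ i, lam i := by
    intro v hv; obtain ⟨a, rfl⟩ := hwt v hv; have := (hP.cone_wt a).2
    simp only [Pi.sub_apply, sum_sub_distrib] at this; linarith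
  have hnn : ∀ v, P.ch.coeff v ≠ 0 → ∀ i, 0 ≤ v i := by
    intro v hv i; let last : Fin (n+b+n) := ⟨n+b+n-1, by omega⟩
    have hv' : P.ch.coeff (v ∘ swap i last) ≠ 0 := by rwa [hP.ch_perm]
    obtain ⟨a, ha⟩ := hwt _ hv'; have hc := hP.cone_wt a; have h1 := hc.1 (n+b+n-1)
    have h2 := ps_succ (pad (pad lam)-P.wt a) last
    have h3 : ps (pad (pad lam)-P.wt a) ((last : ℕ)+1) = 0 := by
      have : (last : ℕ)+1 = n+b+n := by simp only [last]; omega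
      rw [this, ps_top]; exact hc.2
    have h4 : (pad (pad (j := b) lam) : ℚ^(n+b+n)) last = 0 := by
      have : ¬ (last : ℕ) < n+b := by simp only [last]; omega
      exact dif_neg this
    have h5 : P.wt a last = v i := by rw [ha]; simp
    rw [h3, Pi.sub_apply, h4, h5] at h2; change 0 ≤ ps _ (last : ℕ) at h1; linarith
  have hit : ∀ v, P.ch.coeff v ≠ 0 → Intg v := by
    intro v hv; refine intg_of_mul_alt (Intg.add ?_ (intg_rho _)) hP.ch_eq hv; intro a; unfold pad
    split_ifs
    · exact hi _
    · exact ⟨0, by simp⟩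
    · exact ⟨0, by simp⟩
  set g := mapHom (foldMap n b) P.ch with hg
  have hgps : ∀ v, g.coeff v ≠ 0 → ∀ j, j < n → ps v j ≤ ps lam j := by
    intro v hv j hj; obtain ⟨u, hu, rfl⟩ := exists_of_mapHom hv
    have hps : ∀ x : ℚ^(n+b+n), ps x j = ∑ i ∈ univ.filter (fun i : Fin n => (i : ℕ) < j), x (lo b i) := by
      intro x; unfold ps; rw [sum_filter, sum_filter, sum_split]
      have e1 : ∑ l : Fin b, (if ((castAdd n (natAdd n l) : Fin (n+b+n)) : ℕ) < j then
          x (castAdd n (natAdd n l)) else 0) = 0 := by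
        refine sum_eq_zero fun l _ => if_neg ?_; simp only [val_castAdd, val_natAdd]; omega
      have e2 : ∑ i : Fin n, (if ((rev (lo b i) : Fin (n+b+n)) : ℕ) < j then
          x (rev (lo b i)) else 0) = 0 := by
        refine sum_eq_zero fun l _ => if_neg ?_; simp only [val_rev, lo]; omega
      rw [e1, e2, add_zero, add_zero]; rfl
    obtain ⟨a, rfl⟩ := hwt u hu; have h1 := (hP.cone_wt a).1 j; rw [hps] at h1
    simp only [Pi.sub_apply, sum_sub_distrib] at h1
    have h2 : ∑ i ∈ univ.filter (fun i : Fin n => (i : ℕ) < j), (pad (pad (j := b) lam) : ℚ^(n+b+n)) (lo b i)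
        = ps lam j := by
      unfold ps; exact sum_congr rfl fun i _ => by rw [lo_eq, pad_castAdd, pad_castAdd]
    have h3 : ps (foldMap n b (P.wt a)) j
        ≤ ∑ i ∈ univ.filter (fun i : Fin n => (i : ℕ) < j), P.wt a (lo b i) := by
      unfold ps; refine sum_le_sum fun i _ => ?_; have := hnn _ hu (rev (lo b i))
      simp only [foldMap, AddMonoidHom.coe_mk, ZeroHom.coe_mk]; linarith
    linarith
  have hl : ∀ i : Fin n, (i : ℕ)+1 = n → lam i = 0 := fun i hi => hlk i (by omega)
  suffices hs : (resChar w (f-g)).coeff z = 0 by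
    have : resChar w f = resChar w (f-g)+resChar w g := by
      unfold resChar; rw [← mapDomain_add, sub_add_cancel]
    rw [this, coeff_add, Finsupp.add_apply, hs, zero_add]
  rw [resChar_coeff, Finsupp.sum]; refine sum_eq_zero fun v hv => ?_; rw [if_neg]; rintro rfl
  have hne : f.coeff v ≠ g.coeff v := by
    rw [mem_support_iff, coeff_sub, Finsupp.sub_apply] at hv; exact sub_ne_zero.1 hv
  have habs := abs_compare hn hty hb hi ha hl h0 hnn hit hsum hP.ch_perm hP.ch_eq hf hne
  have hps : ∀ j, j < n → ps v j ≤ ps lam j := by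
    intro j hj; by_cases hfv : f.coeff v = 0
    · exact hgps v (fun h => hne (by rw [hfv, h])) j hj
    · exact ps_le_of_coeff hty hdom hf hj hfv
  have hpsa : ∀ j, ps v j ≤ ∑ i, |v i| := by
    intro j; unfold ps; refine (sum_le_sum fun i _ => le_abs_self (v i)).trans ?_
    exact sum_le_sum_of_subset_of_nonneg (filter_subset _ _) fun i _ _ => abs_nonneg _
  have hpsl : ∀ j, k < j → ps lam j = ∑ i, lam i := by
    intro j hj; unfold ps; refine sum_subset (filter_subset _ _) fun i _ hi => hlk i ?_
    simp only [mem_filter, mem_univ, true_and, not_lt] at hi; omega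
  rw [dot_resMap] at hz; set t : ℝ^n := fun i => dotHom η (w i) with ht
  let T : ℕ → ℝ := fun j => if hj : j < n then t ⟨j, hj⟩ else 0
  have hT : ∀ j, T (j+1) ≤ T j := by
    intro j; by_cases h1 : j+1 < n
    · simp only [T, dif_pos h1, dif_pos (show j < n by omega)]; exact hw (by simp [le_def])
    · simp only [T, dif_neg h1]; split_ifs with h2
      · exact hw0 _
      · exact le_rfl
  have hTn : T n = 0 := by simp [T]
  have hsumT : ∀ x : ℚ^n, dotHom t x = ∑ i : Fin n, (x i : ℝ)*T i := by
    intro x; rw [dotHom_apply]; exact sum_congr rfl fun i _ => by simp [T, mul_comm]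
  have hd : dotHom t (v-lam) ≤ -2*T k := by
    rw [hsumT, sum_mul_eq_abel, hTn, mul_zero, zero_add]
    have hk' : -2*T k = ∑ j ∈ range n, -2*(if k ≤ j then T j-T (j+1) else 0) := by
      rw [← mul_sum, sum_tail, if_pos (by omega), hTn, sub_zero]
    rw [hk']; refine sum_le_sum fun j hj => ?_
    have hsub : ps (v-lam) (j+1) = ps v (j+1)-ps lam (j+1) := by
      unfold ps; rw [← sum_sub_distrib]; rfl
    have h3 := hT j; split_ifs with h1
    · have h2 : ps (v-lam) (j+1) ≤ -2 := by rw [hsub, hpsl (j+1) (by omega)]; linarith [hpsa (j+1)]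
      have h2' : (ps (v-lam) (j+1) : ℝ) ≤ -2 := mod_cast h2; nlinarith
    · have h2 : ps (v-lam) (j+1) ≤ 0 := by rw [hsub]; linarith [hps (j+1) (by omega)]
      have h2' : (ps (v-lam) (j+1) : ℝ) ≤ 0 := mod_cast h2; nlinarith
  rw [map_sub (dotHom t)] at hd
  have hTk : T k = dotHom η (w ⟨k, by omega⟩) := by simp only [T, dif_pos (show k < n by omega), ht]
  rw [hTk] at hd; linarith

end Cmp

/-! ### Existence of polynomial representations -/

lemma exists_list_om : ∀ (M : ℕ) (v : Fin N → ℕ), Antitone v → ∑ i, v i ≤ M →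
    ∃ L : List ℕ, (∀ k ∈ L, k ≤ N) ∧ (L.map (om N)).sum = fun i => (v i : ℚ) := by
  intro M
  induction M with
  | zero =>
    intro v _ hM; refine ⟨[], by simp, ?_⟩
    aesop
  | succ M ih =>
    intro v hv hM; by_cases h0 : ∀ i, v i = 0
    · exact ⟨[], by simp, by funext i; simp [h0]⟩
    push Not at h0
    obtain ⟨i0, hi0⟩ := h0; set k := #{i | 0 < v i} with hk
    have hlt : ∀ i : Fin N, 0 < v i ↔ (i : ℕ) < k := by
      intro i; constructor
      · intro hi
        have : Iic i ⊆ univ.filter fun i => 0 < v i := by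
          intro j hj; simp only [mem_filter_univ]; exact hi.trans_le (hv (mem_Iic.1 hj))
        have := card_le_card this
        simp_all
      · intro hi; by_contra hc
        have : (univ.filter fun i => 0 < v i) ⊆ Iio i := by
          intro j hj; simp only [mem_filter_univ] at hj; rw [mem_Iio]; by_contra hij
          exact hc (hj.trans_le (hv (not_lt.1 hij)))
        have := card_le_card this; rw [card_Iio] at this; omega
    obtain ⟨L, hL, hs⟩ := ih (fun i => v i-1) (fun i j hij => Nat.sub_le_sub_right (hv hij) 1) (by
      have : ∑ i, (v i-1) < ∑ i, v i :=
        sum_lt_sum (fun i _ => Nat.sub_le _ _) ⟨i0, mem_univ _, by omega⟩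
      omega)
    refine ⟨k :: L, ?_, ?_⟩
    · intro j hj; rcases List.mem_cons.1 hj with rfl | hj
      · have := card_le_univ (univ.filter fun i => 0 < v i); simpa using this
      · exact hL j hj
    · rw [List.map_cons, List.sum_cons, hs]; funext i; simp only [Pi.add_apply, om]
      by_cases hi : 0 < v i
      · rw [if_pos ((hlt i).1 hi)]; push_cast [Nat.one_le_iff_ne_zero.2 hi.ne']; ring
      · rw [if_neg fun h => hi ((hlt i).2 h)]; have : v i = 0 := by omega
        simp [this]

lemma exists_isIrr {v : ℚ^N} (hv : Antitone v) (hi : Intg v) (h0 : ∀ i, 0 ≤ v i) :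
    ∃ (κ : Type) (_ : Fintype κ) (_ : DecidableEq κ) (P : Rep N κ), P.IsIrr v := by
  choose z hz using hi
  have hz0 : ∀ i, 0 ≤ z i := fun i => by have := h0 i; rw [hz] at this; exact_mod_cast this
  have hc : ∀ i, (((z i).toNat : ℕ) : ℚ) = v i := fun i => by
    rw [hz]; exact_mod_cast Int.toNat_of_nonneg (hz0 i)
  obtain ⟨L, hL, hs⟩ := exists_list_om _ (fun i => (z i).toNat) (fun i j hij => by
    have := hv hij; rw [hz, hz] at this; have : z j ≤ z i := mod_cast this
    exact Int.toNat_le_toNat this) le_rfl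
  obtain ⟨κ, i1, i2, P, hP⟩ := exists_irr L hL; refine ⟨κ, i1, i2, P, ?_⟩; rw [hs] at hP
  simpa only [hc] using hP

/-! ### Enumerations of weights -/

section Enum
variable {r n b : ℕ} {ι : Type} [Fintype ι] [DecidableEq ι]

/-- An enumeration of the weights of a self-dual representation by decreasing values of a
functional, compatible with negation. -/
structure Enum (R : Rep (r+1) ι) (η : ℝ^(r+1)) (e : Fin (n+b+n) ≃ ι) : Prop where
  anti : Antitone fun a => dotHom η (R.wt (e a))
  neg : ∀ a, R.wt (e (rev a)) = -R.wt (e a)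

lemma exists_neg_equiv {R : Rep (r+1) ι} (hneg : ∀ v, R.ch.coeff (-v) = R.ch.coeff v) :
    ∃ π : ι ≃ ι, ∀ a, R.wt (π a) = -R.wt a := by
  classical
  have : ∀ c, Nonempty ({a // -R.wt a = c} ≃ {a // R.wt a = c}) := by
    intro c; refine ⟨Fintype.equivOfCardEq ?_⟩; have h1 := hneg c; rw [R.ch_coeff, R.ch_coeff] at h1
    rw [Fintype.card_subtype, Fintype.card_subtype]
    have h2 : (univ.filter fun a => -R.wt a = c) = univ.filter fun a => R.wt a = -c := by grind
    rw [h2]; exact_mod_cast h1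
  exact ⟨Equiv.ofFiberEquiv fun c => (this c).some, fun a =>
    Equiv.ofFiberEquiv_map (f := fun a => -R.wt a) (g := R.wt) _ a⟩

lemma exists_enum {R : Rep (r+1) ι} (hneg : ∀ v, R.ch.coeff (-v) = R.ch.coeff v)
    (hcard : Fintype.card ι = n+b+n) (η η₂ : ℝ^(r+1))
    (hsep : ∀ a c, dotHom η₂ (R.wt a) = dotHom η₂ (R.wt c) → R.wt a = R.wt c) :
    ∃ e : Fin (n+b+n) ≃ ι, Enum R η e := by
  obtain ⟨π, hπ⟩ := exists_neg_equiv hneg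
  let e₀ : Fin (n+b+n) ≃ ι := (Fintype.equivFinOfCardEq hcard).symm
  let key : Fin (n+b+n) → ℝ ×ₗ ℝ := fun a => toLex (-dotHom η (R.wt (e₀ a)), -dotHom η₂ (R.wt (e₀ a)))
  let σ := Tuple.sort key; have hσ : Monotone (key ∘ σ) := Tuple.monotone_sort key
  let e : Fin (n+b+n) ≃ ι := σ.trans e₀
  let σ' : Perm (Fin (n+b+n)) := (Fin.revPerm.trans e).trans (π.trans e₀.symm)
  have hσ'k : ∀ a, key (σ' a) = toLex (dotHom η (R.wt (e (rev a))), dotHom η₂ (R.wt (e (rev a)))) := by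
    aesop
  have hσ' : Monotone (key ∘ σ') := by
    intro a c hac; have h1 := hσ (Fin.rev_le_rev.2 hac); simp only [Function.comp_apply, hσ'k]
    change toLex (-dotHom η (R.wt (e (rev c))), -dotHom η₂ (R.wt (e (rev c))))
      ≤ toLex (-dotHom η (R.wt (e (rev a))), -dotHom η₂ (R.wt (e (rev a)))) at h1
    rw [Prod.Lex.toLex_le_toLex] at h1 ⊢; grind
  have heq := Tuple.unique_monotone hσ hσ'; refine ⟨e, ⟨fun a c hac => ?_, fun a => ?_⟩⟩
  · have h1 := hσ hac
    change toLex (-dotHom η (R.wt (e a)), -dotHom η₂ (R.wt (e a)))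
      ≤ toLex (-dotHom η (R.wt (e c)), -dotHom η₂ (R.wt (e c))) at h1
    rw [Prod.Lex.toLex_le_toLex] at h1; grind
  · have h1 := congrFun heq a; simp only [Function.comp_apply, hσ'k] at h1
    have h2 : -dotHom η₂ (R.wt (e a)) = dotHom η₂ (R.wt (e (rev a))) :=
      congrArg (fun p : ℝ ×ₗ ℝ => (ofLex p).2) h1
    grind

variable {R : Rep (r+1) ι} {η : ℝ^(r+1)} {e : Fin (n+b+n) ≃ ι}

lemma Enum.anti_lo (h : Enum R η e) : Antitone fun i : Fin n => dotHom η (R.wt (e (lo b i))) :=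
  fun i j hij => h.anti (show lo b i ≤ lo b j from hij)

lemma Enum.nonneg (h : Enum R η e) (i : Fin n) : 0 ≤ dotHom η (R.wt (e (lo b i))) := by
  have h1 := h.anti (show lo b i ≤ rev (lo b i) by simp only [lo, le_def, val_rev]; omega)
  simp only [h.neg, map_neg (dotHom η)] at h1; linarith

lemma Enum.mid (h : Enum R η e) (hb : b ≤ 1) (j : Fin b) :
    R.wt (e (castAdd n (natAdd n j))) = 0 := by
  have hr : rev (castAdd n (natAdd n j)) = castAdd n (natAdd n j) := by grind
  have h1 := h.neg (castAdd n (natAdd n j)); grind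

lemma Enum.pull_ch (h : Enum R η e) (hb : b ≤ 1) {κ : Type} [Fintype κ] [DecidableEq κ]
    (S : Rep (n+b+n) κ) : (R.pull e S).ch
      = resChar (fun i : Fin n => R.wt (e (lo b i))) (mapHom (foldMap n b) S.ch) := by
  unfold Rep.ch; rw [map_sum]
  have hadd : ∀ (s : Finset κ) (g : κ → CharRing n), resChar (fun i : Fin n => R.wt (e (lo b i))) (∑ c ∈ s, g c)
      = ∑ c ∈ s, resChar (fun i : Fin n => R.wt (e (lo b i))) (g c) := by
    intro s g
    exact map_sum ({ toFun := resChar (fun i : Fin n => R.wt (e (lo b i)))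
                     map_zero' := by unfold resChar; simp
                     map_add' := fun x y => by unfold resChar; rw [mapDomain_add] } :
      CharRing n →+ CharRing (r+1)) g s
  rw [hadd]; refine sum_congr rfl fun c _ => ?_; rw [mono, mono, mapHom_single, resChar_single]
  congr 1; change ∑ a, S.wt c a • R.wt (e a) = _; rw [sum_split]
  simp only [h.mid hb, h.neg, smul_zero, sum_const_zero, add_zero]; rw [← sum_add_distrib]
  refine sum_congr rfl fun i _ => ?_
  simp only [foldMap, AddMonoidHom.coe_mk, ZeroHom.coe_mk, sub_smul, smul_neg]; abel

lemma Enum.wtSys (h : Enum R η e) (hb : b = if ty = .B then 1 else 0)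
    {δ : Fin r → ℕ} (hR : R.IsIrr (slWt r δ)) : WtSys ty n r δ fun i => R.wt (e (lo b i)) := by
  unfold WtSys; rw [altA_eq_alt, altA_eq_alt, rhoA_eq, ← hR.ch_eq]; congr 1; unfold Rep.ch
  rw [← e.sum_comp, sum_split]; have hb1 : b ≤ 1 := by grind
  simp only [h.mid hb1, h.neg, sum_add_distrib]
  have : (if ty = .B then mono (0 : ℚ^(r+1)) else 0) = ∑ j : Fin b, mono (0 : ℚ^(r+1)) := by
    simp_all
  rw [this]; abel

lemma Enum.coeff_le_one (h : Enum R η e) (hb : b = if ty = .B then 1 else 0)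
    {δ : Fin r → ℕ} (hR : R.IsIrr (slWt r δ)) {lam : Fin n → ℕ} (hmf : IsMFRes ty n r δ lam)
    {f : CharRing n} (hf : IsCharY ty n lam f) (v : ℚ^(r+1)) :
    (resChar (fun i : Fin n => R.wt (e (lo b i))) f*alt ℤ (rho (r+1))).coeff v ≤ 1 := by
  obtain ⟨c, hc, hle⟩ := hmf _ (h.wtSys hb hR) f hf; exact MF.coeff_le_one hc hle v

lemma dot_root (η : ℝ^m) (i j : Fin m) : dotHom η (eps i-eps j) = η i-η j := by
  have : ∀ i, dotHom η (eps i) = η i := by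
    intro i; rw [dotHom_apply, sum_eq_single i]
    all_goals simp_all
  simp_all

lemma Enum.lt_of_ne_zero (h : Enum R η e) (hη : StrictAnti η) {i j : Fin (r+1)} (hij : i < j)
    {a c : Fin (n+b+n)} (hne : R.E i j (e a) (e c) ≠ 0) : a < c := by
  by_contra hac; have h1 := h.anti (not_lt.1 hac); have h2 := R.wt_eq hne; have h3 := dot_root η i j
  simp only [h2] at h1; rw [add_sub_assoc, map_add (dotHom η), h3] at h1; have := hη hij; linarith

/-- Highest weight vectors near the top of a general linear representation give multiplicities in
the restriction of the orthogonal one. -/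
lemma Enum.finrank_le (h : Enum R η e) (hη : StrictAnti η) (hty : ty ≠ .C)
    (hb : b = if ty = .B then 1 else 0) {lam : ℚ^n} (hi : Intg lam) (hdom : DomY ty lam)
    (h0 : ∀ i, 0 ≤ lam i) (hk : k+1 < n) (hlk : ∀ i : Fin n, k < (i : ℕ) → lam i = 0)
    {f : CharRing n} (hf : altY ty n (rhoY ty n)*f = altY ty n (lam+rhoY ty n))
    (hmf : ∀ v, (resChar (fun i : Fin n => R.wt (e (lo b i))) f*alt ℤ (rho (r+1))).coeff v ≤ 1)
    {κ : Type} [Fintype κ] [DecidableEq κ] {S : Rep (n+b+n) κ} {lam₁ : ℚ^(n+b+n)}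
    (hS : S.IsIrr lam₁) (hi₁ : Intg lam₁) (hanti : Antitone (pad (pad lam)-lam₁))
    (hnn : ∀ a, 0 ≤ (pad (pad lam)-lam₁ : ℚ^(n+b+n)) a) {z : ℚ^(r+1)}
    (hz : dotHom (fun a => dotHom η (R.wt (e a))) lam₁-2*dotHom η (R.wt (e ⟨k, by omega⟩)) < dotHom η z) :
    finrank ℝ ((R.pull e S).Inv z) ≤ 1 := by
  classical
  have hipad : Intg (pad (pad lam) : ℚ^(n+b+n)) := by
    intro a; unfold pad; split_ifs
    · exact hi _
    · exact ⟨0, by simp⟩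
    · exact ⟨0, by simp⟩
  obtain ⟨κ', i1, i2, T, hT⟩ := exists_isIrr hanti (hipad.sub hi₁) hnn
  obtain ⟨κ'', j1, j2, P, Φ, hP, hinj, hcomm, hwt⟩ := Rep.exists_cartan hS hT
  rw [add_sub_cancel] at hP; set z₂ := ∑ a, (pad (pad lam)-lam₁ : ℚ^(n+b+n)) a • R.wt (e a) with hz₂
  have hmem : ∀ x ∈ (R.pull e S).Inv z, Φ x ∈ (R.pull e P).Inv (z+z₂) := by
    intro x hx; rw [Rep.mem_Inv] at hx ⊢; constructor
    · -- split into weight spaces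
      have hdec : x = ∑ c, Pi.single (M := fun _ => ℝ) c (x c) := (univ_sum_single x).symm
      rw [hdec, map_sum]; refine Submodule.sum_mem _ fun c _ => ?_; by_cases hc : x c = 0
      · rw [hc, Pi.single_zero, map_zero]; exact Submodule.zero_mem _
      have hcz : (R.pull e S).wt c = z := by by_contra hne; exact hc (hx.1 c hne)
      have h1 : Pi.single (M := fun _ => ℝ) c (x c) ∈ S.Wt (S.wt c) := by
        rw [Rep.mem_Wt]; intro d hd; rw [Pi.single_eq_of_ne]; rintro rfl; exact hd rfl
      have h2 := hwt _ _ h1; rw [Rep.mem_Wt] at h2 ⊢; intro d hd; apply h2; intro hd'; apply hd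
      rw [← hcz, hz₂]; change ∑ a, P.wt d a • R.wt (e a) = ∑ a, S.wt c a • R.wt (e a)+_
      rw [← sum_add_distrib, hd']; exact sum_congr rfl fun a _ => by rw [← add_smul, Pi.add_apply]
    · intro i j hij
      have hE : (R.pull e P).E i j *ᵥ Φ x = Φ ((R.pull e S).E i j *ᵥ x) := by
        change (∑ a, ∑ c, R.E i j (e a) (e c) • P.E a c) *ᵥ Φ x
          = Φ ((∑ a, ∑ c, R.E i j (e a) (e c) • S.E a c) *ᵥ x)
        simp only [sum_mulVec, map_sum, smul_mulVec, map_smul]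
        refine sum_congr rfl fun a _ => sum_congr rfl fun c _ => ?_
        by_cases hne : R.E i j (e a) (e c) = 0
        · simp_all
        · rw [hcomm a c (h.lt_of_ne_zero hη hij hne)]
      simp_all
  by_contra hgt
  push Not at hgt
  have hle : finrank ℝ ((R.pull e S).Inv z) ≤ finrank ℝ ((R.pull e P).Inv (z+z₂)) := by
    let Ψ : (R.pull e S).Inv z →ₗ[ℝ] (R.pull e P).Inv (z+z₂) := Φ.restrict hmem
    refine LinearMap.finrank_le_finrank_of_injective (f := Ψ) ?_; intro x y hxy; apply Subtype.ext
    exact hinj (congrArg Subtype.val hxy)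
  obtain ⟨x, hx⟩ := Module.finrank_pos_iff_exists_ne_zero.1 (show 0 < finrank ℝ ((R.pull e S).Inv z) by omega)
  have hant : Antitone (z+z₂) := Rep.antitone_of_Inv (hmem x.1 x.2) (fun h0 => hx (Subtype.ext
    (hinj (h0.trans (map_zero Φ).symm))))
  have hfr := (R.pull e P).finrank_Inv hant; have hb1 : b ≤ 1 := by rw [hb]; split_ifs <;> simp
  have hcoef := hmf (z+z₂+rho (r+1))
  rw [coeff_mul_alt_congr hη (G := (R.pull e P).ch), ← hfr] at hcoef
  · omega
  intro z' hz'; rw [h.pull_ch hb1]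
  refine res_compare (by omega) hty hb hi hdom h0 hk hlk hP hf h.anti_lo h.nonneg ?_
  refine lt_of_lt_of_le ?_ hz'
  have e1 : dotHom η z₂ = dotHom (fun a => dotHom η (R.wt (e a))) (pad (pad lam)-lam₁) := by
    rw [hz₂, dot_resMap]
  have e2 : dotHom (fun i => dotHom η (R.wt (e (lo b i)))) lam
      = dotHom (fun a => dotHom η (R.wt (e a))) (pad (pad lam)) := by
    rw [dotHom_apply, dotHom_apply, sum_split]
    have s1 : ∀ i, (pad (pad (j := b) lam) : ℚ^(n+b+n)) (lo b i) = lam i := fun i => by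
      rw [lo_eq, pad_castAdd, pad_castAdd]
    have s2 : ∀ i, (pad (pad (j := b) lam) : ℚ^(n+b+n)) (rev (lo b i)) = 0 := fun i => by
      rw [rev_lo, pad_natAdd]
    have s3 : ∀ j, (pad (pad (j := b) lam) : ℚ^(n+b+n)) (castAdd n (natAdd n j)) = 0 := fun j => by
      rw [pad_castAdd, pad_natAdd]
    simp only [s1, s2, s3]; simp
  rw [map_add (dotHom η), e1, e2, map_sub (dotHom fun a => dotHom η (R.wt (e a)))]
  have e3 : lo b (⟨k, by omega⟩ : Fin n) = ⟨k, by omega⟩ := rfl; rw [e3]; linarith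

end Enum

/-! ### Highest weight vectors near the top of exterior powers -/

namespace Rep
variable {m : ℕ} {κ : Type} [Fintype κ] [DecidableEq κ] (P : Rep m κ)

lemma finrank_Wt (z : ℚ^m) : finrank ℝ (P.Wt z) = #{c | P.wt c = z} :=
  finrank_coord _ _ fun x => by simp [mem_Wt]

lemma card_le_finrank_Inv {η : ℝ^m} (hη : StrictAnti η) {z : ℚ^m}
    (h : ∀ c, dotHom η (P.wt c) ≤ dotHom η z) :
    #{c | P.wt c = z} ≤ finrank ℝ (P.Inv z) := by
  rw [← P.finrank_Wt]; refine Submodule.finrank_mono fun x hx => P.mem_Inv.2 ⟨hx, fun i j hij => ?_⟩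
  funext c; refine P.E_mem_Wt hx i j c fun hc => ?_; have h1 := h c
  rw [hc, add_sub_assoc, map_add (dotHom η), dot_root] at h1; have := hη hij; linarith

lemma card_le_finrank_Inv_add_one {η : ℝ^m} {z : ℚ^m} {c₀ : κ}
    (h : ∀ c, dotHom η (P.wt c₀) ≤ dotHom η (P.wt c) → c = c₀) {i j : Fin m}
    (hz : P.wt c₀ = z+eps i-eps j)
    (hmin : ∀ p q, p < q → η i-η j ≤ η p-η q) :
    #{c | P.wt c = z} ≤ finrank ℝ (P.Inv z)+1 := by
  rw [← P.finrank_Wt]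
  let f : P.Wt z →ₗ[ℝ] ℝ := ((LinearMap.proj c₀).comp (mulVecLin (P.E i j))).comp (P.Wt z).subtype
  have h1 := f.finrank_range_add_finrank_ker
  have h2 : finrank ℝ (LinearMap.range f) ≤ 1 := by
    simpa using Submodule.finrank_le (LinearMap.range f)
  have h3 : finrank ℝ (LinearMap.ker f) ≤ finrank ℝ (P.Inv z) := by
    refine LinearMap.finrank_le_finrank_of_injective
      (f := LinearMap.codRestrict (P.Inv z) ((P.Wt z).subtype.comp (LinearMap.ker f).subtype) ?_) ?_
    · rintro ⟨⟨x, hx⟩, hx0⟩; refine P.mem_Inv.2 ⟨hx, fun p q hpq => ?_⟩; funext c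
      by_cases hc : P.wt c = z+eps p-eps q
      · have hcc : c = c₀ := by
          apply h
          rw [hc, hz, add_sub_assoc, add_sub_assoc, map_add (dotHom η), map_add (dotHom η), dot_root, dot_root]
          linarith [hmin p q hpq]
        subst hcc; have he : (eps p-eps q : ℚ^m) = eps i-eps j := by grind
        have hp : p = i := by
          have := congrFun he p; by_contra hne; simp [Pi.single_apply, hpq.ne, hne] at this
          split_ifs at this <;> norm_num at this
        have hq : q = j := by
          have := congrFun he q; by_contra hne; simp [Pi.single_apply, hpq.ne', hne] at this
          split_ifs at this <;> norm_num at this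
        subst hp; subst hq; exact LinearMap.mem_ker.1 hx0
      · exact P.E_mem_Wt hx p q c hc
    · intro x y hxy; have := congrArg Subtype.val hxy; exact Subtype.ext (Subtype.ext this)
  omega

end Rep

lemma sum_le_level {N K : ℕ} (t : ℝ^N) (c : ℝ) {S : Finset (Fin N)} (hS : S.card = K) :
    ∑ a ∈ S, t a ≤ K*c + ∑ a, max (t a-c) 0 := by
  have h1 : ∑ a ∈ S, (t a-c) ≤ ∑ a, max (t a-c) 0 := (sum_le_sum fun a _ => le_max_left _ _).trans
      (sum_le_sum_of_subset_of_nonneg (subset_univ S) fun a _ _ => le_max_right _ _)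
  rw [sum_sub_distrib, sum_const, hS, nsmul_eq_mul] at h1; linarith

lemma sum_eq_level {N K : ℕ} (t : ℝ^N) (c : ℝ) {S : Finset (Fin N)} (hS : S.card = K) :
    ∑ a ∈ S, t a = K*c + ∑ a, max (t a-c) 0 ↔ (∀ a ∈ S, c ≤ t a) ∧ ∀ a, c < t a → a ∈ S := by
  have h0 : ∑ a ∈ S, t a = K*c + ∑ a ∈ S, (t a-c) := by
    simp_all
  have h1 : ∑ a, max (t a-c) 0 - ∑ a ∈ S, (t a-c)
      = ∑ a, (max (t a-c) 0-if a ∈ S then t a-c else 0) := by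
    simp
  have h2 : ∀ a, 0 ≤ max (t a-c) 0-if a ∈ S then t a-c else 0 := by grind
  rw [h0, add_right_inj, eq_comm, ← sub_eq_zero, h1, sum_eq_zero_iff_of_nonneg fun a _ => h2 a]
  grind

section ExtMF
variable {r n b K : ℕ} {ι : Type} [Fintype ι] [DecidableEq ι] {R : Rep (r+1) ι}

/-- Near its top, the `K`-th exterior power has no repeated highest weights. -/
def ExtMF (R : Rep (r+1) ι) (n b K : ℕ) : Prop :=
  ∀ (η : ℝ^(r+1)) (e : Fin (n+b+n) ≃ ι), StrictAnti η → Enum R η e → ∀ (c : ℝ) z,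
    (∀ a : Fin (n+b+n), (a : ℕ) < K → c ≤ dotHom η (R.wt (e a))) →
    ∑ a ∈ univ.filter (fun a : Fin (n+b+n) => (a : ℕ) < K), dotHom η (R.wt (e a))-2*c
      < dotHom η z → finrank ℝ ((R.pull e (ext (n+b+n) K)).Inv z) ≤ 1

lemma pull_ext_wt (e : Fin N ≃ ι) (S : {S : Finset (Fin N) // S.card = K}) :
    (R.pull e (ext N K)).wt S = ∑ a ∈ S.1, R.wt (e a) := by
  change ∑ a, (if a ∈ S.1 then (1 : ℚ) else 0) • R.wt (e a) = _; simp

lemma card_first (hK : K ≤ N) : #{a : Fin N | (a : ℕ) < K} = K := by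
  rw [Fin.card_filter_val_lt, min_eq_right hK]

/-- The number of weights above, or not below, a given weight. -/
def nGt (R : Rep (r+1) ι) (η : ℝ^(r+1)) (c : ℝ) : ℕ := #{a | c < dotHom η (R.wt a)}

def nGe (R : Rep (r+1) ι) (η : ℝ^(r+1)) (c : ℝ) : ℕ := #{a | c ≤ dotHom η (R.wt a)}

lemma Enum.lt_iff {η : ℝ^(r+1)} {e : Fin (n+b+n) ≃ ι} (h : Enum R η e)
    (p : ℝ → Prop) (hp : ∀ x y, x ≤ y → p x → p y) [DecidablePred p] (a : Fin (n+b+n)) :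
    (a : ℕ) < #{a | p (dotHom η (R.wt a))} ↔ p (dotHom η (R.wt (e a))) := by
  have hc : #{a | p (dotHom η (R.wt a))} = #{a | p (dotHom η (R.wt (e a)))} := by
    refine (card_bij (fun a _ => e a) ?_ ?_ ?_).symm
    · simp
    · simp
    · intro a ha; exact ⟨e.symm a, by simpa using ha, by simp⟩
  rw [hc]; constructor
  · intro ha; by_contra hn
    have : (univ.filter fun a => p (dotHom η (R.wt (e a)))) ⊆ Iio a := by
      intro c hc; rw [mem_Iio]; by_contra hac
      exact hn (hp _ _ (h.anti (not_lt.1 hac)) (mem_filter.1 hc).2)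
    have := card_le_card this; rw [card_Iio] at this; omega
  · intro ha
    have : Iic a ⊆ (univ.filter fun a => p (dotHom η (R.wt (e a)))) := by
      intro c hc; exact mem_filter.2 ⟨mem_univ _, hp _ _ (h.anti (mem_Iic.1 hc)) ha⟩
    have := card_le_card this
    simp_all

lemma Enum.lt_nGe {η : ℝ^(r+1)} {e : Fin (n+b+n) ≃ ι} (h : Enum R η e) (c : ℝ)
    (a : Fin (n+b+n)) : (a : ℕ) < nGe R η c ↔ c ≤ dotHom η (R.wt (e a)) :=
  h.lt_iff (fun x => c ≤ x) (fun x y hxy hx => hx.trans hxy) a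

lemma Enum.lt_nGt {η : ℝ^(r+1)} {e : Fin (n+b+n) ≃ ι} (h : Enum R η e) (c : ℝ)
    (a : Fin (n+b+n)) : (a : ℕ) < nGt R η c ↔ c < dotHom η (R.wt (e a)) :=
  h.lt_iff (fun x => c < x) (fun x y hxy hx => hx.trans_le hxy) a

lemma Enum.sum_first {η : ℝ^(r+1)} {e : Fin (n+b+n) ≃ ι} (h : Enum R η e)
    (hKN : K ≤ n+b+n) {c : ℝ} (h1 : nGt R η c ≤ K) (h2 : K ≤ nGe R η c) :
    ∑ a ∈ univ.filter (fun a : Fin (n+b+n) => (a : ℕ) < K), dotHom η (R.wt (e a))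
      = K*c + ∑ a, max (dotHom η (R.wt (e a))-c) 0 := by
  refine (sum_eq_level _ c (card_first hKN)).2 ⟨fun a ha => ?_, fun a ha => ?_⟩
  · exact (h.lt_nGe c a).1 ((mem_filter.1 ha).2.trans_le h2)
  · exact mem_filter.2 ⟨mem_univ _, ((h.lt_nGt c a).2 ha).trans_le h1⟩

/-- A cut strictly inside the level of a repeated weight is impossible. -/
lemma ExtMF.cut (hE : ExtMF R n b K) (hKN : K ≤ n+b+n) {η : ℝ^(r+1)} (hη : StrictAnti η)
    {e : Fin (n+b+n) ≃ ι} (h : Enum R η e) {μ : ℚ^(r+1)} (hμ : 2 ≤ R.ch.coeff μ)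
    (hpos : 0 < dotHom η μ) (h1 : nGt R η (dotHom η μ) < K) : nGe R η (dotHom η μ) ≤ K := by
  classical
  by_contra h2
  push Not at h2
  set c := dotHom η μ with hc; rw [R.ch_coeff] at hμ
  obtain ⟨a', ha', a'', ha'', hne⟩ := one_lt_card.1 (show 1 < #{a | R.wt a = μ} by
    exact_mod_cast hμ)
  obtain ⟨a, rfl⟩ := e.surjective a'; obtain ⟨d, rfl⟩ := e.surjective a''
  have hne : a ≠ d := fun h => hne (by rw [h]); have hwa : R.wt (e a) = μ := by simpa using ha'
  have hwd : R.wt (e d) = μ := by simpa using ha''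
  have cgt : #{x | c < dotHom η (R.wt (e x))} = nGt R η c := by
    refine card_bij (fun x _ => e x) (fun x hx => by simpa using hx)
      (fun x _ y _ hxy => e.injective hxy) fun y hy => ⟨e.symm y, by simpa using hy, by simp⟩
  have cge : #{x | c ≤ dotHom η (R.wt (e x))} = nGe R η c := by
    refine card_bij (fun x _ => e x) (fun x hx => by simpa using hx)
      (fun x _ y _ hxy => e.injective hxy) fun y hy => ⟨e.symm y, by simpa using hy, by simp⟩
  obtain ⟨S, hS1, hS2, hScard⟩ := exists_subsuperset_card_eq
    (s := insert a (univ.filter fun x => c < dotHom η (R.wt (e x))))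
    (t := (univ.filter fun x => c ≤ dotHom η (R.wt (e x))).erase d) (n := K) (by
      intro x hx; rcases mem_insert.1 hx with rfl | hx
      · simp [hne, hwa, hc]
      · have := (mem_filter.1 hx).2; refine mem_erase.2 ⟨?_, by simpa using this.le⟩; rintro rfl
        rw [hwd] at this
        exact lt_irrefl _ this) (by
      refine (card_insert_le _ _).trans ?_
      omega) (by
      grind)
  have haS : a ∈ S := hS1 (mem_insert_self _ _)
  have hdS : d ∉ S := fun h => (mem_erase.1 (hS2 h)).1 rfl
  have hS'card : (insert d (S.erase a)).card = K := by grind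
  set z := ∑ x ∈ S, R.wt (e x) with hz
  have htop : dotHom η z = K*c + ∑ a, max (dotHom η (R.wt (e a))-c) 0 := by
    rw [hz, map_sum (dotHom η)]; refine (sum_eq_level _ c hScard).2 ⟨fun x hx => ?_, fun x hx => ?_⟩
    all_goals grind
  have hle := hE η e hη h c z (fun x hx => (h.lt_nGe c x).1 (hx.trans h2)) (by
    rw [h.sum_first hKN h1.le h2.le, htop]; linarith)
  have hge := (R.pull e (ext (n+b+n) K)).card_le_finrank_Inv hη (z := z) (fun T => by
    rw [pull_ext_wt, map_sum (dotHom η), htop]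
    exact sum_le_level _ c T.2)
  have : 1 < #{T | (R.pull e (ext (n+b+n) K)).wt T = z} := by
    refine one_lt_card.2 ⟨⟨S, hScard⟩, by simp [pull_ext_wt, hz], ⟨_, hS'card⟩, ?_, ?_⟩
    · simp only [mem_filter, mem_univ, true_and, pull_ext_wt]
      rw [sum_insert (fun h => hdS (mem_of_mem_erase h)), hwd, ← hwa,
        add_sum_erase _ (fun x => R.wt (e x)) haS]
    · grind
  omega

/-- A cut just below the level of a weight with repeated neighbours is impossible. -/
lemma ExtMF.clean (hE : ExtMF R n b K) (hKN : K ≤ n+b+n) {η : ℝ^(r+1)} (hη : StrictAnti η)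
    {e : Fin (n+b+n) ≃ ι} (h : Enum R η e) {μ : ℚ^(r+1)} {i j : Fin (r+1)} (hij : i < j)
    (hmin : ∀ p q, p < q → η i-η j ≤ η p-η q)
    (hμ : 3 ≤ R.ch.coeff μ*R.ch.coeff (μ-(eps i-eps j)))
    (hpos : η i-η j < 2*dotHom η μ) : nGe R η (dotHom η μ) ≠ K := by
  classical
  intro hK; set c := dotHom η μ with hc
  set S₀ := univ.filter fun a : Fin (n+b+n) => (a : ℕ) < K with hS₀
  have hS₀c : S₀.card = K := card_first hKN
  have hmem : ∀ a, a ∈ S₀ ↔ c ≤ dotHom η (R.wt (e a)) := fun a => by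
    rw [← h.lt_nGe c a, hK]; simp [hS₀]
  have hgt : nGt R η c ≤ K := by
    rw [← hK]; exact card_le_card fun a ha => by simp at ha ⊢; exact ha.le
  have htop := h.sum_first hKN hgt hK.ge
  set P := R.pull e (ext (n+b+n) K) with hP; set z := P.wt ⟨S₀, hS₀c⟩ - (eps i-eps j) with hz
  have hroot := dot_root η i j; have hlt := hη hij
  have hz₀ : dotHom η (P.wt ⟨S₀, hS₀c⟩) = K*c + ∑ a, max (dotHom η (R.wt (e a))-c) 0 := by
    rw [hP, pull_ext_wt, map_sum (dotHom η), ← htop]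
  have hle := hE η e hη h c z (fun x hx => (h.lt_nGe c x).1 (hx.trans_le hK.ge)) (by
    rw [htop, hz, map_sub (dotHom η), hz₀, hroot]; linarith)
  have hge := P.card_le_finrank_Inv_add_one (η := η) (z := z) (c₀ := ⟨S₀, hS₀c⟩) (i := i) (j := j) (fun T hT => by
    rw [hz₀, hP, pull_ext_wt, map_sum (dotHom η)] at hT
    have h3 := (sum_eq_level _ c T.2).1 (le_antisymm (sum_le_level _ c T.2) hT); apply Subtype.ext
    refine eq_of_subset_of_card_le (fun a ha => (hmem a).2 (h3.1 a ha)) ?_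
    rw [T.2, hS₀c]) (by rw [hz]; abel) hmin
  have hcard : R.ch.coeff μ*R.ch.coeff (μ-(eps i-eps j)) ≤ (#{T | P.wt T = z} : ℤ) := by
    rw [R.ch_coeff, R.ch_coeff]; norm_cast; rw [← card_product]
    have hS : ∀ p : ι × ι, R.wt p.1 = μ → R.wt p.2 = μ-(eps i-eps j) →
        e.symm p.1 ∈ S₀ ∧ e.symm p.2 ∉ S₀ := by
      intro p h1 h2
      rw [hmem, hmem, apply_symm_apply, apply_symm_apply, h1, h2, map_sub (dotHom η), hroot]
      exact ⟨le_rfl, by linarith⟩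
    have hcd : ∀ p : ι × ι, R.wt p.1 = μ → R.wt p.2 = μ-(eps i-eps j) →
        (insert (e.symm p.2) (S₀.erase (e.symm p.1))).card = K := by
      intro p h1 h2; obtain ⟨h3, h4⟩ := hS p h1 h2
      rw [card_insert_of_notMem (fun h => h4 (mem_of_mem_erase h)), card_erase_of_mem h3]
      have := card_pos.2 ⟨_, h3⟩; omega
    refine card_le_card_of_injOn (fun p => if hp : (insert (e.symm p.2) (S₀.erase (e.symm p.1))).card = K
      then ⟨_, hp⟩ else ⟨S₀, hS₀c⟩) ?_ ?_
    · intro p hp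
      simp only [coe_product, coe_filter, mem_univ, true_and, Set.mem_prod, Set.mem_ofPred_eq] at hp
      obtain ⟨h3, h4⟩ := hS p hp.1 hp.2
      simp only [dif_pos (hcd p hp.1 hp.2), coe_filter, mem_univ, true_and, Set.mem_ofPred_eq, hz]
      rw [hP, pull_ext_wt, pull_ext_wt, sum_insert (fun h => h4 (mem_of_mem_erase h)),
        apply_symm_apply, hp.2, ← add_sum_erase _ (fun x => R.wt (e x)) h3]
      simp only [apply_symm_apply, hp.1]; abel
    · intro p hp q hq hpq
      simp only [coe_product, coe_filter, mem_univ, true_and, Set.mem_prod, Set.mem_ofPred_eq] at hp hq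
      obtain ⟨h3, h4⟩ := hS p hp.1 hp.2; obtain ⟨h5, h6⟩ := hS q hq.1 hq.2
      simp only [dif_pos (hcd p hp.1 hp.2), dif_pos (hcd q hq.1 hq.2), Subtype.mk.injEq] at hpq
      have e2 : e.symm p.2 = e.symm q.2 := by
        have : e.symm p.2 ∈ insert (e.symm q.2) (S₀.erase (e.symm q.1)) := hpq ▸ mem_insert_self _ _
        rcases mem_insert.1 this with h | h
        · exact h
        · exact absurd (mem_of_mem_erase h) h4
      have e1 : e.symm p.1 = e.symm q.1 := by
        by_contra hne
        have : e.symm p.1 ∈ insert (e.symm q.2) (S₀.erase (e.symm q.1)) :=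
          mem_insert_of_mem (mem_erase.2 ⟨hne, h3⟩)
        rw [← hpq] at this; rcases mem_insert.1 this with h | h
        · exact h4 (h ▸ h3)
        · exact (mem_erase.1 h).1 rfl
      exact Prod.ext (e.symm.injective e1) (e.symm.injective e2)
  have : (#{T | P.wt T = z} : ℤ) ≤ 2 := by exact_mod_cast hge.trans (Nat.add_le_add_right hle 1)
  omega

lemma continuous_dotHom (v : ℚ^(r+1)) : Continuous fun η => dotHom η v := by
  simp only [dotHom_apply]; fun_prop

/-- Whether the cut lies above a repeated weight does not depend on the functional. -/
lemma ExtMF.gt_of_gt (hE : ExtMF R n b K) (hKN : K ≤ n+b+n)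
    (henum : ∀ η, ∃ e : Fin (n+b+n) ≃ ι, Enum R η e) {μ : ℚ^(r+1)} (hμ : 2 ≤ R.ch.coeff μ)
    (hpos : ∀ η : ℝ^(r+1), StrictAnti η → 0 < dotHom η μ) {η₀ η₁ : ℝ^(r+1)} (h₀ : StrictAnti η₀)
    (h₁ : StrictAnti η₁) (hK : K < nGe R η₀ (dotHom η₀ μ)) : K ≤ nGt R η₁ (dotHom η₁ μ) := by
  classical
  let U : Set ℝ^(r+1) := {η | K ≤ nGt R η (dotHom η μ)}
  let V : Set ℝ^(r+1) := {η | nGe R η (dotHom η μ) ≤ K}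
  have hU : IsOpen U := by
    have : U = ⋃ T : {T : Finset ι // K ≤ T.card}, ⋂ a ∈ T.1, {η | dotHom η μ < dotHom η (R.wt a)} := by
      ext η; simp only [Set.mem_iUnion, Set.mem_iInter, Set.mem_ofPred_eq, U]; constructor
      · intro h; exact ⟨⟨_, h⟩, fun a ha => (mem_filter.1 ha).2⟩
      · rintro ⟨T, hT⟩; exact T.2.trans (card_le_card fun a ha => by simpa using hT a ha)
    rw [this]
    exact isOpen_iUnion fun T => isOpen_biInter_finset fun a _ =>
      isOpen_lt (continuous_dotHom _) (continuous_dotHom _)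
  have hV : IsOpen V := by
    have : V = ⋃ T : {T : Finset ι // T.card ≤ K}, ⋂ a ∈ T.1ᶜ, {η | dotHom η (R.wt a) < dotHom η μ} := by
      ext η; simp only [Set.mem_iUnion, Set.mem_iInter, Set.mem_ofPred_eq, V]; constructor
      · intro h; exact ⟨⟨_, h⟩, fun a ha => by simpa using ha⟩
      · rintro ⟨T, hT⟩; refine (card_le_card fun a ha => ?_).trans T.2; by_contra hc
        exact absurd (hT a (mem_compl.2 hc)) (not_lt.2 (mem_filter.1 ha).2)
    rw [this]
    exact isOpen_iUnion fun T => isOpen_biInter_finset fun a _ =>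
      isOpen_lt (continuous_dotHom _) (continuous_dotHom _)
  have hconv : Convex ℝ {η : ℝ^(r+1) | StrictAnti η} := by
    intro x hx y hy a b ha hb hab i j hij; have h1 := hx hij; have h2 := hy hij
    simp only [Pi.add_apply, Pi.smul_apply, smul_eq_mul]; rcases ha.eq_or_lt with rfl | ha
    · simp_all
    · nlinarith [mul_lt_mul_of_pos_left h1 ha, mul_le_mul_of_nonneg_left h2.le hb]
  have hdisj : ∀ η, nGt R η (dotHom η μ)+2 ≤ nGe R η (dotHom η μ) := by
    intro η; rw [R.ch_coeff] at hμ; have h2 : 2 ≤ #{a | R.wt a = μ} := mod_cast hμ; unfold nGt nGe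
    have h3 : Disjoint (univ.filter fun a => dotHom η μ < dotHom η (R.wt a))
        (univ.filter fun a => R.wt a = μ) := by
      rw [disjoint_filter]; grind
    refine le_trans ?_ (card_le_card (s := (univ.filter fun a => dotHom η μ < dotHom η (R.wt a))
      ∪ (univ.filter fun a => R.wt a = μ)) ?_)
    · simp_all
    · grind
  rcases isPreconnected_iff_subset_of_disjoint.1 hconv.isPreconnected U V hU hV (fun η hη => by
      obtain ⟨e, he⟩ := henum η; by_cases h : K ≤ nGt R η (dotHom η μ)
      · exact Or.inl h
      · exact Or.inr (hE.cut hKN hη he hμ (hpos η hη) (not_le.1 h))) (by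
      rw [Set.eq_empty_iff_forall_notMem]; rintro η ⟨_, h1, h2⟩; have h3 := hdisj η
      have h1 : K ≤ nGt R η (dotHom η μ) := h1; have h2 : nGe R η (dotHom η μ) ≤ K := h2
      omega) with h | h
  · exact h h₁
  · have : nGe R η₀ (dotHom η₀ μ) ≤ K := h h₀; omega

end ExtMF

/-! ### Weight multiplicities -/

namespace Rep
variable {m : ℕ} {ι : Type} [Fintype ι] [DecidableEq ι] (R : Rep m ι)

lemma ch_coeff_eq_finrank (ν : ℚ^m) : R.ch.coeff ν = finrank ℝ (R.Wt ν) := by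
  rw [R.ch_coeff, R.finrank_Wt]

lemma exists_wt {ν : ℚ^m} (h : 0 < R.ch.coeff ν) : ∃ a, R.wt a = ν := by
  rw [R.ch_coeff] at h
  obtain ⟨a, ha⟩ := card_pos.1 (show 0 < #{a | R.wt a = ν} by exact_mod_cast h); grind

lemma E_eq_zero {μ : ℚ^m} {x : ι → ℝ} (hx : x ∈ R.Wt μ) {i j : Fin m}
    (h : ∀ a, R.wt a ≠ μ+eps i-eps j) : R.E i j *ᵥ x = 0 := by
  funext a; exact R.E_mem_Wt hx i j a (h a)

lemma coeff_le_sub_root {ν : ℚ^m} {i j : Fin m} (hij : ν j < ν i) :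
    R.ch.coeff ν ≤ R.ch.coeff (ν-(eps i-eps j)) := by
  rw [R.ch_coeff_eq_finrank, R.ch_coeff_eq_finrank]
  have hw : ν-(eps i-eps j) = ν+eps j-eps i := by abel
  rw [hw]; norm_cast
  refine LinearMap.finrank_le_finrank_of_injective
    (f := (mulVecLin (R.E j i)).restrict (fun x hx => R.E_mem_Wt hx j i)) ?_
  rw [injective_iff_map_eq_zero]; rintro ⟨x, hx⟩ h; by_contra h0
  exact R.E_ne_zero hx (fun h => h0 (Subtype.ext h)) hij (congrArg Subtype.val h)

/-- Multiplicities add up along a path through a middle coordinate. -/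
lemma coeff_add_le {μ : ℚ^m} {i k l : Fin m} (hik : μ k < μ i) (hkl : μ l < μ k)
    (h1 : ∀ a, R.wt a ≠ μ+eps i-eps k) (h2 : ∀ a, R.wt a ≠ μ+eps k-eps l) :
    R.ch.coeff (μ+eps k-eps i)+R.ch.coeff μ ≤ R.ch.coeff (μ+eps l-eps i) := by
  have nik : i ≠ k := by grind
  have nkl : k ≠ l := by grind
  have nil : i ≠ l := by grind
  rw [R.ch_coeff_eq_finrank, R.ch_coeff_eq_finrank, R.ch_coeff_eq_finrank]; norm_cast
  rw [← Module.finrank_prod]; set c : ℝ := (μ k : ℝ)-μ l with hc; set d : ℝ := (μ i : ℝ)-μ k with hd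
  have hc0 : 0 < c := by simp_all
  have hd0 : 0 < d := by simp_all
  let Y : (ι → ℝ) →ₗ[ℝ] (ι → ℝ) := (c+1) • (mulVecLin (R.E k i)).comp (mulVecLin (R.E l k))
    - c • (mulVecLin (R.E l k)).comp (mulVecLin (R.E k i))
  have hY : ∀ v, Y v = (c+1) • (R.E k i *ᵥ (R.E l k *ᵥ v))-c • (R.E l k *ᵥ (R.E k i *ᵥ v)) := fun v => rfl
  have w1 : ∀ {v}, v ∈ R.Wt (μ+eps k-eps i) → R.E l k *ᵥ v ∈ R.Wt (μ+eps l-eps i) := fun {v} hv => by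
    have := R.E_mem_Wt hv l k
    rwa [show μ+eps k-eps i+eps l-eps k = μ+eps l-eps i by abel] at this
  have w2 : ∀ {v}, v ∈ R.Wt μ → Y v ∈ R.Wt (μ+eps l-eps i) := fun {v} hv => by
    rw [hY]
    refine Submodule.sub_mem _ (Submodule.smul_mem _ _ ?_) (Submodule.smul_mem _ _ (w1 (R.E_mem_Wt hv k i)))
    have := R.E_mem_Wt (R.E_mem_Wt hv l k) k i
    simp_all
  have hW : ∀ {v}, v ∈ R.Wt μ → R.E k l *ᵥ Y v = 0 ∧ R.E i k *ᵥ Y v = (c+d+1) • (R.E l k *ᵥ v) := by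
    intro v hv; have e1 : R.E k l *ᵥ v = 0 := R.E_eq_zero hv h2
    have e2 : R.E i k *ᵥ v = 0 := R.E_eq_zero hv h1; have s := fun p => R.E_self hv p
    have sk := fun p => R.E_self (R.E_mem_Wt hv k i) p
    have sl := fun p => R.E_self (R.E_mem_Wt hv l k) p; constructor
    · rw [hY, mulVec_sub, mulVec_smul, mulVec_smul, R.comm_vec k l k i,
        R.comm_vec k l l k v, R.comm_vec k l l k (R.E k i *ᵥ v), R.comm_vec k l k i v, e1]
      simp only [nkl.symm, nik, if_true, if_false, mulVec_zero, s, sk,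
        mulVec_smul, zero_add, sub_zero, add_zero, ← sub_smul, smul_smul]
      simp [nik.symm, nil.symm, nkl.symm]; left; rw [hc]; ring
    · rw [hY, mulVec_sub, mulVec_smul, mulVec_smul, R.comm_vec i k k i (R.E l k *ᵥ v),
        R.comm_vec i k l k v, R.comm_vec i k l k (R.E k i *ᵥ v), R.comm_vec i k k i v, e2]
      simp only [nkl, nik.symm, if_true, if_false, mulVec_zero, s, sl,
        mulVec_smul, zero_add, sub_zero, add_zero, ← sub_smul, smul_smul]
      simp [nik, nil, nkl]; congr 1; rw [hc, hd]; ring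
  refine LinearMap.finrank_le_finrank_of_injective
    (f := LinearMap.codRestrict (R.Wt (μ+eps l-eps i))
      (((mulVecLin (R.E l k)).comp (R.Wt (μ+eps k-eps i)).subtype).coprod (Y.comp (R.Wt μ).subtype))
      (fun p => Submodule.add_mem _ (w1 p.1.2) (w2 p.2.2))) ?_
  rw [injective_iff_map_eq_zero]; rintro ⟨⟨u, hu⟩, ⟨v, hv⟩⟩ h
  have h : R.E l k *ᵥ u+Y v = 0 := congrArg Subtype.val h
  have hu0 : R.E l k *ᵥ u = 0 := by
    have h3 := congrArg (fun x => R.E k l *ᵥ x) h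
    simp only [mulVec_add, (hW hv).1, add_zero, mulVec_zero] at h3; by_contra hne
    have := dot_self_pos hne; rw [R.dot_E, h3] at this; simp at this
  have hu1 : u = 0 := by
    by_contra hne; refine R.E_ne_zero hu hne (i := k) (j := l) ?_ hu0
    simp [nik.symm, nil.symm, nkl.symm]; linarith
  have hv0 : v = 0 := by
    by_contra hne; rw [hu0, zero_add] at h; have h3 := (hW hv).2; rw [h, mulVec_zero] at h3
    exact R.E_ne_zero hv hne hkl ((smul_eq_zero.1 h3.symm).resolve_left (by positivity))
  subst hu1; subst hv0; rfl

lemma IsIrr.intg {R : Rep m ι} {lam : ℚ^m} (h : R.IsIrr lam) (hi : Intg lam) (a : ι) : Intg (R.wt a) := by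
  refine intg_of_mul_alt (hi.add (intg_rho m)) h.ch_eq ?_; rw [R.ch_coeff]; simp

lemma IsIrr.sum_wt {R : Rep m ι} {lam : ℚ^m} (h : R.IsIrr lam) (h0 : ∑ i, lam i = 0) (a : ι) :
    ∑ i, R.wt a i = 0 := by
  have := (h.cone_wt a).2
  simp_all

lemma exists_isIrr' {lam : ℚ^m} (hlam : Antitone lam) (hi : Intg lam) :
    ∃ (κ : Type) (_ : Fintype κ) (_ : DecidableEq κ) (P : Rep m κ), P.IsIrr lam := by
  rcases Nat.eq_zero_or_pos m with hm | hm
  · subst hm; exact exists_isIrr hlam hi fun i => i.elim0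
  set c := lam ⟨m-1, by omega⟩ with hc
  obtain ⟨κ, i1, i2, P, hP⟩ := exists_isIrr (v := lam-fun _ => c) (fun i j hij => by
    simpa using hlam hij) (hi.sub fun _ => hi _) (fun i => by
    simp only [Pi.sub_apply, sub_nonneg, hc]
    exact hlam (le_def.2 (by simp; omega)))
  refine ⟨κ, i1, i2, P.twist c, hlam, ?_⟩
  have h1 : (P.twist c).ch = single (fun _ => c) 1*P.ch := by
    unfold Rep.ch; rw [mul_sum]; refine sum_congr rfl fun a _ => ?_
    change mono (P.wt a+fun _ => c) = _; rw [mono, mono, single_mul_single, add_comm, one_mul]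
  rw [h1, mul_assoc, hP.ch_eq]; unfold alt; rw [mul_sum]; refine sum_congr rfl fun σ _ => ?_
  rw [single_mul_single, one_mul]; congr 1; funext i; simp only [Pi.add_apply, Pi.sub_apply]; ring

/-- The Weyl dimension formula. -/
lemma IsIrr.card {R : Rep (r+1) ι} {d : Fin r → ℕ} (h : R.IsIrr (slWt r d)) :
    (Fintype.card ι : ℚ) = dimA r d := by
  let L : CharRing (r+1) →+ ℚ := (Finsupp.liftAddHom fun v : ℚ^(r+1) =>
    (AddMonoidHom.mulRight (∏ i, v i ^ (i : ℕ))).comp (Int.castAddHom ℚ)).comp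
      (coeffAddEquiv (R := ℤ) (M := ℚ^(r+1))).toAddMonoidHom
  have hL : ∀ v (c : ℤ), L (single v c) = c * ∏ i, v i ^ (i : ℕ) := by intro v c; simp [L]
  have hdet : ∀ w u : ℚ^(r+1), L (∑ σ : Perm (Fin (r+1)),
      single (w+fun i => u (σ i)) ((sign σ : ℤˣ) : ℤ)) = (vandermonde u).det := by
    intro w u
    rw [det_eval_matrixOfPolynomials_eq_det_vandermonde u
      (fun j => (Polynomial.X+Polynomial.C (w j)) ^ (j : ℕ)) (fun j => by simp)
      (fun j => (Polynomial.monic_X_add_C _).pow _), det_apply', map_sum]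
    refine sum_congr rfl fun σ _ => ?_; rw [hL]; simp [add_comm]
  have h1 := congrArg L h.ch_eq; unfold Rep.ch at h1; rw [sum_mul, map_sum] at h1
  have h2 : ∀ a, L (mono (R.wt a)*alt ℤ (rho (r+1))) = (vandermonde (rho (r+1))).det := by
    intro a; rw [← hdet (R.wt a)]; congr 1; unfold alt mono; rw [mul_sum]; simp
  have h3 : L (alt ℤ (slWt r d+rho (r+1))) = (vandermonde (slWt r d+rho (r+1))).det := by
    rw [← hdet 0]; congr 1; unfold alt; simp
  simp only [h2, sum_const, card_univ, nsmul_eq_mul] at h1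
  rw [h3, det_vandermonde, det_vandermonde] at h1
  have hne : (∏ i : Fin (r+1), ∏ j ∈ Ioi i, (rho (r+1) j-rho (r+1) i)) ≠ 0 := by
    refine prod_ne_zero_iff.2 fun i _ => prod_ne_zero_iff.2 fun j hj => ?_
    exact (sub_neg.2 (strictAnti_rho (r+1) (mem_Ioi.1 hj))).ne
  rw [eq_div_of_mul_eq hne h1, ← prod_div_distrib]; simp only [← prod_div_distrib]; unfold dimA
  rw [prod_filter, ← univ_product_univ, prod_product]; refine prod_congr rfl fun i _ => ?_
  rw [← prod_filter]
  have : (univ.filter fun j : Fin (r+1) => (i : ℕ) < j) = Ioi i := by ext j; simp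
  rw [this]; refine prod_congr rfl fun j hj => ?_; simp only [Pi.add_apply, rho, slWt]
  rw [← neg_div_neg_eq]; congr 1 <;> ring

end Rep

section Zero
variable {m : ℕ} {ι : Type} [Fintype ι] [DecidableEq ι] {R : Rep m ι} {lam : ℚ^m}

lemma exists_root_pos {ν : ℚ^m} (hi : Intg ν) (h0 : ∑ i, ν i = 0) (hν : ν ≠ 0) : ∃ i, 1 ≤ ν i := by
  by_contra hc
  push Not at hc
  have hle : ∀ i, ν i ≤ 0 := fun i => by
    obtain ⟨z, hz⟩ := hi i; have := hc i; rw [hz] at this ⊢; have : z < 1 := mod_cast this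
    have : z ≤ 0 := by omega
    exact_mod_cast this
  apply hν; funext i; exact (sum_eq_zero_iff_of_nonpos fun i _ => hle i).1 h0 i (mem_univ i)

lemma coeff_root_zero (h : R.IsIrr lam) {M : ℤ} (N : ℕ) : ∀ ν : ℚ^m, Intg ν → ∑ i, ν i = 0 →
    ν ≠ 0 → M ≤ R.ch.coeff ν → ∑ i, ν i ^ 2 ≤ N →
    M ≤ R.ch.coeff 0 ∧ ∀ p q, p ≠ q → M ≤ R.ch.coeff (eps p-eps q) := by
  induction N with
  | zero =>
    intro ν _ _ hν _ hN
    exact absurd (funext fun i => by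
      have := (sum_eq_zero_iff_of_nonneg fun i _ => sq_nonneg (ν i)).1
        (le_antisymm (by simpa using hN) (sum_nonneg fun i _ => sq_nonneg (ν i))) i (mem_univ i)
      simpa using this) hν
  | succ N ih =>
    intro ν hi h0 hν hM hN; obtain ⟨i, hi1⟩ := exists_root_pos hi h0 hν
    obtain ⟨j, hj1⟩ := exists_root_pos (ν := -ν) (fun i => by
      obtain ⟨z, hz⟩ := hi i; exact ⟨-z, by simp [hz]⟩) (by simp [h0]) (by simpa using hν)
    simp only [Pi.neg_apply] at hj1; have hji : ν j < ν i := by linarith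
    have hij : i ≠ j := by grind
    have hM' := hM.trans (R.coeff_le_sub_root hji); by_cases hz : ν-(eps i-eps j) = 0
    · rw [hz] at hM'; refine ⟨hM', fun p q hpq => ?_⟩
      obtain ⟨σ, h1, h2⟩ := MulAction.is_two_pretransitive_iff.1
        (Perm.isMultiplyPretransitive (Fin m) 2) hpq hij
      rw [sub_eq_zero.1 hz, ← h.ch_perm σ] at hM; convert hM using 2; funext l
      simp only [Perm.smul_def] at h1 h2
      simp only [Pi.sub_apply, Function.comp_apply, Pi.single_apply, ← h1, ← h2, σ.injective.eq_iff]
    · refine ih _ (hi.sub fun l => ?_) (by simp [sum_sub_distrib, h0]) hz hM' ?_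
      · refine ⟨(if l = i then 1 else 0)-if l = j then 1 else 0, ?_⟩
        simp only [Pi.sub_apply, Pi.single_apply]; push_cast; rfl
      · have : ∑ l, (ν-(eps i-eps j)) l ^ 2 = ∑ l, ν l ^ 2-2*(ν i-ν j)+2 := by
          have e1 : ∀ l, (ν-(eps i-eps j)) l ^ 2 = ν l ^ 2+((if l = i then 1-2*ν i else 0)
              + if l = j then 1+2*ν j else 0) := by
            intro l; simp only [Pi.sub_apply, Pi.single_apply]; by_cases h1 : l = i
            · grind
            · by_cases h2 : l = j
              · grind
              · simp [h1, h2]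
          simp only [e1, sum_add_distrib, sum_ite_eq', mem_univ, if_true]; ring
        grind

end Zero

/-! ### Symmetric and exterior squares -/

section Squares
variable {m : ℕ}

lemma coeff_mul_alt_symm {F : CharRing m} (hp : ∀ (σ : Perm (Fin m)) v, F.coeff (v ∘ σ) = F.coeff v)
    (hn : ∀ v, F.coeff (-v) = F.coeff v) (u w : ℚ^m) :
    (F*alt ℤ u).coeff w = (F*alt ℤ w).coeff u := by
  rw [coeff_mul_alt, coeff_mul_alt, ← Equiv.sum_comp (Equiv.inv (Perm (Fin m)))]
  refine sum_congr rfl fun σ _ => ?_; simp only [Equiv.inv_apply, Perm.sign_inv]; rw [← hp σ, ← hn]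
  congr 2; funext i; simp

lemma alt_eq_neg {u w : ℚ^m} {i j : Fin m} (hij : i ≠ j) (h : u ∘ swap i j = w) :
    alt ℤ w = -alt ℤ u := by
  rw [← h, alt_perm, Perm.sign_swap hij]; simp

lemma natural_perm (σ : Perm (Fin m)) (c : ℚ) (a : Fin m) :
    c • (eps (σ⁻¹ a) : ℚ^m) = (c • eps a) ∘ σ := by
  funext i; simp only [Pi.smul_apply, Function.comp_apply, Pi.single_apply]
  simp only [Perm.eq_inv_iff_eq]

lemma sum_mono_eps_mul_alt (c : ℚ) (u : ℚ^m) :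
    (∑ a, mono (c • eps a : ℚ^m))*alt ℤ u = ∑ a, alt ℤ (u+c • eps a) :=
  sum_mono_mul_alt (fun a => c • eps a) (fun σ => ⟨σ⁻¹, fun a => natural_perm σ c a⟩) u

lemma square_ch (hN : 2 ≤ N) {κ : Type} [Fintype κ] [DecidableEq κ] {S : Rep N κ} {s : ℤ}
    (hs : s = 1 ∧ S.IsIrr ((2 : ℚ) • eps ⟨0, by omega⟩) ∨ s = -1 ∧ S.IsIrr (om N 2)) :
    (2 : ℤ) • S.ch = (∑ a, mono ((1 : ℚ) • eps a : ℚ^N))*(∑ a, mono ((1 : ℚ) • eps a : ℚ^N))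
      + s • ∑ a, mono ((2 : ℚ) • eps a : ℚ^N) := by
  obtain ⟨N, rfl⟩ : ∃ N', N = N'+2 := ⟨N-2, by omega⟩
  set A := alt ℤ ((2 : ℚ) • eps 0+rho (N+2)) with hA; set B := alt ℤ (om (N+2) 2+rho (N+2)) with hB
  have hz : ∀ (c d : ℚ) (a : Fin N) , c = 1 ∧ (d = 0 ∨ d = 1) ∨ c = 2 ∧ d = 0 →
      alt ℤ (rho (N+2)+d • eps 0+c • eps a.succ.succ) = 0 := by
    rintro c d a (⟨rfl, hd⟩ | ⟨rfl, rfl⟩)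
    · refine alt_eq_zero (i := a.succ.succ) (j := a.castSucc.succ) (by simp [Fin.ext_iff]) ?_
      simp [Fin.ext_iff, rho]; ring
    · refine alt_eq_zero (i := a.succ.succ) (j := a.castSucc.castSucc) (by simp [Fin.ext_iff]; omega) ?_
      have : ¬ (a : ℕ) = a+1+1 := by omega
      simp [Fin.ext_iff, rho, this]; ring
  have hB' : alt ℤ (rho (N+2)+(1 : ℚ) • eps 0+(1 : ℚ) • eps 1) = B := by
    rw [hB]; congr 1; funext i
    refine Fin.cases ?_ (fun i => Fin.cases ?_ (fun i => ?_) i) i <;>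
      simp [om, Fin.ext_iff, rho, add_comm]
  have h1 : (∑ a, mono ((1 : ℚ) • eps a : ℚ^(N+2)))*alt ℤ (rho (N+2)) = alt ℤ (rho (N+2)+(1 : ℚ) • eps 0) := by
    rw [sum_mono_eps_mul_alt, sum_univ_succ, sum_univ_succ, sum_eq_zero fun a _ => ?_]
    · rw [succ_zero_eq_one, alt_eq_zero (u := rho (N+2)+(1 : ℚ) • eps 1) (i := (0 : Fin (N+2))) (j := 1) (by simp) (by
        simp [rho]), zero_add, add_zero]
    · simpa using hz 1 0 a (Or.inl ⟨rfl, Or.inl rfl⟩)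
  have h2 : (∑ a, mono ((1 : ℚ) • eps a : ℚ^(N+2)))*alt ℤ (rho (N+2)+(1 : ℚ) • eps 0) = A+B := by
    rw [sum_mono_eps_mul_alt, sum_univ_succ, sum_univ_succ, sum_eq_zero fun a _ => ?_]
    · rw [add_zero, succ_zero_eq_one, hB', hA]; congr 2; rw [two_smul]; simp; abel
    · exact hz 1 1 a (Or.inl ⟨rfl, Or.inr rfl⟩)
  have h3 : (∑ a, mono ((2 : ℚ) • eps a : ℚ^(N+2)))*alt ℤ (rho (N+2)) = A-B := by
    rw [sum_mono_eps_mul_alt, sum_univ_succ, sum_univ_succ, sum_eq_zero fun a _ => ?_]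
    · rw [succ_zero_eq_one, add_zero, sub_eq_add_neg, hA, add_comm (rho _)]; congr 1; rw [← hB']
      refine alt_eq_neg (i := 0) (j := 1) (by simp) ?_; funext i
      refine Fin.cases ?_ (fun i => Fin.cases ?_ (fun i => ?_) i) i
      · simp [rho]
      · simp [rho]; ring
      · rw [Function.comp_apply, swap_apply_of_ne_of_ne (by simp [Fin.ext_iff]) (by simp [Fin.ext_iff])]
        simp [Fin.ext_iff]
    · simpa using hz 2 0 a (Or.inr ⟨rfl, rfl⟩)
  refine mul_right_cancel₀ (alt_rho_ne_zero (N+2)) ?_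
  rw [add_mul, mul_assoc, h1, h2, smul_mul_assoc, smul_mul_assoc, h3]
  rcases hs with ⟨rfl, hS⟩ | ⟨rfl, hS⟩
  · rw [hS.ch_eq, show (⟨0, by omega⟩ : Fin (N+2)) = 0 from rfl, ← hA]
    simp only [one_smul, two_smul]; abel
  · rw [hS.ch_eq, ← hB]; simp only [neg_smul, one_smul, two_smul]; abel

/-- The multiplicity of a weight of non-square parity in the symmetric or exterior square. -/
lemma finrank_square {ι : Type} [Fintype ι] [DecidableEq ι] (R : Rep m ι) (hN : 2 ≤ N)
    (e : Fin N ≃ ι) {κ : Type} [Fintype κ] [DecidableEq κ] {S : Rep N κ} {s : ℤ}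
    (hs : s = 1 ∧ S.IsIrr ((2 : ℚ) • eps ⟨0, by omega⟩) ∨ s = -1 ∧ S.IsIrr (om N 2))
    {μ : ℚ^m} (hμ : Antitone μ)
    (hpar : ∀ (σ : Perm (Fin m)) a, (2 : ℚ) • R.wt a ≠ μ+rho m-fun i => rho m (σ i)) :
    2*(finrank ℝ ((R.pull e S).Inv μ) : ℤ) = (R.ch*R.ch*alt ℤ (rho m)).coeff (μ+rho m) := by
  let ψ : ℚ^N →+ ℚ^m :=
    { toFun := fun v => ∑ a, v a • R.wt (e a)
      map_zero' := by simp
      map_add' := fun v w => by simp [add_smul, sum_add_distrib] }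
  have hψ : ∀ (c : ℚ) a, ψ (c • eps a) = c • R.wt (e a) := by
    intro c a; change ∑ b, (c • eps a : ℚ^N) b • R.wt (e b) = _; rw [sum_eq_single a]
    all_goals simp_all
  have hm : ∀ v, mapHom ψ (mono v) = mono (ψ v) := fun v => by rw [mono, mapHom_single, mono]
  have hsum : ∀ c : ℚ, mapHom ψ (∑ a, mono (c • eps a)) = ∑ a, mono (c • R.wt a) := by
    intro c; rw [map_sum, ← e.sum_comp]
    simp_all
  have h1 : (R.pull e S).ch = mapHom ψ S.ch := by
    unfold Rep.ch; rw [map_sum]; exact sum_congr rfl fun a _ => by rw [hm]; rfl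
  have h2 := congrArg (mapHom ψ) (square_ch hN hs)
  rw [map_zsmul, ← h1, map_add, map_mul, map_zsmul, hsum, hsum] at h2; simp only [one_smul] at h2
  have h3 := congrArg (fun F => (F*alt ℤ (rho m)).coeff (μ+rho m)) h2
  simp only [add_mul, smul_mul_assoc, coeff_add, coeff_smul, Finsupp.add_apply,
    Finsupp.smul_apply, ← (R.pull e S).finrank_Inv hμ] at h3
  have h4 : ((∑ a, mono ((2 : ℚ) • R.wt a))*alt ℤ (rho m)).coeff (μ+rho m) = 0 := by
    rw [coeff_mul_alt]; refine sum_eq_zero fun σ _ => ?_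
    rw [coeff_sum, sum_apply', sum_eq_zero, mul_zero]; intro a _
    rw [mono, coeff_single, Finsupp.single_apply, if_neg (hpar σ a)]
  rw [h4, smul_zero, add_zero, smul_eq_mul] at h3; exact h3

/-- A parity obstruction to being twice a weight. -/
lemma two_smul_ne {u : Fin m → ℤ} (h : #{i : Fin m | Even (((i : ℕ) : ℤ)+u i)}
      ≠ #{i : Fin m | Even ((i : ℕ) : ℤ)}) {v : ℚ^m} (hv : Intg v)
    (σ : Perm (Fin m)) : (2 : ℚ) • v ≠ (fun i => (u i : ℚ))+rho m-fun i => rho m (σ i) := by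
  intro hc; apply h; refine card_bij (fun i _ => σ i) ?_ (fun a _ b _ hab => σ.injective hab) ?_
  all_goals
    have key : ∀ i : Fin m, Even (((i : ℕ) : ℤ)+u i) ↔ Even ((σ i : ℕ) : ℤ) := by
      intro i; obtain ⟨z, hz⟩ := hv i; have h1 := congrFun hc i
      simp only [Pi.smul_apply, Pi.add_apply, Pi.sub_apply, rho, smul_eq_mul, hz] at h1
      have h2 : 2*z = u i-(i : ℕ)+(σ i : ℕ) := by
        have : (2 : ℚ)*z = u i-(i : ℕ)+(σ i : ℕ) := by rw [h1]; ring
        exact_mod_cast this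
      grind
  · simp_all
  · intro j hj; exact ⟨σ⁻¹ j, by simpa using (key (σ⁻¹ j)).2 (by simpa using hj), by simp⟩

end Squares

section Adjoint
variable {r : ℕ}

lemma sum_roots_mul_alt (u : ℚ^(r+1)) :
    (∑ p : Fin (r+1) × Fin (r+1), mono (eps p.1-eps p.2 : ℚ^(r+1)))*alt ℤ u
      = ∑ p : Fin (r+1) × Fin (r+1), alt ℤ (u+(eps p.1-eps p.2)) :=
  sum_mono_mul_alt (fun p : Fin (r+1) × Fin (r+1) => eps p.1-eps p.2) (fun σ =>
    ⟨Equiv.prodCongr σ⁻¹ σ⁻¹, fun p => by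
      have := natural_perm σ 1; simp only [one_smul] at this
      simp only [Equiv.prodCongr_apply, Prod.map, this]
      rfl⟩) u

lemma sum_roots_mul_alt_rho (hr : 1 ≤ r) :
    (∑ p : Fin (r+1) × Fin (r+1), mono (eps p.1-eps p.2 : ℚ^(r+1)))*alt ℤ (rho (r+1))
      = alt ℤ (rho (r+1))+alt ℤ (eps 0-eps (last r)+rho (r+1)) := by
  rw [sum_roots_mul_alt, Fintype.sum_prod_type, sum_univ_succ]
  have h1 : ∀ i : Fin r, ∑ j, alt ℤ (rho (r+1)+(eps i.succ-eps j)) = 0 := by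
    intro i; rw [Fintype.sum_eq_add i.succ i.castSucc (by simp [Fin.ext_iff]) fun j hj => ?_]
    · rw [sub_self, add_zero, alt_eq_neg (w := rho (r+1)+(eps i.succ-eps i.castSucc)) (u := rho (r+1)) (i := i.succ) (j := i.castSucc) (by simp [Fin.ext_iff]),
        add_neg_cancel]
      funext l; rcases eq_or_ne l i.succ with rfl | h1
      · simp [Fin.ext_iff]; simp [rho]; ring
      · rcases eq_or_ne l i.castSucc with rfl | h2
        · simp [Fin.ext_iff]; simp [rho]; ring
        · rw [Function.comp_apply, swap_apply_of_ne_of_ne h1 h2]; simp [h1, h2]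
    · refine alt_eq_zero (i := i.succ) (j := i.castSucc) (by simp [Fin.ext_iff]) ?_
      simp [hj.1.symm, hj.2.symm, Fin.ext_iff]; simp [rho]; ring
  rw [sum_eq_zero fun i _ => h1 i, add_zero,
    Fintype.sum_eq_add 0 (last r) (by simp [Fin.ext_iff]; omega) fun j hj => ?_]
  · rw [sub_self, add_zero, add_comm (rho (r+1))]
  · obtain ⟨k, rfl⟩ := exists_castSucc_eq.2 hj.2; have hk : k.castSucc ≠ 0 := hj.1
    refine alt_eq_zero (i := k.castSucc) (j := k.succ) (by simp [Fin.ext_iff]) ?_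
    simp [hk, Fin.ext_iff]; simp [rho]; ring

/-- The multiplicity of the adjoint module in the square of a self-dual module. -/
lemma coeff_theta {ι : Type} [Fintype ι] [DecidableEq ι] {R : Rep (r+1) ι} {d : Fin r → ℕ}
    (h : R.IsIrr (slWt r d)) (hr : 1 ≤ r) (hneg : ∀ v, R.ch.coeff (-v) = R.ch.coeff v) :
    ((#{k | d k ≠ 0} : ℕ) : ℤ)
      ≤ (R.ch*R.ch*alt ℤ (rho (r+1))).coeff (eps 0-eps (last r)+rho (r+1)) := by
  set v := slWt r d+rho (r+1) with hv; have hvA : StrictAnti v := strictAnti_add_rho h.anti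
  have h1 : R.ch*alt ℤ (eps 0-eps (last r)+rho (r+1))
      = ∑ p : Fin (r+1) × Fin (r+1), alt ℤ (v+(eps p.1-eps p.2))-alt ℤ v := by
    rw [← sum_roots_mul_alt, hv, ← h.ch_eq, ← add_sub_cancel_left (alt ℤ (rho (r+1)))
      (alt ℤ (eps 0-eps (last r)+rho (r+1))), ← sum_roots_mul_alt_rho hr]
    ring
  rw [mul_assoc, h.ch_eq, coeff_mul_alt_symm h.ch_perm hneg, h1, coeff_sub, Finsupp.sub_apply,
    coeff_sum, sum_apply', alt_coeff_dominant hvA hvA, if_pos rfl, Fintype.sum_prod_type, ← hv]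
  have h2 : ∀ i j, (if i = j then 1 else 0)-(if v j = v i+1 then 1 else 0 : ℤ)
      = (alt ℤ (v+(eps i-eps j))).coeff v := by
    intro i j; rcases eq_or_ne i j with rfl | hij
    · simp [alt_coeff_dominant hvA hvA]
    rw [if_neg hij, zero_sub]; split_ifs with hji
    · rw [alt_eq_neg (u := v) hij, coeff_neg, Finsupp.neg_apply, alt_coeff_dominant hvA hvA, if_pos rfl]
      funext l; rcases eq_or_ne l i with rfl | h1
      · simp [hij, hji]
      · rcases eq_or_ne l j with rfl | h2
        · simp [hij.symm, hji]
        · rw [Function.comp_apply, swap_apply_of_ne_of_ne h1 h2]; simp [h1, h2]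
    · rw [alt_coeff, sum_eq_zero, neg_zero]; intro σ _; rw [if_neg]; intro hσ; apply hji
      have h3 : ∑ l, (v+(eps i-eps j)) l ^ 2 = ∑ l, v l ^ 2 := by
        rw [← Equiv.sum_comp σ]; exact sum_congr rfl fun l _ => by rw [← congrFun hσ l]; rfl
      have e1 : ∀ l, (v+(eps i-eps j)) l ^ 2 = v l ^ 2+((if l = i then 1+2*v i else 0)
          + if l = j then 1-2*v j else 0) := by
        intro l; simp only [Pi.add_apply, Pi.sub_apply, Pi.single_apply]; by_cases h1 : l = i
        · subst h1; simp [hij]; ring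
        · by_cases h2 : l = j
          · subst h2; simp [h1]; ring
          · simp [h1, h2]
      simp only [e1, sum_add_distrib, sum_ite_eq', mem_univ, if_true] at h3; linarith
  simp only [← h2, sum_sub_distrib, sum_ite_eq, mem_univ, if_true, sum_const,
    card_univ, Fintype.card_fin]
  have h4 : ∀ i j, v j = v i+1 → ∃ k : Fin r, j = k.castSucc ∧ i = k.succ ∧ d k = 0 := by
    intro i j hij; have hji : j < i := by by_contra hc; have := hvA.antitone (not_lt.1 hc); linarith
    obtain ⟨k, rfl⟩ := exists_castSucc_eq.2 (Fin.ne_last_of_lt hji); have h5 := slWt_sub d k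
    have h6 : v i ≤ v k.succ := hvA.antitone (Fin.castSucc_lt_iff_succ_le.1 hji)
    have h7 : v k.castSucc-v k.succ = d k+1 := by
      rw [hv]; simp only [Pi.add_apply]; simp [rho]; linarith
    have h8 : (d k : ℚ) = 0 := le_antisymm (by linarith) (Nat.cast_nonneg _)
    refine ⟨k, rfl, hvA.injective ?_, mod_cast h8⟩; linarith
  have h9 : ∑ i, ∑ j, (if v j = v i+1 then 1 else 0 : ℤ) ≤ (#{k | ¬ d k ≠ 0} : ℤ) := by
    rw [← Fintype.sum_prod_type' (f := fun i j => (if v j = v i+1 then 1 else 0 : ℤ)), sum_boole]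
    norm_cast
    refine (card_le_card (t := (univ.filter fun k => ¬ d k ≠ 0).image fun k => (k.succ, k.castSucc)) ?_).trans
      card_image_le
    intro p hp; obtain ⟨k, h1, h2, h3⟩ := h4 p.1 p.2 (by simpa using hp)
    exact mem_image.2 ⟨k, by simpa using h3, Prod.ext h2.symm h1.symm⟩
  have h10 := card_filter_add_card_filter_not (s := (univ : Finset (Fin r))) (fun k => d k ≠ 0)
  rw [card_univ, Fintype.card_fin] at h10
  have h11 : ((#{k | d k ≠ 0} : ℕ) : ℤ)+(#{k | ¬ d k ≠ 0} : ℤ) = r := by exact_mod_cast h10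
  rw [nsmul_eq_mul, mul_one]; push_cast; linarith

end Adjoint

/-! ### Highest weight vectors in the endomorphism algebra -/

namespace Rep
variable {m : ℕ} {ι : Type} [Fintype ι] [DecidableEq ι] (R : Rep m ι)

/-- The entries of the square of the matrix of generators. -/
def Y (i j : Fin m) : Matrix ι ι ℝ := ∑ p, R.E i p*R.E p j

/-- A linear combination of the two copies of the adjoint module. -/
def Z (u : ℝ) (i j : Fin m) : Matrix ι ι ℝ := u • R.E i j+R.Y i j

lemma E_mul_E (i j k l : Fin m) : R.E i j*R.E k l = R.E k l*R.E i j
    + (if j = k then R.E i l else 0)-if l = i then R.E k j else 0 := by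
  have := R.comm i j k l; grind

lemma E_mul_Y (i j k l : Fin m) : R.E i j*R.Y k l = R.Y k l*R.E i j
    + (if j = k then R.Y i l else 0)-if l = i then R.Y k j else 0 := by
  have h : ∀ p, R.E i j*(R.E k p*R.E p l) = R.E k p*R.E p l*R.E i j
      + (if j = p then R.E k p*R.E i l else 0)-(if l = i then R.E k p*R.E p j else 0)
      + (if j = k then R.E i p*R.E p l else 0)-if p = i then R.E k j*R.E p l else 0 := by
    intro p
    rw [← mul_assoc, R.E_mul_E i j k p, sub_mul, add_mul, mul_assoc (R.E k p), R.E_mul_E i j p l, mul_sub, mul_add,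
      mul_assoc]
    split_ifs <;> simp
  unfold Y; rw [mul_sum, sum_congr rfl fun p _ => h p]
  simp only [sum_add_distrib, sum_sub_distrib, sum_mul, sum_ite_eq, sum_ite_eq', mem_univ, if_true]
  split_ifs <;> (try rw [sum_const_zero]) <;> abel

lemma E_mul_Z (u : ℝ) (i j k l : Fin m) : R.E i j*R.Z u k l = R.Z u k l*R.E i j
    + (if j = k then R.Z u i l else 0)-if l = i then R.Z u k j else 0 := by
  unfold Z; rw [mul_add, Matrix.mul_smul, R.E_mul_E, R.E_mul_Y, add_mul, smul_mul]
  split_ifs <;> simp only [smul_add, smul_sub, add_zero, sub_zero] <;> abel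

lemma Y_mul_Y {a b c d : Fin m} (had : a ≠ d) (hbc : b ≠ c) (hab : a ≠ b) (hcd : c ≠ d) :
    R.Y a b*R.Y c d = R.Y c d*R.Y a b+R.E c b*R.Y a d-R.E a d*R.Y c b := by
  have h1 : ∀ i j k l : Fin m, R.Y k l*R.E i j = R.E i j*R.Y k l
      - (if j = k then R.Y i l else 0)+if l = i then R.Y k j else 0 := by
    intro i j k l; rw [R.E_mul_Y]; abel
  have h2 : R.Y a b*R.Y c d = R.Y c d*R.Y a b+R.E c b*R.Y a d-R.Y c b*R.E a d := by
    conv_lhs => unfold Y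
    rw [← Y, mul_sum]
    have : ∀ p, R.Y a b*(R.E c p*R.E p d) = R.E c p*R.E p d*R.Y a b
        + (if b = p then R.E c p*R.Y a d else 0)-if p = a then R.Y c b*R.E p d else 0 := by
      intro p
      rw [← mul_assoc, h1, if_neg hbc, add_zero, sub_mul, mul_assoc, h1, if_neg had.symm, sub_zero, mul_add, ← mul_assoc]
      split_ifs <;> simp
    rw [sum_congr rfl fun p _ => this p, sum_sub_distrib, sum_add_distrib, ← sum_mul]; simp [Y]
  grind

lemma E_Z_vec (u : ℝ) (i j k l : Fin m) (y : ι → ℝ) : R.E i j *ᵥ (R.Z u k l *ᵥ y)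
    = R.Z u k l *ᵥ (R.E i j *ᵥ y)+(if j = k then R.Z u i l *ᵥ y else 0)-if l = i then R.Z u k j *ᵥ y else 0 := by
  rw [mulVec_mulVec, R.E_mul_Z, sub_mulVec, add_mulVec, mulVec_mulVec]; split_ifs <;> simp

lemma Z_vec (u : ℝ) (i j : Fin m) (y : ι → ℝ) : R.Z u i j *ᵥ y = u • (R.E i j *ᵥ y)+R.Y i j *ᵥ y := by
  rw [Z, add_mulVec, smul_mulVec]

lemma Y_vec (i j : Fin m) (y : ι → ℝ) : R.Y i j *ᵥ y = ∑ p, R.E i p *ᵥ (R.E p j *ᵥ y) := by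
  rw [Y, sum_mulVec]; simp [mulVec_mulVec]

lemma E_E_ne_zero {ξ : ℚ^m} {x : ι → ℝ} (hx : x ∈ R.Wt ξ) (h0 : x ≠ 0) {a b : Fin m}
    (hab : ξ a+2 ≤ ξ b) (h : R.E b a *ᵥ x = 0) : R.E a b *ᵥ (R.E a b *ᵥ x) ≠ 0 := by
  have hne : a ≠ b := by rintro rfl; linarith
  have hy := R.E_mem_Wt hx a b; set y := R.E a b *ᵥ x with hydef; have h1 := R.dot_E_E hy hne.symm
  have h2 : R.E b a *ᵥ y = ((ξ b : ℝ)-ξ a) • x := by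
    rw [hydef, R.comm_vec b a a b, h, if_pos rfl, if_pos rfl, R.E_self hx, R.E_self hx, mulVec_zero, zero_add, sub_smul]
  have h3 : (((ξ+eps a-eps b) b : ℚ) : ℝ)-((ξ+eps a-eps b) a : ℚ) = (ξ b : ℝ)-ξ a-2 := by
    simp [hne, hne.symm]; ring
  have h4 : (2 : ℝ) ≤ (ξ b : ℝ)-ξ a := by
    have : (2 : ℚ) ≤ ξ b-ξ a := by linarith
    exact_mod_cast this
  intro h5; rw [h5, h3, h2] at h1
  have h6 := dot_self_pos (x := ((ξ b : ℝ)-ξ a) • x) (smul_ne_zero (by linarith) h0)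
  have h7 := mul_nonneg (show (0 : ℝ) ≤ (ξ b : ℝ)-ξ a-2 by linarith) (dot_self_nonneg y)
  simp only [zero_dotProduct] at h1; linarith

/-- An extremal weight vector. -/
structure Ext (ξ : ℚ^m) (x : ι → ℝ) : Prop where
  wt : x ∈ R.Wt ξ
  ne : x ≠ 0
  zero : ∀ p q, p ≠ q → ξ q ≤ ξ p → R.E p q *ᵥ x = 0

variable {R} {ξ : ℚ^m} {x : ι → ℝ}

lemma Ext.Y_lt (h : R.Ext ξ x) {a b : Fin m} (hab : ξ a < ξ b) (hno : ∀ p, ξ a < ξ p → ξ b ≤ ξ p) :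
    R.Y a b *ᵥ x = ((ξ a+ξ b + #{p | ξ p ≤ ξ a} : ℚ) : ℝ) • (R.E a b *ᵥ x) := by
  have hne : a ≠ b := by grind
  rw [R.Y_vec]
  have key : ∀ p, R.E a p *ᵥ (R.E p b *ᵥ x) = ((if p = a then (ξ a : ℝ) else 0)+(if p = b then (ξ b : ℝ) else 0)
      + if ξ p ≤ ξ a then 1 else 0) • (R.E a b *ᵥ x) := by
    intro p; rcases eq_or_ne p b with rfl | hpb
    · rw [R.E_self h.wt, mulVec_smul, if_neg hne.symm, if_pos rfl, if_neg (not_le.2 hab)]; simp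
    rw [if_neg hpb]; by_cases hpa : ξ p ≤ ξ a
    · rcases eq_or_ne p a with rfl | hpa'
      · rw [R.E_self (R.E_mem_Wt h.wt _ _), if_pos rfl, if_pos le_rfl]; congr 1; simp [hne]
      · rw [R.comm_vec, if_pos rfl, if_neg hne.symm, h.zero a p hpa'.symm hpa, if_neg hpa', if_pos hpa]
        simp
    · have hpa' : p ≠ a := by grind
      rw [h.zero p b hpb (hno p (not_le.1 hpa)), if_neg hpa', if_neg hpa]; simp
  rw [sum_congr rfl fun p _ => key p, ← sum_smul]; congr 1
  simp only [sum_add_distrib, sum_ite_eq', mem_univ, if_true, sum_boole]; push_cast; rfl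

lemma Ext.Y_eq (h : R.Ext ξ x) {a b : Fin m} (hne : a ≠ b) (hab : ξ a = ξ b) : R.Y a b *ᵥ x = 0 := by
  rw [R.Y_vec]; refine sum_eq_zero fun p _ => ?_; have h0 := h.zero a b hne hab.ge
  rcases eq_or_ne p b with rfl | hpb
  · rw [R.E_self h.wt, mulVec_smul, h0, smul_zero]
  by_cases hp : ξ b ≤ ξ p
  · rw [h.zero p b hpb hp, mulVec_zero]
  · have hpa : a ≠ p := by grind
    rw [R.comm_vec, if_pos rfl, if_neg hne.symm, h0, h.zero a p hpa (by linarith)]; simp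

lemma Ext.Y_self (h : R.Ext ξ x) (a : Fin m) : R.Y a a *ᵥ x
    = ((ξ a ^ 2 + ∑ p, (if ξ p < ξ a then ξ a-ξ p else 0) : ℚ) : ℝ) • x := by
  rw [R.Y_vec]
  have key : ∀ p, R.E a p *ᵥ (R.E p a *ᵥ x) = ((if p = a then (ξ a : ℝ) ^ 2 else 0)
      + if ξ p < ξ a then (ξ a : ℝ)-ξ p else 0) • x := by
    intro p; rcases eq_or_ne p a with rfl | hpa
    · rw [R.E_self h.wt, mulVec_smul, R.E_self h.wt, smul_smul]; simp [sq]
    rw [if_neg hpa, zero_add]; split_ifs with hp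
    · rw [R.comm_vec, if_pos rfl, if_pos rfl, h.zero a p hpa.symm hp.le, R.E_self h.wt, R.E_self h.wt]
      simp [sub_smul]
    · rw [h.zero p a hpa (not_lt.1 hp)]; simp
  rw [sum_congr rfl fun p _ => key p, ← sum_smul]; congr 1
  simp only [sum_add_distrib, sum_ite_eq', mem_univ, if_true]; push_cast; congr 1
  exact sum_congr rfl fun p _ => by split_ifs <;> simp

/-- A determinant of generators. -/
def Del (R : Rep m ι) (u : ℝ) (a c k l : Fin m) : Matrix ι ι ℝ :=
  R.Z u a l*R.Z (u-1) c k-R.Z u c l*R.Z (u-1) a k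

lemma Z_mul_Z (u : ℝ) {a b c d : Fin m} (had : a ≠ d) (hbc : b ≠ c) (hab : a ≠ b) (hcd : c ≠ d) :
    R.Z u a b*R.Z (u-1) c d = R.Z (u-1) c d*R.Z u a b+R.E c b*R.Y a d-R.E a d*R.Y c b := by
  have e1 := R.E_mul_E a b c d; have e2 := R.E_mul_Y a b c d; have e3 := R.E_mul_Y c d a b
  rw [if_neg hbc, if_neg had.symm] at e1 e2; rw [if_neg had.symm, if_neg hbc] at e3
  simp only [add_zero, sub_zero] at e1 e2 e3; unfold Z
  simp only [add_mul, mul_add, smul_mul, Matrix.mul_smul, e1, e2, ← e3, R.Y_mul_Y had hbc hab hcd, smul_smul]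
  rw [mul_comm u (u-1)]; abel

lemma Del_eq (u : ℝ) {a c k l : Fin m} (hak : a ≠ k) (hal : a ≠ l) (hck : c ≠ k) (hcl : c ≠ l) :
    R.Del u a c k l = R.Z (u-1) c k*R.Z u a l-R.Z (u-1) c l*R.Z u a k := by
  have e3 := R.E_mul_Y a k c l; rw [if_neg hck.symm, if_neg hal.symm] at e3
  simp only [add_zero, sub_zero] at e3; have e4 := R.E_mul_E a k c l
  rw [if_neg hck.symm, if_neg hal.symm] at e4; simp only [add_zero, sub_zero] at e4
  have hz : ∀ i j, R.Z u i j = R.E i j+R.Z (u-1) i j := by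
    intro i j; unfold Z; rw [sub_smul, one_smul]; abel
  unfold Del; rw [Z_mul_Z u hak hcl.symm hal hck, hz c l, hz a k]
  simp only [mul_add, add_mul, Z, smul_mul, Matrix.mul_smul, e3]; abel

end Rep
namespace Rep
variable {m : ℕ} {ι : Type} [Fintype ι] [DecidableEq ι] {R : Rep m ι} {ξ : ℚ^m} {x : ι → ℝ}

lemma Ext.del_left (h : R.Ext ξ x) {a c k l : Fin m} (hac : a ≠ c) (hak : a ≠ k) (hal : a ≠ l) (hck : c ≠ k)
    (hcl : c ≠ l) (hkl : k ≠ l) {β : ℚ} (hβ : 2 ≤ β) (ha : ξ a = -β) (hc : ξ c = -β) (hk : ξ k = 0) (hl : ξ l = β)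
    (hval : ∀ p, ξ p = -β ∨ ξ p = 0 ∨ ξ p = β) {y₁ y₂ : ℝ}
    (hy₁ : y₁ = β + #{p | ξ p ≤ 0})
    (hy₂ : y₂ = -β + #{p | ξ p ≤ -β}) :
    R.Del (1-y₂) a c k l *ᵥ x = 0 ∧ ∀ g₀ g₁ : ℝ,
      g₀ • (R.Z (-y₁) a l *ᵥ (R.Del (-y₁) a c k l *ᵥ x))+g₁ • (R.E a l *ᵥ (R.Del (-y₁) a c k l *ᵥ x)) = 0 →
      g₀ = 0 ∧ g₁ = 0 := by
  have hb : (2 : ℝ) ≤ β := mod_cast hβ; set L := y₁-y₂ with hL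
  have hL1 : 1 < L := by
    have : #{p | ξ p ≤ -β} ≤ #{p | ξ p ≤ 0} := card_le_card fun p hp => by grind
    have : (#{p | ξ p ≤ -β} : ℝ) ≤ #{p | ξ p ≤ 0} := by exact_mod_cast this
    linarith
  have yk : ∀ p, ξ p = -β → R.Y p k *ᵥ x = y₂ • (R.E p k *ᵥ x) := by
    intro p hp
    rw [h.Y_lt (by rw [hp, hk]; linarith) (fun q hq => by
      rcases hval q with h | h | h <;> rw [h] at hq ⊢ <;> linarith), hy₂]
    simp_all
  have ykl : R.Y k l *ᵥ x = y₁ • (R.E k l *ᵥ x) := by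
    rw [h.Y_lt (by rw [hk, hl]; linarith) (fun q hq => by
      rcases hval q with h | h | h <;> rw [h] at hq ⊢ <;> linarith), hy₁]
    simp_all
  have zk : ∀ u p, ξ p = -β → R.Z u p k *ᵥ x = (u+y₂) • (R.E p k *ᵥ x) := fun u p hp => by
    rw [R.Z_vec, yk p hp, add_smul]
  have hD : ∀ u, R.Del u a c k l *ᵥ x = (u-1+y₂) • (R.Z u a l *ᵥ (R.E c k *ᵥ x)-R.Z u c l *ᵥ (R.E a k *ᵥ x)) := by
    intro u
    rw [Del, sub_mulVec, ← mulVec_mulVec, ← mulVec_mulVec, zk _ c hc, zk _ a ha,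
      mulVec_smul, mulVec_smul, smul_sub]
  refine ⟨by rw [hD, show 1-y₂-1+y₂ = 0 by ring, zero_smul], fun g₀ g₁ hg => ?_⟩
  have bkl : R.Z (-y₁) k l *ᵥ x = 0 := by rw [R.Z_vec, ykl, ← add_smul, neg_add_cancel, zero_smul]
  have zc : R.E k c *ᵥ x = 0 := h.zero k c hck.symm (by rw [hk, hc]; linarith)
  have za : R.E k a *ᵥ x = 0 := h.zero k a hak.symm (by rw [hk, ha]; linarith)
  have zlk : R.E l k *ᵥ x = 0 := h.zero l k hkl.symm (by rw [hk, hl]; linarith)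
  have zac : R.E a c *ᵥ x = 0 := h.zero a c hac (by rw [ha, hc]); have s := fun p => R.E_self h.wt p
  set p := R.Z (-y₁) a l *ᵥ x with hp; set f := R.E a k *ᵥ (R.E a k *ᵥ x) with hf
  have hf0 : f ≠ 0 := R.E_E_ne_zero h.wt h.ne (by rw [ha, hk]; linarith) za
  have hf1 : R.E a k *ᵥ x ≠ 0 := fun h0 => hf0 (by rw [hf, h0, mulVec_zero])
  have hJ : R.E k c *ᵥ (R.Z (-y₁) a l *ᵥ (R.E c k *ᵥ x)-R.Z (-y₁) c l *ᵥ (R.E a k *ᵥ x)) = (β+1 : ℝ) • p := by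
    have e1 : R.E k c *ᵥ (R.E c k *ᵥ x) = (β : ℝ) • x := by
      rw [R.comm_vec, zc, if_pos rfl, if_pos rfl, s, s, hk, hc]; simp
    have e2 : R.E k c *ᵥ (R.E a k *ᵥ x) = 0 := by
      rw [R.comm_vec, zc, if_neg hac.symm, if_pos rfl, zac]; simp
    have e3 := R.E_Z_vec (-y₁) a k k l x
    rw [if_pos rfl, if_neg hal.symm, bkl, mulVec_zero, sub_zero] at e3
    rw [mulVec_sub, R.E_Z_vec, R.E_Z_vec, e1, e2, if_neg hac.symm, if_neg hkl.symm, if_pos rfl, if_neg hkl.symm,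
      mulVec_smul, mulVec_zero, add_smul, one_smul]
    grind
  have hJZ : ∀ y, R.E k c *ᵥ (R.Z (-y₁) a l *ᵥ y) = R.Z (-y₁) a l *ᵥ (R.E k c *ᵥ y) := fun y => by
    rw [R.E_Z_vec, if_neg hac.symm, if_neg hkl.symm]; simp
  have hJE : ∀ y, R.E k c *ᵥ (R.E a l *ᵥ y) = R.E a l *ᵥ (R.E k c *ᵥ y) := fun y => by
    rw [R.comm_vec, if_neg hac.symm, if_neg hkl.symm]; simp
  have hrel : g₀ • (R.Z (-y₁) a l *ᵥ p)+g₁ • (R.E a l *ᵥ p) = 0 := by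
    have := congrArg (fun v => R.E k c *ᵥ v) hg
    simp only [mulVec_add, mulVec_smul, hD, hJZ, hJE, hJ, mulVec_zero, smul_smul] at this
    have hne : (-y₁-1+y₂)*(β+1 : ℝ) ≠ 0 := mul_ne_zero (by rw [hL] at hL1; linarith) (by linarith)
    refine (smul_eq_zero.1 (?_ : ((-y₁-1+y₂)*(β+1 : ℝ)) • (_ : ι → ℝ) = 0)).resolve_left hne
    rw [smul_add, smul_smul, smul_smul, ← this]; congr 2 <;> ring
  have hK1 : R.E l k *ᵥ p = L • (R.E a k *ᵥ x) := by
    rw [hp, R.E_Z_vec, zlk, if_neg hak.symm, if_pos rfl, zk _ a ha, mulVec_zero, hL]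
    rw [← neg_smul_neg]; simp only [zero_sub, add_zero]
    rw [smul_neg, ← neg_smul, ← neg_smul]; congr 1; ring
  have hH1 : R.E k a *ᵥ p = 0 := by rw [hp, R.E_Z_vec, za, if_pos rfl, if_neg hkl.symm, bkl]; simp
  have hKk : R.E l k *ᵥ (R.E a k *ᵥ x) = 0 := by
    rw [R.comm_vec, zlk, if_neg hak.symm, if_neg hkl]; simp
  have hBk : R.Z (-y₁) a k *ᵥ (R.E a k *ᵥ x) = (-L) • f := by
    have := R.E_Z_vec (-y₁) a k a k x
    rw [if_neg hak.symm, zk _ a ha, mulVec_smul, add_zero, sub_zero] at this; grind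
  have hKB : ∀ y, R.E l k *ᵥ (R.Z (-y₁) a l *ᵥ y) = R.Z (-y₁) a l *ᵥ (R.E l k *ᵥ y)-R.Z (-y₁) a k *ᵥ y := fun y => by
    rw [R.E_Z_vec, if_neg hak.symm, if_pos rfl, add_zero]
  have hKE : ∀ y, R.E l k *ᵥ (R.E a l *ᵥ y) = R.E a l *ᵥ (R.E l k *ᵥ y)-R.E a k *ᵥ y := fun y => by
    rw [R.comm_vec, if_neg hak.symm, if_pos rfl, add_zero]
  have hKEk : ∀ y, R.E l k *ᵥ (R.E a k *ᵥ y) = R.E a k *ᵥ (R.E l k *ᵥ y) := fun y => by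
    rw [R.comm_vec, if_neg hak.symm, if_neg hkl]; simp
  have hKBk : ∀ y, R.E l k *ᵥ (R.Z (-y₁) a k *ᵥ y) = R.Z (-y₁) a k *ᵥ (R.E l k *ᵥ y) := fun y => by
    rw [R.E_Z_vec, if_neg hak.symm, if_neg hkl]; simp
  have hK2 : R.E l k *ᵥ (R.E l k *ᵥ (R.Z (-y₁) a l *ᵥ p)) = (2*L ^ 2) • f := by
    simp only [hKB, hK1, hKBk, mulVec_sub, mulVec_smul, hKk, hBk, mulVec_zero, zero_sub, smul_neg,
      smul_smul]
    module
  have hK3 : R.E l k *ᵥ (R.E l k *ᵥ (R.E a l *ᵥ p)) = (-2*L) • f := by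
    rw [hKE, hK1, mulVec_sub, mulVec_smul, mulVec_smul, hKE, hKk, hKEk, hK1, mulVec_zero,
      mulVec_smul, ← hf]
    module
  have hH2 : R.E k a *ᵥ (R.Z (-y₁) a l *ᵥ p) = -(R.E k l *ᵥ p) := by
    have e1 := congrArg (fun M : Matrix ι ι ℝ => M *ᵥ x) (R.Y_mul_Y (a := k) (b := l) (c := a) (d := l) hkl hal.symm hkl hal)
    simp only [sub_mulVec, add_mulVec, ← mulVec_mulVec, ykl, mulVec_smul] at e1
    have e2 := R.comm_vec k l a l x; have e3 := R.E_Z_vec 0 k l a l x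
    have e4 := R.E_Z_vec 0 a l k l x; rw [if_neg hal.symm, if_neg hkl.symm] at e2 e3
    rw [if_neg hkl.symm, if_neg hal.symm] at e4
    simp only [R.Z_vec, zero_smul, zero_add, add_zero, sub_zero, ykl, mulVec_smul] at e2 e3 e4
    rw [R.E_Z_vec, if_pos rfl, if_neg hkl.symm, hH1, hp]
    simp only [R.Z_vec, mulVec_add, mulVec_smul, mulVec_zero, smul_add, smul_zero, add_zero, zero_add,
      sub_zero, e1, e2, e3, ← e4]
    module
  have hH3 : R.E k a *ᵥ (R.E a l *ᵥ p) = R.E k l *ᵥ p := by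
    rw [R.comm_vec, if_pos rfl, if_neg hkl.symm, hH1]; simp
  have hg0 : R.E k l *ᵥ p ≠ 0 := by
    intro h0
    have hpw : p ∈ R.Wt (ξ+eps a-eps l) := by
      rw [hp, R.Z_vec, R.Y_vec]
      refine Submodule.add_mem _ (Submodule.smul_mem _ _ (R.E_mem_Wt h.wt _ _)) (Submodule.sum_mem _ fun q _ => ?_)
      have := R.E_mem_Wt (R.E_mem_Wt h.wt q l) a q
      rwa [show ξ+eps q-eps l+eps a-eps q = ξ+eps a-eps l by abel] at this
    have e1 : R.E l k *ᵥ (R.E k l *ᵥ p) = L • (R.E k l *ᵥ (R.E a k *ᵥ x))+(β-1 : ℝ) • p := by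
      rw [R.comm_vec, if_pos rfl, if_pos rfl, hK1, R.E_self hpw, R.E_self hpw, mulVec_smul]
      simp [hk, hl, hkl, hal.symm, hak.symm]
    have e2 : R.E l k *ᵥ (R.E k l *ᵥ (R.E a k *ᵥ x)) = (β+1 : ℝ) • (R.E a k *ᵥ x) := by
      rw [R.comm_vec, if_pos rfl, if_pos rfl, hKk, R.E_self (R.E_mem_Wt h.wt a k), R.E_self (R.E_mem_Wt h.wt a k)]
      simp [hk, hl, hkl.symm, hal.symm, hak.symm, add_smul]
    have e3 : R.E l k *ᵥ (R.E l k *ᵥ (R.E k l *ᵥ p)) = (2*β*L : ℝ) • (R.E a k *ᵥ x) := by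
      rw [e1, mulVec_add, mulVec_smul, mulVec_smul, e2, hK1]; module
    rw [h0, mulVec_zero, mulVec_zero] at e3; exact smul_ne_zero (by positivity) hf1 e3.symm
  have r1 := congrArg (fun v => R.E l k *ᵥ (R.E l k *ᵥ v)) hrel
  have r2 := congrArg (fun v => R.E k a *ᵥ v) hrel
  simp only [mulVec_add, mulVec_smul, hK2, hK3, hH2, hH3, mulVec_zero, smul_smul, smul_neg,
    ← neg_smul, ← add_smul] at r1 r2
  have q1 := (smul_eq_zero.1 r1).resolve_right hf0; have q2 := (smul_eq_zero.1 r2).resolve_right hg0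
  have q3 : g₁ = g₀ := by linarith
  have q4 : g₀*(2*L*(L-1)) = 0 := by grind
  have q5 : g₀ = 0 := (mul_eq_zero.1 q4).resolve_right (mul_ne_zero (by linarith) (by linarith))
  grind

lemma Ext.del_right (h : R.Ext ξ x) {a c k l : Fin m} (hac : a ≠ c) (hak : a ≠ k) (hal : a ≠ l) (hck : c ≠ k)
    (hcl : c ≠ l) (hkl : k ≠ l) {β : ℚ} (hβ : 2 ≤ β) (ha : ξ a = 0) (hc : ξ c = -β) (hk : ξ k = β) (hl : ξ l = β)
    (hval : ∀ p, ξ p = -β ∨ ξ p = 0 ∨ ξ p = β) {y₁ y₂ : ℝ}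
    (hy₁ : y₁ = β + #{p | ξ p ≤ 0})
    (hy₂ : y₂ = -β + #{p | ξ p ≤ -β}) :
    R.E a l *ᵥ (R.Del (1-y₂) a c k l *ᵥ x) ≠ 0 := by
  have hb : (2 : ℝ) ≤ β := mod_cast hβ; set n₁ := #{p | ξ p ≤ -β}; set n₂ := #{p | ξ p ≤ 0}
  have hn : (n₁ : ℝ) ≤ n₂ := by
    have : n₁ ≤ n₂ := card_le_card fun p hp => by grind
    exact_mod_cast this
  set L := y₁-y₂ with hL; have hLe : L = 2*β+n₂-n₁ := by rw [hL, hy₁, hy₂]; ring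
  have y : ∀ q, ξ q = β → R.Y a q *ᵥ x = y₁ • (R.E a q *ᵥ x) := by
    intro q hq
    rw [h.Y_lt (by rw [ha, hq]; linarith) (fun p hp => by
      rw [ha] at hp; rcases hval p with h | h | h <;> rw [h] at hp ⊢ <;> linarith), hy₁, ha, hq]
    aesop
  have z : ∀ u q, ξ q = β → R.Z u a q *ᵥ x = (u+y₁) • (R.E a q *ᵥ x) := fun u q hq => by
    rw [R.Z_vec, y q hq, add_smul]
  have zkc : R.E k c *ᵥ x = 0 := h.zero k c hck.symm (by rw [hk, hc]; linarith)
  have zac : R.E a c *ᵥ x = 0 := h.zero a c hac (by rw [ha, hc]; linarith)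
  have zkl : R.Z (-y₂) k l *ᵥ x = 0 := by
    rw [R.Z_vec, h.Y_eq hkl (by rw [hk, hl]), h.zero k l hkl (by rw [hk, hl])]; simp
  have hdiag : ∀ q, R.Z (-y₂) q q *ᵥ x = ((-y₂)*ξ q+(ξ q ^ 2 + ∑ p, (if ξ p < ξ q then ξ q-ξ p else 0) : ℚ) : ℝ) • x :=
    fun q => by rw [R.Z_vec, h.Y_self, R.E_self h.wt, smul_smul, ← add_smul]
  have hs1 : ∑ p, (if ξ p < ξ k then ξ k-ξ p else 0) = β*n₂+β*n₁ := by
    rw [hk, show β*n₂+β*n₁ = ∑ p, ((if ξ p ≤ 0 then β else 0)+if ξ p ≤ -β then β else 0) by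
      rw [sum_add_distrib, ← sum_filter, ← sum_filter, sum_const, sum_const]
      grind]
    refine sum_congr rfl fun p _ => ?_; grind
  have hs2 : ∑ p, (if ξ p < ξ c then ξ c-ξ p else 0) = 0 := by
    refine sum_eq_zero fun p _ => ?_; grind
  have key : R.E k c *ᵥ (R.Del (1-y₂) a c k l *ᵥ x) = ((1+L)*((β+1)*L) : ℝ) • (R.E a l *ᵥ x) := by
    have e1 : R.E k c *ᵥ (R.E a l *ᵥ x) = 0 := by
      rw [R.comm_vec, zkc, if_neg hac.symm, if_neg hkl.symm]; simp
    have e2 : R.E k c *ᵥ (R.E a k *ᵥ x) = 0 := by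
      rw [R.comm_vec, zkc, if_neg hac.symm, if_pos rfl, zac]; simp
    have e3 := R.E_Z_vec (-y₂) a k k l x
    rw [if_pos rfl, if_neg hal.symm, zkl, mulVec_zero, sub_zero, z _ l hl, eq_comm, ← eq_neg_iff_add_eq_zero] at e3
    have e4 : ∀ q, q ≠ a → q ≠ l → R.Z (-y₂) q q *ᵥ (R.E a l *ᵥ x) = R.E a l *ᵥ (R.Z (-y₂) q q *ᵥ x) := by
      intro q h1 h2; rw [R.E_Z_vec, if_neg h2.symm, if_neg h1]; simp
    rw [R.Del_eq _ hak hal hck hcl, show 1-y₂-1 = -y₂ by ring, sub_mulVec, ← mulVec_mulVec,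
      ← mulVec_mulVec, z _ l hl, z _ k hk, mulVec_smul, mulVec_smul, ← smul_sub, mulVec_smul,
      mulVec_sub, R.E_Z_vec, R.E_Z_vec, e1, e2, if_pos rfl, if_pos rfl, if_pos rfl, if_neg hkl.symm,
      e4 k hak.symm hkl, e4 c hac.symm hcl, hdiag, hdiag, e3, hs1, hs2, hk, hc]
    simp only [mulVec_smul, mulVec_zero, zero_add, sub_zero]
    rw [← sub_smul, ← neg_smul, ← sub_smul, smul_smul]; congr 1; push_cast; grind
  intro h0; have h1 := congrArg (fun v => R.E k c *ᵥ v) h0; simp only [mulVec_zero] at h1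
  rw [R.comm_vec, if_neg hac.symm, if_neg hkl.symm, key, mulVec_smul, add_zero, sub_zero] at h1
  have hLp : 0 < L := by rw [hLe]; linarith
  refine smul_ne_zero (by positivity) (R.E_E_ne_zero h.wt h.ne (by rw [ha, hl]; linarith) ?_) h1
  exact h.zero l a hal.symm (by rw [ha, hl]; linarith)

end Rep
namespace Rep
variable {m : ℕ} {ι : Type} [Fintype ι] [DecidableEq ι] (R : Rep m ι)

/-- The action of the generators on endomorphisms. -/
def ad (i j : Fin m) (φ : Matrix ι ι ℝ) : Matrix ι ι ℝ := R.E i j*φ-φ*R.E i j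

lemma ad_mul (i j : Fin m) (φ ψ : Matrix ι ι ℝ) : R.ad i j (φ*ψ) = R.ad i j φ*ψ+φ*R.ad i j ψ := by
  unfold ad; noncomm_ring

lemma ad_sub (i j : Fin m) (φ ψ : Matrix ι ι ℝ) : R.ad i j (φ-ψ) = R.ad i j φ-R.ad i j ψ := by
  unfold ad; noncomm_ring

lemma ad_Z (u : ℝ) (i j k l : Fin m) : R.ad i j (R.Z u k l)
    = (if j = k then R.Z u i l else 0)-if l = i then R.Z u k j else 0 := by
  rw [ad, R.E_mul_Z]; abel

lemma mem_Inv_of_ad {κ : ℚ^m} {φ : Matrix ι ι ℝ} (h1 : ∀ i, R.ad i i φ = (κ i : ℝ) • φ)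
    (h2 : ∀ i j, i < j → R.ad i j φ = 0) : (fun p : ι × ι => φ p.1 p.2) ∈ (R.tensor R.dual).Inv κ := by
  refine mem_Inv.2 ⟨fun p hp => ?_, fun i j hij => ?_⟩
  · obtain ⟨i, hi⟩ := Function.ne_iff.1 hp; have := congrFun (congrFun (h1 i) p.1) p.2
    rw [ad, R.diag, Matrix.sub_apply, diagonal_mul, mul_diagonal, Matrix.smul_apply, smul_eq_mul] at this
    refine (mul_eq_zero.1 (?_ : ((((R.tensor R.dual).wt p i : ℚ) : ℝ)-κ i)*φ p.1 p.2 = 0)).resolve_left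
      (sub_ne_zero.2 (mod_cast hi))
    simp only [tensor, dual, Pi.add_apply, Pi.neg_apply]; push_cast
    linear_combination this
  · ext p; have := congrFun (congrFun (h2 i j hij) p.1) p.2
    rw [ad, Matrix.sub_apply, Matrix.mul_apply, Matrix.mul_apply, Matrix.zero_apply] at this
    rw [Pi.zero_apply, ← this]
    simp only [mulVec, dotProduct, tensor, dual, Matrix.add_apply, kroneckerMap_apply, Fintype.sum_prod_type, add_mul, sum_add_distrib,
      one_apply, mul_ite, ite_mul, mul_one, one_mul, mul_zero, zero_mul, sum_ite_eq, mem_univ, if_true, sum_ite_irrel,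
      sum_const_zero, Matrix.neg_apply, neg_mul, sum_neg_distrib, sub_eq_add_neg]
    congr 2; exact sum_congr rfl fun d _ => by rw [R.symm_apply j i, mul_comm]

lemma ad_Del {a c k l : Fin m} (hak : a ≠ k) (hal : a ≠ l) (hck : c ≠ k) (hcl : c ≠ l)
    (ho : ∀ i j, i < j → j ≠ a ∧ i ≠ l ∧ (j = c → i = a) ∧ (i = k → j = l)) (w u : ℝ) :
    (fun p : ι × ι => (R.Z w a l*R.Del u a c k l) p.1 p.2)
      ∈ (R.tensor R.dual).Inv (eps a-eps l+(eps a-eps l)+(eps c-eps k)) := by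
  refine R.mem_Inv_of_ad (fun i => ?_) fun i j hij => ?_
  · have hz : ∀ u k l, R.ad i i (R.Z u k l) = (((eps k-eps l : ℚ^m) i : ℚ) : ℝ) • R.Z u k l := by
      intro u k l; rw [ad_Z]
      by_cases h1 : i = k <;> by_cases h2 : l = i <;> simp [h1, h2, Pi.single_apply, sub_smul]
      all_goals (try subst h1); simp_all [eq_comm]
    rw [Del, ad_mul, ad_sub, ad_mul, ad_mul, hz, hz, hz, hz, hz]
    simp only [smul_mul, Matrix.mul_smul, mul_sub, mul_add, Pi.add_apply, Pi.sub_apply, smul_sub]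
    push_cast; module
  · obtain ⟨h1, h2, h3, h4⟩ := ho i j hij
    have e0 : ∀ u, R.ad i j (R.Z u a l) = 0 := fun u => by rw [ad_Z, if_neg h1, if_neg (Ne.symm h2), sub_zero]
    have e1 : R.Del u a c l l = 0 := by rw [R.Del_eq u hal hal hcl hcl, sub_self]
    rw [ad_mul, e0, Matrix.zero_mul, zero_add, Del, ad_sub, ad_mul, ad_mul, e0, ad_Z, ad_Z, ad_Z, if_neg h1, if_neg (Ne.symm h2),
      Matrix.zero_mul, zero_add]
    have e2 : (if j = c then R.Z u i l else 0) = if j = c then R.Z u a l else 0 := by grind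
    have e3 : (if j = c then R.Z (u-1) i k else 0) = if j = c then R.Z (u-1) a k else 0 := by grind
    rw [e2, e3]; by_cases h : k = i
    · rw [if_pos h, if_pos h, h4 h.symm]; unfold Del at e1
      split_ifs <;> simp only [mul_sub, Matrix.zero_mul, sub_zero, zero_sub, mul_neg] <;>
        rw [show R.Z u a l*R.Z (u-1) c l = R.Z u c l*R.Z (u-1) a l from sub_eq_zero.1 e1] <;> noncomm_ring
    · rw [if_neg h, if_neg h]; split_ifs <;> simp

variable {R} {lam : ℚ^m}

lemma IsIrr.wt_ne (h : R.IsIrr lam) {ξ : ℚ^m} (hξ : ∑ i, lam i ^ 2 ≤ ∑ i, ξ i ^ 2) {p q : Fin m} (hpq : p ≠ q)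
    (hle : ξ q ≤ ξ p) (a : ι) : R.wt a ≠ ξ+eps p-eps q := by
  intro hc; have h1 := h.sq_le a
  have h2 : ∀ i, (ξ+eps p-eps q : ℚ^m) i ^ 2 = ξ i ^ 2+(if i = p then 2*ξ i+1 else 0)
      + if i = q then 1-2*ξ i else 0 := by
    intro i; simp only [Pi.add_apply, Pi.sub_apply, Pi.single_apply]; grind
  rw [hc, sum_congr rfl fun i _ => h2 i, sum_add_distrib, sum_add_distrib] at h1
  simp only [sum_ite_eq', mem_univ, if_true] at h1; linarith

lemma IsIrr.exists_ext (h : R.IsIrr lam) (σ : Perm (Fin m)) : ∃ x, R.Ext (lam ∘ σ) x := by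
  obtain ⟨a, ha⟩ := R.exists_wt (ν := lam ∘ σ) (by rw [h.ch_perm, h.ch_lam]; exact one_pos)
  have hx : Pi.single a 1 ∈ R.Wt (lam ∘ σ) := fun c hc => Pi.single_eq_of_ne (by rintro rfl; exact hc ha) _
  exact ⟨Pi.single a 1, hx, by simp, fun p q hpq hle => R.E_eq_zero hx
    (h.wt_ne (Equiv.sum_comp σ fun i => lam i ^ 2).ge hpq hle)⟩

end Rep

lemma exists_perm {x y : Fin 4 → Fin m} (hx : Injective x) (hy : Injective y) :
    ∃ σ : Perm (Fin m), ∀ i, σ (x i) = y i := by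
  obtain ⟨σ, hσ⟩ := (Perm.isMultiplyPretransitive (Fin m) 4).exists_smul_eq ⟨x, hx⟩ ⟨y, hy⟩
  exact ⟨σ, fun i => DFunLike.congr_fun hσ i⟩

lemma injective_vec {a c k l : Fin m} (h1 : a ≠ c) (h2 : a ≠ k) (h3 : a ≠ l) (h4 : c ≠ k) (h5 : c ≠ l) (h6 : k ≠ l) :
    Injective ![a, c, k, l] := by
  simp [Injective, Fin.forall_fin_succ, h1, h2, h3, h4, h5, h6, h1.symm, h2.symm, h3.symm, h4.symm, h5.symm, h6.symm]

lemma Rep.dual_ch {ι : Type} [Fintype ι] [DecidableEq ι] {R : Rep (r+1) ι}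
    (hneg : ∀ v, R.ch.coeff (-v) = R.ch.coeff v) : R.dual.ch = R.ch := by
  obtain ⟨π, hπ⟩ := exists_neg_equiv hneg; unfold Rep.ch; rw [← Equiv.sum_comp π]
  simp [Rep.dual, hπ]

lemma three_le_kappa {ι : Type} [Fintype ι] [DecidableEq ι] {R : Rep (r+1) ι} {lam : ℚ^(r+1)}
    (h : R.IsIrr lam) (hneg : ∀ v, R.ch.coeff (-v) = R.ch.coeff v) {a c k l q : Fin (r+1)}
    (hac : a ≠ c) (hkl : k ≠ l) (ho : ∀ i j, i < j → j ≠ a ∧ i ≠ l ∧ (j = c → i = a) ∧ (i = k → j = l))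
    {β : ℚ} (hβ : 2 ≤ β) (ha : lam a = β) (hc : lam c = β) (hq : lam q = 0) (hk : lam k = -β) (hl : lam l = -β)
    (hval : ∀ p, lam p = -β ∨ lam p = 0 ∨ lam p = β) :
    3 ≤ (R.ch*R.ch*alt ℤ (rho (r+1))).coeff
      (eps a-eps l+(eps a-eps l)+(eps c-eps k)+rho (r+1)) := by
  have hne : ∀ {i j}, lam i ≠ lam j → i ≠ j := fun h h' => h (by rw [h'])
  have hak : a ≠ k := hne (by rw [ha, hk]; linarith)
  have hal : a ≠ l := hne (by rw [ha, hl]; linarith)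
  have hck : c ≠ k := hne (by rw [hc, hk]; linarith)
  have hcl : c ≠ l := hne (by rw [hc, hl]; linarith)
  have hqa : q ≠ a := hne (by rw [ha, hq]; linarith)
  have hqc : q ≠ c := hne (by rw [hc, hq]; linarith)
  have hqk : q ≠ k := hne (by rw [hk, hq]; linarith)
  have hql : q ≠ l := hne (by rw [hl, hq]; linarith)
  have hx := injective_vec hac hak hal hck hcl hkl
  obtain ⟨σ, hσ⟩ := exists_perm hx (injective_vec hkl hqk.symm hak.symm hql.symm hal.symm hqa)
  obtain ⟨τ, hτ⟩ := exists_perm hx (injective_vec hql hqa hqc hal.symm hcl.symm hac)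
  have s0 := hσ 0; have s1 := hσ 1; have s2 := hσ 2; have s3 := hσ 3
  have t0 := hτ 0; have t1 := hτ 1; have t2 := hτ 2; have t3 := hτ 3
  simp at s0 s1 s2 s3 t0 t1 t2 t3; obtain ⟨x, hx⟩ := h.exists_ext σ
  obtain ⟨x', hx'⟩ := h.exists_ext τ
  have hcard : ∀ (σ : Perm (Fin (r+1))) (z : ℚ), #{p | lam p ≤ z}
      = #{p | (lam ∘ σ) p ≤ z} := fun σ z => (card_equiv σ (by simp)).symm
  obtain ⟨h1, h2⟩ := hx.del_left hac hak hal hck hcl hkl hβ (by simp [s0, hk]) (by simp [s1, hl]) (by simp [s2, hq])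
    (by simp [s3, ha]) (fun p => hval _) (by rw [← hcard]) (by rw [← hcard])
  have h3 := hx'.del_right hac hak hal hck hcl hkl hβ (by simp [t0, hq]) (by simp [t1, hl]) (by simp [t2, ha])
    (by simp [t3, hc]) (fun p => hval _) (by rw [← hcard]) (by rw [← hcard])
  set y₁ : ℝ := β + #{p | lam p ≤ 0}; set y₂ : ℝ := -β + #{p | lam p ≤ -β}
  have hE : R.E a l = R.Z 1 a l-R.Z 0 a l := by simp [Rep.Z]
  set κ : ℚ^(r+1) := eps a-eps l+(eps a-eps l)+(eps c-eps k); have hZ := R.ad_Del hak hal hck hcl ho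
  let V : Fin 3 → Matrix ι ι ℝ := ![R.Z (-y₁) a l*R.Del (-y₁) a c k l, R.E a l*R.Del (-y₁) a c k l,
    R.E a l*R.Del (1-y₂) a c k l]
  have hV : ∀ i, (fun p : ι × ι => V i p.1 p.2) ∈ (R.tensor R.dual).Inv κ := by
    have hEm : ∀ u, (fun p : ι × ι => (R.E a l*R.Del u a c k l) p.1 p.2) ∈ (R.tensor R.dual).Inv κ := fun u => by
      rw [hE, sub_mul]; exact Submodule.sub_mem _ (hZ 1 u) (hZ 0 u)
    intro i; fin_cases i
    exacts [hZ _ _, hEm _, hEm _]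
  have hli : LinearIndependent ℝ fun i => (⟨_, hV i⟩ : (R.tensor R.dual).Inv κ) := by
    refine Fintype.linearIndependent_iff.2 fun g hg => ?_
    have hm : ∑ i, g i • V i = 0 := by
      ext p q; have := congrFun (congrArg Subtype.val hg) (p, q)
      simpa [Matrix.sum_apply] using this
    have hv : ∀ y, g 0 • (R.Z (-y₁) a l *ᵥ (R.Del (-y₁) a c k l *ᵥ y))+g 1 • (R.E a l *ᵥ (R.Del (-y₁) a c k l *ᵥ y))
        + g 2 • (R.E a l *ᵥ (R.Del (1-y₂) a c k l *ᵥ y)) = 0 := fun y => by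
      have := congrArg (fun M : Matrix ι ι ℝ => M *ᵥ y) hm
      simpa [Fin.sum_univ_three, V, add_mulVec, smul_mulVec, ← mulVec_mulVec] using this
    have e1 := hv x; rw [h1, mulVec_zero, smul_zero, add_zero] at e1; obtain ⟨g0, g1⟩ := h2 _ _ e1
    have e2 := hv x'; rw [g0, g1, zero_smul, zero_smul, zero_add, zero_add] at e2
    have g2 := (smul_eq_zero.1 e2).resolve_right h3; intro i; fin_cases i
    exacts [g0, g1, g2]
  have h4 := hli.fintype_card_le_finrank; have h5 := hli.ne_zero 0
  have h6 := (R.tensor R.dual).finrank_Inv (Rep.antitone_of_Inv (hV 0) fun h => h5 (Subtype.ext h))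
  rw [Rep.tensor_ch, Rep.dual_ch hneg] at h6; rw [← h6]; simpa using h4

/-! ### Weights of large multiplicity -/

section
variable {r : ℕ} {ι : Type} [Fintype ι] [DecidableEq ι] {R : Rep (r+1) ι} {lam : ℚ^(r+1)}

lemma coeff_sub_add_le (h : R.IsIrr lam) {i k l : Fin (r+1)} (hik : lam k < lam i) (hkl : lam l < lam k) :
    R.ch.coeff (lam+eps k-eps i)+1 ≤ R.ch.coeff (lam+eps l-eps i) := by
  have hne : ∀ {i j}, lam i < lam j → j ≠ i := fun h h' => by rw [h'] at h; exact lt_irrefl _ h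
  have := R.coeff_add_le hik hkl (h.wt_ne le_rfl (hne hik) hik.le) (h.wt_ne le_rfl (hne hkl) hkl.le)
  rwa [h.ch_lam] at this

lemma two_le_coeff (h : R.IsIrr lam) {i k l : Fin (r+1)} (hik : lam k < lam i) (hkl : lam l < lam k) :
    2 ≤ R.ch.coeff (lam+eps l-eps i) := by
  have h1 := coeff_sub_add_le h hik hkl; have h2 := R.coeff_le_sub_root hik
  rw [h.ch_lam, show lam-(eps i-eps k) = lam+eps k-eps i by abel] at h2; linarith

lemma IsIrr_wt_le (h : R.IsIrr lam) (a : ι) (j : Fin (r+1)) : R.wt a j ≤ lam 0 := by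
  have hpos : 0 < R.ch.coeff (R.wt a ∘ swap 0 j) := by
    rw [h.ch_perm, Rep.ch_coeff]; exact_mod_cast card_pos.2 ⟨a, by simp⟩
  obtain ⟨c, hc⟩ := R.exists_wt hpos; have h1 := (h.cone_wt c).1 1
  have h2 := ps_succ (lam-R.wt c) 0; simp only [val_zero, zero_add] at h2; rw [h2, hc] at h1
  simp [ps] at h1; exact h1

lemma le_IsIrr_wt (h : R.IsIrr lam) (hneg : ∀ v, R.ch.coeff (-v) = R.ch.coeff v) (a : ι) (j : Fin (r+1)) :
    -lam 0 ≤ R.wt a j := by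
  obtain ⟨π, hπ⟩ := exists_neg_equiv hneg; have := IsIrr_wt_le h (π a) j
  rw [hπ, Pi.neg_apply] at this; linarith

lemma four_le_coeff (h : R.IsIrr lam) (hneg : ∀ v, R.ch.coeff (-v) = R.ch.coeff v) {a c k l q : Fin (r+1)} (hac : a ≠ c)
    (hkl : k ≠ l) {β : ℚ} (hβ : 2 ≤ β) (h0 : lam 0 = β) (ha : lam a = β) (hc : lam c = β) (hq : lam q = 0)
    (hk : lam k = -β) (hl : lam l = -β) : 4 ≤ R.ch.coeff (lam+eps l-eps a+eps k-eps c) := by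
  have hne : ∀ {i j}, lam i ≠ lam j → i ≠ j := fun h h' => h (by rw [h'])
  have hal : a ≠ l := hne (by rw [ha, hl]; linarith)
  have hak : a ≠ k := hne (by rw [ha, hk]; linarith)
  have hck : c ≠ k := hne (by rw [hc, hk]; linarith)
  have hcl : c ≠ l := hne (by rw [hc, hl]; linarith)
  have hqa : q ≠ a := hne (by rw [ha, hq]; linarith)
  have hqc : q ≠ c := hne (by rw [hc, hq]; linarith)
  have hqk : q ≠ k := hne (by rw [hk, hq]; linarith)
  have hql : q ≠ l := hne (by rw [hl, hq]; linarith)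
  have h2 := two_le_coeff h (i := a) (k := q) (l := l) (by rw [ha, hq]; linarith) (by rw [hl, hq]; linarith)
  set ν := lam+eps l-eps a with hν; have νc : ν c = β := by simp_all
  have νq : ν q = 0 := by simp [hν, hq, hqa, hql]
  have νk : ν k = -β := by simp_all
  have h3 := R.coeff_add_le (μ := ν) (i := c) (k := q) (l := k) (by rw [νc, νq]; linarith) (by rw [νk, νq]; linarith)
    (fun p hp => by
      have := IsIrr_wt_le h p c; rw [hp] at this; simp [νc, hqc.symm, h0] at this
      linarith)
    (fun p hp => by
      have := le_IsIrr_wt h hneg p k; rw [hp] at this; simp [νk, hqk.symm, h0] at this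
      linarith)
  have h4 := R.coeff_le_sub_root (ν := ν) (i := c) (j := q) (by rw [νc, νq]; linarith)
  rw [show ν-(eps c-eps q) = ν+eps q-eps c by abel] at h4; linarith

/-- The height functional. -/
def ht (r : ℕ) : ℝ^(r+1) := fun i => -((i : ℕ) : ℝ)

lemma strictAnti_ht (r : ℕ) : StrictAnti (ht r) := fun i j hij => by
  have : ((i : ℕ) : ℝ) < ((j : ℕ) : ℝ) := mod_cast hij; simp only [ht]; linarith

lemma exists_simple {μ : ℚ^(r+1)} (hs : ∑ i, μ i = 0) (hpos : 0 < dotHom (ht r) μ) :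
    ∃ i : Fin r, μ i.succ < μ i.castSucc := by
  by_contra! hno; have hm : Monotone μ := Fin.monotone_iff_le_succ.2 hno
  have hv : Monovary (fun i : Fin (r+1) => ((i : ℕ) : ℝ)) fun i => (μ i : ℝ) := fun i j hij => by
    have : i < j := by
      by_contra! h'; have := hm h'; have : (μ j : ℝ) ≤ μ i := mod_cast this; linarith
    exact Nat.cast_le.2 (le_def.1 this.le)
  have h1 := hv.sum_mul_sum_le_card_mul_sum; have h2 : ∑ i, (μ i : ℝ) = 0 := mod_cast hs
  have h3 : dotHom (ht r) μ = -∑ i : Fin (r+1), ((i : ℕ) : ℝ)*μ i := by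
    rw [dotHom_apply, ← sum_neg_distrib]; exact sum_congr rfl fun i _ => by simp [ht]
  rw [h2, mul_zero, Fintype.card_fin] at h1
  have : 0 ≤ ∑ i : Fin (r+1), ((i : ℕ) : ℝ)*μ i := nonneg_of_mul_nonneg_right h1 (by positivity)
  linarith

lemma ht_simple (i : Fin r) : ht r i.castSucc-ht r i.succ = 1 := by simp [ht]

lemma exists_multi (hs : ∀ a, ∑ i, R.wt a i = 0) {c : ℕ} (hc : 1 ≤ c) : ∀ (j : ℕ) (μ : ℚ^(r+1)),
    2 ≤ R.ch.coeff μ → dotHom (ht r) μ = c+j → ∃ (i : Fin r) (μ : ℚ^(r+1)), 2 ≤ R.ch.coeff μ ∧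
      2 ≤ R.ch.coeff (μ-(eps i.castSucc-eps i.succ)) ∧ dotHom (ht r) μ = c := by
  intro j; have hc' : (1 : ℝ) ≤ c := mod_cast hc
  induction j with
  | zero =>
    intro μ h2 hμ; obtain ⟨a, ha⟩ := R.exists_wt (by linarith : 0 < R.ch.coeff μ)
    obtain ⟨i, hi⟩ := exists_simple (ha ▸ hs a) (by rw [hμ]; push_cast; linarith)
    exact ⟨i, μ, h2, h2.trans (R.coeff_le_sub_root hi), by simpa using hμ⟩
  | succ j ih =>
    intro μ h2 hμ; obtain ⟨a, ha⟩ := R.exists_wt (by linarith : 0 < R.ch.coeff μ)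
    obtain ⟨i, hi⟩ := exists_simple (ha ▸ hs a) (by rw [hμ]; positivity)
    refine ih _ (h2.trans (R.coeff_le_sub_root hi)) ?_
    rw [map_sub, dot_root, ht_simple, hμ]; push_cast; ring

end

/-! ### Functionals separating the weights -/

lemma digits_unique {M : ℤ} : ∀ {k : ℕ} (u : Fin k → ℤ), (∀ i, |u i| < M) → ∑ i, u i*M ^ (i : ℕ) = 0 → u = 0 := by
  intro k
  induction k with
  | zero => intro u _ _; ext i; exact i.elim0
  | succ k ih =>
    intro u hu h; rw [sum_univ_succ] at h
    have e : ∑ i : Fin k, u i.succ*M ^ ((i.succ : Fin (k+1)) : ℕ) = M * ∑ i : Fin k, u i.succ*M ^ (i : ℕ) := by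
      rw [mul_sum]; exact sum_congr rfl fun i _ => by rw [Fin.val_succ, pow_succ]; ring
    rw [e, val_zero, pow_zero, mul_one] at h
    have h0 : u 0 = 0 := Int.eq_zero_of_abs_lt_dvd ⟨-∑ i : Fin k, u i.succ*M ^ (i : ℕ), by linarith⟩ (hu 0)
    have hM : M ≠ 0 := (lt_of_le_of_lt (abs_nonneg _) (hu 0)).ne'; rw [h0, zero_add] at h
    have := ih (fun i => u i.succ) (fun i => hu _) ((mul_eq_zero.1 h).resolve_left hM); ext i
    refine Fin.cases h0 (fun i => congrFun this i) i

/-- A functional separating small integral weights. -/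
def sep (r M : ℕ) : ℝ^(r+1) := fun i => -(M : ℝ) ^ (i : ℕ)

section
variable {r M : ℕ}

lemma strictAnti_sep (hM : 2 ≤ M) : StrictAnti (sep r M) := fun i j hij => by
  have : (M : ℝ) ^ (i : ℕ) < (M : ℝ) ^ (j : ℕ) := pow_lt_pow_right₀ (mod_cast hM) hij
  simp only [sep]; linarith

lemma sep_min (hM : 2 ≤ M) {i j : Fin (r+1)} (hi : (i : ℕ) = 0) (hj : (j : ℕ) = 1) (p q : Fin (r+1)) (hpq : p < q) :
    sep r M i-sep r M j ≤ sep r M p-sep r M q := by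
  have h1 : (2 : ℝ) ≤ M := mod_cast hM
  have h2 : (M : ℝ) ^ ((p : ℕ)+1) ≤ (M : ℝ) ^ (q : ℕ) := pow_le_pow_right₀ (by linarith) hpq
  have h3 : (1 : ℝ) ≤ (M : ℝ) ^ (p : ℕ) := one_le_pow₀ (by linarith)
  simp only [sep, hi, hj, pow_zero, pow_one]; rw [pow_succ] at h2; nlinarith

lemma sep_int (hM : 2 ≤ M) {v : ℚ^(r+1)} {u : Fin (r+1) → ℤ} (hu : ∀ i, v i = u i) :
    dotHom (sep r M) v = ((-∑ i, u i*(M : ℤ) ^ (i : ℕ) : ℤ) : ℝ) := by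
  rw [dotHom_apply]; push_cast; rw [← sum_neg_distrib]
  exact sum_congr rfl fun i _ => by rw [hu]; simp only [sep]; push_cast; ring

lemma sep_eq_zero (hM : 2 ≤ M) {v : ℚ^(r+1)} (hi : Intg v) (hb : ∀ i, |v i| < M) (h : dotHom (sep r M) v = 0) : v = 0 := by
  choose u hu using hi; rw [sep_int hM hu] at h
  have := digits_unique u (M := M) (fun i => by have := hb i; rw [hu] at this; exact_mod_cast this)
    (by have := Int.cast_eq_zero.1 h; linarith)
  ext i; rw [hu, this]; simp

lemma sep_ge (hM : 2 ≤ M) {v : ℚ^(r+1)} (hi : Intg v) (hs : ∑ i, v i = 0) {i j : Fin (r+1)} (hi0 : (i : ℕ) = 0)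
    (hj : (j : ℕ) = 1) (h : 0 < dotHom (sep r M) v) : sep r M i-sep r M j ≤ dotHom (sep r M) v := by
  choose u hu using hi
  have hs' : ∑ i, u i = 0 := by
    have : ∑ i, (u i : ℚ) = 0 := by simp_all
    exact_mod_cast this
  have hd : (M : ℤ)-1 ∣ -∑ i, u i*(M : ℤ) ^ (i : ℕ) := by
    rw [dvd_neg, show ∑ i, u i*(M : ℤ) ^ (i : ℕ) = ∑ i : Fin (r+1), u i*((M : ℤ) ^ (i : ℕ)-1) by
      simp only [mul_sub, sum_sub_distrib, mul_one, hs', sub_zero]]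
    exact dvd_sum fun i _ => (sub_one_dvd_pow_sub_one _ _).mul_left _
  rw [sep_int hM hu] at h ⊢; have := Int.le_of_dvd (mod_cast h) hd
  have : (((M : ℤ)-1 : ℤ) : ℝ) ≤ ((-∑ i, u i*(M : ℤ) ^ (i : ℕ) : ℤ) : ℝ) := mod_cast this
  refine le_trans (le_of_eq ?_) this; simp [sep, hi0, hj]; ring

end

/-! ### Wedging with the top vectors -/

section
variable {r N : ℕ} {ι : Type} [Fintype ι] [DecidableEq ι] {R : Rep (r+1) ι} {e : Fin N ≃ ι}

lemma pull_fock (i j : Fin (r+1)) (x : Finset (Fin N) → ℝ) :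
    (R.pull e (fock N)).E i j *ᵥ x = ∑ a, ∑ b, R.E i j (e a) (e b) • fockOp a b x := by
  simp only [Rep.pull, sum_mulVec, smul_mulVec, fock_E]

lemma pull_cr (i j : Fin (r+1)) (c : Fin N) (x : Finset (Fin N) → ℝ) : (R.pull e (fock N)).E i j *ᵥ cr c x
    = cr c ((R.pull e (fock N)).E i j *ᵥ x) + ∑ a, R.E i j (e a) (e c) • cr a x := by
  simp only [pull_fock, map_sum, map_smul, fockOp_cr, smul_add, sum_add_distrib, smul_ite, smul_zero, sum_ite_eq', mem_univ,
    if_true]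

lemma an_pull (i j : Fin (r+1)) (c : Fin N) (x : Finset (Fin N) → ℝ) : an c ((R.pull e (fock N)).E i j *ᵥ x)
    = (R.pull e (fock N)).E i j *ᵥ an c x + ∑ b, R.E i j (e c) (e b) • an b x := by
  simp only [pull_fock, map_sum, map_smul, fockOp_an, smul_sub, sum_sub_distrib, smul_ite, smul_zero, sum_ite_irrel,
    sum_const_zero, sum_ite_eq, mem_univ, if_true, sub_add_cancel]

lemma pull_fock_wt (S : Finset (Fin N)) : (R.pull e (fock N)).wt S = ∑ a ∈ S, R.wt (e a) := by
  change ∑ a, (if a ∈ S then (1 : ℚ) else 0) • R.wt (e a) = _; simp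

lemma pull_fock_card {i j : Fin (r+1)} {S T : Finset (Fin N)} (h : S.card ≠ T.card) :
    (R.pull e (fock N)).E i j S T = 0 := by
  simp only [Rep.pull, Matrix.sum_apply, Matrix.smul_apply]
  exact sum_eq_zero fun a _ => sum_eq_zero fun b _ => by
    rw [not_not.1 fun h' => h (fockOp_card (a := a) (b := b) h'), smul_zero]

/-- Extension by zero to the Fock space. -/
def hat (k : ℕ) : ({S : Finset (Fin N) // S.card = k} → ℝ) →ₗ[ℝ] (Finset (Fin N) → ℝ) where
  toFun x S := if h : S.card = k then x ⟨S, h⟩ else 0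
  map_add' x y := by aesop
  map_smul' c x := by aesop

lemma hat_of_ne (x : {S : Finset (Fin N) // S.card = k} → ℝ) {S : Finset (Fin N)} (h : S.card ≠ k) :
    hat k x S = 0 := dif_neg h

lemma pull_ext_E (i j : Fin (r+1)) {y : Finset (Fin N) → ℝ} (hy : ∀ S, S.card ≠ k → y S = 0)
    (S : {S : Finset (Fin N) // S.card = k}) :
    ((R.pull e (ext N k)).E i j *ᵥ fun T => y T.1) S = ((R.pull e (fock N)).E i j *ᵥ y) S.1 := by
  have h1 : ∀ T, (R.pull e (ext N k)).E i j S T = (R.pull e (fock N)).E i j S.1 T.1 := fun T => by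
    simp only [Rep.pull, Matrix.sum_apply, Matrix.smul_apply]; rfl
  simp only [mulVec, dotProduct, h1]
  rw [← sum_subtype (univ.filter fun T : Finset (Fin N) => T.card = k) (by simp)
    fun T => (R.pull e (fock N)).E i j S.1 T*y T, sum_filter]
  grind

lemma hat_mem_Inv {μ : ℚ^(r+1)} {x : {S : Finset (Fin N) // S.card = k} → ℝ}
    (hx : x ∈ (R.pull e (ext N k)).Inv μ) : hat k x ∈ (R.pull e (fock N)).Inv μ := by
  refine ⟨fun S hS => ?_, fun i j hij => ?_⟩
  · by_cases h : S.card = k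
    · exact (dif_pos h).trans (hx.1 ⟨S, h⟩ (by rwa [pull_ext_wt, ← pull_fock_wt]))
    · exact hat_of_ne x h
  · ext S; by_cases h : S.card = k
    · rw [← pull_ext_E i j (fun S => hat_of_ne x) ⟨S, h⟩]
      have : (fun T : {S : Finset (Fin N) // S.card = k} => hat k x T.1) = x := funext fun T => dif_pos T.2
      rw [this, hx.2 i j hij]; rfl
    · rw [Pi.zero_apply, mulVec, dotProduct]; refine sum_eq_zero fun T _ => ?_
      by_cases hT : T.card = k
      · rw [pull_fock_card (by rwa [hT]), zero_mul]
      · rw [hat_of_ne x hT, mul_zero]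

lemma restrict_mem_Inv {μ : ℚ^(r+1)} {y : Finset (Fin N) → ℝ} (hy : ∀ S, S.card ≠ k → y S = 0)
    (h : y ∈ (R.pull e (fock N)).Inv μ) : (fun T => y T.1) ∈ (R.pull e (ext N k)).Inv μ := by
  refine ⟨fun S hS => h.1 S.1 (by rwa [pull_fock_wt, ← pull_ext_wt]), fun i j hij => ?_⟩; ext S
  rw [pull_ext_E i j hy, h.2 i j hij]; rfl

/-- The wedge product with the first `p` basis vectors. -/
def wed : ∀ p, p ≤ N → (Finset (Fin N) → ℝ) →ₗ[ℝ] (Finset (Fin N) → ℝ)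
  | 0, _ => LinearMap.id
  | p+1, h => (cr ⟨p, h⟩).comp (wed p (Nat.le_of_succ_le h))

lemma wed_succ (p : ℕ) (h : p+1 ≤ N) (x : Finset (Fin N) → ℝ) :
    wed (p+1) h x = cr ⟨p, h⟩ (wed p (Nat.le_of_succ_le h) x) := rfl

lemma cr_wed (x : Finset (Fin N) → ℝ) (a : Fin N) : ∀ p (h : p ≤ N), (a : ℕ) < p → cr a (wed p h x) = 0
  | p+1, h, ha => by
    rw [wed_succ]; by_cases h' : (a : ℕ) = p
    · rw [show a = ⟨p, h⟩ from Fin.ext h', cr_self]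
    · rw [cr_cr, cr_wed x a p _ (by omega), map_zero, neg_zero]

lemma pull_wed {i j : Fin (r+1)} (hl : ∀ a c, R.E i j (e a) (e c) ≠ 0 → a < c) (x : Finset (Fin N) → ℝ) :
    ∀ p (h : p ≤ N), (R.pull e (fock N)).E i j *ᵥ wed p h x = wed p h ((R.pull e (fock N)).E i j *ᵥ x)
  | 0, _ => rfl
  | p+1, h => by
    rw [wed_succ, pull_cr, pull_wed hl x p, wed_succ, add_eq_left]; refine sum_eq_zero fun a _ => ?_
    by_cases ha : R.E i j (e a) (e ⟨p, h⟩) = 0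
    · rw [ha, zero_smul]
    · rw [cr_wed x a p _ (lt_def.1 (hl _ _ ha)), smul_zero]

lemma filter_succ {p : ℕ} (h : p+1 ≤ N) : (univ.filter fun a : Fin N => (a : ℕ) < p+1)
    = insert ⟨p, h⟩ (univ.filter fun a : Fin N => (a : ℕ) < p) := by
  grind

lemma wed_mem_Wt {μ : ℚ^(r+1)} {x : Finset (Fin N) → ℝ} (hx : x ∈ (R.pull e (fock N)).Wt μ) : ∀ p (h : p ≤ N),
    wed p h x ∈ (R.pull e (fock N)).Wt (μ + ∑ a ∈ univ.filter (fun a : Fin N => (a : ℕ) < p), R.wt (e a))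
  | 0, _ => by simpa [wed] using hx
  | p+1, h => fun S hS => by
    rw [wed_succ, cr_apply]; split_ifs with hp
    · rw [wed_mem_Wt hx p _ _ fun h' => hS ?_, mul_zero]; rw [pull_fock_wt] at h' ⊢
      rw [← add_sum_erase _ _ hp, h', filter_succ h, sum_insert (by simp)]; abel
    · rfl

lemma wed_card {x : Finset (Fin N) → ℝ} (hx : ∀ S, S.card ≠ k → x S = 0) : ∀ p (h : p ≤ N) (S : Finset (Fin N)),
    S.card ≠ p+k → wed p h x S = 0
  | 0, _, S, hS => hx S (by omega)
  | p+1, h, S, hS => by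
    rw [wed_succ, cr_apply]; split_ifs with hp
    · rw [wed_card hx p _ _ (by rw [card_erase_of_mem hp]; have := card_pos.2 ⟨_, hp⟩; omega), mul_zero]
    · rfl

lemma wed_apply_ne {x : Finset (Fin N) → ℝ} {T : Finset (Fin N)} (hx : x T ≠ 0) : ∀ p (h : p ≤ N), (∀ a ∈ T, p ≤ (a : ℕ)) →
    wed p h x (univ.filter (fun a : Fin N => (a : ℕ) < p) ∪ T) ≠ 0
  | 0, _, _ => by simpa [wed] using hx
  | p+1, h, hT => by
    have h1 : (⟨p, h⟩ : Fin N) ∉ univ.filter (fun a : Fin N => (a : ℕ) < p) ∪ T := by grind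
    rw [wed_succ, cr_apply, filter_succ h, insert_union, if_pos (mem_insert_self _ _), erase_insert h1]
    refine mul_ne_zero (fun h0 => ?_) (wed_apply_ne hx p _ fun a ha => (Nat.le_succ p).trans (hT a ha))
    have := sgn_mul_self (⟨p, h⟩ : Fin N) (insert ⟨p, h⟩ (univ.filter (fun a : Fin N => (a : ℕ) < p) ∪ T))
    simp_all

lemma mem_Inv_of_simple {R : Rep m ι} {μ : ℚ^m} {x : ι → ℝ} (hx : x ∈ R.Wt μ)
    (hs : ∀ i j : Fin m, (j : ℕ) = i+1 → R.E i j *ᵥ x = 0) : x ∈ R.Inv μ := by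
  refine ⟨hx, fun i j hij => ?_⟩
  obtain ⟨d, hd⟩ : ∃ d, (j : ℕ) = i+1+d := ⟨j-(i+1), by have := lt_def.1 hij; omega⟩
  induction d generalizing j with
  | zero => exact hs i j hd
  | succ d ih =>
    have hk : (i : ℕ)+1+d < m := by have := j.2; omega
    have h1 := ih ⟨_, hk⟩ (lt_def.2 (by simp; omega)) rfl; have h2 := hs ⟨_, hk⟩ j (by simp; omega)
    have h3 := R.comm_vec i ⟨_, hk⟩ ⟨_, hk⟩ j x; rw [h1, h2, if_pos rfl, if_neg hij.ne'] at h3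
    simpa using h3.symm

lemma exists_balanced {lam : ℚ^(r+1)} (hR : R.IsIrr lam) (hit : ∀ a, ∃ z : ℤ, dotHom (ht r) (R.wt a) = z)
    {μ : ℚ^(r+1)} {y : ℤ} (hy : dotHom (ht r) μ = 2*y) (hlam : (y : ℝ) < dotHom (ht r) lam)
    {x : {S : Finset (Fin N) // S.card = 2} → ℝ} (hx : x ∈ (R.pull e (ext N 2)).Inv μ) (h0 : x ≠ 0) :
    ∃ S, hat 2 x S ≠ 0 ∧ ∀ a ∈ S, dotHom (ht r) (R.wt (e a)) = y := by
  have hX := hat_mem_Inv hx; set X := hat 2 x; choose H hH using hit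
  set f : Fin N → ℤ := fun a => H (e a); let t : Fin N → ℝ^N := fun a b => an b (an a X) ∅
  have ht0 : ∀ a b, t a b ≠ 0 ↔ a ≠ b ∧ X {a, b} ≠ 0 := by
    intro a b
    have : ∀ (a : Fin N) S, sgn a S ≠ 0 := fun a S h => by simpa [h] using sgn_mul_self a S
    simp [t, an_apply, this]
  have hsum : ∀ a b, t a b ≠ 0 → R.wt (e a)+R.wt (e b) = μ ∧ f a+f b = 2*y := by
    intro a b h; obtain ⟨hab, h⟩ := (ht0 a b).1 h; have h1 := not_not.1 fun h' => h (hX.1 _ h')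
    rw [pull_fock_wt, sum_pair hab] at h1; refine ⟨h1, ?_⟩; have h2 := congrArg (dotHom (ht r)) h1
    rw [map_add, hH, hH, hy] at h2; exact_mod_cast h2
  by_contra! hno
  have hno' : ∀ a b, t a b ≠ 0 → f a ≠ y := by
    intro a b h hf; obtain ⟨c, hc, hc'⟩ := hno {a, b} ((ht0 a b).1 h).2; have := (hsum a b h).2
    refine hc' ?_; rw [hH]; rcases mem_insert.1 hc with rfl | hc
    · exact_mod_cast hf
    · rw [mem_singleton.1 hc]; exact_mod_cast (by omega : f b = y)
  have hanti : ∀ a b, t a b = -t b a := fun a b => by simp only [t]; rw [an_an]; rfl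
  have hrel : ∀ (i : Fin (r+1)) j, i < j → ∀ a b, ∑ c, R.E i j (e a) (e c)*t c b + ∑ c, R.E i j (e b) (e c)*t a c = 0 := by
    intro i j hij a b; have h1 := congrFun (congrArg (fun w => an b (an a w)) (hX.2 i j hij)) ∅
    simp only [an_pull, map_add, map_sum, map_smul, map_zero] at h1
    have h2 : ∀ w, ((R.pull e (fock N)).E i j *ᵥ w) ∅ = 0 := fun w => by
      rw [pull_fock]; simp [fockOp_apply, cr_apply]
    simp only [Pi.add_apply, h2, zero_add, Finset.sum_apply, Pi.smul_apply, smul_eq_mul, Pi.zero_apply] at h1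
    rw [add_comm]; exact h1
  obtain ⟨a₀, b₀, h₀⟩ : ∃ a b, t a b ≠ 0 := by
    obtain ⟨S, hS⟩ := Function.ne_iff.1 h0; obtain ⟨a, b, hab, hS'⟩ := card_eq_two.1 S.2
    refine ⟨a, b, (ht0 a b).2 ⟨hab, ?_⟩⟩; rw [← hS']; exact (dif_pos S.2).trans_ne hS
  have hlt : ∃ a, f a < y ∧ ∃ b, t a b ≠ 0 := by
    rcases lt_or_gt_of_ne (hno' _ _ h₀) with h | h
    · exact ⟨a₀, h, b₀, h₀⟩
    · exact ⟨b₀, by have := (hsum _ _ h₀).2; omega, a₀, by rw [hanti, neg_ne_zero]; exact h₀⟩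
  obtain ⟨a, ha, hmax⟩ := exists_max_image (univ.filter fun a => f a < y ∧ ∃ b, t a b ≠ 0) f
    (by obtain ⟨a, ha⟩ := hlt; exact ⟨a, by simpa using ha⟩)
  simp only [mem_filter_univ] at ha hmax; obtain ⟨hay, b, hab⟩ := ha
  set v : ι → ℝ := fun c => t (e.symm c) b
  have hv : v ∈ R.Wt (μ-R.wt (e b)) := fun c hc => by
    by_contra h; exact hc (by rw [← (hsum _ _ h).1]; simp)
  have hE : ∀ {i j c d}, R.E i j (e c) (e d) ≠ 0 → (j : ℕ) = i+1 → f c = f d+1 := by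
    intro i j c d h hij; have := congrArg (dotHom (ht r)) (R.wt_eq h)
    rw [add_sub_assoc, map_add, dot_root, hH, hH] at this
    have h2 : ht r i-ht r j = 1 := by simp [ht, hij]
    rw [h2] at this; exact_mod_cast this
  have hb := (hsum _ _ hab).2
  have hI : v ∈ R.Inv (μ-R.wt (e b)) := mem_Inv_of_simple hv fun i j hij => by
    ext c; obtain ⟨c, rfl⟩ := e.surjective c; have h1 := hrel i j (lt_def.2 (by omega)) c b
    have h2 : (R.E i j *ᵥ v) (e c) = ∑ d, R.E i j (e c) (e d)*t d b := by
      rw [mulVec, dotProduct, ← Equiv.sum_comp e]; simp [v]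
    rw [h2, Pi.zero_apply, eq_neg_of_add_eq_zero_left h1, neg_eq_zero]
    refine sum_eq_zero fun d _ => ?_; by_contra h; obtain ⟨hd1, hd2⟩ := ne_zero_and_ne_zero_of_mul h
    have e1 := hE hd1 hij; have e2 := (hsum _ _ hd2).2; have e3 := hno' _ _ hd2
    have := hmax c ⟨by omega, d, hd2⟩; omega
  have hδ := hR.eq_of_Inv hI fun h => hab (by have := congrFun h (e a); simpa [v] using this)
  have h1 : μ-R.wt (e b) = R.wt (e a) := by rw [← (hsum _ _ hab).1]; simp
  rw [← hδ, h1, hH] at hlam; have : y < f a := mod_cast hlam; omega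

lemma finrank_wedge {lam : ℚ^(r+1)} (hR : R.IsIrr lam) (hit : ∀ a, ∃ z : ℤ, dotHom (ht r) (R.wt a) = z)
    (hl : ∀ i j, i < j → ∀ a c, R.E i j (e a) (e c) ≠ 0 → a < c)
    {μ : ℚ^(r+1)} {y : ℤ} (hy : dotHom (ht r) μ = 2*y) (hlam : (y : ℝ) < dotHom (ht r) lam) {p : ℕ} (hp : p ≤ N)
    (hlow : ∀ a : Fin N, (a : ℕ) < p → (y : ℝ) < dotHom (ht r) (R.wt (e a))) :
    finrank ℝ ((R.pull e (ext N 2)).Inv μ) ≤ finrank ℝ ((R.pull e (ext N (p+2))).Inv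
      (μ + ∑ a ∈ univ.filter (fun a : Fin N => (a : ℕ) < p), R.wt (e a))) := by
  let Φ : ({S : Finset (Fin N) // S.card = 2} → ℝ) →ₗ[ℝ] ({S : Finset (Fin N) // S.card = p+2} → ℝ) :=
    (LinearMap.funLeft ℝ ℝ Subtype.val).comp ((wed p hp).comp (hat 2))
  have hc : ∀ x (S : Finset (Fin N)), S.card ≠ p+2 → wed p hp (hat 2 x) S = 0 := fun x S hS =>
    wed_card (fun T hT => hat_of_ne x hT) p hp S hS
  have hΦ : ∀ x ∈ (R.pull e (ext N 2)).Inv μ, Φ x ∈ (R.pull e (ext N (p+2))).Inv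
      (μ + ∑ a ∈ univ.filter (fun a : Fin N => (a : ℕ) < p), R.wt (e a)) := by
    intro x hx
    refine restrict_mem_Inv (hc x) ⟨wed_mem_Wt (hat_mem_Inv hx).1 p hp, fun i j hij => ?_⟩
    exact (pull_wed (hl i j hij) _ p hp).trans (by rw [(hat_mem_Inv hx).2 i j hij, map_zero])
  refine LinearMap.finrank_le_finrank_of_injective (f := Φ.restrict hΦ) ((injective_iff_map_eq_zero _).2 fun x hx => ?_)
  by_contra h0
  obtain ⟨S, hS, hS'⟩ := exists_balanced hR hit hy hlam x.2 fun h => h0 (Subtype.ext h)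
  have h1 := wed_apply_ne hS p hp fun a ha => not_lt.1 fun h => by
    have := hlow a h
    simp_all
  have h2 := not_not.1 fun h => h1 (hc _ _ h); exact h1 (congrFun (congrArg Subtype.val hx) ⟨_, h2⟩)

end

/-! ### Elimination of the highest weights -/

section
variable {r n b : ℕ} {ι : Type} [Fintype ι] [DecidableEq ι] {R : Rep (r+1) ι}

lemma exists_int_ht {v : ℚ^(r+1)} (hv : Intg v) : ∃ z : ℤ, dotHom (ht r) v = z := by
  choose u hu using hv; refine ⟨∑ i : Fin (r+1), -((i : ℕ) : ℤ)*u i, ?_⟩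
  rw [dotHom_apply]; push_cast; exact sum_congr rfl fun i _ => by rw [hu]; simp [ht]

lemma ExtMF.lt_height (hk : k < n+b+n) (hE : ExtMF R n b (k+1)) (hr : 1 ≤ r)
    (hi : ∀ a, Intg (R.wt a)) (hs : ∀ a, ∑ i, R.wt a i = 0) (h0 : 3 ≤ R.ch.coeff 0)
    (hroot : ∀ p q, p ≠ q → 3 ≤ R.ch.coeff (eps p-eps q)) (henum : ∀ η, ∃ e : Fin (n+b+n) ≃ ι, Enum R η e)
    {M : ℕ} (hM : 2 ≤ M) {e₀ : Fin (n+b+n) ≃ ι} (he₀ : Enum R (sep r M) e₀)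
    (hpos : 0 < dotHom (sep r M) (R.wt (e₀ ⟨k, hk⟩))) {μ₀ : ℚ^(r+1)} (hμ₀ : 2 ≤ R.ch.coeff μ₀) {H : ℕ}
    (hH : dotHom (ht r) μ₀ = H) {e : Fin (n+b+n) ≃ ι} (he : Enum R (ht r) e) :
    (H : ℝ) < dotHom (ht r) (R.wt (e ⟨k, hk⟩)) := by
  set j : Fin (r+1) := ⟨1, by omega⟩; have h0j : (0 : Fin (r+1)) < j := lt_def.2 (by simp [j])
  have hsep := strictAnti_sep (r := r) hM
  have hα : ∀ η : ℝ^(r+1), StrictAnti η → 0 < dotHom η (eps 0-eps j) := fun η hη => by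
    rw [dot_root, sub_pos]; exact hη h0j
  have hr3 := hroot 0 j h0j.ne
  have h1 : k+1 ≤ nGe R (sep r M) (dotHom (sep r M) (eps 0-eps j)) := (he₀.lt_nGe _ ⟨k, hk⟩).2 (by
    rw [dot_root]; exact sep_ge hM (hi _) (hs _) rfl rfl hpos)
  have h2 := hE.clean hk hsep he₀ (μ := eps 0-eps j) h0j (sep_min hM rfl rfl) (by rw [sub_self]; nlinarith)
    (by rw [← dot_root]; linarith [hα _ hsep])
  have h3 := hE.gt_of_gt hk henum (by linarith) hα hsep (strictAnti_ht r) (lt_of_le_of_ne h1 h2.symm)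
  have h4 := (he.lt_nGt _ ⟨k, hk⟩).1 h3; obtain ⟨z, hz⟩ := exists_int_ht (hi (e ⟨k, hk⟩))
  have hz0 : 0 < z := by
    have : (0 : ℝ) < z := by rw [← hz]; exact (hα _ (strictAnti_ht r)).trans h4
    exact_mod_cast this
  lift z to ℕ using hz0.le
  by_contra! hle; rw [hz] at hle; have hzH : z ≤ H := mod_cast hle
  obtain ⟨i, μ, hμ, hμ', hh⟩ := exists_multi hs (c := z) (by omega) (H-z) μ₀ hμ₀ (by
    simp_all)
  have hzR : (1 : ℝ) ≤ z := mod_cast hz0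
  have h5 : k+1 ≤ nGe R (ht r) (dotHom (ht r) μ) := (he.lt_nGe _ ⟨k, hk⟩).2 (by rw [hh, hz]; simp)
  have h6 : nGt R (ht r) (dotHom (ht r) μ) < k+1 := Nat.lt_succ_of_le (not_lt.1 fun h =>
    absurd ((he.lt_nGt _ ⟨k, hk⟩).1 h) (by rw [hh, hz]; simp))
  have h7 := hE.cut hk (strictAnti_ht r) he hμ (by rw [hh]; linarith) h6
  refine hE.clean hk (strictAnti_ht r) he (Fin.castSucc_lt_succ (i := i)) (fun p q hpq => ?_) (by nlinarith)
    (by rw [ht_simple, hh]; linarith) (le_antisymm h7 h5)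
  have : ((p : ℕ) : ℝ)+1 ≤ (q : ℕ) := mod_cast lt_def.1 hpq
  rw [ht_simple]; simp only [ht]; linarith

/-- The tail sums of the coordinates of a weight. -/
def tl (c : Fin n → ℕ) (i : Fin n) : ℕ := ∑ k ∈ univ.filter (fun k : Fin n => (i : ℕ) ≤ (k : ℕ)), c k

lemma tl_antitone (c : Fin n → ℕ) : Antitone (tl c) := fun i j hij => sum_le_sum_of_subset fun k hk => by
  grind

lemma le_tl (c : Fin n → ℕ) {i k : Fin n} (h : i ≤ k) : c k ≤ tl c i :=
  single_le_sum (f := c) (fun _ _ => Nat.zero_le _) (by simpa using h)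

lemma epsWt_eq  (hty : ty ≠ .C) (hn : 2 ≤ n) (c : Fin n → ℕ) : ∃ (q : ℚ) (d : ℤ), 2*q = d ∧ 0 ≤ q ∧
    (∀ i, epsWt ty n c i = tl c i-q) ∧ ∀ i : Fin n, (ty = .D → (i : ℕ)+1 < n) → 2*q ≤ tl c i := by
  have c1 : cval c (n-1) = c ⟨n-1, by omega⟩ := dif_pos _
  have c2 : cval c (n-2) = c ⟨n-2, by omega⟩ := dif_pos _
  cases ty with
  | C => exact absurd rfl hty
  | B =>
    refine ⟨cval c (n-1)/2, c ⟨n-1, by omega⟩, by rw [c1]; push_cast; ring, by rw [c1]; positivity,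
      fun i => by simp [epsWt, tl], fun i _ => ?_⟩
    rw [c1, mul_div_cancel₀ _ two_ne_zero]
    exact_mod_cast le_tl c (le_def.2 (by simp; omega))
  | D =>
    refine ⟨(cval c (n-2)+cval c (n-1))/2, c ⟨n-2, by omega⟩ + c ⟨n-1, by omega⟩, by rw [c1, c2]; push_cast; ring,
      by rw [c1, c2]; positivity, fun i => by simp [epsWt, tl], fun i hi => ?_⟩
    have hi := hi rfl; rw [c1, c2, mul_div_cancel₀ _ two_ne_zero]
    have := sum_le_sum_of_subset (f := c) (s := {⟨n-2, by omega⟩, ⟨n-1, by omega⟩})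
      (t := univ.filter fun k : Fin n => (i : ℕ) ≤ (k : ℕ)) (by grind)
    rw [sum_pair (by simp [Fin.ext_iff]; omega)] at this; exact_mod_cast this

lemma exists_isCharY_dom  (hty : ty ≠ .C) (hn : 2 ≤ n) (c : Fin n → ℕ) :
    DomY ty (epsWt ty n c) ∧ ∃ f, IsCharY ty n c f := by
  obtain ⟨q, d, hd, hq, hL, hS⟩ := epsWt_eq hty hn c
  refine ⟨⟨fun i j hij => ?_, fun hB i => ?_⟩, exists_isCharY hty (d := -d-if ty = .B then 1 else 0) c fun i =>
    ⟨tl c i+n-1-i+if ty = .B then 1 else 0, ?_⟩⟩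
  · have h1 := hS i fun _ => by have := lt_def.1 hij; omega
    have h2 : (tl c j : ℚ) ≤ tl c i := mod_cast tl_antitone c hij.le; grind
  · grind
  · rw [Pi.add_apply, hL, rhoY_apply hty]; push_cast; grind

lemma Enum.wt_eq_zero {η : ℝ^(r+1)} {e : Fin (n+b+n) ≃ ι} (h : Enum R η e) (h0 : 3 ≤ R.ch.coeff 0)
    (hz : ∀ a, dotHom η (R.wt a) = 0 → R.wt a = 0) {z : Fin n} (hzn : 2*n+b ≤ 2*z+4) : R.wt (e (lo b z)) = 0 := by
  refine hz _ (not_not.1 fun hne => ?_); have hpos := lt_of_le_of_ne (h.nonneg z) (Ne.symm hne)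
  have h1 : ∀ a, R.wt (e a) = 0 → lo b z < a := fun a ha => not_le.1 fun hle => by
    have := h.anti hle; grind
  have h2 : #{a | R.wt a = 0} ≤ (Ioo (lo b z) (rev (lo b z))).card := by
    refine card_le_card_of_injOn e.symm (fun a ha => ?_) e.symm.injective.injOn
    have ha : R.wt a = 0 := by simpa using ha
    have h3 := h1 (e.symm a) (by simpa using ha)
    have h4 := h1 (rev (e.symm a)) (by rw [h.neg]; simpa using ha); grind
  rw [Rep.ch_coeff] at h0; rw [Fin.card_Ioo, val_rev] at h2; simp only [lo] at h2; omega

lemma pad_sub (hk : k < n) {c : Fin n → ℕ} (hc : ∀ i, c i ≠ 0 → (i : ℕ) ≤ k) {t : ℕ} (ht : t ≤ c ⟨k, hk⟩)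
    {L : ℚ^n} (hL : ∀ i, L i = tl c i) {v : ℚ^(n+b+n)} (hv : ∀ a, v a = if (a : ℕ) ≤ k then (t : ℚ) else 0) :
    Antitone (pad (pad L)-v) ∧ ∀ a, 0 ≤ (pad (pad L)-v : ℚ^(n+b+n)) a := by
  have htl : ∀ i : Fin n, k < (i : ℕ) → tl c i = 0 := fun i hi => sum_eq_zero fun j hj => by grind
  have h1 : ∀ a : Fin (n+b+n), (pad (pad L)-v : ℚ^(n+b+n)) a
      = if h : (a : ℕ) ≤ k then (tl c ⟨a, by omega⟩ : ℚ)-t else 0 := by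
    intro a; rw [Pi.sub_apply, hv]; simp only [pad]
    split_ifs with h1 h2 h3 <;> first | omega | simp [hL]
    simp_all
  have h2 : ∀ i : Fin n, (i : ℕ) ≤ k → (t : ℚ) ≤ tl c i := fun i hi => by
    exact_mod_cast ht.trans (le_tl c (le_def.2 hi))
  have h3 : ∀ a, 0 ≤ (pad (pad L)-v : ℚ^(n+b+n)) a := fun a => by
    rw [h1]; split_ifs with h
    all_goals simp_all
  refine ⟨fun a d had => ?_, h3⟩; by_cases h : (d : ℕ) ≤ k
  · have had := le_def.1 had; rw [h1 a, h1 d, dif_pos h, dif_pos (had.trans h)]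
    have : (tl c ⟨d, by omega⟩ : ℚ) ≤ tl c ⟨a, by omega⟩ := mod_cast tl_antitone c (le_def.2 had)
    linarith
  · grind

lemma not_isMFRes  (hty : ty ≠ .C) (hb : b = if ty = .B then 1 else 0) {δ : Fin r → ℕ}
    (hR : R.IsIrr (slWt r δ)) (hneg : ∀ v, R.ch.coeff (-v) = R.ch.coeff v) (hi : Intg (slWt r δ))
    (hs0 : ∑ i, slWt r δ i = 0) (hcard : Fintype.card ι = n+b+n) (hr : 1 ≤ r) (h0 : 3 ≤ R.ch.coeff 0)
    (hroot : ∀ p q, p ≠ q → 3 ≤ R.ch.coeff (eps p-eps q)) {μ₀ : ℚ^(r+1)} (hμ₀ : 2 ≤ R.ch.coeff μ₀) {H y : ℕ}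
    (hH : dotHom (ht r) μ₀ = H) (hl1 : dotHom (ht r) (slWt r δ) ≤ H+r) (hl2 : H < dotHom (ht r) (slWt r δ))
    {μ : ℚ^(r+1)} (hμ : Antitone μ) (hy : dotHom (ht r) μ = 2*y) (hyH : y ≤ H) (hry : r ≤ 2*y)
    (hpar : ∀ (σ : Perm (Fin (r+1))) a, (2 : ℚ) • R.wt a ≠ μ+rho (r+1)-fun i => rho (r+1) (σ i))
    (hM3 : 3 ≤ (R.ch*R.ch*alt ℤ (rho (r+1))).coeff (μ+rho (r+1))) {c : Fin n → ℕ} (hc0 : c ≠ 0)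
    (hc1 : c ≠ e n 1) : ¬ IsMFRes ty n r δ c := by
  intro hmf; have hin := fun a => hR.intg hi a; have hs := fun a => hR.sum_wt hs0 a
  have hn : 2 ≤ n := by
    set j : Fin (r+1) := ⟨1, by omega⟩
    have h0j : (0 : Fin (r+1)) ≠ j := fun h => by simpa [j] using congrArg Fin.val h
    obtain ⟨a, ha⟩ := R.exists_wt (by linarith [hroot 0 j h0j] : 0 < R.ch.coeff (eps 0-eps j))
    rw [Rep.ch_coeff] at h0; have h0' : 3 ≤ #{a | R.wt a = 0} := mod_cast h0
    have h1 : #{a | R.wt a = 0} < (univ : Finset ι).card := card_lt_card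
      ((filter_ssubset).2 ⟨a, mem_univ _, fun h => by
        have := congrFun (ha.symm.trans h) 0
        simp [h0j] at this⟩)
    rw [card_univ, hcard] at h1; have : b ≤ 1 := by rw [hb]; split_ifs <;> omega
    omega
  obtain ⟨z, hz⟩ := hi 0; set M := 2*z.toNat+2 with hMdef; have hM : 2 ≤ M := by omega
  have hMz : 2*slWt r δ 0 < M := by
    have : z ≤ z.toNat := Int.self_le_toNat z; have : (z : ℚ) ≤ (z.toNat : ℚ) := mod_cast this
    grind
  have hbd : ∀ a i, |R.wt a i| ≤ slWt r δ 0 := fun a i => abs_le.2 ⟨le_IsIrr_wt hR hneg a i, IsIrr_wt_le hR a i⟩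
  have hsep : ∀ a d, dotHom (sep r M) (R.wt a) = dotHom (sep r M) (R.wt d) → R.wt a = R.wt d := fun a d h =>
    sub_eq_zero.1 (sep_eq_zero hM ((hin a).sub (hin d)) (fun i => by
      refine (abs_sub _ _).trans_lt ?_
      linarith [hbd a i, hbd d i]) (by rw [map_sub, h, sub_self]))
  have hz0 : ∀ a, dotHom (sep r M) (R.wt a) = 0 → R.wt a = 0 := fun a h => sep_eq_zero hM (hin a) (fun i => by
    linarith [hbd a i, abs_nonneg (R.wt a i)]) h
  have henum : ∀ η, ∃ e : Fin (n+b+n) ≃ ι, Enum R η e := fun η => exists_enum hneg hcard η _ hsep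
  obtain ⟨e₀, he₀⟩ := henum (sep r M); obtain ⟨hdom, f, hf⟩ := exists_isCharY_dom hty hn c
  have hLz := fun (z : Fin n) (hz : R.wt (e₀ (lo b z)) = 0) (hD : ty = .D → (z : ℕ)+1 < n) =>
    lam_eq_zero hty (strictAnti_sep hM) he₀.anti_lo he₀.nonneg (fun i j => hsep _ _) (fun i => hz0 _) hdom hf
      (he₀.coeff_le_one hb hR hmf hf) hz fun h => ⟨⟨z+1, hD h⟩, by simp [Fin.ext_iff], hz0 _ (le_antisymm
        ((he₀.anti_lo (show z ≤ ⟨z+1, hD h⟩ from le_def.2 (by simp))).trans (by simp [hz])) (he₀.nonneg _))⟩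
  obtain ⟨q, d, hd, hq, hL, hS⟩ := epsWt_eq hty hn c
  have hq0 : q = 0 ∧ tl c ⟨n-1, by omega⟩ = 0 := by
    obtain ⟨z, hz1, hz2, hz3⟩ : ∃ z : Fin n, 2*n+b ≤ 2*z+4 ∧ (ty = .D → (z : ℕ)+1 < n) ∧ (z : ℕ) ≤ n-1 := by
      by_cases hB : ty = .B
      · exact ⟨⟨n-1, by omega⟩, by rw [hb, if_pos hB]; simp; omega, by rw [hB]; simp, le_rfl⟩
      · exact ⟨⟨n-2, by omega⟩, by rw [hb, if_neg hB]; simp; omega, fun _ => by simp; omega, by simp; omega⟩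
    have h1 := hLz z (he₀.wt_eq_zero h0 hz0 hz1) hz2; have h2 := hS z hz2; rw [hL] at h1
    have h3 : q = 0 := by linarith
    have h4 : (tl c z : ℚ) = 0 := by linarith
    exact ⟨h3, Nat.le_zero.1 ((tl_antitone c (le_def.2 hz3)).trans (mod_cast h4.le))⟩
  have hL : ∀ i, epsWt ty n c i = tl c i := fun i => by rw [hL, hq0.1, sub_zero]
  obtain ⟨⟨k, hkn⟩, hk, hmax⟩ := exists_max_image (univ.filter fun i => c i ≠ 0) id (by
    obtain ⟨i, hi⟩ := Function.ne_iff.1 hc0; exact ⟨i, by simpa using hi⟩)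
  simp only [mem_filter, mem_univ, true_and, id] at hk hmax
  have hk1 : k+1 < n := by
    by_contra h; have := le_tl c (i := ⟨n-1, by omega⟩) (k := ⟨k, hkn⟩) (le_def.2 (by simp; omega))
    omega
  have hlk : ∀ i : Fin n, k < (i : ℕ) → epsWt ty n c i = 0 := fun i hi => by
    rw [hL, Nat.cast_eq_zero]; refine sum_eq_zero fun j hj => ?_; by_contra h
    have := le_def.1 (hmax j h); simp only [mem_filter_univ] at hj this; omega
  have hfin : ∀ (η : ℝ^(r+1)) (e : Fin (n+b+n) ≃ ι), StrictAnti η → Enum R η e → ∀ t : ℕ, t ≤ c ⟨k, hkn⟩ →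
      ∀ v : ℚ^(n+b+n), (∀ a, v a = if (a : ℕ) ≤ k then (t : ℚ) else 0) → ∀ {κ : Type} [Fintype κ] [DecidableEq κ]
      {S : Rep (n+b+n) κ}, S.IsIrr v → ∀ z, dotHom (fun a => dotHom η (R.wt (e a))) v
        - 2*dotHom η (R.wt (e ⟨k, by omega⟩)) < dotHom η z → finrank ℝ ((R.pull e S).Inv z) ≤ 1 :=
    fun η e hη he t ht v hv κ _ _ S hS z hz =>
      have hp := pad_sub hkn (fun i h => le_def.1 (hmax i h)) ht hL hv
      he.finrank_le hη hty hb (fun i => ⟨tl c i, by rw [hL]; simp⟩) hdom (fun i => by rw [hL]; positivity) hk1 hlk hf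
        (he.coeff_le_one hb hR hmf hf) hS (fun a => ⟨if (a : ℕ) ≤ k then t else 0, by rw [hv]; push_cast; rfl⟩) hp.1 hp.2 hz
  have hE : ExtMF R n b (k+1) := by
    intro η e hη he cc z hcc hz
    refine hfin η e hη he 1 (Nat.one_le_iff_ne_zero.2 hk) (om _ (k+1)) (fun a => by simp [om])
      (ext_isIrr (by omega)) z ?_
    have h1 := hcc ⟨k, by omega⟩ (by simp)
    have h2 : dotHom (fun a => dotHom η (R.wt (e a))) (om (n+b+n) (k+1))
        = ∑ a ∈ univ.filter (fun a : Fin (n+b+n) => (a : ℕ) < k+1), dotHom η (R.wt (e a)) := by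
      rw [dotHom_apply, sum_filter]
      exact sum_congr rfl fun a _ => by simp only [om]; split_ifs <;> simp
    linarith
  have hkN : k < n+b+n := by omega
  have hpos : 0 < dotHom (sep r M) (R.wt (e₀ ⟨k, hkN⟩)) := by
    refine lt_of_le_of_ne (he₀.nonneg ⟨k, hkn⟩) fun h => hk ?_
    have := hLz ⟨k, hkn⟩ (hz0 _ h.symm) fun _ => hk1; rw [hL, Nat.cast_eq_zero] at this
    exact Nat.le_zero.1 (this ▸ le_tl c le_rfl)
  obtain ⟨e, he⟩ := henum (ht r)
  have hlt := hE.lt_height hkN hr hin hs h0 hroot henum hM he₀ hpos hμ₀ hH he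
  have hyR : (y : ℝ) ≤ H := mod_cast hyH; have hryR : (r : ℝ) ≤ 2*y := mod_cast hry
  have hrR : (1 : ℝ) ≤ r := mod_cast hr; rcases k with _ | p
  · have hc2 : 2 ≤ c ⟨0, hkn⟩ := by
      by_contra h; refine hc1 (funext fun i => ?_); by_cases hi : (i : ℕ) = 0
      · rw [show i = ⟨0, hkn⟩ from Fin.ext hi]; simp [MFPaper.e]; omega
      · simp only [MFPaper.e]; rw [if_neg (by omega)]; by_contra h'
        exact hi (Nat.le_zero.1 (le_def.1 (hmax i h')))
    have hv : ∀ a : Fin (n+b+n), ((2 : ℚ) • eps ⟨0, hkN⟩ : ℚ^(n+b+n)) a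
        = if (a : ℕ) ≤ 0 then ((2 : ℕ) : ℚ) else 0 := fun a => by
      simp [Pi.single_apply, Fin.ext_iff]
    obtain ⟨κ, _, _, S, hS⟩ := exists_isIrr (v := ((2 : ℚ) • eps ⟨0, hkN⟩ : ℚ^(n+b+n)))
      (fun a d had => by
        have := le_def.1 had
        rw [hv, hv]; split_ifs <;> first | omega | norm_num)
      (fun a => ⟨if (a : ℕ) ≤ 0 then 2 else 0, by rw [hv]; split_ifs <;> simp⟩)
      (fun a => by rw [hv]; split_ifs <;> norm_num)
    have h1 := finrank_square R (by omega) e (Or.inl ⟨rfl, hS⟩) hμ hpar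
    have h2 := hfin _ e (strictAnti_ht r) he 2 hc2 _ hv hS μ (by
      rw [dotHom_apply, sum_eq_single ⟨0, hkN⟩ (fun a _ ha => by simp [ha]) (by simp), hy]
      simp only [Pi.smul_apply, Pi.single_eq_same, smul_eq_mul, mul_one]
      push_cast; linarith)
    omega
  · have h1 := finrank_square R (by omega) e (Or.inr ⟨rfl, ext_isIrr (by omega)⟩) hμ hpar
    have hanti := he.anti
    have h2 := finrank_wedge hR (fun a => exists_int_ht (hin a)) (fun i j hij a c => he.lt_of_ne_zero (strictAnti_ht r) hij)
      (y := y) (mod_cast hy) (by push_cast; linarith) (p := p) (by omega) (e := e) (fun a ha => by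
        have := hanti (show a ≤ ⟨p+1, hkN⟩ from le_def.2 (by simp; omega)); simp only at this
        push_cast; linarith)
    have h3 := hE (ht r) e (strictAnti_ht r) he (dotHom (ht r) (R.wt (e ⟨p+1, hkN⟩)))
      (μ + ∑ a ∈ univ.filter (fun a : Fin (n+b+n) => (a : ℕ) < p), R.wt (e a))
      (fun a ha => hanti (le_def.2 (by simp; omega))) (by
        rw [filter_succ (by omega), sum_insert (by simp), filter_succ (by omega), sum_insert (by simp), map_add, map_sum, hy]
        have h4 := cone_pair_nonneg (hR.cone_wt (e ⟨p, by omega⟩)) (ht r) fun i j hij => (strictAnti_ht r).antitone hij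
        have h5 : dotHom (ht r) (slWt r δ-R.wt (e ⟨p, by omega⟩))
            = ∑ i, ((slWt r δ-R.wt (e ⟨p, by omega⟩)) i : ℝ)*ht r i := by
          rw [dotHom_apply]; exact sum_congr rfl fun i _ => mul_comm _ _
        rw [← h5, map_sub] at h4
        linarith)
    linarith

end

/-! ### Self-dual weights -/

section
variable {r : ℕ}

lemma sum_slWt (d : Fin r → ℕ) : ∑ i, slWt r d i = 0 := by
  have h1 : ∑ i, partLift r d i = ∑ j : Fin r, (((j : ℕ) : ℚ)+1)*d j := by
    simp only [partLift, sum_filter]; rw [sum_comm]; refine sum_congr rfl fun j _ => ?_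
    rw [← sum_filter, sum_const, nsmul_eq_mul]
    have : (univ.filter fun i : Fin (r+1) => (i : ℕ) ≤ (j : ℕ)) = Iic j.castSucc := by
      ext i; simp [le_def]
    rw [this, card_Iic]; simp
  simp only [slWt, sum_sub_distrib, h1, sum_const, card_univ, Fintype.card_fin, nsmul_eq_mul]
  have : ((r+1 : ℕ) : ℚ) ≠ 0 := by positivity
  push_cast at this ⊢; field_simp; ring

lemma slWt_rev {d : Fin r → ℕ} (hd : ∀ i, d i = d (rev i)) (i : Fin (r+1)) : slWt r d (rev i) = -slWt r d i := by
  have h1 : ∀ i, slWt r d i+slWt r d (rev i) = slWt r d 0+slWt r d (rev 0) := by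
    intro i
    induction i using Fin.induction with
    | zero => rfl
    | succ i ih =>
      rw [← ih, Fin.rev_succ, Fin.rev_castSucc]; have e1 := slWt_sub d i
      have e2 := slWt_sub d (rev i); rw [← hd] at e2; linarith
  have h2 : ∑ i, (slWt r d i+slWt r d (rev i)) = 0 := by
    rw [sum_add_distrib, sum_slWt, zero_add]; exact (Equiv.sum_comp Fin.revPerm (slWt r d)).trans (sum_slWt d)
  rw [sum_congr rfl fun i _ => h1 i, sum_const, nsmul_eq_mul, card_univ, Fintype.card_fin] at h2
  have h3 := (mul_eq_zero.1 h2).resolve_left (by positivity); have := h1 i; linarith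

lemma mapHom_neg_alt {u : ℚ^(r+1)} {c : ℚ} (hu : ∀ i, -u (rev i) = u i-c) :
    ((sign (Fin.revPerm (n := r+1)) : ℤˣ) : ℤ) • mapHom (-AddMonoidHom.id _) (alt ℤ u)
      = mono (fun _ => -c)*alt ℤ u := by
  have h1 : mapHom (-AddMonoidHom.id _) (alt ℤ u) = alt ℤ (-u) := by
    rw [alt_eq_single, alt_eq_single, map_sum]
    exact sum_congr rfl fun σ _ => by rw [mapHom_single]; rfl
  rw [h1, ← alt_perm, alt_eq_single, alt_eq_single, mul_sum]; refine sum_congr rfl fun σ _ => ?_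
  rw [mono, single_mul_single, one_mul]; congr 1; ext i; have := hu (σ i)
  simp only [Function.comp, Pi.neg_apply, Fin.revPerm_apply, Pi.add_apply]; linarith

lemma coeff_neg_of_rev {ι : Type} [Fintype ι] [DecidableEq ι] {R : Rep (r+1) ι} {lam : ℚ^(r+1)} (h : R.IsIrr lam)
    (hl : ∀ i, lam (rev i) = -lam i) (v : ℚ^(r+1)) : R.ch.coeff (-v) = R.ch.coeff v := by
  have e0 : ∀ i : Fin (r+1), -rho (r+1) (rev i) = rho (r+1) i-r := fun i => by
    simp only [rho, val_rev]; rw [Nat.cast_sub (by omega)]; push_cast; ring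
  have e1 := mapHom_neg_alt e0
  have e2 := mapHom_neg_alt (u := lam+rho (r+1)) (c := r) fun i => by
    have := e0 i; simp only [Pi.add_apply, hl]; linarith
  rw [← h.ch_eq, map_mul, ← mul_smul_comm, e1] at e2
  have hne : mono (fun _ : Fin (r+1) => -(r : ℚ))*alt ℤ (rho (r+1)) ≠ 0 := mul_ne_zero
    (by simp [mono]) (alt_rho_ne_zero _)
  have h3 : mapHom (-AddMonoidHom.id _) R.ch = R.ch := mul_right_cancel₀ hne (by rw [e2]; ring)
  have h4 := mapHom_coeff_inj (φ := -AddMonoidHom.id ℚ^(r+1)) neg_injective R.ch v; rw [h3] at h4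
  exact h4

end

lemma sum_le_ht {s : ℕ} {lam : ℚ^(2*s+1)} (hl : Antitone lam) (h0 : ∑ i, lam i = 0)
    (hm : lam ⟨s, by omega⟩ = 0) (T : Finset (Fin (2*s+1))) :
    ∑ i ∈ T, ((s : ℝ)-(i : ℕ))*lam i ≤ dotHom (ht (2*s)) lam := by
  have h1 : dotHom (ht (2*s)) lam = ∑ i, ((s : ℝ)-((i : Fin (2*s+1)) : ℕ))*lam i := by
    have : ∑ i, (lam i : ℝ) = 0 := mod_cast h0
    simp only [sub_mul, sum_sub_distrib, ← mul_sum, this, mul_zero, zero_sub]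
    rw [dotHom_apply, ← sum_neg_distrib]; exact sum_congr rfl fun i _ => by simp [ht]
  rw [h1]; refine sum_le_sum_of_subset_of_nonneg (subset_univ _) fun i _ _ => ?_
  rcases le_total (i : ℕ) s with h | h
  · have h2 : lam ⟨s, by omega⟩ ≤ lam i := hl (le_def.2 h); rw [hm] at h2
    have h2 : (0 : ℝ) ≤ lam i := mod_cast h2; exact mul_nonneg (sub_nonneg.2 (mod_cast h)) h2
  · have h2 : lam i ≤ lam ⟨s, by omega⟩ := hl (le_def.2 h); rw [hm] at h2
    have h2 : (lam i : ℝ) ≤ 0 := mod_cast h2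
    exact mul_nonneg_of_nonpos_of_nonpos (sub_nonpos.2 (mod_cast h)) h2

set_option maxHeartbeats 600000 in
lemma even_rank_general (s n : ℕ) (t : CType) (δ : Fin (2*s) → ℕ) (hsd : ∀ i, δ i = δ (rev i))
    (hδ0 : δ ≠ 0)
    (hδ1 : ¬ ∃ b : ℕ, 1 ≤ b ∧ δ = b • MFPaper.e (2*s) 1+b • MFPaper.e (2*s) (2*s))
    (hδ2 : ¬ ∃ i : ℕ, δ = MFPaper.e (2*s) i+MFPaper.e (2*s) (2*s+1-i))
    (hC : t ≠ .C)
    (hdim : 2*(n : ℚ)+(if t = .B then 1 else 0) = dimA (2*s) δ) :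
    ∀ c : Fin n → ℕ, c ≠ 0 → c ≠ MFPaper.e n 1 → ¬ IsMFRes t n (2*s) δ c := by
  intro c hc0 hc1; set b : ℕ := if t = .B then 1 else 0 with hb; set lam := slWt (2*s) δ with hlam
  have hs : 1 ≤ s := by grind
  have hanti : Antitone lam := slWt_antitone δ
  have hrev : ∀ i, lam (rev i) = -lam i := slWt_rev hsd; have hsum : ∑ i, lam i = 0 := sum_slWt δ
  set mid : Fin (2*s+1) := ⟨s, by omega⟩ with hmid; set lst := last (2*s) with hlst
  have hm : lam mid = 0 := by have := hrev mid; grind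
  have hl0 : lam lst = -lam 0 := by rw [← hrev 0, Fin.rev_zero]
  have hval : ∀ i, lam i = partLift (2*s) δ i-partLift (2*s) δ mid := fun i => by
    have h1 : lam i = lam i-lam mid := by rw [hm, sub_zero]
    rw [h1]; simp only [lam, slWt]; ring
  have hit : Intg lam := fun i => ⟨(∑ j ∈ univ.filter (fun j : Fin (2*s) => (i : ℕ) ≤ (j : ℕ)), (δ j : ℤ))
    - ∑ j ∈ univ.filter (fun j : Fin (2*s) => (mid : ℕ) ≤ (j : ℕ)), (δ j : ℤ), by rw [hval]; simp [partLift]⟩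
  obtain ⟨ι, _, _, R, hR⟩ := Rep.exists_isIrr' hanti hit; have hneg := coeff_neg_of_rev hR hrev
  have hcard : Fintype.card ι = n+b+n := by
    have h1 := hR.card; rw [← hdim] at h1
    have h2 : (b : ℚ) = if t = .B then 1 else 0 := by rw [hb]; push_cast; rfl
    rw [← h2] at h1; have : (Fintype.card ι : ℚ) = (n+b+n : ℕ) := by rw [h1]; push_cast; ring
    exact_mod_cast this
  have key : ∀ ν : ℚ^(2*s+1), Intg ν → ∑ i, ν i = 0 → ν ≠ 0 → 3 ≤ R.ch.coeff ν → ∀ (u : Fin (2*s+1) → ℤ) (y : ℕ),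
      Antitone u → #{i : Fin (2*s+1) | Even (((i : ℕ) : ℤ)+u i)}
        ≠ #{i : Fin (2*s+1) | Even ((i : ℕ) : ℤ)} →
      dotHom (ht (2*s)) (fun i => (u i : ℚ)) = 2*y → s ≤ y → (y+2*s : ℝ) ≤ dotHom (ht (2*s)) lam → 1 ≤ lam 0 →
      3 ≤ (R.ch*R.ch*alt ℤ (rho (2*s+1))).coeff ((fun i => (u i : ℚ))+rho (2*s+1)) →
      ¬ IsMFRes t n (2*s) δ c := by
    intro ν h1 h2 h3 h4 u y hu hpar hy hsy hH h0 hM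
    obtain ⟨h5, h6⟩ := coeff_root_zero hR ⌈∑ i, ν i ^ 2⌉₊ ν h1 h2 h3 h4 (Nat.le_ceil _)
    obtain ⟨z, hz⟩ := exists_int_ht hit
    have hzy : ((y+2*s : ℕ) : ℤ) ≤ z := by
      have : (y+2*s : ℝ) ≤ z := by rw [← hz]; exact hH
      exact_mod_cast this
    obtain ⟨H, rfl⟩ : ∃ H : ℕ, z = H+2*s := ⟨(z-2*s).toNat, by push_cast at hzy; omega⟩
    push_cast at hz hzy; have hsR : (1 : ℝ) ≤ s := mod_cast hs
    refine not_isMFRes hC rfl hR hneg hit hsum hcard (by omega) h5 h6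
      (two_le_coeff hR (i := 0) (k := mid) (l := lst) (by rw [hm]; linarith) (by rw [hm, hl0]; linarith)) (H := H) (y := y) ?_
      (by rw [hz]; push_cast; exact le_rfl) (by rw [hz]; linarith) (fun i j hij => ?_) hy (by omega) (by omega)
      (fun σ a => two_smul_ne hpar (hR.intg hit a) σ) hM hc0 hc1
    · rw [add_sub_assoc, map_add, dot_root, hz]; simp [ht, lst]
    · exact Int.cast_le.2 (hu hij)
  have hst : ∀ i j : Fin (2*s+1), ∑ p, (eps i-eps j : ℚ^(2*s+1)) p = 0 := fun i j => by simp [sum_sub_distrib]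
  have hie : ∀ i : Fin (2*s+1), Intg (eps i : ℚ^(2*s+1)) := fun i p => ⟨if p = i then 1 else 0, by
    simp [Pi.single_apply]⟩
  by_cases hp : 3 ≤ #{k | δ k ≠ 0}
  · obtain ⟨f, hf⟩ : ∃ f : Fin 3 ↪o Fin (2*s), ∀ i, δ (f i) ≠ 0 := by
      obtain ⟨T, hT, hT3⟩ := exists_subset_card_eq hp
      exact ⟨T.orderEmbOfFin hT3, fun i => by simpa using hT (orderEmbOfFin_mem T hT3 i)⟩
    have hj : ∀ i, lam (f i).succ+1 ≤ lam (f i).castSucc := fun i => by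
      have h1 := slWt_sub δ (f i)
      have h2 : (1 : ℚ) ≤ δ (f i) := mod_cast Nat.one_le_iff_ne_zero.2 (hf i); linarith
    have h01 : lam (f 1).castSucc ≤ lam (f 0).succ := hanti (Fin.succ_le_castSucc_iff.2 (f.strictMono (by decide)))
    have h12 : lam (f 2).castSucc ≤ lam (f 1).succ := hanti (Fin.succ_le_castSucc_iff.2 (f.strictMono (by decide)))
    have j0 := hj 0; have j1 := hj 1; have j2 := hj 2
    have h0 : lam (f 0).castSucc ≤ lam 0 := hanti (Fin.zero_le _)
    have h3 : lam lst ≤ lam (f 2).succ := hanti (Fin.le_last _)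
    have hge : 2 ≤ lam 0 := by
      obtain ⟨z, hz⟩ := hit 0; have : (1 : ℚ) < z := by rw [← hz]; linarith
      have : 1 < z := mod_cast this; rw [hz]; exact_mod_cast this
    have c1 := two_le_coeff hR (i := (f 0).castSucc) (k := (f 1).castSucc) (l := (f 2).castSucc) (by linarith) (by linarith)
    have c2 := coeff_sub_add_le hR (i := (f 0).castSucc) (k := (f 2).castSucc) (l := (f 2).succ) (by linarith) (by linarith)
    have hgeR : (2 : ℝ) ≤ lam 0 := mod_cast hge; have hsR : (1 : ℝ) ≤ s := mod_cast hs
    have hbd := sum_le_ht hanti hsum hm {0, lst}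
    rw [sum_pair (by simp [lst, Fin.ext_iff]; omega), hl0] at hbd
    have h0l : (0 : Fin (2*s+1)) ≠ lst := by simp [lst, Fin.ext_iff]; omega
    have hu : (fun i : Fin (2*s+1) => (((if (i : ℕ) = 0 then 1 else if (i : ℕ) = 2*s then -1 else 0 : ℤ)) : ℚ))
        = eps 0-eps lst := by
      ext i; simp only [Pi.sub_apply, Pi.single_apply, Fin.ext_iff, lst, val_last, val_zero]
      split_ifs <;> first | omega | simp
    refine key _ (((hit.add (hie _)).sub (hie _))) ?_ (fun hν => ?_) (by linarith)
      (fun i => if (i : ℕ) = 0 then 1 else if (i : ℕ) = 2*s then -1 else 0) s ?_ ?_ ?_ le_rfl ?_ (by linarith) ?_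
    · have := hst (f 2).succ (f 0).castSucc
      rw [add_sub_assoc]; simp only [Pi.add_apply, sum_add_distrib, hsum, zero_add]; exact this
    · have hne : ∀ {i j}, lam i ≠ lam j → i ≠ j := fun h h' => h (by rw [h'])
      have a1 := congrFun hν (f 1).castSucc; have a2 := congrFun hν (f 2).castSucc
      simp [hne (show lam (f 1).castSucc ≠ lam (f 2).succ by linarith),
        hne (show lam (f 1).castSucc ≠ lam (f 0).castSucc by linarith)] at a1
      simp [hne (show lam (f 2).castSucc ≠ lam (f 2).succ by linarith),
        hne (show lam (f 2).castSucc ≠ lam (f 0).castSucc by linarith)] at a2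
      linarith
    · intro i j hij; have := le_def.1 hij; dsimp only; split_ifs <;> omega
    · refine (card_lt_card ⟨fun i hi => ?_, fun h => ?_⟩).ne
      · simp only [mem_filter_univ] at hi ⊢; split_ifs at hi with h1 h2
        · rw [h1] at hi; simp at hi
        · rw [h2] at hi; exact absurd hi (by rw [Int.not_even_iff]; push_cast; omega)
        · simpa using hi
      · have := h (show (0 : Fin (2*s+1)) ∈ _ by simp); simp at this
    · rw [hu, dot_root]; simp [ht, lst]
    · simp only [lst, val_zero, val_last] at hbd; push_cast at hbd; nlinarith
    · rw [hu]; exact le_trans (mod_cast hp) (coeff_theta hR (by omega) hneg)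
  · obtain ⟨i₁, hi₁⟩ := Function.ne_iff.1 hδ0
    have hrv : ∀ i : Fin (2*s), ((rev i : Fin (2*s)) : ℕ) = 2*s-1-i := fun i => by rw [val_rev]; omega
    obtain ⟨i, hi, his⟩ : ∃ i : Fin (2*s), δ i ≠ 0 ∧ (i : ℕ) < s := by
      rcases lt_or_ge (i₁ : ℕ) s with h | h
      · exact ⟨i₁, hi₁, h⟩
      · exact ⟨rev i₁, by rw [← hsd]; exact hi₁, by rw [hrv]; omega⟩
    have hir : i ≠ rev i := fun h => by have := congrArg Fin.val h; rw [hrv] at this; omega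
    have hsupp : ∀ j, δ j = if j = i ∨ j = rev i then δ i else 0 := by
      intro j; split_ifs with h
      · grind
      · by_contra hj
        push Not at h
        refine hp ?_; rw [← card_eq_three.2 ⟨i, rev i, j, hir, h.1.symm, h.2.symm, rfl⟩]
        refine card_le_card fun k hk => ?_; grind
    have hsum2 : ∀ (i j : Fin (2*s)), i ≠ j → ∀ k, (if k = i ∨ k = j then δ i else 0)
        = (if k = i then δ i else 0)+if k = j then δ i else 0 := fun i j hij k => by
      grind
    have hb2 : 2 ≤ δ i := by
      by_contra h; refine hδ2 ⟨i+1, funext fun k => ?_⟩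
      rw [hsupp, hsum2 _ _ hir, show δ i = 1 by omega]
      simp only [Pi.add_apply, MFPaper.e, Fin.ext_iff, hrv]; congr 2 <;> simp; omega
    have hi1 : 1 ≤ (i : ℕ) := by
      by_contra h; refine hδ1 ⟨δ i, by omega, funext fun k => ?_⟩; rw [hsupp, hsum2 _ _ hir]
      simp only [Pi.add_apply, Pi.smul_apply, smul_eq_mul, mul_ite, mul_one, mul_zero, MFPaper.e, Fin.ext_iff, hrv]
      congr 2 <;> simp <;> omega
    have hpl : ∀ j : Fin (2*s+1), partLift (2*s) δ j
        = (if (j : ℕ) ≤ i then (δ i : ℚ) else 0)+if (j : ℕ) ≤ 2*s-1-i then (δ i : ℚ) else 0 := by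
      intro j; simp only [partLift, sum_filter]; rw [← hrv]
      trans ∑ k : Fin (2*s), ((if k = i then (if (j : ℕ) ≤ i then (δ i : ℚ) else 0) else 0)
        + if k = rev i then (if (j : ℕ) ≤ (rev i : Fin (2*s)) then (δ i : ℚ) else 0) else 0)
      · refine sum_congr rfl fun k _ => ?_; rw [hsupp k, hsum2 _ _ hir]; by_cases h1 : k = i
        · subst h1; simp [hir]
        · by_cases h2 : k = rev i
          · subst h2; simp [h1]
          · simp [h1, h2]
      · simp [sum_add_distrib]
    obtain ⟨β, hβd⟩ : ∃ β : ℚ, β = δ i := ⟨_, rfl⟩; simp only [← hβd] at hpl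
    have hβ : 2 ≤ β := by rw [hβd]; exact_mod_cast hb2
    have hlv : ∀ j : Fin (2*s+1), lam j = if (j : ℕ) ≤ i then β else if (j : ℕ) ≤ 2*s-1-i then 0 else -β := by
      intro j; have h1 : ¬ s ≤ (i : ℕ) := by omega
      have h2 : s ≤ 2*s-1-i := by omega
      grind
    set o : Fin (2*s+1) := ⟨1, by omega⟩ with ho; set k : Fin (2*s+1) := ⟨2*s-1, by omega⟩ with hk
    have l0 : lam 0 = β := by grind
    have l1 : lam o = β := by grind
    have l2 : lam k = -β := by grind
    have l3 : lam lst = -β := by rw [hl0, l0]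
    have n1 : (0 : Fin (2*s+1)) ≠ o := by simp [o, Fin.ext_iff]
    have n2 : k ≠ lst := by grind
    have n3 : (0 : Fin (2*s+1)) ≠ k := by grind
    have n4 : (0 : Fin (2*s+1)) ≠ lst := by grind
    have n5 : o ≠ k := by grind
    have n6 : o ≠ lst := by grind
    have c4 := four_le_coeff hR hneg n1 n2 hβ l0 l0 l1 hm l2 l3
    have hβR : (2 : ℝ) ≤ β := mod_cast hβ; have hsR : (1 : ℝ) ≤ s := mod_cast hs
    have hbd := sum_le_ht hanti hsum hm {0, lst, o, k}
    rw [sum_insert (by simp [n1, n3, n4]), sum_insert (by simp [n2.symm, n6.symm]), sum_pair n5, l0, l1, l2, l3] at hbd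
    have hu : (fun i : Fin (2*s+1) => (((if (i : ℕ) = 0 then 2 else if (i : ℕ) = 1 then 1 else
        if (i : ℕ) = 2*s-1 then -1 else if (i : ℕ) = 2*s then -2 else 0 : ℤ)) : ℚ))
        = eps 0-eps lst+(eps 0-eps lst)+(eps o-eps k) := by
      ext i
      simp only [Pi.sub_apply, Pi.add_apply, Pi.single_apply, Fin.ext_iff, lst, o, k, val_last, val_zero]
      split_ifs <;> first | omega | norm_num
    refine key _ ((((hit.add (hie _)).sub (hie _)).add (hie _)).sub (hie _)) ?_ (fun hν => ?_) (by linarith) (fun i =>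
      if (i : ℕ) = 0 then 2 else if (i : ℕ) = 1 then 1 else if (i : ℕ) = 2*s-1 then -1 else if (i : ℕ) = 2*s then -2 else 0)
      (3*s-1) ?_ ?_ ?_ (by omega) ?_ (by linarith) ?_
    · have h1 := hst lst 0; have h2 := hst k o
      rw [add_sub_assoc, add_sub_assoc]; simp only [Pi.add_apply _ _, sum_add_distrib, hsum, h1, h2, add_zero]
    · have := congrFun hν o; simp [n1.symm, n5, n6, l1] at this; linarith
    · intro i j hij; have := le_def.1 hij; dsimp only; split_ifs <;> omega
    · refine (card_lt_card ⟨fun i hi => ?_, fun h => ?_⟩).ne'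
      · simp only [mem_filter, mem_univ, true_and, Int.even_iff] at hi ⊢; split_ifs <;> omega
      · have := h (show o ∈ _ by simp [o]); simp [o] at this
    · rw [hu, map_add, map_add, dot_root, dot_root]; simp only [ht, lst, o, k, val_last, val_zero]
      rw [Nat.cast_sub (by omega), Nat.cast_sub (by omega)]; push_cast; ring
    · simp only [lst, o, k, val_zero, val_last] at hbd; rw [Nat.cast_sub (by omega)] at hbd ⊢
      push_cast at hbd ⊢; nlinarith
    · rw [hu]; refine three_le_kappa hR hneg n1 n2 (fun i j hij => ?_) hβ l0 l1 hm l2 l3 fun p => ?_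
      · have := lt_def.1 hij; simp only [ne_eq, Fin.ext_iff, lst, o, k, val_last, val_zero]; omega
      · rw [hlv]; split_ifs <;> simp

end MF

/-- **Theorem 12.1.**  Let `X = A_{2s}` (even rank `2s`), let
`δ = (a₁,…,a_s,a_s,…,a₁)` be a nonzero self-dual dominant weight for `X` which is
neither of the form `bω₁ + bω_{2s}` (`b ≥ 1`) nor of the form `ω_i + ω_{2s+1-i}`
(in particular `s ≥ 2`).  Let `W = V_X(δ)` and `X < Y = SO(W)` (all self-dual
irreducibles of `A_{2s}` are orthogonal, so `Y` has type `B` or `D`).  Then for every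
dominant weight `lam ≠ 0, λ₁` of `Y`, the restriction `V_Y(lam)↓X` is NOT
multiplicity-free. -/
theorem thm_even_rank_general
    (s n : ℕ) (t : CType) (δ : Fin (2 * s) → ℕ)
    (hsd : ∀ i, δ i = δ (Fin.rev i))
    (hδ0 : δ ≠ 0)
    (hδ1 : ¬ ∃ b : ℕ, 1 ≤ b ∧ δ = b • e (2 * s) 1 + b • e (2 * s) (2 * s))
    (hδ2 : ¬ ∃ i : ℕ, δ = e (2 * s) i + e (2 * s) (2 * s + 1 - i))
    (ht : t ≠ CType.C)
    (hdim : 2 * (n : ℚ) + (if t = CType.B then 1 else 0) = dimA (2 * s) δ) :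
    ∀ lam : Fin n → ℕ, lam ≠ 0 → lam ≠ e n 1 →
      ¬ IsMFRes t n (2 * s) δ lam :=
  MF.even_rank_general s n t δ hsd hδ0 hδ1 hδ2 ht hdim
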